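/- For every integer m ≥ 2 there are infinitely many natural numbers r such that the run of consecutive prime gaps δ_j = p_{r+j+1} − p_{r+j} (1 ≤ j ≤ m) satisfies δ_{j+1} ∣ δ_j for every j with 1 ≤ j ≤ m − 1. -/

import Mathlib

/-- `nthPrime n` is the `n`-th smallest prime, so `nthPrime 1 = 2`. -/
noncomputable def nthPrime (n : ℕ) : ℕ := Nat.nth Nat.Prime (n - 1)

/-- The `j`-th prime gap in the run starting at `r`:
`primeGap r j = p_{r+j+1} - p_{r+j}`. -/
noncomputable def primeGap (r j : ℕ) : ℕ := nthPrime (r + j + 1) - nthPrime (r + j)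

/-- The Maynard–Tao theorem, in a form that prescribes the residue class of `n`. -/
def MaynardTao : Prop := ∀ m : ℕ, ∃ k : ℕ, ∀ h : Fin k → ℕ, Function.Injective h → ∃ D₀ : ℕ,
  ∀ W b : ℕ, 0 < W → (∀ p, p.Prime → p ≤ D₀ → p ∣ W) → (∀ i, Nat.Coprime (b + h i) W) →
  ∀ N₀ : ℕ, ∃ n ≥ N₀, n ≡ b [MOD W] ∧
    m + 1 ≤ (Finset.univ.filter fun i => (n + h i).Prime).card

/-- A sequence whose differences divide all later differences. -/
def factSeq : ℕ → ℕ
  | 0 => 1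
  | u + 1 => factSeq u + (factSeq u).factorial

lemma factSeq_strictMono : StrictMono factSeq :=
  strictMono_nat_of_lt_succ fun u => by
    have := Nat.factorial_pos (factSeq u)
    simp only [factSeq]; omega

lemma factSeq_sub_dvd {s t u : ℕ} (hst : s < t) (htu : t ≤ u) :
    factSeq t - factSeq s ∣ factSeq u - factSeq t := by
  have h1 := factSeq_strictMono hst
  induction u, htu using Nat.le_induction with
  | base => simp
  | succ u hu ih =>
    have h2 := factSeq_strictMono.monotone hu
    have e : factSeq (u + 1) - factSeq t
        = (factSeq u - factSeq t) + (factSeq u).factorial := by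
      simp only [factSeq]; omega
    rw [e]
    exact dvd_add ih (Nat.dvd_factorial (by omega) (by omega))

lemma exists_reverse_dividing_tuple (k : ℕ) : ∃ h : Fin k → ℕ, Function.Injective h ∧
    (∀ i, k.factorial ∣ h i) ∧
    ∀ i j l, h i < h j → h j < h l → (h l - h j) ∣ (h j - h i) := by
  have key : ∀ i j : Fin k, k.factorial * (factSeq k - factSeq i)
      < k.factorial * (factSeq k - factSeq j) → j < i := by
    intro i j hij
    have := lt_of_mul_lt_mul_left' hij
    by_contra hc
    have := factSeq_strictMono.monotone (show (i : ℕ) ≤ j from not_lt.mp hc)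
    omega
  refine ⟨fun i => k.factorial * (factSeq k - factSeq i), ?_, fun i => dvd_mul_right _ _, ?_⟩
  · intro i j hij
    have h1 := Nat.eq_of_mul_eq_mul_left (Nat.factorial_pos k) hij
    have h2 := factSeq_strictMono i.2
    have h3 := factSeq_strictMono j.2
    exact Fin.ext (factSeq_strictMono.injective (by omega))
  · intro i j l h1 h2
    have a := key _ _ h1
    have b := key _ _ h2
    have h3 := factSeq_strictMono i.2
    have h4 := factSeq_strictMono (show (j : ℕ) < i from a)
    have h5 := factSeq_strictMono (show (l : ℕ) < j from b)
    simp only [← Nat.mul_sub]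
    apply Nat.mul_dvd_mul_left
    rw [show factSeq k - factSeq l - (factSeq k - factSeq j) = factSeq j - factSeq l by omega,
      show factSeq k - factSeq j - (factSeq k - factSeq i) = factSeq i - factSeq j by omega]
    exact factSeq_sub_dvd b a.le

lemma exists_avoiding_residue {k : ℕ} (h : Fin k → ℕ) (hk : ∀ i, k.factorial ∣ h i)
    {p : ℕ} (hp : p.Prime) : ∃ c : ℕ, ∀ i, ¬ p ∣ c + h i := by
  have := Fact.mk hp
  rcases le_or_gt p k with hpk | hpk
  · refine ⟨1, fun i hi => ?_⟩
    have h1 : p ∣ h i := ((Nat.dvd_factorial hp.pos hpk)).trans (hk i)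
    exact hp.one_lt.ne' (Nat.dvd_one.mp ((Nat.dvd_add_left h1).mp hi))
  · have : ∃ c : ZMod p, c ∉ Finset.univ.image (fun i => -(h i : ZMod p)) := by
      by_contra! hc
      have h1 : (Finset.univ : Finset (ZMod p)) ⊆ Finset.univ.image (fun i => -(h i : ZMod p)) :=
        fun c _ => hc c
      have h2 := (Finset.card_le_card h1).trans Finset.card_image_le
      simp only [Finset.card_univ, ZMod.card, Fintype.card_fin] at h2
      omega
    obtain ⟨c, hc⟩ := this
    refine ⟨c.val, fun i hi => hc ?_⟩
    rw [← ZMod.natCast_eq_zero_iff] at hi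
    push_cast at hi
    rw [ZMod.natCast_zmod_val] at hi
    exact Finset.mem_image.mpr ⟨i, Finset.mem_univ _, (eq_neg_of_add_eq_zero_left hi).symm⟩

lemma exists_isolating_residue {k : ℕ} (h : Fin k → ℕ) (hk : ∀ i, k.factorial ∣ h i) (D₀ B : ℕ)
    (hB : ∀ i, h i ≤ B) : ∃ W b : ℕ, 0 < W ∧ (∀ p, p.Prime → p ≤ D₀ → p ∣ W) ∧
      (∀ i, Nat.Coprime (b + h i) W) ∧
      ∀ t ≤ B, (∀ i, h i ≠ t) → ∃ p, p.Prime ∧ p ∣ W ∧ p ∣ b + t := by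
  set D₁ := max D₀ B with hD₁
  set q : ℕ → ℕ := fun t => Nat.nth Nat.Prime (D₁ + t) with hq
  have hqinj : Function.Injective q := fun s t hst => by
    have := Nat.nth_injective Nat.infinite_setOfPred_prime hst
    omega
  have hqp : ∀ t, (q t).Prime := fun t => Nat.prime_nth_prime _
  have hqD : ∀ t, D₁ < q t := fun t => by
    have := Nat.add_two_le_nth_prime (D₁ + t)
    simp only [hq]; omega
  have hex : ∀ p : ℕ, p.Prime → ∃ c : ℕ, (∀ i, ¬ p ∣ c + h i) ∧
      ∀ t ≤ B, (∀ i, h i ≠ t) → p = q t → p ∣ c + t := by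
    intro p hp
    by_cases hc : ∃ t ≤ B, (∀ i, h i ≠ t) ∧ p = q t
    · obtain ⟨t, ht, hti, rfl⟩ := hc
      refine ⟨q t - t, fun i hi => ?_, fun s _ _ hs => ?_⟩
      · have h1 := hqD t
        have h2 := hB i
        have h3 := hti i
        have h4 : t < q t := by omega
        rcases lt_or_gt_of_ne h3 with h5 | h5
        · have := Nat.le_of_dvd (by omega) hi
          omega
        · have : q t ∣ h i - t := by
            have e : q t - t + h i = q t + (h i - t) := by omega
            rw [e] at hi
            exact (Nat.dvd_add_right dvd_rfl).mp hi
          have := Nat.le_of_dvd (by omega) this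
          omega
      · obtain rfl := hqinj hs
        have := hqD t
        rw [Nat.sub_add_cancel (by omega)]
    · obtain ⟨c, hc'⟩ := exists_avoiding_residue h hk hp
      exact ⟨c, hc', fun t ht hti e => (hc ⟨t, ht, hti, e⟩).elim⟩
  choose! c hc1 hc2 using hex
  set S := (Finset.range (q B + 1)).filter Nat.Prime with hS
  have hSp : ∀ p ∈ S, p.Prime := fun p hp => (Finset.mem_filter.mp hp).2
  have hcop : Set.Pairwise (S : Set ℕ) (Function.onFun Nat.Coprime id) := fun p hp r hr hpr =>
    (Nat.coprime_primes (hSp p hp) (hSp r hr)).mpr hpr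
  obtain ⟨b, hb⟩ := Nat.chineseRemainderOfFinset c id S (fun p hp => (hSp p hp).ne_zero) hcop
  have hbd : ∀ p ∈ S, ∀ t, (p ∣ b + t ↔ p ∣ c p + t) := fun p hp t =>
    ((hb p hp).add_right t).dvd_iff dvd_rfl
  refine ⟨∏ p ∈ S, p, b, Finset.prod_pos fun p hp => (hSp p hp).pos, ?_, ?_, ?_⟩
  · intro p hp hpD
    apply Finset.dvd_prod_of_mem
    have := hqD B
    simp only [hS, Finset.mem_filter, Finset.mem_range]
    exact ⟨by omega, hp⟩
  · intro i
    apply Nat.Coprime.prod_right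
    intro p hp
    rw [Nat.coprime_comm, (hSp p hp).coprime_iff_not_dvd, hbd p hp]
    exact hc1 p (hSp p hp) i
  · intro t ht hti
    have hm : q t ∈ S := by
      simp only [hS, Finset.mem_filter, Finset.mem_range]
      refine ⟨Nat.lt_succ_of_le (Nat.nth_monotone Nat.infinite_setOfPred_prime (by omega)), hqp t⟩
    refine ⟨q t, hqp t, Finset.dvd_prod_of_mem _ hm, ?_⟩
    rw [hbd _ hm]
    exact hc2 _ (hqp t) t ht hti rfl

theorem infinite_of_maynardTao (MT : MaynardTao) (m : ℕ) (hm : 2 ≤ m) :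
    {r : ℕ | ∀ j : ℕ, 1 ≤ j → j ≤ m - 1 → primeGap r (j + 1) ∣ primeGap r j}.Infinite := by
  obtain ⟨k, hk⟩ := MT m
  obtain ⟨h, hinj, hfac, hdiv⟩ := exists_reverse_dividing_tuple k
  obtain ⟨D₀, hD⟩ := hk h hinj
  set B := ∑ i, h i
  have hB : ∀ i, h i ≤ B := fun i => Finset.single_le_sum (fun _ _ => Nat.zero_le _) (Finset.mem_univ i)
  obtain ⟨W, b, hW, hWD, hcop, hiso⟩ := exists_isolating_residue h hfac D₀ B hB
  have key := hD W b hW hWD hcop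
  rw [Set.infinite_iff_exists_gt]
  intro a
  obtain ⟨n, hn, hnb, hcard⟩ := key (Nat.nth Nat.Prime (a + 1) + W + 1)
  have hprime : ∀ t ≤ B, (n + t).Prime → ∃ i, h i = t := by
    intro t ht hp
    by_contra! hc
    obtain ⟨p, hpp, hpW, hpb⟩ := hiso t ht hc
    have h1 : p ∣ n + t := (((hnb.of_dvd hpW).add_right t).dvd_iff dvd_rfl).mpr hpb
    have h2 := (Nat.prime_dvd_prime_iff_eq hpp hp).mp h1
    have h3 := Nat.le_of_dvd hW hpW
    omega
  set r := Nat.count Nat.Prime n with hr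
  have hra : a < r := by
    have h1 : Nat.count Nat.Prime (Nat.nth Nat.Prime (a + 1)) = a + 1 :=
      Nat.count_nth_of_infinite Nat.infinite_setOfPred_prime _
    have := Nat.count_monotone Nat.Prime (show Nat.nth Nat.Prime (a + 1) ≤ n by omega)
    omega
  have hcount : r + (m + 1) ≤ Nat.count Nat.Prime (n + (B + 1)) := by
    rw [Nat.count_add, Nat.count_eq_card_filter_range (fun t => Nat.Prime (n + t))]
    have : (Finset.univ.filter fun i => (n + h i).Prime).card ≤
        ((Finset.range (B + 1)).filter fun t => Nat.Prime (n + t)).card := by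
      apply Finset.card_le_card_of_injOn h
      · intro i hi
        have hi' := (Finset.mem_filter.mp hi).2
        have := hB i
        exact Finset.mem_coe.mpr (Finset.mem_filter.mpr ⟨Finset.mem_range.mpr (by omega), hi'⟩)
      · exact hinj.injOn
    omega
  have hval : ∀ s ≤ m, ∃ i, Nat.nth Nat.Prime (r + s) = n + h i := by
    intro s hs
    have h1 : n ≤ Nat.nth Nat.Prime (r + s) :=
      (Nat.le_nth_count Nat.infinite_setOfPred_prime n).trans
        (Nat.nth_monotone Nat.infinite_setOfPred_prime (Nat.le_add_right r s))
    have h2 : Nat.nth Nat.Prime (r + s) < n + (B + 1) := Nat.nth_lt_of_lt_count (by omega)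
    obtain ⟨i, hi⟩ := hprime (Nat.nth Nat.Prime (r + s) - n) (by omega) (by
      rw [Nat.add_sub_cancel' h1]; exact Nat.prime_nth_prime _)
    exact ⟨i, by omega⟩
  refine ⟨r, ?_, hra⟩
  intro j hj1 hj2
  obtain ⟨i1, h1⟩ := hval (j - 1) (by omega)
  obtain ⟨i2, h2⟩ := hval j (by omega)
  obtain ⟨i3, h3⟩ := hval (j + 1) (by omega)
  have l1 : Nat.nth Nat.Prime (r + (j - 1)) < Nat.nth Nat.Prime (r + j) :=
    Nat.nth_strictMono Nat.infinite_setOfPred_prime (by omega)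
  have l2 : Nat.nth Nat.Prime (r + j) < Nat.nth Nat.Prime (r + (j + 1)) :=
    Nat.nth_strictMono Nat.infinite_setOfPred_prime (by omega)
  have := hdiv i1 i2 i3 (by omega) (by omega)
  simp only [primeGap, nthPrime]
  rw [show r + (j + 1) + 1 - 1 = r + (j + 1) by omega, show r + (j + 1) - 1 = r + j by omega,
    show r + j + 1 - 1 = r + j by omega, show r + j - 1 = r + (j - 1) by omega, h1, h2, h3]
  convert this using 1 <;> omega

open Finset

lemma sum_fin_succ_arrow {n : ℕ} {X : Type*} [Fintype X] (f : (Fin (n + 1) → X) → ℝ) :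
    ∑ x, f x = ∑ x₀, ∑ x' : Fin n → X, f (Fin.cons x₀ x') := by
  rw [← (Fin.consEquiv (fun _ : Fin (n + 1) => X)).sum_comp, Fintype.sum_prod_type]
  rfl

/-- A tensor product of inequalities between sums of squares is again such an inequality. -/
lemma tensor_sum_sq_le {A X E : Type*} [Fintype A] [Fintype X] [Fintype E] {n : ℕ}
    (w : Fin n → X → ℝ) (K : Fin n → X → A → ℝ) (d : Fin n → E → ℝ) (T : Fin n → E → A → ℝ)
    (hw : ∀ i x, 0 ≤ w i x) (hd : ∀ i e, 0 ≤ d i e)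
    (hloc : ∀ i (c : A → ℝ),
      ∑ e, d i e * (∑ a, T i e a * c a) ^ 2 ≤ ∑ x, w i x * (∑ a, K i x a * c a) ^ 2)
    (y : (Fin n → A) → ℝ) :
    ∑ e : Fin n → E, (∏ i, d i (e i)) * (∑ ρ, (∏ i, T i (e i) (ρ i)) * y ρ) ^ 2 ≤
      ∑ x : Fin n → X, (∏ i, w i (x i)) * (∑ ρ, (∏ i, K i (x i) (ρ i)) * y ρ) ^ 2 := by
  induction n with
  | zero => simp
  | succ n ih =>
    simp only [sum_fin_succ_arrow, Fin.prod_univ_succ, Fin.cons_zero, Fin.cons_succ]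
    have hsplit : ∀ (s : A → ℝ) (g : (Fin n → A) → ℝ),
        ∑ a, ∑ ρ : Fin n → A, s a * g ρ * y (Fin.cons a ρ)
          = ∑ ρ : Fin n → A, g ρ * ∑ a, s a * y (Fin.cons a ρ) := by
      intro s g
      rw [sum_comm]
      refine sum_congr rfl fun ρ _ => ?_
      rw [mul_sum]
      exact sum_congr rfl fun a _ => by ring
    have hsplit' : ∀ (s : A → ℝ) (g : (Fin n → A) → ℝ),
        ∑ ρ : Fin n → A, g ρ * ∑ a, s a * y (Fin.cons a ρ)
          = ∑ a, s a * ∑ ρ : Fin n → A, g ρ * y (Fin.cons a ρ) := by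
      intro s g
      rw [← hsplit]
      refine sum_congr rfl fun a _ => ?_
      rw [mul_sum]
      exact sum_congr rfl fun ρ _ => by ring
    simp only [hsplit]
    calc ∑ e, ∑ e' : Fin n → E, (d 0 e * ∏ i, d i.succ (e' i)) *
            (∑ ρ : Fin n → A, (∏ i, T i.succ (e' i) (ρ i)) * ∑ a, T 0 e a * y (Fin.cons a ρ)) ^ 2
        = ∑ e' : Fin n → E, (∏ i, d i.succ (e' i)) * ∑ e, d 0 e *
            (∑ a, T 0 e a * ∑ ρ : Fin n → A, (∏ i, T i.succ (e' i) (ρ i)) * y (Fin.cons a ρ)) ^ 2 := by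
          rw [sum_comm]
          refine sum_congr rfl fun e' _ => ?_
          rw [mul_sum]
          refine sum_congr rfl fun e _ => ?_
          rw [hsplit', mul_comm (d 0 e), mul_assoc]
      _ ≤ ∑ e' : Fin n → E, (∏ i, d i.succ (e' i)) * ∑ x, w 0 x *
            (∑ a, K 0 x a * ∑ ρ : Fin n → A, (∏ i, T i.succ (e' i) (ρ i)) * y (Fin.cons a ρ)) ^ 2 := by
          gcongr with e' _
          · exact prod_nonneg fun i _ => hd _ _
          · exact hloc 0 _
      _ = ∑ x, w 0 x * ∑ e' : Fin n → E, (∏ i, d i.succ (e' i)) *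
            (∑ ρ : Fin n → A, (∏ i, T i.succ (e' i) (ρ i)) * ∑ a, K 0 x a * y (Fin.cons a ρ)) ^ 2 := by
          simp only [mul_sum (s := (univ : Finset X)), mul_sum (s := (univ : Finset (Fin n → E)))]
          rw [sum_comm]
          refine sum_congr rfl fun x _ => sum_congr rfl fun e' _ => ?_
          rw [hsplit']; ring
      _ ≤ ∑ x, w 0 x * ∑ x' : Fin n → X, (∏ i, w i.succ (x' i)) *
            (∑ ρ : Fin n → A, (∏ i, K i.succ (x' i) (ρ i)) * ∑ a, K 0 x a * y (Fin.cons a ρ)) ^ 2 := by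
          gcongr with x _
          · exact hw _ _
          · exact ih _ _ _ _ (fun i => hw _) (fun i => hd _) (fun i => hloc _) _
      _ = _ := by
          refine sum_congr rfl fun x _ => ?_
          rw [mul_sum]
          exact sum_congr rfl fun x' _ => by rw [mul_assoc]

/-- The value of the local sieve factor of colour `a` at the local state `x` at a prime `P`. -/
noncomputable def localFactor {k : ℕ} (P : ℝ) (x a : Option (Fin k)) : ℝ :=
  if a ≠ none ∧ x = a then 1 - P else 1

lemma sum_localFactor_none {k : ℕ} (P : ℝ) (c : Option (Fin k) → ℝ) :
    ∑ a, localFactor P none a * c a = c none + ∑ i, c (some i) := by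
  simp [Fintype.sum_option, localFactor]

lemma sum_localFactor_some {k : ℕ} (P : ℝ) (c : Option (Fin k) → ℝ) (l : Fin k) :
    ∑ a, localFactor P (some l) a * c a = c none + ∑ i, c (some i) - P * c (some l) := by
  have : ∀ i : Fin k, localFactor P (some l) (some i) * c (some i)
      = c (some i) - if l = i then P * c (some i) else 0 := by
    intro i
    by_cases h : l = i <;> simp [localFactor, h]; ring
  simp only [Fintype.sum_option, this, sum_sub_distrib, sum_ite_eq, mem_univ, if_true]
  simp [localFactor]; ring

noncomputable def uniformWeight {k : ℕ} (P : ℝ) : Option (Fin k) → ℝ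
  | none => 1 - k / P
  | some _ => 1 / P

noncomputable def primeWeight {k : ℕ} (j : Fin k) (P : ℝ) : Option (Fin k) → ℝ
  | none => 1 - (k - 1) / (P - 1)
  | some c => if c = j then 0 else 1 / (P - 1)

noncomputable def diagWeight {k : ℕ} (P : ℝ) (e : Option (Fin k)) : ℝ := if e = none then 1 else P

noncomputable def lowerWeight {k : ℕ} (j : Fin k) (P : ℝ) : Option (Fin k) → ℝ
  | none => 1 - 1 / P ^ 2
  | some c => if c = j then 0 else P - 4 * k

noncomputable def lowerMatrix {k : ℕ} (j : Fin k) (e a : Option (Fin k)) : ℝ :=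
  if e = a ∨ (e = none ∧ a = some j) then 1 else 0

lemma uniform_local_le {k : ℕ} {P : ℝ} (hP : 0 < P) (c : Option (Fin k) → ℝ) :
    ∑ x, uniformWeight P x * (∑ a, localFactor P x a * c a) ^ 2 ≤
      ∑ e, diagWeight P e * (∑ a, (if e = a then 1 else 0) * c a) ^ 2 := by
  rw [Fintype.sum_option (fun x => uniformWeight P x * (∑ a, localFactor P x a * c a) ^ 2)]
  simp only [sum_localFactor_none, sum_localFactor_some, uniformWeight, ite_mul, one_mul, zero_mul, sum_ite_eq, mem_univ, if_true]
  simp only [Fintype.sum_option, diagWeight, if_true, reduceCtorEq, if_false, one_mul]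
  set q := ∑ i, c (some i)
  have h1 : ∑ i, 1 / P * (c none + q - P * c (some i)) ^ 2
      = k / P * (c none + q) ^ 2 - 2 * (c none + q) * q + ∑ i, P * c (some i) ^ 2 := by
    have : ∀ i, 1 / P * (c none + q - P * c (some i)) ^ 2
        = 1 / P * (c none + q) ^ 2 - 2 * (c none + q) * c (some i) + P * c (some i) ^ 2 := by
      intro i; field_simp; ring
    simp only [this, sum_add_distrib, sum_sub_distrib, ← mul_sum, sum_const, card_univ,
      Fintype.card_fin, nsmul_eq_mul]
    simp only [q]; ring
  rw [h1]
  nlinarith [sq_nonneg q]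

lemma prime_local_ge {k : ℕ} (j : Fin k) {P : ℝ} (hP : 16 ≤ P)
    (c : Option (Fin k) → ℝ) :
    ∑ e, lowerWeight j P e * (∑ a, lowerMatrix j e a * c a) ^ 2 ≤
      ∑ x, primeWeight j P x * (∑ a, localFactor P x a * c a) ^ 2 := by
  have hk : 1 ≤ (k : ℝ) := by exact_mod_cast j.pos
  have e1 : ∑ a, lowerMatrix j none a * c a = c none + c (some j) := by
    simp [Fintype.sum_option, lowerMatrix]
  have e2 : ∀ l, ∑ a, lowerMatrix j (some l) a * c a = c (some l) := by
    intro l; simp [lowerMatrix]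
  have hsplit : ∀ f : Fin k → ℝ, ∑ i, f i = f j + ∑ i ∈ univ.erase j, f i := fun f =>
    (add_sum_erase _ f (mem_univ j)).symm
  have hne : ∀ (f g : Fin k → ℝ), ∑ i ∈ univ.erase j, (if i = j then (0 : ℝ) else f i) * g i
      = ∑ i ∈ univ.erase j, f i * g i := by
    intro f g
    refine sum_congr rfl fun i hi => ?_
    rw [if_neg (ne_of_mem_erase hi)]
  rw [Fintype.sum_option (fun x => primeWeight j P x * (∑ a, localFactor P x a * c a) ^ 2),
    Fintype.sum_option (fun e => lowerWeight j P e * (∑ a, lowerMatrix j e a * c a) ^ 2)]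
  simp only [sum_localFactor_none, sum_localFactor_some, primeWeight, lowerWeight, e1, e2]
  rw [hsplit (fun x => (if x = j then (0:ℝ) else _) * _),
    hsplit (fun x => (if x = j then (0:ℝ) else _) * _), hne, hne]
  simp only [if_true, zero_mul, zero_add]
  rw [hsplit (fun i => c (some i))]
  set A := c none + c (some j) with hA
  set q := ∑ i ∈ univ.erase j, c (some i) with hq
  set S := ∑ i ∈ univ.erase j, c (some i) ^ 2 with hS
  have hcard : (((univ.erase j : Finset (Fin k)).card : ℕ) : ℝ) = k - 1 := by
    rw [card_erase_of_mem (mem_univ j), card_univ, Fintype.card_fin,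
      Nat.cast_sub (Nat.succ_le_of_lt j.pos)]; simp
  have hP1 : 0 < P - 1 := by linarith
  have hCS : q ^ 2 ≤ (k - 1) * S := by
    have := sq_sum_le_card_mul_sum_sq (s := univ.erase j) (f := fun i => c (some i))
    rwa [hcard] at this
  have hS0 : 0 ≤ S := sum_nonneg fun i _ => sq_nonneg _
  have h1 : ∑ i ∈ univ.erase j, 1 / (P - 1) * (c none + (c (some j) + q) - P * c (some i)) ^ 2
      = (k - 1) / (P - 1) * (A + q) ^ 2 - 2 * P / (P - 1) * (A + q) * q + P ^ 2 / (P - 1) * S := by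
    have : ∀ i, 1 / (P - 1) * (c none + (c (some j) + q) - P * c (some i)) ^ 2
        = 1 / (P - 1) * (A + q) ^ 2 - 2 * P / (P - 1) * (A + q) * c (some i)
          + P ^ 2 / (P - 1) * c (some i) ^ 2 := by
      intro i; rw [hA]; field_simp; ring
    simp only [this, sum_add_distrib, sum_sub_distrib, ← mul_sum, sum_const, nsmul_eq_mul, hcard]
    rw [← hq, ← hS]; ring
  rw [h1, ← mul_sum, ← hS, show c none + (c (some j) + q) = A + q by rw [hA]; ring]
  set α := P / (P - 1) with hα
  have hα1 : α ≤ 16 / 15 := by rw [hα, div_le_div_iff₀ hP1 (by norm_num)]; linarith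
  have hα0 : 1 ≤ α := by rw [hα, le_div_iff₀ hP1]; linarith
  have hαP : α - 1 = α * (1 / P) := by rw [hα]; field_simp; ring
  have h2 : P ≤ P ^ 2 / (P - 1) := by rw [le_div_iff₀ hP1]; nlinarith
  have e3 : 2 * P / (P - 1) = 2 * α := by rw [hα]; ring
  rw [e3]
  have h3 : (P - 4 * k) * S ≤ P ^ 2 / (P - 1) * S - 4 * q ^ 2 := by nlinarith
  have h4 : -(2 * (α - 1) * A * q) ≥ -((1 / P) ^ 2 * A ^ 2) - α ^ 2 * q ^ 2 := by
    rw [hαP]; nlinarith [sq_nonneg (1 / P * A - α * q)]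
  have h5 : (2 * α - 1 + α ^ 2) * q ^ 2 ≤ 4 * q ^ 2 := by
    apply mul_le_mul_of_nonneg_right _ (sq_nonneg q); nlinarith
  have e5 : 1 / P ^ 2 = (1 / P) ^ 2 := by rw [one_div, one_div, inv_pow]
  rw [e5]
  nlinarith

lemma prod_le_prod_of_subset_of_one_le_real {ι : Type*} {s t : Finset ι} {f : ι → ℝ}
    (h : s ⊆ t) (hf : ∀ i ∈ t, i ∉ s → 1 ≤ f i) (hs : ∀ i ∈ s, 0 ≤ f i) :
    ∏ i ∈ s, f i ≤ ∏ i ∈ t, f i := by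
  classical
  rw [← prod_sdiff h]
  refine le_mul_of_one_le_left (prod_nonneg hs) (one_le_prod fun i hi => ?_)
  exact hf i (mem_sdiff.mp hi).1 (mem_sdiff.mp hi).2

def colorFiber {k n : ℕ} (ρ : Fin n → Option (Fin k)) (c : Fin k) : Finset (Fin n) :=
  univ.filter fun i => ρ i = some c

def colorSupport {k n : ℕ} (ρ : Fin n → Option (Fin k)) : Finset (Fin n) :=
  univ.filter fun i => ρ i ≠ none

lemma colorFiber_injective {k n : ℕ} :
    Function.Injective (colorFiber : (Fin n → Option (Fin k)) → Fin k → Finset (Fin n)) := by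
  intro ρ ρ' h
  have key : ∀ i c, ρ i = some c ↔ ρ' i = some c := fun i c => by
    have := congrArg (i ∈ ·) (congrFun h c)
    simpa [colorFiber] using this
  funext i
  exact Option.ext fun c => key i c

lemma prod_colorSupport {k n : ℕ} (ρ : Fin n → Option (Fin k)) (f : Fin n → ℝ) :
    ∏ i ∈ colorSupport ρ, f i = ∏ c, ∏ i ∈ colorFiber ρ c, f i := by
  have h : ∀ i, (if ρ i ≠ none then f i else 1) = ∏ c, if ρ i = some c then f i else 1 := by
    intro i
    rcases hi : ρ i with _ | c <;> simp
  simp only [colorSupport, colorFiber, prod_filter, h]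
  exact prod_comm

lemma sum_coloring_le {k n : ℕ} (φ : (Fin k → Finset (Fin n)) → ℝ) (hφ : ∀ S, 0 ≤ φ S) :
    ∑ ρ : Fin n → Option (Fin k), φ (colorFiber ρ) ≤ ∑ S, φ S := by
  rw [← sum_image (s := univ) (f := φ) (g := colorFiber) colorFiber_injective.injOn]
  exact sum_le_sum_of_subset_of_nonneg (subset_univ _) fun S _ _ => hφ S

open Classical in
lemma sum_disjoint_le_sum_coloring {k n : ℕ} (φ : (Fin k → Finset (Fin n)) → ℝ)
    (hφ : ∀ S, 0 ≤ φ S) :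
    ∑ S ∈ univ.filter (fun S : Fin k → Finset (Fin n) => Pairwise (Function.onFun Disjoint S)), φ S ≤
      ∑ ρ : Fin n → Option (Fin k), φ (colorFiber ρ) := by
  rw [← sum_image (s := univ) (f := φ) (g := colorFiber) colorFiber_injective.injOn]
  refine sum_le_sum_of_subset_of_nonneg ?_ fun S _ _ => hφ S
  intro S hS
  have hS := (mem_filter.mp hS).2
  have huniq : ∀ i c c', i ∈ S c → i ∈ S c' → c = c' := by
    intro i c c' h h'
    by_contra hne
    exact (disjoint_left.mp (hS hne)) h h'
  refine mem_image.mpr ⟨fun i => if h : ∃ c, i ∈ S c then some h.choose else none, mem_univ _, ?_⟩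
  funext c
  ext i
  simp only [colorFiber, mem_filter, mem_univ, true_and]
  constructor
  · intro h
    split_ifs at h with h1
    have := h1.choose_spec
    rwa [Option.some.inj h] at this
  · intro h
    have h1 : ∃ c, i ∈ S c := ⟨c, h⟩
    rw [dif_pos h1, huniq i _ c h1.choose_spec h]

/-- The indicator that a local state lies in the class `t`, where `none` imposes no condition. -/
noncomputable def stateIndicator {k : ℕ} (t x : Option (Fin k)) : ℝ :=
  if t = none ∨ t = x then 1 else 0

noncomputable def pairCoeff {k : ℕ} (P : ℝ) (a b : Option (Fin k)) : Option (Fin k) → ℝ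
  | none => 1
  | some c => localFactor P (some c) a * localFactor P (some c) b - 1

lemma localFactor_mul_localFactor {k : ℕ} (P : ℝ) (x a b : Option (Fin k)) :
    localFactor P x a * localFactor P x b = ∑ t, pairCoeff P a b t * stateIndicator t x := by
  rw [Fintype.sum_option]
  rcases x with _ | c
  · have : ∀ a : Option (Fin k), localFactor P none a = 1 := by
      intro a; unfold localFactor; rw [if_neg]; rintro ⟨h, h'⟩; exact h h'.symm
    simp [stateIndicator, pairCoeff, this]
  · simp [stateIndicator, pairCoeff]

lemma abs_pairCoeff_le {k : ℕ} {P : ℝ} (hP : 1 ≤ P) (a b t : Option (Fin k)) :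
    |pairCoeff P a b t| ≤ (if a = none ∨ t = none then 1 else P) *
      (if b = none ∨ t = none then 1 else P) := by
  rcases t with _ | c
  · simp [pairCoeff]
  · have key : ∀ a : Option (Fin k), (a = none ∧ localFactor P (some c) a = 1) ∨
        (a ≠ none ∧ (localFactor P (some c) a = 1 ∨ localFactor P (some c) a = 1 - P)) := by
      intro a
      unfold localFactor
      rcases a with _ | a
      · left; simp
      · right; refine ⟨by simp, ?_⟩
        split_ifs <;> simp
    simp only [pairCoeff, reduceCtorEq, or_false]
    rcases key a with ⟨ha, h1⟩ | ⟨ha, h1 | h1⟩ <;> rcases key b with ⟨hb, h2⟩ | ⟨hb, h2 | h2⟩ <;>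
      rw [h1, h2] <;> simp only [ha, hb, if_true, if_false] <;> rw [abs_le] <;> constructor <;>
      nlinarith

lemma pairCoeff_eq_zero {k : ℕ} {P : ℝ} {a b : Option (Fin k)} {t : Option (Fin k)}
    (ha : a = none) (hb : b = none) (ht : t ≠ none) : pairCoeff P a b t = 0 := by
  subst ha hb
  rcases t with _ | c
  · exact absurd rfl ht
  · simp [pairCoeff, localFactor]

lemma sq_coloring_expand {k n : ℕ} (p : Fin n → ℝ) (y : (Fin n → Option (Fin k)) → ℝ)
    (x : Fin n → Option (Fin k)) :
    (∑ ρ, (∏ i, localFactor (p i) (x i) (ρ i)) * y ρ) ^ 2 =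
      ∑ τ : Fin n → Option (Fin k), (∑ ρ, ∑ ρ', y ρ * y ρ' * ∏ i, pairCoeff (p i) (ρ i) (ρ' i) (τ i)) *
        ∏ i, stateIndicator (τ i) (x i) := by
  have h : ∀ ρ ρ' : Fin n → Option (Fin k),
      ((∏ i, localFactor (p i) (x i) (ρ i)) * y ρ) * ((∏ i, localFactor (p i) (x i) (ρ' i)) * y ρ')
      = ∑ τ : Fin n → Option (Fin k), (y ρ * y ρ' * ∏ i, pairCoeff (p i) (ρ i) (ρ' i) (τ i)) *
        ∏ i, stateIndicator (τ i) (x i) := by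
    intro ρ ρ'
    have e : ((∏ i, localFactor (p i) (x i) (ρ i)) * y ρ) *
        ((∏ i, localFactor (p i) (x i) (ρ' i)) * y ρ')
        = y ρ * y ρ' * ∏ i, (localFactor (p i) (x i) (ρ i) * localFactor (p i) (x i) (ρ' i)) := by
      rw [prod_mul_distrib]; ring
    rw [e]
    simp only [localFactor_mul_localFactor]
    rw [prod_univ_sum, mul_sum, Fintype.piFinset_univ]
    refine sum_congr rfl fun τ _ => ?_
    rw [prod_mul_distrib]; ring
  rw [sq, sum_mul_sum]
  simp only [h, sum_mul]
  calc _ = ∑ ρ : Fin n → Option (Fin k), ∑ τ : Fin n → Option (Fin k), ∑ ρ' : Fin n → Option (Fin k),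
          (y ρ * y ρ' * ∏ i, pairCoeff (p i) (ρ i) (ρ' i) (τ i)) * ∏ i, stateIndicator (τ i) (x i) :=
        sum_congr rfl fun ρ _ => sum_comm
    _ = _ := sum_comm

lemma sum_weight_stateIndicator {k n : ℕ} (w : Fin n → Option (Fin k) → ℝ)
    (τ : Fin n → Option (Fin k)) :
    ∑ x : Fin n → Option (Fin k), (∏ i, w i (x i)) * ∏ i, stateIndicator (τ i) (x i) =
      ∏ i, ∑ a, w i a * stateIndicator (τ i) a := by
  rw [prod_univ_sum, Fintype.piFinset_univ]
  exact sum_congr rfl fun x _ => by rw [prod_mul_distrib]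

lemma prod_gamma_eq {k n : ℕ} (p : Fin n → ℝ) (τ ρ : Fin n → Option (Fin k)) :
    ∏ i, (if ρ i = none ∨ τ i = none then 1 else p i) =
      ∏ c, ∏ i ∈ colorFiber ρ c ∩ colorSupport τ, p i := by
  have h1 := prod_colorSupport ρ fun i => if τ i = none then 1 else p i
  have h2 : ∀ c, ∏ i ∈ colorFiber ρ c ∩ colorSupport τ, p i
      = ∏ i ∈ colorFiber ρ c, if τ i = none then 1 else p i := by
    intro c
    rw [colorSupport, inter_filter, inter_univ, prod_filter]
    exact prod_congr rfl fun i _ => by by_cases h : τ i = none <;> simp [h]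
  rw [prod_congr rfl fun c _ => h2 c, ← h1, colorSupport, prod_filter]
  exact prod_congr rfl fun i _ => by by_cases h : ρ i = none <;> simp [h]

/-- Comparison of a weighted sum of the square of a sieve polynomial with its expected value. -/
lemma sieve_equidistribution {k n : ℕ} (p : Fin n → ℝ) (hp : ∀ i, 1 ≤ p i)
    (x : ℕ → Fin n → Option (Fin k)) (s : Finset ℕ) (u : ℕ → ℝ) (M : ℝ)
    (w : Fin n → Option (Fin k) → ℝ) (y : (Fin n → Option (Fin k)) → ℝ) {B R : ℝ} (hB : 0 ≤ B)
    (hR : 0 ≤ R)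
    (hy : ∀ ρ, |y ρ| ≤ B / ∏ i ∈ colorSupport ρ, p i)
    (hyR : ∀ ρ, y ρ ≠ 0 → ∏ i ∈ colorSupport ρ, p i ≤ R)
    (Err : (Fin n → Option (Fin k)) → ℝ)
    (hErr : ∀ τ, ∏ i ∈ colorSupport τ, p i ≤ R ^ 2 →
      |∑ N ∈ s, u N * ∏ i, stateIndicator (τ i) (x N i) -
        M * ∏ i, ∑ a, w i a * stateIndicator (τ i) a| ≤ Err τ) :
    |∑ N ∈ s, u N * (∑ ρ, (∏ i, localFactor (p i) (x N i) (ρ i)) * y ρ) ^ 2 -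
      M * ∑ z : Fin n → Option (Fin k), (∏ i, w i (z i)) *
        (∑ ρ, (∏ i, localFactor (p i) (z i) (ρ i)) * y ρ) ^ 2| ≤
      ∑ τ ∈ univ.filter (fun τ : Fin n → Option (Fin k) => ∏ i ∈ colorSupport τ, p i ≤ R ^ 2),
        (B * (∑ S ∈ univ.filter (fun S : Finset (Fin n) => ∏ i ∈ S, p i ≤ R),
          (∏ i ∈ S ∩ colorSupport τ, p i) / ∏ i ∈ S, p i) ^ k) ^ 2 * Err τ := by
  have hpos : ∀ i, 0 < p i := fun i => one_pos.trans_le (hp i)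
  set Γ : (Fin n → Option (Fin k)) → ℝ := fun τ =>
    ∑ ρ, ∑ ρ', y ρ * y ρ' * ∏ i, pairCoeff (p i) (ρ i) (ρ' i) (τ i) with hΓ
  have hΓ0 : ∀ τ, ¬ ∏ i ∈ colorSupport τ, p i ≤ R ^ 2 → Γ τ = 0 := by
    intro τ hτ
    refine sum_eq_zero fun ρ _ => sum_eq_zero fun ρ' _ => ?_
    by_contra hne
    have hρ : y ρ ≠ 0 := fun h => hne (by rw [h]; ring)
    have hρ' : y ρ' ≠ 0 := fun h => hne (by rw [h]; ring)
    have hco : ∀ i, pairCoeff (p i) (ρ i) (ρ' i) (τ i) ≠ 0 := fun i hi =>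
      hne (by rw [prod_eq_zero (mem_univ i) hi, mul_zero])
    apply hτ
    have hsub : colorSupport τ ⊆ colorSupport ρ ∪ colorSupport ρ' := by
      intro i hi
      have hi' := (mem_filter.mp hi).2
      by_contra hc
      simp only [colorSupport, mem_union, mem_filter, mem_univ, true_and, not_or, not_not] at hc
      exact hco i (pairCoeff_eq_zero hc.1 hc.2 hi')
    calc ∏ i ∈ colorSupport τ, p i ≤ ∏ i ∈ colorSupport ρ ∪ colorSupport ρ', p i :=
          prod_le_prod_of_subset_of_one_le_real hsub (fun i _ _ => hp i) fun i _ => (hpos i).le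
      _ ≤ (∏ i ∈ colorSupport ρ ∪ colorSupport ρ', p i) *
          ∏ i ∈ colorSupport ρ ∩ colorSupport ρ', p i :=
          le_mul_of_one_le_right (prod_nonneg fun i _ => (hpos i).le) (one_le_prod fun i _ => hp i)
      _ = (∏ i ∈ colorSupport ρ, p i) * ∏ i ∈ colorSupport ρ', p i := prod_union_inter
      _ ≤ R * R := mul_le_mul (hyR _ hρ) (hyR _ hρ') (prod_nonneg fun i _ => (hpos i).le) hR
      _ = R ^ 2 := (sq R).symm
  have hΓle : ∀ τ, |Γ τ| ≤ (B * (∑ S ∈ univ.filter (fun S : Finset (Fin n) => ∏ i ∈ S, p i ≤ R),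
          (∏ i ∈ S ∩ colorSupport τ, p i) / ∏ i ∈ S, p i) ^ k) ^ 2 := by
    intro τ
    have h1 : |Γ τ| ≤ (∑ ρ, |y ρ| * ∏ i, (if ρ i = none ∨ τ i = none then 1 else p i)) ^ 2 := by
      rw [sq, sum_mul_sum]
      refine (abs_sum_le_sum_abs _ _).trans (sum_le_sum fun ρ _ => ?_)
      refine (abs_sum_le_sum_abs _ _).trans (sum_le_sum fun ρ' _ => ?_)
      rw [abs_mul, abs_mul, abs_prod, mul_mul_mul_comm, ← prod_mul_distrib]
      gcongr with i _
      exact abs_pairCoeff_le (hp i) _ _ _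
    refine h1.trans ?_
    have h2 : 0 ≤ ∑ ρ, |y ρ| * ∏ i, (if ρ i = none ∨ τ i = none then 1 else p i) := by
      refine sum_nonneg fun ρ _ => mul_nonneg (abs_nonneg _) (prod_nonneg fun i _ => ?_)
      split_ifs
      · exact zero_le_one
      · exact (hpos i).le
    refine pow_le_pow_left₀ h2 ?_ 2
    set φ : Finset (Fin n) → ℝ := fun S => if ∏ i ∈ S, p i ≤ R then
      (∏ i ∈ S ∩ colorSupport τ, p i) / ∏ i ∈ S, p i else 0 with hφ
    have hφ0 : ∀ S, 0 ≤ φ S := by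
      intro S; simp only [hφ]; split_ifs
      · exact div_nonneg (prod_nonneg fun i _ => (hpos i).le) (prod_nonneg fun i _ => (hpos i).le)
      · exact le_rfl
    calc ∑ ρ, |y ρ| * ∏ i, (if ρ i = none ∨ τ i = none then 1 else p i)
        ≤ ∑ ρ : Fin n → Option (Fin k), B * ∏ c, φ (colorFiber ρ c) := by
          refine sum_le_sum fun ρ _ => ?_
          by_cases h0 : y ρ = 0
          · rw [h0, abs_zero, zero_mul]
            exact mul_nonneg hB (prod_nonneg fun c _ => hφ0 _)
          have hle : ∀ c, ∏ i ∈ colorFiber ρ c, p i ≤ R := fun c =>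
            (prod_le_prod_of_subset_of_one_le_real (fun i hi => by
              simp only [colorFiber, colorSupport, mem_filter, mem_univ, true_and] at hi ⊢
              simp [hi]) (fun i _ _ => hp i) fun i _ => (hpos i).le).trans (hyR ρ h0)
          have e : ∏ c, φ (colorFiber ρ c) = (∏ c, ∏ i ∈ colorFiber ρ c ∩ colorSupport τ, p i) /
              ∏ i ∈ colorSupport ρ, p i := by
            rw [prod_colorSupport, ← prod_div_distrib]
            exact prod_congr rfl fun c _ => by simp only [hφ, if_pos (hle c)]
          rw [e, prod_gamma_eq]
          calc _ ≤ B / (∏ i ∈ colorSupport ρ, p i) *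
                ∏ c, ∏ i ∈ colorFiber ρ c ∩ colorSupport τ, p i := by
                apply mul_le_mul_of_nonneg_right (hy ρ)
                exact prod_nonneg fun c _ => prod_nonneg fun i _ => (hpos i).le
            _ = _ := by ring
      _ = B * ∑ ρ : Fin n → Option (Fin k), ∏ c, φ (colorFiber ρ c) := (mul_sum _ _ _).symm
      _ ≤ B * ∑ S : Fin k → Finset (Fin n), ∏ c, φ (S c) := by
          apply mul_le_mul_of_nonneg_left _ hB
          exact sum_coloring_le (fun S => ∏ c, φ (S c)) fun S => prod_nonneg fun c _ => hφ0 _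
      _ = B * (∑ S, φ S) ^ k := by rw [Fintype.sum_pow]
      _ = _ := by rw [sum_filter]
  have e1 : ∑ N ∈ s, u N * (∑ ρ, (∏ i, localFactor (p i) (x N i) (ρ i)) * y ρ) ^ 2
      = ∑ τ, Γ τ * ∑ N ∈ s, u N * ∏ i, stateIndicator (τ i) (x N i) := by
    simp only [sq_coloring_expand, mul_sum]
    rw [sum_comm]
    exact sum_congr rfl fun τ _ => sum_congr rfl fun N _ => by simp only [hΓ]; ring
  have e2 : M * ∑ z : Fin n → Option (Fin k), (∏ i, w i (z i)) *
        (∑ ρ, (∏ i, localFactor (p i) (z i) (ρ i)) * y ρ) ^ 2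
      = ∑ τ, Γ τ * (M * ∏ i, ∑ a, w i a * stateIndicator (τ i) a) := by
    simp only [sq_coloring_expand, ← sum_weight_stateIndicator, mul_sum]
    rw [sum_comm]
    exact sum_congr rfl fun τ _ => sum_congr rfl fun N _ => by simp only [hΓ]; ring
  rw [e1, e2, ← sum_sub_distrib]
  refine (abs_sum_le_sum_abs _ _).trans ?_
  rw [sum_filter]
  refine sum_le_sum fun τ _ => ?_
  rw [← mul_sub, abs_mul]
  split_ifs with h
  · exact mul_le_mul (hΓle τ) (hErr τ h) (abs_nonneg _) (sq_nonneg _)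
  · rw [hΓ0 τ h]; simp

/-- Sieve weights attached to a one-variable cutoff `F`. -/
noncomputable def sieveWeight {k n : ℕ} (p : Fin n → ℝ) (R : ℝ) (F : ℝ → ℝ)
    (ρ : Fin n → Option (Fin k)) : ℝ :=
  (if ∏ i ∈ colorSupport ρ, p i ≤ R then ∏ c, F (∏ i ∈ colorFiber ρ c, p i) else 0) /
    ∏ i ∈ colorSupport ρ, p i

lemma uniform_main_le {k n : ℕ} (p : Fin n → ℝ) (hp : ∀ i, (k : ℝ) + 1 ≤ p i) (R : ℝ) (F : ℝ → ℝ) :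
    ∑ z : Fin n → Option (Fin k), (∏ i, uniformWeight (p i) (z i)) *
        (∑ ρ, (∏ i, localFactor (p i) (z i) (ρ i)) * sieveWeight p R F ρ) ^ 2 ≤
      (∑ S : Finset (Fin n), F (∏ i ∈ S, p i) ^ 2 / ∏ i ∈ S, p i) ^ k := by
  have hk : (0 : ℝ) ≤ k := Nat.cast_nonneg k
  have hpos : ∀ i, 0 < p i := fun i => by linarith [hp i]
  have hw : ∀ i (a : Option (Fin k)), 0 ≤ uniformWeight (p i) a := by
    rintro i (_ | a)
    · simp only [uniformWeight]
      have : (k : ℝ) / p i ≤ 1 := (div_le_one (hpos i)).mpr (by linarith [hp i])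
      linarith
    · exact (one_div_pos.mpr (hpos i)).le
  have hd : ∀ i (a : Option (Fin k)), 0 ≤ diagWeight (p i) a := by
    intro i a; unfold diagWeight; split_ifs
    · exact zero_le_one
    · exact (hpos i).le
  refine (tensor_sum_sq_le (fun i => diagWeight (p i)) (fun _ e a => if e = a then 1 else 0)
    (fun i => uniformWeight (p i)) (fun i => localFactor (p i)) hd hw
    (fun i c => uniform_local_le (hpos i) c) (sieveWeight p R F)).trans ?_
  have h1 : ∀ x : Fin n → Option (Fin k),
      ∑ ρ, (∏ i, if x i = ρ i then (1 : ℝ) else 0) * sieveWeight p R F ρ = sieveWeight p R F x := by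
    intro x
    rw [Fintype.sum_eq_single x]
    · simp
    · intro ρ hρ
      obtain ⟨i, hi⟩ := Function.ne_iff.mp hρ
      rw [prod_eq_zero (mem_univ i) (if_neg (Ne.symm hi)), zero_mul]
  simp only [h1]
  have hD : ∀ x : Fin n → Option (Fin k), ∏ i, diagWeight (p i) (x i) = ∏ i ∈ colorSupport x, p i := by
    intro x
    rw [colorSupport, prod_filter]
    exact prod_congr rfl fun i _ => by by_cases h : x i = none <;> simp [diagWeight, h]
  have hpp : ∀ S : Finset (Fin n), 0 < ∏ i ∈ S, p i := fun S => prod_pos fun i _ => hpos i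
  calc _ ≤ ∑ x : Fin n → Option (Fin k), ∏ c,
        (F (∏ i ∈ colorFiber x c, p i) ^ 2 / ∏ i ∈ colorFiber x c, p i) := by
        refine sum_le_sum fun x _ => ?_
        rw [hD, prod_div_distrib, ← prod_colorSupport, prod_pow]
        unfold sieveWeight
        have := hpp (colorSupport x)
        rw [div_pow, mul_div_assoc', sq (∏ i ∈ colorSupport x, p i), mul_div_mul_left _ _ this.ne']
        refine div_le_div_of_nonneg_right ?_ this.le
        split_ifs
        · exact le_rfl
        · rw [zero_pow two_ne_zero]; positivity
    _ ≤ ∑ S : Fin k → Finset (Fin n), ∏ c, (F (∏ i ∈ S c, p i) ^ 2 / ∏ i ∈ S c, p i) :=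
        sum_coloring_le (fun S => ∏ c, (F (∏ i ∈ S c, p i) ^ 2 / ∏ i ∈ S c, p i)) fun S =>
          prod_nonneg fun c _ => div_nonneg (sq_nonneg _) (hpp _).le
    _ = _ := by rw [Fintype.sum_pow]

lemma sum_mem_le {n : ℕ} (p : Fin n → ℝ) (hp : ∀ i, 1 ≤ p i) (H : ℝ → ℝ) (hH : Antitone H)
    (hH0 : ∀ t, 0 ≤ H t) (i : Fin n) :
    ∑ S : Finset (Fin n), (if i ∈ S then H (∏ l ∈ S, p l) / ∏ l ∈ S, p l else 0) ≤
      1 / p i * ∑ S : Finset (Fin n), H (∏ l ∈ S, p l) / ∏ l ∈ S, p l := by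
  have hpos : ∀ i, 0 < p i := fun i => one_pos.trans_le (hp i)
  have hpp : ∀ S : Finset (Fin n), 0 < ∏ i ∈ S, p i := fun S => prod_pos fun i _ => hpos i
  set f : Finset (Fin n) → ℝ := fun S => H (∏ l ∈ S, p l) / ∏ l ∈ S, p l with hf
  have hf0 : ∀ S, 0 ≤ f S := fun S => div_nonneg (hH0 _) (hpp S).le
  rw [← sum_filter]
  calc ∑ S ∈ univ.filter (fun S : Finset (Fin n) => i ∈ S), f S ≤
        ∑ S ∈ univ.filter (fun S : Finset (Fin n) => i ∈ S), 1 / p i * f (S.erase i) := by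
        refine sum_le_sum fun S hS => ?_
        have hi : i ∈ S := (mem_filter.mp hS).2
        have e := mul_prod_erase S p hi
        simp only [hf]
        rw [← e, one_div, inv_mul_eq_div, div_div, mul_comm (∏ l ∈ S.erase i, p l)]
        have := hpp (S.erase i)
        have := hpos i
        gcongr
        apply hH
        nlinarith [hp i]
    _ = 1 / p i * ∑ S ∈ (univ.filter (fun S : Finset (Fin n) => i ∈ S)).image
        (fun S : Finset (Fin n) => S.erase i), f S := by
        rw [← mul_sum, sum_image]
        intro S hS T hT h
        have hS : i ∈ S := (mem_filter.mp hS).2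
        have hT : i ∈ T := (mem_filter.mp hT).2
        rw [← insert_erase hS, ← insert_erase hT]; exact congrArg _ h
    _ ≤ 1 / p i * ∑ S, f S := by
        apply mul_le_mul_of_nonneg_left _ (one_div_pos.mpr (hpos i)).le
        exact sum_le_sum_of_subset_of_nonneg (subset_univ _) fun S _ _ => hf0 S

lemma sum_tuple_mul_le {k n : ℕ} (φ ψ : Fin k → Finset (Fin n) → ℝ) (a : Fin k → ℝ)
    (hφ : ∀ c S, 0 ≤ φ c S) (hψ : ∀ c S, 0 ≤ ψ c S)
    (h : ∀ c, ∑ S, φ c S * ψ c S ≤ a c * ∑ S, φ c S) :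
    ∑ S : Fin k → Finset (Fin n), (∏ c, φ c (S c)) * ∏ c, ψ c (S c) ≤
      (∏ c, a c) * ∏ c, ∑ S, φ c S := by
  have : ∑ S : Fin k → Finset (Fin n), (∏ c, φ c (S c)) * ∏ c, ψ c (S c)
      = ∏ c, ∑ S, φ c S * ψ c S := by
    rw [prod_univ_sum, Fintype.piFinset_univ]
    exact sum_congr rfl fun S _ => by rw [prod_mul_distrib]
  rw [this, ← prod_mul_distrib]
  exact prod_le_prod (fun c _ => sum_nonneg fun S _ => mul_nonneg (hφ c S) (hψ c S)) fun c _ => h c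

lemma one_sub_sum_le_prod {ι : Type*} (s : Finset ι) (x : ι → ℝ) (h0 : ∀ i ∈ s, 0 ≤ x i)
    (h1 : ∀ i ∈ s, x i ≤ 1) : 1 - ∑ i ∈ s, x i ≤ ∏ i ∈ s, (1 - x i) := by
  classical
  induction s using Finset.induction_on with
  | empty => simp
  | insert i s hi ih =>
    rw [sum_insert hi, prod_insert hi]
    have ih := ih (fun i h => h0 i (mem_insert_of_mem h)) fun i h => h1 i (mem_insert_of_mem h)
    have a := h0 i (mem_insert_self _ _)
    have b := h1 i (mem_insert_self _ _)
    have c : 0 ≤ ∑ i ∈ s, x i := sum_nonneg fun i h => h0 i (mem_insert_of_mem h)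
    nlinarith

open Classical in
/-- Under a product measure most tuples of sets are disjoint, consist of large primes and have
small product. -/
lemma sum_good_tuples {k n : ℕ} (p : Fin n → ℝ) (hp : ∀ i, 1 ≤ p i)
    (φ : Fin k → Finset (Fin n) → ℝ) (hφ : ∀ c S, 0 ≤ φ c S) {ℓ : ℝ} (hℓ : 0 < ℓ) (hk : 0 < k)
    (hmem : ∀ c i, ∑ S, φ c S * (if i ∈ S then 1 else 0) ≤ 1 / p i * ∑ S, φ c S)
    (hlog : ∀ c, ∑ S, φ c S * Real.log (∏ i ∈ S, p i) ≤ ℓ / (8 * k) * ∑ S, φ c S)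
    (hsum : ∑ i, 1 / p i ^ 2 ≤ 1 / (100 * (k : ℝ) ^ 2)) :
    1 / 2 * ∏ c, ∑ S, φ c S ≤
      ∑ S ∈ (univ.filter (fun S : Fin k → Finset (Fin n) => Pairwise (Function.onFun Disjoint S))),
        (if ∑ c, ∑ i ∈ S c, 1 / p i ≤ 1 / (8 * k) ∧ ∑ c, Real.log (∏ i ∈ S c, p i) ≤ ℓ then
          ∏ c, φ c (S c) else 0) := by
  have hpos : ∀ i, 0 < p i := fun i => one_pos.trans_le (hp i)
  have hk' : (0 : ℝ) < k := by exact_mod_cast hk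
  set T := ∏ c, ∑ S, φ c S with hT
  have hT0 : 0 ≤ T := prod_nonneg fun c _ => sum_nonneg fun S _ => hφ c S
  have hg0 : ∀ S : Fin k → Finset (Fin n), 0 ≤ ∏ c, φ c (S c) := fun S => prod_nonneg fun c _ => hφ _ _
  have htot : T = ∑ S : Fin k → Finset (Fin n), ∏ c, φ c (S c) := by
    rw [hT, prod_univ_sum, Fintype.piFinset_univ]
  have hlog0 : ∀ S : Finset (Fin n), 0 ≤ Real.log (∏ i ∈ S, p i) := fun S =>
    Real.log_nonneg (one_le_prod fun i _ => hp i)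
  have one : ∀ (ψ : Finset (Fin n) → ℝ) (a : ℝ) (c₀ : Fin k), (∀ S, 0 ≤ ψ S) →
      (∑ S, φ c₀ S * ψ S ≤ a * ∑ S, φ c₀ S) →
      ∑ S : Fin k → Finset (Fin n), (∏ c, φ c (S c)) * ψ (S c₀) ≤ a * T := by
    intro ψ a c₀ hψ h
    have := sum_tuple_mul_le φ (fun c S => if c = c₀ then ψ S else 1)
      (fun c => if c = c₀ then a else 1) hφ
      (fun c S => by split_ifs; exacts [hψ S, zero_le_one])
      (fun c => by
        by_cases hc : c = c₀
        · subst hc; simpa using h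
        · simp [hc])
    simpa only [prod_ite_eq', mem_univ, if_true] using this
  have two : ∀ (i : Fin n) (c₀ c₁ : Fin k), c₀ ≠ c₁ →
      ∑ S : Fin k → Finset (Fin n), (∏ c, φ c (S c)) *
        ((if i ∈ S c₀ then 1 else 0) * (if i ∈ S c₁ then 1 else 0)) ≤ 1 / p i ^ 2 * T := by
    intro i c₀ c₁ hne
    have := sum_tuple_mul_le φ
      (fun c S => (if c = c₀ then (if i ∈ S then 1 else 0) else 1) *
        (if c = c₁ then (if i ∈ S then 1 else 0) else 1))
      (fun c => (if c = c₀ then 1 / p i else 1) * (if c = c₁ then 1 / p i else 1)) hφ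
      (fun c S => by positivity)
      (fun c => by
        by_cases h0 : c = c₀
        · subst h0; simpa [hne] using hmem c i
        · by_cases h1 : c = c₁
          · subst h1; simpa [h0] using hmem c i
          · simp [h0, h1])
    simp only [prod_mul_distrib, prod_ite_eq', mem_univ, if_true] at this
    rw [← hT] at this
    convert this using 2
    rw [sq, one_div_mul_one_div]
  have bad1 : ∑ S : Fin k → Finset (Fin n), (∏ c, φ c (S c)) *
      (∑ i, ∑ c₀, ∑ c₁, if c₀ ≠ c₁ then
        ((if i ∈ S c₀ then (1 : ℝ) else 0) * (if i ∈ S c₁ then 1 else 0)) else 0) ≤ 1 / 100 * T := by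
    simp only [mul_sum]
    rw [sum_comm]
    calc _ ≤ ∑ i : Fin n, ∑ c₀ : Fin k, ∑ c₁ : Fin k, 1 / p i ^ 2 * T := by
          refine sum_le_sum fun i _ => ?_
          rw [sum_comm]
          refine sum_le_sum fun c₀ _ => ?_
          rw [sum_comm]
          refine sum_le_sum fun c₁ _ => ?_
          by_cases hne : c₀ ≠ c₁
          · simpa only [if_pos hne] using two i c₀ c₁ hne
          · simp only [if_neg hne, mul_zero, sum_const_zero]; positivity
      _ = (k : ℝ) ^ 2 * (∑ i, 1 / p i ^ 2) * T := by
          simp only [sum_const, card_univ, Fintype.card_fin, nsmul_eq_mul, ← mul_sum, ← sum_mul]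
          ring
      _ ≤ (k : ℝ) ^ 2 * (1 / (100 * (k : ℝ) ^ 2)) * T := by gcongr
      _ = _ := by field_simp
  have bad2 : ∑ S : Fin k → Finset (Fin n), (∏ c, φ c (S c)) *
      (8 * k * ∑ c, ∑ i ∈ S c, 1 / p i) ≤ 8 / 100 * T := by
    have e : ∀ S : Fin k → Finset (Fin n), (∏ c, φ c (S c)) * (8 * k * ∑ c, ∑ i ∈ S c, 1 / p i)
        = 8 * k * ∑ c, ∑ i, 1 / p i * ((∏ c, φ c (S c)) * if i ∈ S c then 1 else 0) := by
      intro S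
      have : ∀ c, ∑ i ∈ S c, 1 / p i = ∑ i, 1 / p i * (if i ∈ S c then 1 else 0) := fun c => by
        simp only [mul_ite, mul_one, mul_zero, sum_ite_mem, univ_inter]
      simp only [this]
      rw [mul_left_comm, mul_sum]
      congr 1
      refine sum_congr rfl fun c _ => ?_
      rw [mul_sum]
      exact sum_congr rfl fun i _ => by ring
    simp only [e]
    rw [← mul_sum, sum_comm]
    calc _ ≤ 8 * k * ∑ c : Fin k, ∑ i, 1 / p i * (1 / p i * T) := by
          gcongr with c _
          rw [sum_comm]
          gcongr with i _
          rw [← mul_sum]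
          have := hpos i
          gcongr
          exact one (fun S => if i ∈ S then 1 else 0) _ c (fun S => by positivity) (hmem c i)
      _ = 8 * (k : ℝ) ^ 2 * (∑ i, 1 / p i ^ 2) * T := by
          simp only [← mul_assoc, ← sq]
          simp only [sum_const, card_univ, Fintype.card_fin, nsmul_eq_mul, ← sum_mul]
          ring_nf
      _ ≤ 8 * (k : ℝ) ^ 2 * (1 / (100 * (k : ℝ) ^ 2)) * T := by gcongr
      _ = _ := by field_simp
  have bad3 : ∑ S : Fin k → Finset (Fin n), (∏ c, φ c (S c)) *
      (1 / ℓ * ∑ c, Real.log (∏ i ∈ S c, p i)) ≤ 1 / 8 * T := by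
    have e : ∀ S : Fin k → Finset (Fin n),
        (∏ c, φ c (S c)) * (1 / ℓ * ∑ c, Real.log (∏ i ∈ S c, p i))
        = 1 / ℓ * ∑ c, (∏ c, φ c (S c)) * Real.log (∏ i ∈ S c, p i) := by
      intro S; rw [← mul_sum]; ring
    simp only [e]
    rw [← mul_sum, sum_comm]
    calc _ ≤ 1 / ℓ * ∑ c : Fin k, ℓ / (8 * k) * T := by
          gcongr with c _
          exact one (fun S => Real.log (∏ i ∈ S, p i)) _ c hlog0 (hlog c)
      _ = _ := by
          simp only [sum_const, card_univ, Fintype.card_fin, nsmul_eq_mul]; field_simp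
  have key : ∀ S : Fin k → Finset (Fin n), (∏ c, φ c (S c)) ≤
      (if Pairwise (Function.onFun Disjoint S) then
        (if ∑ c, ∑ i ∈ S c, 1 / p i ≤ 1 / (8 * k) ∧ ∑ c, Real.log (∏ i ∈ S c, p i) ≤ ℓ then
          ∏ c, φ c (S c) else 0) else 0) +
      ((∏ c, φ c (S c)) * (∑ i, ∑ c₀, ∑ c₁, if c₀ ≠ c₁ then
        ((if i ∈ S c₀ then (1 : ℝ) else 0) * (if i ∈ S c₁ then 1 else 0)) else 0) +
      (∏ c, φ c (S c)) * (8 * k * ∑ c, ∑ i ∈ S c, 1 / p i) +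
      (∏ c, φ c (S c)) * (1 / ℓ * ∑ c, Real.log (∏ i ∈ S c, p i))) := by
    intro S
    have n1 : 0 ≤ ∑ i, ∑ c₀, ∑ c₁, if c₀ ≠ c₁ then
        ((if i ∈ S c₀ then (1 : ℝ) else 0) * (if i ∈ S c₁ then 1 else 0)) else 0 := by positivity
    have n2 : 0 ≤ 8 * k * ∑ c, ∑ i ∈ S c, 1 / p i :=
      mul_nonneg (by positivity) (sum_nonneg fun c _ => sum_nonneg fun i _ => (one_div_pos.mpr (hpos i)).le)
    have n3 : 0 ≤ 1 / ℓ * ∑ c, Real.log (∏ i ∈ S c, p i) :=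
      mul_nonneg (by positivity) (sum_nonneg fun c _ => hlog0 _)
    have hS := hg0 S
    set g := ∏ c, φ c (S c)
    by_cases h1 : Pairwise (Function.onFun Disjoint S)
    · rw [if_pos h1]
      by_cases h2 : ∑ c, ∑ i ∈ S c, 1 / p i ≤ 1 / (8 * k)
      · by_cases h3 : ∑ c, Real.log (∏ i ∈ S c, p i) ≤ ℓ
        · rw [if_pos ⟨h2, h3⟩]; nlinarith
        · have : 1 ≤ 1 / ℓ * ∑ c, Real.log (∏ i ∈ S c, p i) := by
            rw [one_div, inv_mul_eq_div, le_div_iff₀ hℓ]; linarith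
          rw [if_neg (fun h => h3 h.2)]; nlinarith
      · have : 1 ≤ 8 * k * ∑ c, ∑ i ∈ S c, 1 / p i := by
          rw [not_le, div_lt_iff₀ (by positivity)] at h2; linarith
        rw [if_neg (fun h => h2 h.1)]; nlinarith
    · have : 1 ≤ ∑ i, ∑ c₀, ∑ c₁, if c₀ ≠ c₁ then
        ((if i ∈ S c₀ then (1 : ℝ) else 0) * (if i ∈ S c₁ then 1 else 0)) else 0 := by
        simp only [Pairwise, not_forall] at h1
        obtain ⟨c₀, c₁, hne, hd⟩ := h1
        obtain ⟨i, hi0, hi1⟩ := not_disjoint_iff.mp hd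
        refine le_trans ?_ (single_le_sum (fun _ _ => by positivity) (mem_univ i))
        refine le_trans ?_ (single_le_sum (fun _ _ => by positivity) (mem_univ c₀))
        refine le_trans ?_ (single_le_sum (fun _ _ => by positivity) (mem_univ c₁))
        simp [hne, hi0, hi1]
      rw [if_neg h1]; nlinarith
  have := sum_le_sum fun S (_ : S ∈ (univ : Finset (Fin k → Finset (Fin n)))) => key S
  rw [sum_add_distrib, sum_add_distrib, sum_add_distrib, ← htot] at this
  rw [sum_filter]
  linarith

lemma colorSupport_eq_biUnion {k n : ℕ} (ρ : Fin n → Option (Fin k)) :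
    colorSupport ρ = univ.biUnion (colorFiber ρ) := by
  ext i
  simp only [colorSupport, colorFiber, mem_filter, mem_univ, true_and, mem_biUnion]
  exact Option.ne_none_iff_exists'

lemma sum_colorSupport {k n : ℕ} (ρ : Fin n → Option (Fin k)) (f : Fin n → ℝ) :
    ∑ i ∈ colorSupport ρ, f i = ∑ c, ∑ i ∈ colorFiber ρ c, f i := by
  rw [colorSupport_eq_biUnion, sum_biUnion]
  intro c _ c' _ hne
  refine disjoint_left.mpr fun i hi hi' => hne ?_
  simp only [colorFiber, mem_filter, mem_univ, true_and] at hi hi'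
  exact Option.some_injective _ (hi.symm.trans hi')

lemma prod_lowerWeight_ge {k n : ℕ} (p : Fin n → ℝ) (j : Fin k) (hp : ∀ i, 8 * (k : ℝ) ≤ p i)
    (hsum : ∑ i, 1 / p i ^ 2 ≤ 1 / 4) (e : Fin n → Option (Fin k)) (hj : colorFiber e j = ∅)
    (he : ∑ i ∈ colorSupport e, 1 / p i ≤ 1 / (8 * k)) :
    (∏ i ∈ colorSupport e, p i) / 4 ≤ ∏ i, lowerWeight j (p i) (e i) := by
  have hk : 1 ≤ (k : ℝ) := by exact_mod_cast j.pos
  have hpos : ∀ i, 0 < p i := fun i => by linarith [hp i]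
  have h1 : ∏ i ∈ univ.filter (fun i => ¬ e i ≠ none), lowerWeight j (p i) (e i)
      = ∏ i ∈ univ.filter (fun i => ¬ e i ≠ none), (1 - 1 / p i ^ 2) :=
    prod_congr rfl fun i hi => by
      rw [not_not.mp (mem_filter.mp hi).2]; rfl
  have h2 : ∏ i ∈ colorSupport e, lowerWeight j (p i) (e i)
      = (∏ i ∈ colorSupport e, p i) * ∏ i ∈ colorSupport e, (1 - 4 * k * (1 / p i)) := by
    rw [← prod_mul_distrib]
    refine prod_congr rfl fun i hi => ?_
    obtain ⟨c, hc⟩ := Option.ne_none_iff_exists'.mp (mem_filter.mp hi).2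
    have : c ≠ j := by
      rintro rfl
      have : i ∈ colorFiber e c := by simp [colorFiber, hc]
      rw [hj] at this; simp at this
    rw [hc]; simp only [lowerWeight, if_neg this]
    have := hpos i
    field_simp
  rw [← prod_filter_mul_prod_filter_not univ (fun i => e i ≠ none), h1]
  change _ ≤ (∏ i ∈ colorSupport e, lowerWeight j (p i) (e i)) * _
  rw [h2]
  have a1 : (1 : ℝ) / 2 ≤ ∏ i ∈ colorSupport e, (1 - 4 * k * (1 / p i)) := by
    refine le_trans ?_ (one_sub_sum_le_prod _ (fun i => 4 * k * (1 / p i)) (fun i _ => ?_) fun i _ => ?_)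
    · rw [← mul_sum]
      have : 4 * k * ∑ i ∈ colorSupport e, 1 / p i ≤ 4 * k * (1 / (8 * k)) := by gcongr
      have e : 4 * (k : ℝ) * (1 / (8 * k)) = 1 / 2 := by field_simp; norm_num
      linarith
    · have := hpos i; positivity
    · rw [mul_one_div, div_le_one (hpos i)]; linarith [hp i]
  have a2 : (1 : ℝ) / 2 ≤ ∏ i ∈ univ.filter (fun i => ¬ e i ≠ none), (1 - 1 / p i ^ 2) := by
    refine le_trans ?_ (one_sub_sum_le_prod _ (fun i => 1 / p i ^ 2) (fun i _ => by positivity) fun i _ => ?_)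
    · have := sum_le_sum_of_subset_of_nonneg (filter_subset (fun i => ¬ e i ≠ none) univ)
        (f := fun i => 1 / p i ^ 2) fun i _ _ => by positivity
      linarith
    · rw [div_le_one (by have := hpos i; positivity)]
      nlinarith [hp i]
  have hD : 0 < ∏ i ∈ colorSupport e, p i := prod_pos fun i _ => hpos i
  calc _ = (∏ i ∈ colorSupport e, p i) * (1 / 2) * (1 / 2) := by ring
    _ ≤ _ := by gcongr

/-- Colour the uncoloured indices in `T` with `j`. -/
def extendColoring {k n : ℕ} (j : Fin k) (e : Fin n → Option (Fin k)) (T : Finset (Fin n)) :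
    Fin n → Option (Fin k) := fun i => if i ∈ T then some j else e i

lemma sum_disjoint_ge {n : ℕ} (p : Fin n → ℝ) (hp : ∀ i, 1 ≤ p i) (F : ℝ → ℝ) (hF : Antitone F)
    (hF0 : ∀ t, 0 ≤ F t) (D : Finset (Fin n)) (hD : ∑ i ∈ D, 1 / p i ≤ 1 / 2) :
    1 / 2 * ∑ S : Finset (Fin n), F (∏ l ∈ S, p l) / ∏ l ∈ S, p l ≤
      ∑ S ∈ univ.filter (fun S : Finset (Fin n) => Disjoint S D), F (∏ l ∈ S, p l) / ∏ l ∈ S, p l := by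
  have hpos : ∀ i, 0 < p i := fun i => one_pos.trans_le (hp i)
  set f : Finset (Fin n) → ℝ := fun S => F (∏ l ∈ S, p l) / ∏ l ∈ S, p l with hf
  have hf0 : ∀ S, 0 ≤ f S := fun S => div_nonneg (hF0 _) (prod_pos fun i _ => hpos i).le
  have h1 : ∑ S ∈ univ.filter (fun S : Finset (Fin n) => ¬ Disjoint S D), f S ≤
      ∑ i ∈ D, ∑ S : Finset (Fin n), if i ∈ S then f S else 0 := by
    rw [sum_comm, sum_filter]
    refine sum_le_sum fun S _ => ?_
    by_cases h : Disjoint S D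
    swap
    · rw [if_pos h]
      obtain ⟨i, hi, hi'⟩ := not_disjoint_iff.mp h
      refine le_trans (by rw [if_pos hi]) (single_le_sum (f := fun i => if i ∈ S then f S else 0)
        (fun i _ => ?_) hi')
      split_ifs; exacts [hf0 S, le_rfl]
    · rw [if_neg (not_not.mpr h)]
      exact sum_nonneg fun i _ => by split_ifs; exacts [hf0 S, le_rfl]
  have h2 : ∑ i ∈ D, ∑ S : Finset (Fin n), (if i ∈ S then f S else 0) ≤ 1 / 2 * ∑ S, f S := by
    calc _ ≤ ∑ i ∈ D, 1 / p i * ∑ S, f S := sum_le_sum fun i _ => sum_mem_le p hp F hF hF0 i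
      _ = (∑ i ∈ D, 1 / p i) * ∑ S, f S := by rw [sum_mul]
      _ ≤ _ := mul_le_mul_of_nonneg_right hD (sum_nonneg fun S _ => hf0 S)
  have := sum_filter_add_sum_filter_not (univ : Finset (Finset (Fin n))) (fun S => Disjoint S D) f
  linarith

lemma sieveWeight_nonneg {k n : ℕ} (p : Fin n → ℝ) (hp : ∀ i, 0 < p i) (R : ℝ) (F : ℝ → ℝ)
    (hF0 : ∀ t, 0 ≤ F t) (ρ : Fin n → Option (Fin k)) : 0 ≤ sieveWeight p R F ρ := by
  refine div_nonneg ?_ (prod_pos fun i _ => hp i).le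
  split_ifs
  exacts [prod_nonneg fun c _ => hF0 _, le_rfl]

lemma inner_sum_ge {k n : ℕ} (p : Fin n → ℝ) (hp : ∀ i, 1 ≤ p i) (R : ℝ) (F : ℝ → ℝ)
    (hF : Antitone F) (hF0 : ∀ t, 0 ≤ F t) (hR : 0 ≤ R) (hFR : ∀ t, F t ≠ 0 → t ≤ Real.sqrt R)
    (j : Fin k)
    (e : Fin n → Option (Fin k)) (hj : colorFiber e j = ∅)
    (he : ∑ i ∈ colorSupport e, 1 / p i ≤ 1 / 2) (heR : ∏ i ∈ colorSupport e, p i ≤ Real.sqrt R) :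
    (∏ c ∈ univ.erase j, F (∏ i ∈ colorFiber e c, p i)) / (∏ i ∈ colorSupport e, p i) *
      (1 / 2 * ∑ S : Finset (Fin n), F (∏ l ∈ S, p l) / ∏ l ∈ S, p l) ≤
      ∑ ρ, (∏ i, lowerMatrix j (e i) (ρ i)) * sieveWeight p R F ρ := by
  have hpos : ∀ i, 0 < p i := fun i => one_pos.trans_le (hp i)
  have hpp : ∀ S : Finset (Fin n), 0 < ∏ i ∈ S, p i := fun S => prod_pos fun i _ => hpos i
  have hne : ∀ i, e i ≠ some j := by
    intro i hi
    have : i ∈ colorFiber e j := by simp [colorFiber, hi]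
    rw [hj] at this; simp at this
  set D := colorSupport e with hD
  set 𝒯 := univ.filter (fun S : Finset (Fin n) => Disjoint S D) with h𝒯
  have hnone : ∀ T ∈ 𝒯, ∀ i ∈ T, e i = none := by
    intro T hT i hi
    have := disjoint_left.mp (mem_filter.mp hT).2 hi
    simpa [hD, colorSupport] using this
  have hfj : ∀ T, colorFiber (extendColoring j e T) j = T := by
    intro T; ext i
    simp only [colorFiber, extendColoring]
    by_cases hi : i ∈ T <;> simp [hi, hne]
  have hfc : ∀ T ∈ 𝒯, ∀ c, c ≠ j → colorFiber (extendColoring j e T) c = colorFiber e c := by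
    intro T hT c hc; ext i
    rw [colorFiber, colorFiber, mem_filter, mem_filter, extendColoring]
    by_cases hi : i ∈ T
    · simp [hi, hnone T hT i hi, Ne.symm hc]
    · simp [hi]
  have hprod : ∀ T ∈ 𝒯, ∏ i ∈ colorSupport (extendColoring j e T), p i
      = (∏ i ∈ D, p i) * ∏ i ∈ T, p i := by
    intro T hT
    rw [prod_colorSupport, hD, prod_colorSupport, ← mul_prod_erase univ _ (mem_univ j),
      ← mul_prod_erase univ (fun c => ∏ i ∈ colorFiber e c, p i) (mem_univ j), hfj, hj, prod_empty, one_mul, mul_comm]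
    congr 1
    exact prod_congr rfl fun c hc => by rw [hfc T hT c (ne_of_mem_erase hc)]
  calc _ ≤ (∏ c ∈ univ.erase j, F (∏ i ∈ colorFiber e c, p i)) / (∏ i ∈ D, p i) *
        ∑ T ∈ 𝒯, F (∏ l ∈ T, p l) / ∏ l ∈ T, p l := by
        have := sum_disjoint_ge p hp F hF hF0 D he
        have h0 : 0 ≤ (∏ c ∈ univ.erase j, F (∏ i ∈ colorFiber e c, p i)) / (∏ i ∈ D, p i) :=
          div_nonneg (prod_nonneg fun c _ => hF0 _) (hpp D).le
        gcongr
    _ = ∑ T ∈ 𝒯, sieveWeight p R F (extendColoring j e T) := by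
        rw [mul_sum]
        refine sum_congr rfl fun T hT => ?_
        unfold sieveWeight
        rw [hprod T hT, ← mul_prod_erase univ _ (mem_univ j), hfj]
        have hG : ∏ c ∈ univ.erase j, F (∏ i ∈ colorFiber (extendColoring j e T) c, p i) =
            ∏ c ∈ univ.erase j, F (∏ i ∈ colorFiber e c, p i) :=
          prod_congr rfl fun c hc => by rw [hfc T hT c (ne_of_mem_erase hc)]
        rw [hG]
        have hd := hpp D
        have ht := hpp T
        by_cases hz : F (∏ i ∈ T, p i) = 0
        · simp [hz]
        · rw [if_pos]
          · field_simp
          · calc _ ≤ Real.sqrt R * Real.sqrt R := by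
                  have := hFR _ hz
                  gcongr
              _ = R := Real.mul_self_sqrt hR
    _ = ∑ T ∈ 𝒯, (∏ i, lowerMatrix j (e i) (extendColoring j e T i)) *
          sieveWeight p R F (extendColoring j e T) := by
        refine sum_congr rfl fun T hT => ?_
        rw [prod_eq_one, one_mul]
        intro i _
        unfold lowerMatrix extendColoring
        by_cases hi : i ∈ T
        · simp [hi, hnone T hT i hi]
        · simp [hi]
    _ = ∑ ρ ∈ 𝒯.image (extendColoring j e), (∏ i, lowerMatrix j (e i) (ρ i)) *
          sieveWeight p R F ρ := by
        rw [sum_image]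
        intro T _ T' _ h
        rw [← hfj T, ← hfj T', h]
    _ ≤ _ := by
        refine sum_le_sum_of_subset_of_nonneg (subset_univ _) fun ρ _ _ => ?_
        refine mul_nonneg (prod_nonneg fun i _ => ?_) (sieveWeight_nonneg p hpos R F hF0 ρ)
        unfold lowerMatrix; split_ifs <;> norm_num

/-- Lower bound for the main term of the prime-weighted sieve sum. -/
lemma prime_main_ge {k n : ℕ} (p : Fin n → ℝ) (hp : ∀ i, 8 * (k : ℝ) ≤ p i) (hp' : ∀ i, 16 ≤ p i)
    (R : ℝ) (hR : 0 ≤ R) (F : ℝ → ℝ) (hF : Antitone F) (hF0 : ∀ t, 0 ≤ F t)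
    (hFR : ∀ t, F t ≠ 0 → t ≤ Real.sqrt R) (j : Fin k)
    (hsum : ∑ i, 1 / p i ^ 2 ≤ 1 / (100 * (k : ℝ) ^ 2)) {ℓ : ℝ} (hℓ : 0 < ℓ)
    (hℓR : Real.exp ℓ ≤ Real.sqrt R)
    (hlog : ∑ S : Finset (Fin n), F (∏ i ∈ S, p i) ^ 2 / (∏ i ∈ S, p i) * Real.log (∏ i ∈ S, p i) ≤
      ℓ / (8 * k) * ∑ S : Finset (Fin n), F (∏ i ∈ S, p i) ^ 2 / ∏ i ∈ S, p i) :
    1 / 32 * (∑ S : Finset (Fin n), F (∏ i ∈ S, p i) / ∏ i ∈ S, p i) ^ 2 *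
      (∑ S : Finset (Fin n), F (∏ i ∈ S, p i) ^ 2 / ∏ i ∈ S, p i) ^ (k - 1) ≤
    ∑ z : Fin n → Option (Fin k), (∏ i, primeWeight j (p i) (z i)) *
        (∑ ρ, (∏ i, localFactor (p i) (z i) (ρ i)) * sieveWeight p R F ρ) ^ 2 := by
  classical
  have hk0 : 0 < k := j.pos
  have hk : 1 ≤ (k : ℝ) := by exact_mod_cast j.pos
  have hp1 : ∀ i, 1 ≤ p i := fun i => by linarith [hp' i]
  have hpos : ∀ i, 0 < p i := fun i => by linarith [hp' i]
  have hpp : ∀ S : Finset (Fin n), 0 < ∏ i ∈ S, p i := fun S => prod_pos fun i _ => hpos i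
  have hpp1 : ∀ S : Finset (Fin n), 1 ≤ ∏ i ∈ S, p i := fun S => one_le_prod fun i _ => hp1 i
  set Y := ∑ S : Finset (Fin n), F (∏ i ∈ S, p i) / ∏ i ∈ S, p i with hY
  set Z := ∑ S : Finset (Fin n), F (∏ i ∈ S, p i) ^ 2 / ∏ i ∈ S, p i with hZ
  have hY0 : 0 ≤ Y := sum_nonneg fun S _ => div_nonneg (hF0 _) (hpp _).le
  have hw : ∀ i (a : Option (Fin k)), 0 ≤ primeWeight j (p i) a := by
    rintro i (_ | a)
    · simp only [primeWeight]
      have : ((k : ℝ) - 1) / (p i - 1) ≤ 1 :=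
        (div_le_one (by linarith [hp' i])).mpr (by linarith [hp i])
      linarith
    · simp only [primeWeight]; split_ifs
      · exact le_rfl
      · exact (one_div_pos.mpr (by linarith [hp' i])).le
  have hd : ∀ i (a : Option (Fin k)), 0 ≤ lowerWeight j (p i) a := by
    rintro i (_ | a)
    · simp only [lowerWeight]
      have : 1 / p i ^ 2 ≤ 1 := (div_le_one (by have := hpos i; positivity)).mpr (by nlinarith [hp' i])
      linarith
    · simp only [lowerWeight]; split_ifs
      · exact le_rfl
      · linarith [hp i]
  refine le_trans ?_ (tensor_sum_sq_le (fun i => primeWeight j (p i)) (fun i => localFactor (p i))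
    (fun i => lowerWeight j (p i)) (fun _ => lowerMatrix j) hw hd
    (fun i c => prime_local_ge j (hp' i) c) (sieveWeight p R F))
  set φ : Fin k → Finset (Fin n) → ℝ := fun c S =>
    if c = j then (if S = ∅ then 1 else 0) else F (∏ i ∈ S, p i) ^ 2 / ∏ i ∈ S, p i with hφ
  have hφ0 : ∀ c S, 0 ≤ φ c S := by
    intro c S; simp only [hφ]; have := hpp S; split_ifs <;> positivity
  have hφj : ∑ S, φ j S = 1 := by simp [hφ]
  have hφc : ∀ c, c ≠ j → ∑ S, φ c S = Z := fun c hc => by simp [hφ, hc, hZ]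
  have hmain := sum_good_tuples p hp1 φ hφ0 hℓ hk0
    (fun c i => by
      by_cases hc : c = j
      · subst hc
        have : ∀ S : Finset (Fin n), φ c S * (if i ∈ S then 1 else 0) = 0 := by
          intro S; by_cases h : S = ∅ <;> simp [hφ, h]
        simp only [this, sum_const_zero]
        rw [hφj]; have := hpos i; positivity
      · have hA : Antitone fun t => F t ^ 2 := fun a b hab =>
          pow_le_pow_left₀ (hF0 _) (hF hab) 2
        have := sum_mem_le p hp1 (fun t => F t ^ 2) hA (fun t => sq_nonneg _) i
        simpa [hφ, hc] using this)
    (fun c => by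
      by_cases hc : c = j
      · subst hc
        have : ∀ S : Finset (Fin n), φ c S * Real.log (∏ i ∈ S, p i) = 0 := by
          intro S; by_cases h : S = ∅ <;> simp [hφ, h]
        simp only [this, sum_const_zero]
        rw [hφj]; positivity
      · simpa [hφ, hc] using hlog)
    hsum
  have hprod : ∏ c, ∑ S, φ c S = Z ^ (k - 1) := by
    rw [← mul_prod_erase univ _ (mem_univ j), hφj, one_mul,
      prod_congr rfl fun c hc => hφc c (ne_of_mem_erase hc), prod_const, card_erase_of_mem (mem_univ j),
      card_univ, Fintype.card_fin]
  rw [hprod] at hmain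
  set ψ : (Fin k → Finset (Fin n)) → ℝ := fun S =>
    if ∑ c, ∑ i ∈ S c, 1 / p i ≤ 1 / (8 * k) ∧ ∑ c, Real.log (∏ i ∈ S c, p i) ≤ ℓ then
          ∏ c, φ c (S c) else 0 with hψ
  have hψ0 : ∀ S, 0 ≤ ψ S := fun S => by
    simp only [hψ]; split_ifs; exacts [prod_nonneg fun c _ => hφ0 _ _, le_rfl]
  have h2 := hmain.trans (sum_disjoint_le_sum_coloring ψ hψ0)
  calc _ = Y ^ 2 / 16 * (1 / 2 * Z ^ (k - 1)) := by ring
    _ ≤ Y ^ 2 / 16 * ∑ ρ : Fin n → Option (Fin k), ψ (colorFiber ρ) := by gcongr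
    _ = ∑ e : Fin n → Option (Fin k), Y ^ 2 / 16 * ψ (colorFiber e) := mul_sum _ _ _
    _ ≤ _ := by
      refine sum_le_sum fun e _ => ?_
      have hrhs : 0 ≤ (∏ i, lowerWeight j (p i) (e i)) *
          (∑ ρ, (∏ i, lowerMatrix j (e i) (ρ i)) * sieveWeight p R F ρ) ^ 2 :=
        mul_nonneg (prod_nonneg fun i _ => hd _ _) (sq_nonneg _)
      by_cases hcond : ∑ c, ∑ i ∈ colorFiber e c, 1 / p i ≤ 1 / (8 * k) ∧
          ∑ c, Real.log (∏ i ∈ colorFiber e c, p i) ≤ ℓ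
      swap
      · simp only [hψ, if_neg hcond, mul_zero]; exact hrhs
      by_cases hj : colorFiber e j = ∅
      swap
      · have : ∏ c, φ c (colorFiber e c) = 0 := prod_eq_zero (mem_univ j) (by simp [hφ, hj])
        simp only [hψ, if_pos hcond, this, mul_zero]; exact hrhs
      have he : ∑ i ∈ colorSupport e, 1 / p i ≤ 1 / (8 * k) := by
        rw [sum_colorSupport]; exact hcond.1
      have heR : ∏ i ∈ colorSupport e, p i ≤ Real.sqrt R := by
        refine le_trans ?_ hℓR
        rw [← Real.log_le_iff_le_exp (hpp _), prod_colorSupport, Real.log_prod fun c _ => (hpp _).ne']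
        exact hcond.2
      have h8 : 1 / (8 * (k : ℝ)) ≤ 1 / 2 := by
        apply one_div_le_one_div_of_le <;> linarith
      have hq : 1 / (100 * (k : ℝ) ^ 2) ≤ 1 / 4 := by
        apply one_div_le_one_div_of_le <;> nlinarith
      have a1 := prod_lowerWeight_ge p j hp (hsum.trans hq) e hj he
      have a2 := inner_sum_ge p hp1 R F hF hF0 hR hFR j e hj (he.trans h8) heR
      have hD := hpp (colorSupport e)
      have hG : 0 ≤ ∏ c ∈ univ.erase j, F (∏ i ∈ colorFiber e c, p i) := prod_nonneg fun c _ => hF0 _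
      set G := ∏ c ∈ univ.erase j, F (∏ i ∈ colorFiber e c, p i) with hGdef
      set D := ∏ i ∈ colorSupport e, p i with hDdef
      have hψe : ψ (colorFiber e) = G ^ 2 / D := by
        simp only [hψ, if_pos hcond]
        rw [← mul_prod_erase univ _ (mem_univ j)]
        have : φ j (colorFiber e j) = 1 := by simp [hφ, hj]
        rw [this, one_mul, hDdef, prod_colorSupport, ← mul_prod_erase univ _ (mem_univ j), hj, prod_empty,
          one_mul, hGdef, ← prod_pow, ← prod_div_distrib]
        exact prod_congr rfl fun c hc => by simp only [hφ, if_neg (ne_of_mem_erase hc)]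
      rw [hψe]
      calc _ = D / 4 * (G / D * (1 / 2 * Y)) ^ 2 := by field_simp; ring
        _ ≤ _ := by
          have : 0 ≤ ∏ i, lowerWeight j (p i) (e i) := prod_nonneg fun i _ => hd _ _
          gcongr

lemma coprime_block_bounds {W : ℕ} (hW : 0 < W) (J : ℕ) :
    (W.totient : ℝ) / W * (harmonic (J + 1) - 1 : ℚ) ≤
        ∑ n ∈ (Ico W (W * (J + 1))).filter (Nat.Coprime W), (1 : ℝ) / n ∧
      ∑ n ∈ (Ico W (W * (J + 1))).filter (Nat.Coprime W), (1 : ℝ) / n ≤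
        (W.totient : ℝ) / W * (harmonic J : ℚ) := by
  have hW' : (0 : ℝ) < W := by exact_mod_cast hW
  induction J with
  | zero => simp [harmonic]
  | succ J ih =>
    have hsplit : (Ico W (W * (J + 1 + 1))).filter (Nat.Coprime W) =
        (Ico W (W * (J + 1))).filter (Nat.Coprime W) ∪
          (Ico (W * (J + 1)) (W * (J + 1) + W)).filter (Nat.Coprime W) := by
      rw [← filter_union, Ico_union_Ico_eq_Ico]
      · rfl
      · nlinarith
      · omega
    have hdisj : Disjoint ((Ico W (W * (J + 1))).filter (Nat.Coprime W))
        ((Ico (W * (J + 1)) (W * (J + 1) + W)).filter (Nat.Coprime W)) :=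
      disjoint_filter_filter (Ico_disjoint_Ico_consecutive _ _ _)
    rw [hsplit, sum_union hdisj]
    have hcard := Nat.filter_coprime_Ico_eq_totient W (W * (J + 1))
    have hJ : (0 : ℝ) < J + 1 := by positivity
    have lo : (W.totient : ℝ) / W * (1 / (J + 2)) ≤
        ∑ n ∈ (Ico (W * (J + 1)) (W * (J + 1) + W)).filter (Nat.Coprime W), (1 : ℝ) / n := by
      rw [← hcard]
      refine le_trans (le_of_eq ?_) (card_nsmul_le_sum _ _ (1 / (W * (J + 2)) : ℝ) fun n hn => ?_)
      · rw [nsmul_eq_mul]; field_simp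
      · have hn := mem_Ico.mp (mem_filter.mp hn).1
        have h1 : (0 : ℝ) < n := by
          have : 0 < W * (J + 1) := by positivity
          exact_mod_cast this.trans_le hn.1
        apply one_div_le_one_div_of_le h1
        have : n ≤ W * (J + 2) := by nlinarith [hn.2]
        exact_mod_cast this
    have hi : ∑ n ∈ (Ico (W * (J + 1)) (W * (J + 1) + W)).filter (Nat.Coprime W), (1 : ℝ) / n ≤
        (W.totient : ℝ) / W * (1 / (J + 1)) := by
      rw [← hcard]
      refine le_trans (sum_le_card_nsmul _ _ (1 / (W * (J + 1)) : ℝ) fun n hn => ?_) (le_of_eq ?_)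
      · have hn := mem_Ico.mp (mem_filter.mp hn).1
        apply one_div_le_one_div_of_le (by positivity)
        exact_mod_cast hn.1
      · rw [nsmul_eq_mul]; field_simp
    rw [harmonic_succ (J + 1)]
    constructor
    · refine le_trans (le_of_eq ?_) (add_le_add ih.1 lo)
      push_cast; ring
    · refine le_trans (add_le_add ih.2 hi) (le_of_eq ?_)
      rw [harmonic_succ]; push_cast; ring

lemma coprime_harmonic_le {W N : ℕ} (hW : 0 < W) :
    ∑ n ∈ (Icc 1 N).filter (Nat.Coprime W), (1 : ℝ) / n ≤
      W + (W.totient : ℝ) / W * (1 + Real.log N) := by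
  have hsub : (Icc 1 N).filter (Nat.Coprime W) ⊆
      Ico 1 W ∪ (Ico W (W * (N / W + 1))).filter (Nat.Coprime W) := by
    intro n hn
    rw [mem_filter, mem_Icc] at hn
    rw [mem_union, mem_filter, mem_Ico, mem_Ico]
    have := Nat.lt_mul_div_succ N hW
    by_cases h : n < W
    · left; omega
    · right; refine ⟨⟨by omega, by omega⟩, hn.2⟩
  refine (sum_le_sum_of_subset_of_nonneg hsub fun n _ _ => by positivity).trans ?_
  rw [sum_union]
  swap
  · refine disjoint_left.mpr fun n h h' => ?_
    have h1 := mem_Ico.mp h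
    have h2 := mem_Ico.mp (mem_filter.mp h').1
    omega
  refine add_le_add ?_ ?_
  · refine (sum_le_card_nsmul _ _ 1 fun n hn => ?_).trans ?_
    · have : (1 : ℝ) ≤ n := by exact_mod_cast (mem_Ico.mp hn).1
      exact (div_le_one (by positivity)).mpr this
    · simp
  · refine (coprime_block_bounds hW _).2.trans ?_
    gcongr
    rcases Nat.eq_zero_or_pos (N / W) with h | h
    · rw [h]; simp only [harmonic_zero, Rat.cast_zero]
      have : 0 ≤ Real.log N := Real.log_natCast_nonneg _
      linarith
    · refine (harmonic_le_one_add_log _).trans ?_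
      gcongr
      exact Nat.div_le_self _ _

lemma le_coprime_harmonic {W : ℕ} (hW : 0 < W) {x : ℝ} (hx : 0 < x) :
    (W.totient : ℝ) / W * (Real.log x - Real.log W - 1) ≤
      ∑ n ∈ (Icc 1 ⌊x⌋₊).filter (Nat.Coprime W), (1 : ℝ) / n := by
  have hW' : (0 : ℝ) < W := by exact_mod_cast hW
  set N := ⌊x⌋₊ with hN
  rcases Nat.eq_zero_or_pos (N / W) with h | h
  · have h0 : N < W := by
      by_contra hc
      have := Nat.div_pos (not_lt.mp hc) hW
      omega
    have h1 : x < W := by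
      have := Nat.lt_floor_add_one x
      have h2 : (N : ℝ) + 1 ≤ W := by exact_mod_cast h0
      linarith
    have h2 : Real.log x ≤ Real.log W := Real.log_le_log hx h1.le
    have h3 : (W.totient : ℝ) / W * (Real.log x - Real.log W - 1) ≤ 0 :=
      mul_nonpos_of_nonneg_of_nonpos (by positivity) (by linarith)
    exact h3.trans (sum_nonneg fun n _ => by positivity)
  · obtain ⟨J, hJ⟩ := Nat.exists_eq_add_of_le' h
    have hsub : (Ico W (W * (J + 1))).filter (Nat.Coprime W) ⊆ (Icc 1 N).filter (Nat.Coprime W) := by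
      refine filter_subset_filter _ fun n hn => ?_
      rw [mem_Ico] at hn
      have := Nat.mul_div_le N W
      rw [hJ] at this
      rw [mem_Icc]
      exact ⟨hW.trans_le hn.1, hn.2.le.trans this⟩
    refine le_trans ?_ (sum_le_sum_of_subset_of_nonneg hsub fun n _ _ => by positivity)
    refine le_trans ?_ (coprime_block_bounds hW J).1
    push_cast
    gcongr
    refine le_trans ?_ (log_add_one_le_harmonic (J + 1))
    rw [← Real.log_div hx.ne' hW'.ne']
    apply Real.log_le_log (by positivity)
    rw [div_le_iff₀ hW']
    have h1 := Nat.lt_mul_div_succ N hW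
    rw [hJ] at h1
    have h2 := Nat.lt_floor_add_one x
    have h3 : (N : ℝ) + 1 ≤ W * (J + 1 + 1) := by exact_mod_cast h1
    push_cast
    linarith

/-- `p` enumerates the primes up to `R` that do not divide `W`. -/
structure SievePrimes (W : ℕ) (R : ℝ) {n : ℕ} (p : Fin n → ℕ) : Prop where
  inj : Function.Injective p
  prime : ∀ i, (p i).Prime
  le : ∀ i, (p i : ℝ) ≤ R
  not_dvd : ∀ i, ¬ p i ∣ W
  surj : ∀ q : ℕ, q.Prime → (q : ℝ) ≤ R → ¬ q ∣ W → ∃ i, p i = q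

lemma exists_sievePrimes (W : ℕ) (R : ℝ) : ∃ (n : ℕ) (p : Fin n → ℕ), SievePrimes W R p := by
  classical
  set s := (range (⌊R⌋₊ + 1)).filter fun q : ℕ => q.Prime ∧ (q : ℝ) ≤ R ∧ ¬ q ∣ W with hs
  have hmem : ∀ q : ℕ, q ∈ s ↔ q.Prime ∧ (q : ℝ) ≤ R ∧ ¬ q ∣ W := by
    intro q
    rw [hs, mem_filter, mem_range]
    refine ⟨fun h => h.2, fun h => ⟨?_, h⟩⟩
    exact Nat.lt_succ_of_le (Nat.le_floor h.2.1)
  have hP : ∀ i, (s.equivFin.symm i : ℕ) ∈ s := fun i => (s.equivFin.symm i).2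
  refine ⟨s.card, fun i => s.equivFin.symm i, ⟨?_, fun i => ((hmem _).mp (hP i)).1,
    fun i => ((hmem _).mp (hP i)).2.1, fun i => ((hmem _).mp (hP i)).2.2, fun q h1 h2 h3 => ?_⟩⟩
  · exact Subtype.val_injective.comp s.equivFin.symm.injective
  · exact ⟨s.equivFin ⟨q, (hmem q).mpr ⟨h1, h2, h3⟩⟩, by simp⟩

namespace SievePrimes

variable {W n : ℕ} {R : ℝ} {p : Fin n → ℕ}

lemma dvd_prod_iff (hp : SievePrimes W R p) (S : Finset (Fin n)) (i : Fin n) :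
    p i ∣ ∏ l ∈ S, p l ↔ i ∈ S := by
  rw [(hp.prime i).prime.dvd_finsetProd_iff]
  constructor
  · rintro ⟨l, hl, h⟩
    rwa [hp.inj ((Nat.prime_dvd_prime_iff_eq (hp.prime i) (hp.prime l)).mp h)]
  · exact fun h => ⟨i, h, dvd_rfl⟩

lemma prod_injective (hp : SievePrimes W R p) :
    Function.Injective fun S : Finset (Fin n) => ∏ l ∈ S, p l := by
  intro S T h
  ext i
  rw [← hp.dvd_prod_iff S, ← hp.dvd_prod_iff T]
  exact iff_of_eq (congrArg (p i ∣ ·) h)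

lemma coprime_prod (hp : SievePrimes W R p) (S : Finset (Fin n)) :
    Nat.Coprime W (∏ l ∈ S, p l) :=
  Nat.Coprime.prod_right fun i _ => ((hp.prime i).coprime_iff_not_dvd.mpr (hp.not_dvd i)).symm

lemma squarefree_prod (hp : SievePrimes W R p) (S : Finset (Fin n)) :
    Squarefree (∏ l ∈ S, p l) := by
  refine Finset.squarefree_prod_of_pairwise_isCoprime ?_ fun i _ => (hp.prime i).squarefree
  intro i _ j _ hij
  exact Nat.coprime_iff_isRelPrime.mp
    ((Nat.coprime_primes (hp.prime i) (hp.prime j)).mpr fun h => hij (hp.inj h))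

lemma prod_pos (hp : SievePrimes W R p) (S : Finset (Fin n)) : 0 < ∏ l ∈ S, p l :=
  Finset.prod_pos fun i _ => (hp.prime i).pos

lemma exists_prod_eq (hp : SievePrimes W R p) {t : ℕ} (ht : Squarefree t) (htR : (t : ℝ) ≤ R)
    (hW : Nat.Coprime W t) : ∃ S : Finset (Fin n), ∏ l ∈ S, p l = t := by
  refine ⟨univ.filter fun i => p i ∣ t, ?_⟩
  have : ((univ.filter fun i => p i ∣ t).image p) = t.primeFactors := by
    ext q
    rw [mem_image, Nat.mem_primeFactors]
    constructor
    · rintro ⟨i, hi, rfl⟩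
      exact ⟨hp.prime i, (mem_filter.mp hi).2, ht.ne_zero⟩
    · rintro ⟨h1, h2, h3⟩
      obtain ⟨i, hi⟩ := hp.surj q h1 (le_trans (by exact_mod_cast Nat.le_of_dvd (Nat.pos_of_ne_zero h3) h2) htR)
        fun h => h1.one_lt.ne' (Nat.eq_one_of_dvd_coprimes hW h h2)
      exact ⟨i, by simp [hi, h2], hi⟩
  rw [← prod_image (g := p) (f := fun q => q) hp.inj.injOn, this, Nat.prod_primeFactors_of_squarefree ht]

/-- The sum of `1 / t` over squarefree `t ≤ x` composed of sieving primes. -/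
noncomputable def recipSum (p : Fin n → ℕ) (x : ℝ) : ℝ :=
  ∑ S : Finset (Fin n), if ∏ i ∈ S, (p i : ℝ) ≤ x then 1 / ∏ i ∈ S, (p i : ℝ) else 0

lemma recipSum_eq (p : Fin n → ℕ) (x : ℝ) : recipSum p x =
    ∑ S ∈ univ.filter (fun S : Finset (Fin n) => ((∏ i ∈ S, p i : ℕ) : ℝ) ≤ x),
      1 / ((∏ i ∈ S, p i : ℕ) : ℝ) := by
  rw [recipSum, sum_filter]
  push_cast; rfl

lemma recipSum_le_sum (hp : SievePrimes W R p) (x : ℝ) :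
    recipSum p x ≤ ∑ n ∈ (Icc 1 ⌊x⌋₊).filter (Nat.Coprime W), (1 : ℝ) / n := by
  rw [recipSum_eq, ← sum_image (f := fun t : ℕ => (1 : ℝ) / t) (g := fun S : Finset (Fin n) => ∏ i ∈ S, p i)
    hp.prod_injective.injOn]
  refine sum_le_sum_of_subset_of_nonneg ?_ fun _ _ _ => by positivity
  intro t ht
  obtain ⟨S, hS, rfl⟩ := mem_image.mp ht
  exact mem_filter.mpr ⟨mem_Icc.mpr ⟨hp.prod_pos S, Nat.le_floor (mem_filter.mp hS).2⟩, hp.coprime_prod S⟩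

lemma recipSum_le (hp : SievePrimes W R p) (hW : 0 < W) {x : ℝ} (hx : 1 ≤ x) :
    recipSum p x ≤ W + (W.totient : ℝ) / W * (1 + Real.log x) := by
  refine (hp.recipSum_le_sum _).trans
    ((coprime_harmonic_le hW).trans ?_)
  gcongr
  · exact_mod_cast Nat.floor_pos.mpr hx
  · exact Nat.floor_le (by linarith)

lemma recipSum_le_log (hp : SievePrimes W R p) {x : ℝ} (hx : 1 ≤ x) :
    recipSum p x ≤ 1 + Real.log x := by
  refine (hp.recipSum_le_sum _).trans ?_
  refine (sum_le_sum_of_subset_of_nonneg (filter_subset _ _) fun _ _ _ => by positivity).trans ?_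
  have := harmonic_floor_le_one_add_log x hx
  rw [harmonic_eq_sum_Icc] at this
  push_cast at this
  simpa only [one_div] using this

lemma le_recipSum (hp : SievePrimes W R p) (hW : 0 < W) {x : ℝ} (hx : 0 < x) (hxR : x ≤ R) :
    (W.totient : ℝ) / W * (Real.log x - Real.log W - 1) / 2 ≤ recipSum p x := by
  have h1 := le_coprime_harmonic hW hx
  set N := ⌊x⌋₊ with hN
  have h2 : ∑ n ∈ (Icc 1 N).filter (Nat.Coprime W), (1 : ℝ) / n ≤
      (∑ m ∈ Icc 1 N, (1 : ℝ) / m ^ 2) * recipSum p x := by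
    rw [recipSum_eq, sum_mul_sum, ← sum_product']
    set T := univ.filter (fun S : Finset (Fin n) => ((∏ i ∈ S, p i : ℕ) : ℝ) ≤ x) with hT
    have key : (Icc 1 N).filter (Nat.Coprime W) ⊆
        (Icc 1 N ×ˢ T).image fun z => z.1 ^ 2 * ∏ i ∈ z.2, p i := by
      intro r hr
      rw [mem_filter, mem_Icc] at hr
      obtain ⟨t, m, e, ht⟩ := Nat.sq_mul_squarefree r
      have hr0 : 0 < r := hr.1.1
      have hm : 0 < m := Nat.pos_of_ne_zero fun h => by subst h; simp at e; omega
      have ht0 : 0 < t := Nat.pos_of_ne_zero ht.ne_zero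
      have hrx : (r : ℝ) ≤ x := (Nat.cast_le.mpr hr.1.2).trans (Nat.floor_le hx.le)
      have htr : t ≤ r := by rw [← e]; exact Nat.le_mul_of_pos_left _ (by positivity)
      have hmr : m ≤ r := by rw [← e]; nlinarith [Nat.mul_le_mul hm ht0]
      have htx : (t : ℝ) ≤ x := (Nat.cast_le.mpr htr).trans hrx
      obtain ⟨S, hS⟩ := hp.exists_prod_eq ht (htx.trans hxR)
        (hr.2.coprime_dvd_right (by rw [← e]; exact dvd_mul_left _ _))
      refine mem_image.mpr ⟨(m, S), mem_product.mpr ⟨mem_Icc.mpr ⟨hm, hmr.trans hr.1.2⟩, ?_⟩, ?_⟩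
      · simp only [hT, mem_filter, mem_univ, true_and, hS]; exact htx
      · simp only [hS, e]
    refine (sum_le_sum_of_subset_of_nonneg key fun _ _ _ => by positivity).trans ?_
    refine (sum_image_le_of_nonneg ?_).trans (le_of_eq ?_)
    · intro z _; positivity
    · refine sum_congr rfl fun z _ => ?_
      push_cast
      rw [one_div_mul_one_div]
  have h3 : ∑ m ∈ Icc 1 N, (1 : ℝ) / m ^ 2 ≤ 2 := by
    have := sum_Ioo_inv_sq_le (α := ℝ) 0 (N + 1)
    refine le_trans (le_of_eq ?_) (this.trans (by norm_num))
    refine sum_congr ?_ fun m _ => by rw [one_div]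
    ext m; simp only [mem_Icc, mem_Ioo]; omega
  have h4 : 0 ≤ recipSum p x := sum_nonneg fun S _ => by split_ifs <;> positivity
  nlinarith

end SievePrimes

lemma sq_geom_sum_le (I : ℕ) (b : ℕ → ℝ) (h0 : ∀ i, 0 ≤ b i) (h1 : ∀ i, b i ≤ 1) :
    ∑ i ∈ range I, (1 / 2) ^ i * b i ≤ 2 ∧
      (∑ i ∈ range I, (1 / 2) ^ i * b i) ^ 2 ≤ 3 * ∑ i ∈ range I, (1 / 4) ^ i * b i := by
  induction I generalizing b with
  | zero => simp
  | succ I ih =>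
    obtain ⟨a1, a2⟩ := ih (fun i => b (i + 1)) (fun i => h0 _) fun i => h1 _
    have e1 : ∑ i ∈ range (I + 1), (1 / 2 : ℝ) ^ i * b i
        = 1 / 2 * ∑ i ∈ range I, (1 / 2) ^ i * b (i + 1) + b 0 := by
      rw [sum_range_succ', mul_sum, pow_zero, one_mul]
      congr 1
      exact sum_congr rfl fun i _ => by ring
    have e2 : ∑ i ∈ range (I + 1), (1 / 4 : ℝ) ^ i * b i
        = 1 / 4 * ∑ i ∈ range I, (1 / 4) ^ i * b (i + 1) + b 0 := by
      rw [sum_range_succ', mul_sum, pow_zero, one_mul]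
      congr 1
      exact sum_congr rfl fun i _ => by ring
    rw [e1, e2]
    have := h0 0
    have := h1 0
    constructor
    · linarith
    · nlinarith

/-- The cutoff function `∑_{i ≤ I} 2⁻ⁱ 1[t ≤ x₀^(2ⁱ)]`. -/
noncomputable def dyadicCutoff (I : ℕ) (x₀ t : ℝ) : ℝ :=
  ∑ i ∈ range (I + 1), (1 / 2) ^ i * if t ≤ x₀ ^ 2 ^ i then 1 else 0

lemma dyadicCutoff_antitone (I : ℕ) (x₀ : ℝ) : Antitone (dyadicCutoff I x₀) := by
  intro a b hab
  refine sum_le_sum fun i _ => ?_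
  gcongr
  split_ifs with h1 h2
  · exact le_rfl
  · exact absurd (hab.trans h1) h2
  · exact zero_le_one
  · exact le_rfl

lemma dyadicCutoff_nonneg (I : ℕ) (x₀ t : ℝ) : 0 ≤ dyadicCutoff I x₀ t :=
  sum_nonneg fun i _ => by positivity

lemma dyadicCutoff_bounds (I : ℕ) (x₀ t : ℝ) : dyadicCutoff I x₀ t ≤ 2 ∧
    dyadicCutoff I x₀ t ^ 2 ≤ 3 * ∑ i ∈ range (I + 1), (1 / 4) ^ i * if t ≤ x₀ ^ 2 ^ i then 1 else 0 :=
  sq_geom_sum_le (I + 1) (fun i => if t ≤ x₀ ^ 2 ^ i then 1 else 0)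
    (fun i => by positivity) fun i => by split_ifs <;> norm_num

lemma le_of_dyadicCutoff_ne_zero {I : ℕ} {x₀ t : ℝ} (hx : 1 ≤ x₀) (h : dyadicCutoff I x₀ t ≠ 0) :
    t ≤ x₀ ^ 2 ^ I := by
  by_contra hc
  refine h (sum_eq_zero fun i hi => ?_)
  rw [if_neg, mul_zero]
  intro h'
  refine hc (h'.trans (pow_le_pow_right₀ hx (Nat.pow_le_pow_right two_pos ?_)))
  exact Nat.lt_succ_iff.mp (mem_range.mp hi)

lemma one_le_dyadicCutoff {I : ℕ} {x₀ t : ℝ} (h : t ≤ x₀) : 1 ≤ dyadicCutoff I x₀ t := by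
  unfold dyadicCutoff
  rw [sum_range_succ']
  have : 0 ≤ ∑ i ∈ range I, (1 / 2 : ℝ) ^ (i + 1) * (if t ≤ x₀ ^ 2 ^ (i + 1) then 1 else 0) :=
    sum_nonneg fun i _ => by positivity
  simpa [h] using this

section

variable {n : ℕ} (p : Fin n → ℕ)

open SievePrimes

lemma sum_cutoff_mul (I : ℕ) (r : ℝ) (x : ℕ → ℝ) (g : Finset (Fin n) → ℝ) :
    ∑ S : Finset (Fin n), (∑ i ∈ range I, r ^ i * if ∏ l ∈ S, (p l : ℝ) ≤ x i then 1 else 0) * g S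
      = ∑ i ∈ range I, r ^ i * ∑ S : Finset (Fin n), if ∏ l ∈ S, (p l : ℝ) ≤ x i then g S else 0 := by
  simp only [sum_mul, mul_sum]
  rw [sum_comm]
  exact sum_congr rfl fun i _ => sum_congr rfl fun S _ => by split_ifs <;> ring

lemma cutoff_sum_ge {I : ℕ} {x₀ κ : ℝ}
    (hlo : ∀ i ≤ I, κ * (2 ^ i * Real.log x₀) / 4 ≤ recipSum p (x₀ ^ 2 ^ i)) :
    κ * Real.log x₀ * (I + 1) / 4 ≤
      ∑ S : Finset (Fin n), dyadicCutoff I x₀ (∏ l ∈ S, (p l : ℝ)) / ∏ l ∈ S, (p l : ℝ) := by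
  have e : ∑ S : Finset (Fin n), dyadicCutoff I x₀ (∏ l ∈ S, (p l : ℝ)) / ∏ l ∈ S, (p l : ℝ)
      = ∑ i ∈ range (I + 1), (1 / 2) ^ i * recipSum p (x₀ ^ 2 ^ i) := by
    simp only [recipSum]
    rw [← sum_cutoff_mul p (I + 1) (1 / 2) (fun i => x₀ ^ 2 ^ i) fun S => 1 / ∏ l ∈ S, (p l : ℝ)]
    exact sum_congr rfl fun S _ => by rw [div_eq_mul_one_div]; rfl
  rw [e]
  calc _ = ∑ i ∈ range (I + 1), (1 / 2 : ℝ) ^ i * (κ * (2 ^ i * Real.log x₀) / 4) := by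
        have : ∀ i ∈ range (I + 1), (1 / 2 : ℝ) ^ i * (κ * (2 ^ i * Real.log x₀) / 4)
            = κ * Real.log x₀ / 4 := fun i _ => by
          rw [one_div, inv_pow]; field_simp
        rw [sum_congr rfl this, sum_const, card_range, nsmul_eq_mul]; push_cast; ring
    _ ≤ _ := sum_le_sum fun i hi => mul_le_mul_of_nonneg_left
        (hlo i (Nat.lt_succ_iff.mp (mem_range.mp hi))) (by positivity)

lemma cutoff_sq_sum_le {I : ℕ} {x₀ κ : ℝ} (hκ : 0 ≤ κ) (hx : 1 ≤ x₀)
    (hhi : ∀ i ≤ I, recipSum p (x₀ ^ 2 ^ i) ≤ 2 * κ * (2 ^ i * Real.log x₀)) :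
    ∑ S : Finset (Fin n), dyadicCutoff I x₀ (∏ l ∈ S, (p l : ℝ)) ^ 2 / ∏ l ∈ S, (p l : ℝ) ≤
      12 * κ * Real.log x₀ := by
  have hl := Real.log_nonneg hx
  calc _ ≤ ∑ S : Finset (Fin n), (3 * ∑ i ∈ range (I + 1), (1 / 4) ^ i *
          if (∏ l ∈ S, (p l : ℝ)) ≤ x₀ ^ 2 ^ i then 1 else 0) / ∏ l ∈ S, (p l : ℝ) := by
        gcongr with S _
        exact (dyadicCutoff_bounds _ _ _).2
    _ = 3 * ∑ i ∈ range (I + 1), (1 / 4) ^ i * recipSum p (x₀ ^ 2 ^ i) := by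
        have := sum_cutoff_mul p (I + 1) (1 / 4) (fun i => x₀ ^ 2 ^ i) fun S => 1 / ∏ l ∈ S, (p l : ℝ)
        simp only [recipSum]
        rw [← this, mul_sum]
        exact sum_congr rfl fun S _ => by ring
    _ ≤ 3 * ∑ i ∈ range (I + 1), (1 / 4) ^ i * (2 * κ * (2 ^ i * Real.log x₀)) := by
        gcongr with i hi
        exact hhi i (Nat.lt_succ_iff.mp (mem_range.mp hi))
    _ = 6 * κ * Real.log x₀ * ∑ i ∈ range (I + 1), (1 / 2) ^ i * 1 := by
        rw [mul_sum, mul_sum]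
        refine sum_congr rfl fun i _ => ?_
        rw [show (1 / 4 : ℝ) = 1 / 2 * (1 / 2) by norm_num, mul_pow, one_div, inv_pow]
        field_simp; ring
    _ ≤ 6 * κ * Real.log x₀ * 2 := by
        gcongr
        exact (sq_geom_sum_le (I + 1) (fun _ => 1) (fun _ => zero_le_one) fun _ => le_rfl).1
    _ = _ := by ring

lemma cutoff_sq_log_sum_le {I : ℕ} {x₀ κ : ℝ} (hp : ∀ i, 1 ≤ p i) (hx : 1 ≤ x₀)
    (hhi : ∀ i ≤ I, recipSum p (x₀ ^ 2 ^ i) ≤ 2 * κ * (2 ^ i * Real.log x₀)) :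
    ∑ S : Finset (Fin n), dyadicCutoff I x₀ (∏ l ∈ S, (p l : ℝ)) ^ 2 / (∏ l ∈ S, (p l : ℝ)) *
      Real.log (∏ l ∈ S, (p l : ℝ)) ≤ 6 * κ * Real.log x₀ ^ 2 * (I + 1) := by
  have hl := Real.log_nonneg hx
  have hP : ∀ S : Finset (Fin n), 1 ≤ ∏ l ∈ S, (p l : ℝ) := fun S =>
    one_le_prod fun i _ => by exact_mod_cast hp i
  have hlogP : ∀ S : Finset (Fin n), 0 ≤ Real.log (∏ l ∈ S, (p l : ℝ)) := fun S =>
    Real.log_nonneg (hP S)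
  calc _ ≤ ∑ S : Finset (Fin n), (3 * ∑ i ∈ range (I + 1), (1 / 4) ^ i *
          if (∏ l ∈ S, (p l : ℝ)) ≤ x₀ ^ 2 ^ i then 1 else 0) / (∏ l ∈ S, (p l : ℝ)) *
          Real.log (∏ l ∈ S, (p l : ℝ)) := by
        refine sum_le_sum fun S _ => ?_
        have := hlogP S
        gcongr
        exact (dyadicCutoff_bounds _ _ _).2
    _ = 3 * ∑ i ∈ range (I + 1), (1 / 4) ^ i * ∑ S : Finset (Fin n),
          if ∏ l ∈ S, (p l : ℝ) ≤ x₀ ^ 2 ^ i then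
            1 / (∏ l ∈ S, (p l : ℝ)) * Real.log (∏ l ∈ S, (p l : ℝ)) else 0 := by
        have := sum_cutoff_mul p (I + 1) (1 / 4) (fun i => x₀ ^ 2 ^ i) fun S =>
          1 / (∏ l ∈ S, (p l : ℝ)) * Real.log (∏ l ∈ S, (p l : ℝ))
        rw [← this, mul_sum]
        exact sum_congr rfl fun S _ => by ring
    _ ≤ 3 * ∑ i ∈ range (I + 1), (1 / 4) ^ i * (2 ^ i * Real.log x₀ *
          (2 * κ * (2 ^ i * Real.log x₀))) := by
        gcongr with i hi
        refine le_trans ?_ (mul_le_mul_of_nonneg_left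
          (hhi i (Nat.lt_succ_iff.mp (mem_range.mp hi))) (by positivity))
        rw [recipSum, mul_sum]
        refine sum_le_sum fun S _ => ?_
        split_ifs with h
        · rw [mul_comm]
          have h1 : Real.log (∏ l ∈ S, (p l : ℝ)) ≤ 2 ^ i * Real.log x₀ := by
            have := Real.log_le_log (by linarith [hP S]) h
            rw [Real.log_pow] at this
            exact_mod_cast this
          have := hP S
          gcongr
        · simp
    _ = _ := by
        have : ∀ i ∈ range (I + 1), (1 / 4 : ℝ) ^ i * (2 ^ i * Real.log x₀ *
            (2 * κ * (2 ^ i * Real.log x₀))) = 2 * κ * Real.log x₀ ^ 2 := fun i _ => by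
          rw [show (1 / 4 : ℝ) = 1 / 2 * (1 / 2) by norm_num, mul_pow, one_div, inv_pow]
          field_simp
        rw [sum_congr rfl this, sum_const, card_range, nsmul_eq_mul]; push_cast; ring

lemma recipSum_le_cutoff_sq_sum {I : ℕ} {x₀ : ℝ} : recipSum p x₀ ≤
    ∑ S : Finset (Fin n), dyadicCutoff I x₀ (∏ l ∈ S, (p l : ℝ)) ^ 2 / ∏ l ∈ S, (p l : ℝ) := by
  refine sum_le_sum fun S _ => ?_
  split_ifs with h
  · gcongr
    nlinarith [one_le_dyadicCutoff (I := I) h]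
  · positivity

lemma gcd_sum_le (hp : ∀ i, 1 ≤ p i) (R : ℝ) (T : Finset (Fin n)) :
    ∑ S ∈ univ.filter (fun S : Finset (Fin n) => ∏ i ∈ S, (p i : ℝ) ≤ R),
      (∏ i ∈ S ∩ T, (p i : ℝ)) / ∏ i ∈ S, (p i : ℝ) ≤ 2 ^ T.card * recipSum p R := by
  have hp' : ∀ i, (1 : ℝ) ≤ p i := fun i => by exact_mod_cast hp i
  have hpp : ∀ S : Finset (Fin n), 0 < ∏ i ∈ S, (p i : ℝ) := fun S =>
    Finset.prod_pos fun i _ => by linarith [hp' i]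
  have hsplit : ∀ S : Finset (Fin n), (∏ i ∈ S ∩ T, (p i : ℝ)) * ∏ i ∈ S \ T, (p i : ℝ)
      = ∏ i ∈ S, (p i : ℝ) := fun S => by rw [← prod_inter_mul_prod_sdiff S T]
  set A := univ.filter (fun S : Finset (Fin n) => ∏ i ∈ S, (p i : ℝ) ≤ R) with hA
  calc _ = ∑ S ∈ A, 1 / ∏ i ∈ S \ T, (p i : ℝ) := by
        refine sum_congr rfl fun S _ => ?_
        rw [← hsplit S]
        have := hpp (S ∩ T); have := hpp (S \ T)
        field_simp
    _ = ∑ z ∈ A.image (fun S => (S ∩ T, S \ T)), 1 / ∏ i ∈ z.2, (p i : ℝ) := by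
        rw [sum_image]
        intro S _ S' _ h
        simp only [Prod.mk.injEq] at h
        rw [← sdiff_union_inter S T, ← sdiff_union_inter S' T, h.1, h.2]
    _ ≤ ∑ z ∈ T.powerset ×ˢ A, 1 / ∏ i ∈ z.2, (p i : ℝ) := by
        refine sum_le_sum_of_subset_of_nonneg ?_ fun z _ _ => (one_div_pos.mpr (hpp _)).le
        intro z hz
        obtain ⟨S, hS, rfl⟩ := mem_image.mp hz
        rw [mem_product, mem_powerset]
        refine ⟨inter_subset_right, mem_filter.mpr ⟨mem_univ _, le_trans ?_ (mem_filter.mp hS).2⟩⟩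
        exact prod_le_prod_of_subset_of_one_le_real sdiff_subset (fun i _ _ => hp' i)
          fun i _ => by linarith [hp' i]
    _ = _ := by
        rw [sum_product]
        simp only [sum_const, card_powerset, nsmul_eq_mul, recipSum, hA, sum_filter]
        push_cast; rfl

end

lemma sum_shift {M : ℕ} {v : ℕ → ℝ} (hv : ∀ n, M ≤ n → v n = 0) {h : ℕ} (hh : ∀ n < h, v n = 0)
    (g : ℕ → ℝ) : ∑ n ∈ range M, v n * g n = ∑ n ∈ range M, v (n + h) * g (n + h) := by
  have h1 : ∑ n ∈ range M, v n * g n = ∑ n ∈ range (h + M), v n * g n := by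
    rw [add_comm, sum_range_add, left_eq_add]
    exact sum_eq_zero fun n _ => by rw [hv _ (Nat.le_add_right _ _), zero_mul]
  rw [h1, sum_range_add, sum_eq_zero fun n hn => by rw [hh n (mem_range.mp hn), zero_mul], zero_add]
  exact sum_congr rfl fun n _ => by rw [add_comm]

noncomputable def totalVariation (v : ℕ → ℝ) (M : ℕ) : ℝ := ∑ n ∈ range M, |v (n + 1) - v n|

lemma sum_abs_shift_sub_le {M : ℕ} {v : ℕ → ℝ} (hv : ∀ n, M ≤ n → v n = 0) (h : ℕ) :
    ∑ n ∈ range M, |v (n + h) - v n| ≤ h * totalVariation v M := by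
  induction h with
  | zero => simp
  | succ h ih =>
    have h1 : ∑ n ∈ range M, |v (n + (h + 1)) - v (n + h)| ≤ totalVariation v M := by
      have h2 : totalVariation v M = ∑ n ∈ range (h + M), |v (n + 1) - v n| := by
        rw [totalVariation, add_comm, sum_range_add, left_eq_add]
        exact sum_eq_zero fun n _ => by rw [hv _ (by omega), hv _ (by omega), sub_zero, abs_zero]
      rw [h2, sum_range_add]
      have : 0 ≤ ∑ n ∈ range h, |v (n + 1) - v n| := sum_nonneg fun _ _ => abs_nonneg _
      refine le_trans (le_of_eq ?_) (le_add_of_nonneg_left this)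
      refine sum_congr rfl fun n _ => ?_
      rw [show n + (h + 1) = h + n + 1 by ring, show n + h = h + n by ring]
    calc _ ≤ ∑ n ∈ range M, (|v (n + (h + 1)) - v (n + h)| + |v (n + h) - v n|) :=
          sum_le_sum fun n _ => abs_sub_le _ _ _
      _ ≤ totalVariation v M + h * totalVariation v M := by
          rw [sum_add_distrib]; exact add_le_add h1 ih
      _ = _ := by push_cast; ring

lemma abs_sum_shift_sub_le {M : ℕ} {v : ℕ → ℝ} (hv : ∀ n, M ≤ n → v n = 0) {h : ℕ}
    (hh : ∀ n < h, v n = 0) (g : ℕ → ℝ) {K : ℝ} (hK : ∀ n < M, |g (n + h)| ≤ K) :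
    |∑ n ∈ range M, v n * g (n + h) - ∑ n ∈ range M, v n * g n| ≤ K * (h * totalVariation v M) := by
  rw [sum_shift hv hh g, ← sum_sub_distrib]
  refine (abs_sum_le_sum_abs _ _).trans ?_
  rcases Nat.eq_zero_or_pos M with rfl | hM
  · simp [totalVariation]
  have hK0 : 0 ≤ K := (abs_nonneg _).trans (hK 0 hM)
  refine le_trans ?_ (mul_le_mul_of_nonneg_left (sum_abs_shift_sub_le hv h) hK0)
  rw [mul_sum]
  refine sum_le_sum fun n hn => ?_
  rw [← sub_mul, abs_mul, abs_sub_comm, mul_comm]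
  exact mul_le_mul_of_nonneg_right (hK n (mem_range.mp hn)) (abs_nonneg _)

lemma sum_residue_sub_le {M : ℕ} {v : ℕ → ℝ} (hv : ∀ n, M ≤ n → v n = 0) (hv0 : v 0 = 0)
    {Q : ℕ} (hQ : 0 < Q) (a : ℕ) :
    |∑ n ∈ range M, v n * (if n ≡ a [MOD Q] then 1 else 0) - (∑ n ∈ range M, v n) / Q| ≤
      Q * totalVariation v M := by
  set V : ℕ → ℝ := fun a => ∑ n ∈ range M, v n * (if n ≡ a [MOD Q] then 1 else 0) with hV
  have hTV : 0 ≤ totalVariation v M := sum_nonneg fun _ _ => abs_nonneg _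
  have step : ∀ a, |V (a + 1) - V a| ≤ totalVariation v M := by
    intro a
    have h1 : V (a + 1) = ∑ n ∈ range M, v (n + 1) * (if n ≡ a [MOD Q] then 1 else 0) := by
      simp only [hV]
      rw [sum_shift hv (h := 1) (by intro n hn; obtain rfl : n = 0 := by omega
                                    exact hv0)]
      refine sum_congr rfl fun n _ => ?_
      have : n + 1 ≡ a + 1 [MOD Q] ↔ n ≡ a [MOD Q] := Nat.ModEq.add_iff_right rfl
      simp only [this]
    rw [h1]
    simp only [hV]
    rw [← sum_sub_distrib]
    refine (abs_sum_le_sum_abs _ _).trans (sum_le_sum fun n _ => ?_)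
    split_ifs <;> simp
  have far : ∀ t, |V (a + t) - V a| ≤ t * totalVariation v M := by
    intro t
    induction t with
    | zero => simp
    | succ t ih =>
      calc _ ≤ |V (a + t + 1) - V (a + t)| + |V (a + t) - V a| := abs_sub_le _ _ _
        _ ≤ totalVariation v M + t * totalVariation v M := add_le_add (step _) ih
        _ = _ := by push_cast; ring
  have htot : ∑ n ∈ range M, v n = ∑ t ∈ range Q, V (a + t) := by
    simp only [hV]
    rw [sum_comm]
    refine sum_congr rfl fun n _ => ?_
    rw [← mul_sum]
    have : ∑ t ∈ range Q, (if n ≡ a + t [MOD Q] then (1 : ℝ) else 0) = 1 := by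
      have hex : ∃ t ∈ range Q, n ≡ a + t [MOD Q] := by
        refine ⟨(n + (Q - 1) * a) % Q, mem_range.mpr (Nat.mod_lt _ hQ), ?_⟩
        have : a + (n + (Q - 1) * a) % Q ≡ a + (n + (Q - 1) * a) [MOD Q] :=
          Nat.ModEq.add_left _ (Nat.mod_modEq _ _)
        refine Nat.ModEq.trans ?_ this.symm
        have e : a + (n + (Q - 1) * a) = n + Q * a := by
          obtain ⟨q, rfl⟩ := Nat.exists_eq_add_of_le' hQ
          simp only [Nat.add_sub_cancel]; ring
        rw [e]
        simp [Nat.ModEq]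
      obtain ⟨t, ht, hn⟩ := hex
      rw [sum_eq_single_of_mem t ht, if_pos hn]
      intro t' ht' hne
      rw [if_neg]
      intro hn'
      have h1 := Nat.ModEq.add_left_cancel' a (hn'.symm.trans hn)
      exact hne (Nat.ModEq.eq_of_lt_of_lt h1 (mem_range.mp ht') (mem_range.mp ht))
    rw [this, mul_one]
  have hQ' : (0 : ℝ) < Q := by exact_mod_cast hQ
  change |V a - _| ≤ _
  have : V a - (∑ n ∈ range M, v n) / Q = -(∑ t ∈ range Q, (V (a + t) - V a)) / Q := by
    rw [htot, sum_sub_distrib, sum_const, card_range, nsmul_eq_mul]; field_simp; ring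
  rw [this, abs_div, abs_neg, abs_of_pos hQ', div_le_iff₀ hQ']
  calc _ ≤ ∑ t ∈ range Q, |V (a + t) - V a| := abs_sum_le_sum_abs _ _
    _ ≤ ∑ t ∈ range Q, Q * totalVariation v M := sum_le_sum fun t ht => (far t).trans (by
        gcongr; exact (mem_range.mp ht).le)
    _ = _ := by rw [sum_const, card_range, nsmul_eq_mul]; ring

lemma exists_residue_prod {W n : ℕ} (b : ℕ) {p : Fin n → ℕ} (hW : ∀ i, Nat.Coprime W (p i))
    (hp : ∀ i j, i ≠ j → Nat.Coprime (p i) (p j)) (r : Fin n → ℕ) (S : Finset (Fin n)) :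
    ∃ a, ∀ N, (N ≡ b [MOD W] ∧ ∀ i ∈ S, N ≡ r i [MOD p i]) ↔ N ≡ a [MOD W * ∏ i ∈ S, p i] := by
  induction S using Finset.induction_on with
  | empty => exact ⟨b, by simp⟩
  | insert i S hi ih =>
    obtain ⟨a, ha⟩ := ih
    have hcop : Nat.Coprime (W * ∏ i ∈ S, p i) (p i) :=
      Nat.Coprime.mul_left (hW i) (Nat.Coprime.prod_left fun j hj => hp j i fun h => hi (h ▸ hj))
    obtain ⟨c, hc1, hc2⟩ := Nat.chineseRemainder hcop a (r i)
    refine ⟨c, fun N => ?_⟩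
    rw [prod_insert hi, mul_comm (p i), ← mul_assoc, ← Nat.modEq_and_modEq_iff_modEq_mul hcop]
    constructor
    · rintro ⟨h1, h2⟩
      exact ⟨((ha N).mp ⟨h1, fun j hj => h2 j (mem_insert_of_mem hj)⟩).trans hc1.symm,
        (h2 i (mem_insert_self _ _)).trans hc2.symm⟩
    · rintro ⟨h1, h2⟩
      obtain ⟨h3, h4⟩ := (ha N).mpr (h1.trans hc1)
      refine ⟨h3, fun j hj => ?_⟩
      rcases mem_insert.mp hj with rfl | hj
      · exact h2.trans hc2
      · exact h4 j hj

lemma sum_colorSupport_le {k n : ℕ} (g : Finset (Fin n) → ℝ) (hg : ∀ S, 0 ≤ g S) :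
    ∑ τ : Fin n → Option (Fin k), g (colorSupport τ) ≤ ∑ S, (k : ℝ) ^ S.card * g S := by
  rw [← sum_fiberwise_of_maps_to (s := univ) (t := univ) (g := colorSupport)
    (fun _ _ => mem_univ _)]
  refine sum_le_sum fun S _ => ?_
  have hc : ((univ.filter fun τ : Fin n → Option (Fin k) => colorSupport τ = S).card : ℝ) ≤
      (k : ℝ) ^ S.card := by
    have hsub : (univ.filter fun τ : Fin n → Option (Fin k) => colorSupport τ = S) ⊆
        Fintype.piFinset fun i => if i ∈ S then univ.erase none else {none} := by
      intro τ hτ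
      rw [Fintype.mem_piFinset]
      intro i
      have : i ∈ colorSupport τ ↔ i ∈ S := by rw [(mem_filter.mp hτ).2]
      simp only [colorSupport, mem_filter, mem_univ, true_and] at this
      split_ifs with h
      · simpa using this.mpr h
      · simpa using fun h' => h (this.mp h')
    have := card_le_card hsub
    rw [Fintype.card_piFinset] at this
    have e : ∏ i : Fin n, (if i ∈ S then univ.erase (none : Option (Fin k)) else {none}).card
        = k ^ S.card := by
      have : ∀ i, (if i ∈ S then univ.erase (none : Option (Fin k)) else {none}).card
          = if i ∈ S then k else 1 := fun i => by
        split_ifs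
        · rw [card_erase_of_mem (mem_univ _), card_univ, Fintype.card_option, Fintype.card_fin]; simp
        · simp
      simp only [this, prod_ite_mem, univ_inter, prod_const]
    rw [e] at this
    exact_mod_cast this
  calc _ = ∑ τ ∈ univ.filter (fun τ : Fin n → Option (Fin k) => colorSupport τ = S), g S :=
        sum_congr rfl fun τ hτ => by rw [(mem_filter.mp hτ).2]
    _ ≤ _ := by
        rw [sum_const, nsmul_eq_mul]
        exact mul_le_mul_of_nonneg_right hc (hg S)

lemma exists_state {k n : ℕ} {h : Fin k → ℕ} (hinj : Function.Injective h) {p : Fin n → ℕ}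
    (hlt : ∀ i c, h c < p i) : ∃ x : ℕ → Fin n → Option (Fin k),
      ∀ N i c, x N i = some c ↔ p i ∣ N + h c := by
  classical
  have huniq : ∀ N i c d, p i ∣ N + h c → p i ∣ N + h d → c = d := by
    intro N i c d hc hd
    have h1 : N + h c ≡ N + h d [MOD p i] :=
      ((Nat.modEq_zero_iff_dvd).mpr hc).trans ((Nat.modEq_zero_iff_dvd).mpr hd).symm
    exact hinj (Nat.ModEq.eq_of_lt_of_lt (Nat.ModEq.add_left_cancel' N h1) (hlt i c) (hlt i d))
  refine ⟨fun N i => if H : ∃ c, p i ∣ N + h c then some H.choose else none, fun N i c => ?_⟩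
  by_cases H : ∃ c, p i ∣ N + h c
  · dsimp only; rw [dif_pos H, Option.some_inj]
    exact ⟨fun e => e ▸ H.choose_spec, fun hc => huniq N i _ _ H.choose_spec hc⟩
  · dsimp only; rw [dif_neg H]
    exact ⟨fun e => by simp at e, fun hc => absurd ⟨c, hc⟩ H⟩

lemma prod_stateIndicator {k n : ℕ} {h : Fin k → ℕ} {p : Fin n → ℕ}
    {x : ℕ → Fin n → Option (Fin k)} (hx : ∀ N i c, x N i = some c ↔ p i ∣ N + h c)
    (τ : Fin n → Option (Fin k)) (N : ℕ) [Decidable (∀ i c, τ i = some c → p i ∣ N + h c)] :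
    ∏ i, stateIndicator (τ i) (x N i) =
      if ∀ i c, τ i = some c → p i ∣ N + h c then 1 else 0 := by
  have key : ∀ i, (τ i = none ∨ τ i = x N i) ↔ ∀ c, τ i = some c → p i ∣ N + h c := by
    intro i
    cases hτ : τ i with
    | none => simp
    | some c =>
      simp only [reduceCtorEq, false_or, Option.some.injEq, forall_eq', ← hx N i c]
      exact eq_comm
  split_ifs with H
  · exact prod_eq_one fun i _ => by rw [stateIndicator, if_pos ((key i).mpr (H i))]
  · push Not at H
    obtain ⟨i, c, h1, h2⟩ := H
    refine prod_eq_zero (mem_univ i) ?_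
    rw [stateIndicator, if_neg]
    rw [key i]
    exact fun h3 => h2 (h3 c h1)

lemma exists_residue_state {k n W : ℕ} (b : ℕ) (h : Fin k → ℕ) {p : Fin n → ℕ}
    (hW : ∀ i, Nat.Coprime W (p i)) (hp : ∀ i j, i ≠ j → Nat.Coprime (p i) (p j))
    (hlt : ∀ i c, h c < p i) (τ : Fin n → Option (Fin k)) :
    ∃ a, ∀ N, (N ≡ b [MOD W] ∧ ∀ i c, τ i = some c → p i ∣ N + h c) ↔
      N ≡ a [MOD W * ∏ i ∈ colorSupport τ, p i] := by
  obtain ⟨a, ha⟩ := exists_residue_prod b hW hp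
    (fun i => match τ i with | none => 0 | some c => p i - h c) (colorSupport τ)
  refine ⟨a, fun N => ?_⟩
  rw [← ha N]
  refine and_congr_right fun _ => forall_congr' fun i => ?_
  cases hτ : τ i with
  | none => simp [colorSupport, hτ]
  | some c =>
    simp only [colorSupport, mem_filter, mem_univ, hτ, ne_eq, reduceCtorEq, not_false_eq_true,
      and_self, true_imp_iff, Option.some.injEq, forall_eq']
    rw [← Nat.modEq_zero_iff_dvd]
    have h1 : p i - h c + h c ≡ 0 [MOD p i] := by
      rw [Nat.sub_add_cancel (hlt i c).le]; simp [Nat.ModEq]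
    exact ⟨fun h2 => Nat.ModEq.add_right_cancel' _ (h2.trans h1.symm),
      fun h2 => (Nat.ModEq.add_right _ h2).trans h1⟩

lemma uniform_local_sum {k n : ℕ} {p : Fin n → ℝ} (τ : Fin n → Option (Fin k))
    (hp : ∀ i, p i ≠ 0) :
    ∏ i, ∑ a, uniformWeight (p i) a * stateIndicator (τ i) a = 1 / ∏ i ∈ colorSupport τ, p i := by
  rw [one_div, ← prod_inv_distrib, colorSupport, prod_filter]
  refine prod_congr rfl fun i _ => ?_
  have := hp i
  cases hτ : τ i with
  | none =>
    simp [stateIndicator, uniformWeight, Fintype.sum_option]; field_simp; ring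
  | some c =>
    simp [stateIndicator, uniformWeight]

lemma prime_local_sum {k n : ℕ} {p : Fin n → ℝ} (τ : Fin n → Option (Fin k)) (j : Fin k)
    (hp : ∀ i, p i - 1 ≠ 0) :
    ∏ i, ∑ a, primeWeight j (p i) a * stateIndicator (τ i) a =
      if ∃ i, τ i = some j then 0 else 1 / ∏ i ∈ colorSupport τ, (p i - 1) := by
  classical
  split_ifs with H
  · obtain ⟨i, hi⟩ := H
    refine prod_eq_zero (mem_univ i) ?_
    simp [hi, stateIndicator, primeWeight]
  rw [one_div, ← prod_inv_distrib, colorSupport, prod_filter]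
  push Not at H
  refine prod_congr rfl fun i _ => ?_
  have := hp i
  cases hτ : τ i with
  | none =>
    have hs : ∑ x : Fin k, (if x = j then (0 : ℝ) else (p i - 1)⁻¹) = (k - 1) * (p i - 1)⁻¹ := by
      rw [← sum_erase_add _ _ (mem_univ j), if_pos rfl, add_zero,
        sum_congr rfl (g := fun _ => (p i - 1)⁻¹) fun x hx => if_neg (ne_of_mem_erase hx), sum_const,
        card_erase_of_mem (mem_univ j), card_univ, Fintype.card_fin, nsmul_eq_mul,
        Nat.cast_sub j.pos, Nat.cast_one]
    simp [stateIndicator, primeWeight, Fintype.sum_option, hs]; field_simp; ring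
  | some c =>
    have hc : c ≠ j := fun e => H i (by rw [hτ, e])
    simp [stateIndicator, primeWeight, hc]

/-- Equidistribution of a smooth weight in the residue classes cut out by a state. -/
lemma uniform_state_error {k n W b M : ℕ} {R : ℝ} {p : Fin n → ℕ} (hp : SievePrimes W R p)
    (hW : 0 < W) {h : Fin k → ℕ} (hlt : ∀ i c, h c < p i)
    {x : ℕ → Fin n → Option (Fin k)} (hx : ∀ N i c, x N i = some c ↔ p i ∣ N + h c)
    {v : ℕ → ℝ} (hv : ∀ n, M ≤ n → v n = 0) (hv0 : v 0 = 0) (τ : Fin n → Option (Fin k)) :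
    |∑ N ∈ range M, (if N ≡ b [MOD W] then v N else 0) * ∏ i, stateIndicator (τ i) (x N i) -
      (∑ N ∈ range M, v N) / W * ∏ i, ∑ a, uniformWeight (p i : ℝ) a * stateIndicator (τ i) a| ≤
      W * (∏ i ∈ colorSupport τ, (p i : ℝ)) * totalVariation v M := by
  classical
  obtain ⟨a, ha⟩ := exists_residue_state b h
    (fun i => ((hp.prime i).coprime_iff_not_dvd.mpr (hp.not_dvd i)).symm)
    (fun i j hij => (Nat.coprime_primes (hp.prime i) (hp.prime j)).mpr (hp.inj.ne hij)) hlt τ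
  have hpos : 0 < W * ∏ i ∈ colorSupport τ, p i := Nat.mul_pos hW (hp.prod_pos _)
  have h1 := sum_residue_sub_le hv hv0 hpos a
  rw [uniform_local_sum τ fun i => by exact_mod_cast (hp.prime i).ne_zero]
  convert h1 using 2
  · congr 1
    · refine sum_congr rfl fun N _ => ?_
      rw [prod_stateIndicator hx]
      have := ha N
      by_cases h2 : N ≡ b [MOD W] <;>
        by_cases h3 : ∀ i c, τ i = some c → p i ∣ N + h c
      · rw [if_pos h2, if_pos h3, if_pos (this.mp ⟨h2, h3⟩)]
      · rw [if_neg h3, if_neg fun e => h3 (this.mpr e).2]; simp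
      · rw [if_neg h2, if_neg fun e => h2 (this.mpr e).1]; simp
      · rw [if_neg h2, if_neg fun e => h2 (this.mpr e).1]; simp
    · push_cast; rw [div_mul_div_comm, mul_one]
  · push_cast; rfl

/-- Equidistribution of the primes `N + h j` in the residue classes cut out by a state. -/
lemma prime_state_error {k n W b M : ℕ} {R L : ℝ} {p : Fin n → ℕ} (hp : SievePrimes W R p)
    {h : Fin k → ℕ} (hlt : ∀ i c, h c < p i)
    (hbW : ∀ c, Nat.Coprime (b + h c) W)
    {x : ℕ → Fin n → Option (Fin k)} (hx : ∀ N i c, x N i = some c ↔ p i ∣ N + h c)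
    {v : ℕ → ℝ} (hv : ∀ n, M ≤ n → v n = 0) {j : Fin k} (hvR : ∀ n : ℕ, (n : ℝ) ≤ R → v n = 0)
    (hjR : (h j : ℝ) ≤ R) (hML : ((M + h j : ℕ) : ℝ) ≤ Real.exp (4 * L))
    {X E : ℝ} (hE : 0 ≤ E) (hL : 0 ≤ L) (τ : Fin n → Option (Fin k))
    (hdist : ∀ c : ℕ, Nat.Coprime c (W * ∏ i ∈ colorSupport τ, p i) →
      |∑ N ∈ range M, (if N.Prime ∧ N ≡ c [MOD W * ∏ i ∈ colorSupport τ, p i] then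
        Real.log N * v N else 0) - X / (W * ∏ i ∈ colorSupport τ, p i).totient| ≤ E) :
    |∑ N ∈ range M, (if N ≡ b [MOD W] ∧ (N + h j).Prime then
        Real.log ((N + h j : ℕ) : ℝ) * v N else 0) * ∏ i, stateIndicator (τ i) (x N i) -
      X / W.totient * ∏ i, ∑ a, primeWeight j (p i : ℝ) a * stateIndicator (τ i) a| ≤
      E + 4 * L * (h j * totalVariation v M) := by
  classical
  have hTV : 0 ≤ totalVariation v M := sum_nonneg fun _ _ => abs_nonneg _
  rw [prime_local_sum τ j fun i => by
    have : (2 : ℝ) ≤ p i := by exact_mod_cast (hp.prime i).two_le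
    linarith]
  by_cases H : ∃ i, τ i = some j
  · rw [if_pos H, mul_zero, sub_zero, sum_eq_zero, abs_zero]
    · positivity
    intro N _
    obtain ⟨i, hi⟩ := H
    rw [prod_stateIndicator hx]
    split_ifs with h1 h2
    · have h3 := (Nat.prime_dvd_prime_iff_eq (hp.prime i) h1.2).mp (h2 i j hi)
      rw [hvR N, mul_zero, zero_mul]
      refine le_trans ?_ (hp.le i)
      rw [h3]; push_cast; linarith [Nat.cast_nonneg (α := ℝ) (h j)]
    all_goals simp
  rw [if_neg H]
  push Not at H
  have hWp : ∀ i, Nat.Coprime W (p i) := fun i =>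
    ((hp.prime i).coprime_iff_not_dvd.mpr (hp.not_dvd i)).symm
  obtain ⟨a, ha⟩ := exists_residue_state b h hWp
    (fun i j hij => (Nat.coprime_primes (hp.prime i) (hp.prime j)).mpr (hp.inj.ne hij)) hlt τ
  set q := ∏ i ∈ colorSupport τ, p i with hq
  obtain ⟨haW, hap⟩ := (ha a).mpr (Nat.ModEq.refl a)
  have hcop : Nat.Coprime (a + h j) (W * q) := by
    refine Nat.Coprime.mul_right ?_ (Nat.Coprime.prod_right fun i hi => ?_)
    · have : a + h j ≡ b + h j [MOD W] := haW.add_right _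
      rw [Nat.Coprime, this.gcd_eq]
      exact hbW j
    · rw [Nat.coprime_comm, (hp.prime i).coprime_iff_not_dvd, ← hx]
      intro h1
      obtain ⟨c, hc⟩ := Option.ne_none_iff_exists'.mp (mem_filter.mp hi).2
      have h2 := (hx a i c).mpr (hap i c hc)
      rw [h1, Option.some_inj] at h2
      exact H i (h2 ▸ hc)
  have h1 := hdist _ hcop
  have htot : X / (W.totient : ℝ) * (1 / ∏ i ∈ colorSupport τ, ((p i : ℝ) - 1)) =
      X / (W * q).totient := by
    have hc : Nat.Coprime W q := Nat.Coprime.prod_right fun i _ => hWp i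
    have hqt : (q.totient : ℝ) = ∏ i ∈ colorSupport τ, ((p i : ℝ) - 1) := by
      have hgen : ∀ S : Finset (Fin n), ((∏ i ∈ S, p i).totient : ℝ) = ∏ i ∈ S, ((p i : ℝ) - 1) := by
        intro S
        induction S using Finset.induction_on with
        | empty => simp
        | insert i S hi ih =>
          rw [prod_insert hi, prod_insert hi, Nat.totient_mul, Nat.cast_mul, ih,
            Nat.totient_prime (hp.prime i), Nat.cast_sub (hp.prime i).one_le, Nat.cast_one]
          exact Nat.Coprime.prod_right fun l hl => (Nat.coprime_primes (hp.prime i) (hp.prime l)).mpr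
            (hp.inj.ne fun e => hi (e ▸ hl))
      exact hgen _
    rw [Nat.totient_mul hc, Nat.cast_mul, hqt, div_mul_div_comm, mul_one]
  rw [htot]
  set g : ℕ → ℝ := fun N => if N.Prime ∧ N ≡ a + h j [MOD W * q] then Real.log N else 0 with hg
  have h2 := abs_sum_shift_sub_le hv (h := h j) (fun N hN => hvR N (by
      refine le_trans ?_ hjR; exact_mod_cast hN.le)) g (K := 4 * L) (by
    intro N hN
    rw [hg]
    dsimp only
    split_ifs with h3
    · have h4 : (1 : ℝ) ≤ ((N + h j : ℕ) : ℝ) := by exact_mod_cast h3.1.one_le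
      rw [abs_of_nonneg (Real.log_nonneg h4), Real.log_le_iff_le_exp (by linarith)]
      refine le_trans ?_ hML
      exact_mod_cast (Nat.add_lt_add_right hN _).le
    · rw [abs_zero]; positivity)
  have e1 : ∑ N ∈ range M, (if N ≡ b [MOD W] ∧ (N + h j).Prime then
        Real.log ((N + h j : ℕ) : ℝ) * v N else 0) * ∏ i, stateIndicator (τ i) (x N i) =
      ∑ N ∈ range M, v N * g (N + h j) := by
    refine sum_congr rfl fun N _ => ?_
    rw [prod_stateIndicator hx, hg]
    dsimp only
    have h3 := ha N
    have h4 : N + h j ≡ a + h j [MOD W * q] ↔ N ≡ a [MOD W * q] := Nat.ModEq.add_iff_right rfl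
    simp only [h4, ← h3]
    by_cases c1 : N ≡ b [MOD W] <;> by_cases c2 : (N + h j).Prime <;>
      by_cases c3 : ∀ i c, τ i = some c → p i ∣ N + h c <;> simp [c1, c2, c3, mul_comm]
  have e2 : ∑ N ∈ range M, (if N.Prime ∧ N ≡ a + h j [MOD W * q] then
        Real.log N * v N else 0) = ∑ N ∈ range M, v N * g N := by
    refine sum_congr rfl fun N _ => ?_
    rw [hg]
    dsimp only
    split_ifs <;> ring
  rw [e2] at h1
  rw [e1]
  have := abs_sub_le (∑ N ∈ range M, v N * g (N + h j)) (∑ N ∈ range M, v N * g N)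
    (X / (W * q).totient)
  linarith

lemma state_error_sum_le {k n W : ℕ} {R : ℝ} {p : Fin n → ℕ} (hp : SievePrimes W R p)
    (Err : Finset (Fin n) → ℝ) (hErr : ∀ S, 0 ≤ Err S) :
    ∑ τ ∈ univ.filter (fun τ : Fin n → Option (Fin k) => ∏ i ∈ colorSupport τ, (p i : ℝ) ≤ R ^ 2),
      (2 ^ k * (∑ S ∈ univ.filter (fun S : Finset (Fin n) => ∏ i ∈ S, (p i : ℝ) ≤ R),
        (∏ i ∈ S ∩ colorSupport τ, (p i : ℝ)) / ∏ i ∈ S, (p i : ℝ)) ^ k) ^ 2 * Err (colorSupport τ) ≤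
    4 ^ k * SievePrimes.recipSum p R ^ (2 * k) *
      ∑ S ∈ univ.filter (fun S : Finset (Fin n) => ∏ i ∈ S, (p i : ℝ) ≤ R ^ 2),
        ((k : ℝ) * 4 ^ k) ^ S.card * Err S := by
  have hP0 : 0 ≤ SievePrimes.recipSum p R := sum_nonneg fun S _ => by split_ifs <;> positivity
  set P := SievePrimes.recipSum p R with hP
  set g : Finset (Fin n) → ℝ := fun S => if ∏ i ∈ S, (p i : ℝ) ≤ R ^ 2 then
    4 ^ k * P ^ (2 * k) * ((4 ^ k) ^ S.card * Err S) else 0 with hg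
  have hg0 : ∀ S, 0 ≤ g S := fun S => by
    rw [hg]; dsimp only
    split_ifs
    · exact mul_nonneg (by positivity) (mul_nonneg (by positivity) (hErr S))
    · exact le_rfl
  have h1 := sum_colorSupport_le (k := k) g hg0
  rw [sum_filter, mul_sum]
  refine le_trans (sum_le_sum fun τ _ => ?_) (h1.trans (le_of_eq ?_))
  · rw [hg]; dsimp only
    split_ifs with h2
    · have h3 := gcd_sum_le (p := p) (fun i => (hp.prime i).one_le) R (colorSupport τ)
      rw [← mul_assoc]
      refine mul_le_mul_of_nonneg_right ?_ (hErr _)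
      have h0 : 0 ≤ ∑ S ∈ univ.filter (fun S : Finset (Fin n) => ∏ i ∈ S, (p i : ℝ) ≤ R),
        (∏ i ∈ S ∩ colorSupport τ, (p i : ℝ)) / ∏ i ∈ S, (p i : ℝ) :=
        sum_nonneg fun S _ => by positivity
      calc _ ≤ (2 ^ k * (2 ^ (colorSupport τ).card * P) ^ k) ^ 2 := by gcongr
        _ = _ := by
          have e4 : ∀ a : ℕ, (4 : ℝ) ^ a = 2 ^ (a * 2) := fun a => by
            rw [mul_comm, pow_mul]; norm_num
          simp only [e4]
          ring
    · exact le_rfl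
  · rw [sum_filter]
    refine sum_congr rfl fun S _ => ?_
    rw [hg]; dsimp only
    split_ifs
    · rw [mul_pow]; ring
    · simp

/-- The square of the sieve polynomial. -/
noncomputable def sieveSquare {k n : ℕ} (p : Fin n → ℕ) (R : ℝ) (F : ℝ → ℝ)
    (z : Fin n → Option (Fin k)) : ℝ :=
  (∑ ρ, (∏ i, localFactor (p i : ℝ) (z i) (ρ i)) * sieveWeight (fun i => (p i : ℝ)) R F ρ) ^ 2

/-- Equidistribution with a state-independent error and the cutoff-bounded sieve weights. -/
lemma sieve_square_equidistribution {k n W : ℕ} {R : ℝ} {p : Fin n → ℕ} (hp : SievePrimes W R p)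
    (hR : 0 ≤ R) (x : ℕ → Fin n → Option (Fin k)) (s : Finset ℕ) (u : ℕ → ℝ) (M : ℝ)
    (w : Fin n → Option (Fin k) → ℝ) (F : ℝ → ℝ) (hF : ∀ t, 0 ≤ F t) (hF2 : ∀ t, F t ≤ 2)
    (Err : Finset (Fin n) → ℝ) (hErr : ∀ S, 0 ≤ Err S)
    (hu : ∀ τ, ∏ i ∈ colorSupport τ, (p i : ℝ) ≤ R ^ 2 →
      |∑ N ∈ s, u N * ∏ i, stateIndicator (τ i) (x N i) -
        M * ∏ i, ∑ a, w i a * stateIndicator (τ i) a| ≤ Err (colorSupport τ)) :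
    |∑ N ∈ s, u N * sieveSquare p R F (x N) -
      M * ∑ z : Fin n → Option (Fin k), (∏ i, w i (z i)) * sieveSquare p R F z| ≤
    4 ^ k * SievePrimes.recipSum p R ^ (2 * k) *
      ∑ S ∈ univ.filter (fun S : Finset (Fin n) => ∏ i ∈ S, (p i : ℝ) ≤ R ^ 2),
        ((k : ℝ) * 4 ^ k) ^ S.card * Err S := by
  have hp1 : ∀ i, (1 : ℝ) ≤ p i := fun i => by exact_mod_cast (hp.prime i).one_le
  have hp0 : ∀ S : Finset (Fin n), 0 < ∏ i ∈ S, (p i : ℝ) := fun S =>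
    prod_pos fun i _ => one_pos.trans_le (hp1 i)
  have h := sieve_equidistribution (fun i => (p i : ℝ)) hp1 x s u M w
    (sieveWeight (fun i => (p i : ℝ)) R F) (B := 2 ^ k) (by positivity) hR (fun ρ => by
      rw [abs_of_nonneg (sieveWeight_nonneg _ (fun i => one_pos.trans_le (hp1 i)) R F hF ρ),
        sieveWeight]
      refine div_le_div_of_nonneg_right ?_ (hp0 _).le
      split_ifs
      · refine (prod_le_prod (fun c _ => hF _) fun c _ => hF2 _).trans (le_of_eq ?_)
        simp
      · positivity) (fun ρ hρ => by
      by_contra hc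
      exact hρ (by rw [sieveWeight, if_neg hc, zero_div])) (fun τ => Err (colorSupport τ)) hu
  exact h.trans (state_error_sum_le hp Err hErr)

/-- If the prime-weighted sieve sums beat the unweighted one, some shift contains many primes. -/
lemma exists_many_primes {k W b M m : ℕ} {Λ : ℝ} {h : Fin k → ℕ} {v f : ℕ → ℝ}
    (hv : ∀ n, 0 ≤ v n) (hf : ∀ n, 0 ≤ f n)
    (hΛ0 : 0 ≤ Λ) (hΛ : ∀ n < M, ∀ j, Real.log ((n + h j : ℕ) : ℝ) ≤ Λ)
    (hsum : m * Λ * ∑ N ∈ range M, (if N ≡ b [MOD W] then v N else 0) * f N <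
      ∑ j, ∑ N ∈ range M, (if N ≡ b [MOD W] ∧ (N + h j).Prime then
        Real.log ((N + h j : ℕ) : ℝ) * v N else 0) * f N) :
    ∃ N, v N ≠ 0 ∧ N ≡ b [MOD W] ∧ m + 1 ≤ (univ.filter fun j => (N + h j).Prime).card := by
  by_contra! H
  refine absurd hsum (not_lt.mpr ?_)
  rw [sum_comm, mul_sum]
  refine sum_le_sum fun N hN => ?_
  rw [← sum_mul, ← mul_assoc]
  refine mul_le_mul_of_nonneg_right ?_ (hf N)
  by_cases hb : N ≡ b [MOD W]
  · simp only [hb, true_and, if_true]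
    rw [← sum_filter]
    by_cases hvN : v N = 0
    · simp [hvN]
    have h1 := Nat.lt_succ_iff.mp (H N hvN hb)
    calc _ ≤ ∑ j ∈ univ.filter (fun j => (N + h j).Prime), Λ * v N := sum_le_sum fun j _ =>
          mul_le_mul_of_nonneg_right (hΛ N (mem_range.mp hN) j) (hv N)
      _ = ((univ.filter fun j => (N + h j).Prime).card : ℝ) * (Λ * v N) := by
          rw [sum_const, nsmul_eq_mul]
      _ ≤ m * (Λ * v N) := by
          refine mul_le_mul_of_nonneg_right (by exact_mod_cast h1) (mul_nonneg hΛ0 (hv N))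
      _ = _ := by ring
  · simp [hb]

/-- Main terms of the sieve for the dyadic cutoff. -/
lemma dyadic_main_terms {I k n W : ℕ} (hk : k = 2 ^ I) {R lam : ℝ} {p : Fin n → ℕ} (hp : SievePrimes W R p)
    (hW : 0 < W) (hp8 : ∀ i, 8 * (k : ℝ) ≤ p i) (hp16 : ∀ i, (16 : ℝ) ≤ p i)
    (hsum : ∑ i, 1 / (p i : ℝ) ^ 2 ≤ 1 / (100 * (k : ℝ) ^ 2)) (hlam : 0 < lam)
    (hR : R = Real.exp (384 * 2 ^ I * (I + 1) * lam))
    (h1 : 2 * (Real.log W + 1) ≤ lam) (h2 : 1 + W / ((W.totient : ℝ) / W) ≤ lam)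
    (h3 : 1 ≤ (W.totient : ℝ) / W * lam / 4) :
    ∃ Z : ℝ, 1 ≤ Z ∧
      ∑ z : Fin n → Option (Fin k), (∏ i, uniformWeight (p i : ℝ) (z i)) *
        sieveSquare p R (dyadicCutoff I (Real.exp lam)) z ≤ Z ^ k ∧
      ∀ j, (W.totient : ℝ) / W * lam * (I + 1) ^ 2 / 6144 * Z ^ k ≤
        ∑ z : Fin n → Option (Fin k), (∏ i, primeWeight j (p i : ℝ) (z i)) *
          sieveSquare p R (dyadicCutoff I (Real.exp lam)) z := by
  subst hk
  set κ := (W.totient : ℝ) / W with hκ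
  have hκ0 : 0 < κ := div_pos (by exact_mod_cast Nat.totient_pos.mpr hW) (by exact_mod_cast hW)
  have hk1 : (1 : ℝ) ≤ 2 ^ I := one_le_pow₀ (by norm_num)
  have hx0 : (1 : ℝ) ≤ Real.exp lam := Real.one_le_exp hlam.le
  have hp1 : ∀ i, 1 ≤ p i := fun i => (hp.prime i).one_le
  set x₀ := Real.exp lam with hx₀
  set F := dyadicCutoff I x₀ with hF
  have hlogx : Real.log x₀ = lam := Real.log_exp _
  have hlogpow : ∀ i : ℕ, Real.log (x₀ ^ 2 ^ i) = 2 ^ i * lam := fun i => by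
    rw [Real.log_pow, hlogx]; push_cast; rfl
  have hpow1 : ∀ i : ℕ, (1 : ℝ) ≤ x₀ ^ 2 ^ i := fun i => one_le_pow₀ hx0
  have hpowexp : ∀ i : ℕ, x₀ ^ 2 ^ i = Real.exp (2 ^ i * lam) := fun i => by
    rw [← hlogpow, Real.exp_log (one_pos.trans_le (hpow1 i))]
  have hle : ∀ i : ℕ, lam ≤ 2 ^ i * lam := fun i =>
    le_mul_of_one_le_left hlam.le (one_le_pow₀ (by norm_num))
  have hIlam : 2 ^ I * lam ≤ 192 * 2 ^ I * (I + 1) * lam := by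
    have : 0 ≤ (I : ℝ) * (2 ^ I * lam) := by positivity
    have : 0 ≤ 2 ^ I * lam := by positivity
    nlinarith
  have hsqrt : Real.sqrt R = Real.exp (192 * 2 ^ I * (I + 1) * lam) := by
    rw [hR, show 384 * 2 ^ I * ((I : ℝ) + 1) * lam = 192 * 2 ^ I * (I + 1) * lam +
      192 * 2 ^ I * (I + 1) * lam by ring, Real.exp_add, Real.sqrt_mul_self (Real.exp_pos _).le]
  have hxR : x₀ ^ 2 ^ I ≤ Real.sqrt R := by
    rw [hsqrt, hpowexp]; exact Real.exp_le_exp.mpr hIlam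
  have hxR' : ∀ i ≤ I, x₀ ^ 2 ^ i ≤ R := by
    intro i hi
    rw [hR, hpowexp]
    refine Real.exp_le_exp.mpr ?_
    have h4 : (2 : ℝ) ^ i * lam ≤ 2 ^ I * lam := by gcongr; norm_num
    have : 0 ≤ 192 * 2 ^ I * ((I : ℝ) + 1) * lam := by positivity
    linarith
  have hlo : ∀ i ≤ I, κ * (2 ^ i * Real.log x₀) / 4 ≤ SievePrimes.recipSum p (x₀ ^ 2 ^ i) := by
    intro i hi
    refine le_trans ?_ (hp.le_recipSum hW (one_pos.trans_le (hpow1 i)) (hxR' i hi))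
    rw [hlogpow, hlogx, ← hκ]
    have := hle i
    have h5 : 2 ^ i * lam / 2 ≤ 2 ^ i * lam - Real.log W - 1 := by linarith
    nlinarith [mul_le_mul_of_nonneg_left h5 hκ0.le]
  have hhi : ∀ i ≤ I, SievePrimes.recipSum p (x₀ ^ 2 ^ i) ≤ 2 * κ * (2 ^ i * Real.log x₀) := by
    intro i _
    refine (hp.recipSum_le hW (hpow1 i)).trans ?_
    rw [hlogpow, hlogx, ← hκ]
    have h5 : 1 + W / κ ≤ 2 ^ i * lam := h2.trans (hle i)
    have h6 := mul_le_mul_of_nonneg_left h5 hκ0.le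
    rw [mul_add, mul_div_cancel₀ _ hκ0.ne'] at h6
    linarith
  have hY := cutoff_sum_ge p hlo
  have hZ := cutoff_sq_sum_le p hκ0.le hx0 hhi
  have hZlog := cutoff_sq_log_sum_le p hp1 hx0 hhi
  have hZlo : κ * lam / 4 ≤ _ := le_trans (by simpa [hlogx] using hlo 0 (Nat.zero_le _))
    (recipSum_le_cutoff_sq_sum p (I := I) (x₀ := x₀))
  rw [hlogx, ← hF] at hY hZ hZlog
  set Z := ∑ S : Finset (Fin n), dyadicCutoff I x₀ (∏ l ∈ S, (p l : ℝ)) ^ 2 / ∏ l ∈ S, (p l : ℝ)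
    with hZdef
  set Y := ∑ S : Finset (Fin n), F (∏ l ∈ S, (p l : ℝ)) / ∏ l ∈ S, (p l : ℝ) with hYdef
  have hZ1 : 1 ≤ Z := h3.trans hZlo
  refine ⟨Z, hZ1, ?_, fun j => ?_⟩
  · exact uniform_main_le (fun i => (p i : ℝ)) (fun i => by
      have := hp8 i; push_cast at this ⊢; linarith) R F
  · have := prime_main_ge (fun i => (p i : ℝ)) hp8 hp16 R (by rw [hR]; positivity) F
      (dyadicCutoff_antitone I x₀) (dyadicCutoff_nonneg I x₀)
      (fun t ht => (le_of_dyadicCutoff_ne_zero hx0 ht).trans hxR) j hsum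
      (ℓ := 192 * 2 ^ I * (I + 1) * lam) (by positivity) hsqrt.ge (by
        refine hZlog.trans ?_
        have e : 192 * 2 ^ I * ((I : ℝ) + 1) * lam / (8 * ((2 ^ I : ℕ) : ℝ)) = 24 * (I + 1) * lam := by
          push_cast; field_simp; norm_num
        rw [e]
        calc _ = 24 * (I + 1) * lam * (κ * lam / 4) := by ring
          _ ≤ _ := by gcongr)
    refine le_trans ?_ this
    change _ ≤ 1 / 32 * Y ^ 2 * Z ^ (2 ^ I - 1)
    have e : Z ^ 2 ^ I = Z * Z ^ (2 ^ I - 1) := by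
      rw [← pow_succ', Nat.sub_add_cancel Nat.one_le_two_pow]
    rw [e, ← mul_assoc]
    refine mul_le_mul_of_nonneg_right ?_ (pow_nonneg (by linarith) _)
    have hY0 : 0 ≤ κ * lam * (I + 1) / 4 := by positivity
    have hY2 : (κ * lam * (I + 1) / 4) ^ 2 ≤ Y ^ 2 := pow_le_pow_left₀ hY0 hY 2
    have hpos : 0 ≤ κ * lam * ((I : ℝ) + 1) ^ 2 / 6144 := by positivity
    calc _ ≤ κ * lam * ((I : ℝ) + 1) ^ 2 / 6144 * (12 * κ * lam) := by gcongr
      _ = 1 / 32 * (κ * lam * (I + 1) / 4) ^ 2 := by ring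
      _ ≤ _ := by gcongr

lemma sum_inv_sq_le_of_injective {n D : ℕ} {p : Fin n → ℕ} (hinj : Function.Injective p)
    (hD : ∀ i, D < p i) : ∑ i, 1 / (p i : ℝ) ^ 2 ≤ 2 / ((D : ℝ) + 1) := by
  have h := sum_Ioo_inv_sq_le (α := ℝ) D (∑ i, p i + 1)
  refine le_trans ?_ h
  rw [← sum_image (f := fun t : ℕ => 1 / (t : ℝ) ^ 2) (g := p) hinj.injOn]
  simp only [one_div]
  refine sum_le_sum_of_subset_of_nonneg ?_ fun _ _ _ => by positivity
  intro t ht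
  obtain ⟨i, _, rfl⟩ := mem_image.mp ht
  exact mem_Ioo.mpr ⟨hD i, Nat.lt_succ_of_le (single_le_sum (f := p) (fun _ _ => Nat.zero_le _)
    (mem_univ i))⟩

/-- Primes have a level of distribution against arbitrarily long smooth weights. -/
def PrimesHaveLevel : Prop := ∃ θ : ℝ, 0 < θ ∧ ∀ W : ℕ, 0 < W → ∀ (C : ℝ) (A : ℕ) (L₁ : ℝ), ∃ L ≥ L₁,
  ∃ (v E : ℕ → ℝ) (M : ℕ) (X : ℝ),
    (∀ n, 0 ≤ v n) ∧ (∀ n : ℕ, v n ≠ 0 → Real.exp L ≤ n) ∧ (∀ n, M ≤ n → v n = 0) ∧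
    (M : ℝ) ≤ Real.exp (3 * L) ∧ 0 < ∑ n ∈ range M, v n ∧
    (∑ n ∈ range M, v n) / 2 ≤ X ∧ X ≤ 2 * ∑ n ∈ range M, v n ∧
    totalVariation v M ≤ Real.exp (-(L / 2)) * ∑ n ∈ range M, v n ∧ (∀ q, 0 ≤ E q) ∧
    (∀ q c : ℕ, Squarefree q → Nat.Coprime W q → (q : ℝ) ≤ Real.exp (θ * L) →
      Nat.Coprime c (W * q) →
      |∑ n ∈ range M, (if n.Prime ∧ n ≡ c [MOD W * q] then Real.log n * v n else 0) -
        X / (W * q).totient| ≤ E q) ∧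
    ∑ q ∈ (Icc 1 ⌊Real.exp (θ * L)⌋₊).filter (fun q => Squarefree q ∧ Nat.Coprime W q),
      C ^ q.primeFactors.card * E q ≤ X / L ^ A

namespace SievePrimes

variable {W n : ℕ} {R : ℝ} {p : Fin n → ℕ}

lemma primeFactors_card (hp : SievePrimes W R p) (S : Finset (Fin n)) :
    (∏ i ∈ S, p i).primeFactors.card = S.card := by
  have h1 : ∏ i ∈ S, p i = ∏ q ∈ S.image p, q := by
    rw [prod_image hp.inj.injOn]
  rw [h1, Nat.primeFactors_prod, card_image_of_injective _ hp.inj]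
  intro q hq
  obtain ⟨i, _, rfl⟩ := mem_image.mp hq
  exact hp.prime i

lemma image_prod_subset (hp : SievePrimes W R p) (T : ℝ) :
    (univ.filter (fun S : Finset (Fin n) => ∏ i ∈ S, (p i : ℝ) ≤ T)).image (fun S => ∏ i ∈ S, p i) ⊆
      (Icc 1 ⌊T⌋₊).filter (fun q => Squarefree q ∧ Nat.Coprime W q) := by
  intro q hq
  obtain ⟨S, hS, rfl⟩ := mem_image.mp hq
  refine mem_filter.mpr ⟨mem_Icc.mpr ⟨hp.prod_pos S, Nat.le_floor ?_⟩, hp.squarefree_prod S,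
    hp.coprime_prod S⟩
  push_cast
  exact (mem_filter.mp hS).2

lemma sum_pow_card_mul_le (hp : SievePrimes W R p) {C : ℝ} (hC : 0 ≤ C) (T : ℝ) {E : ℕ → ℝ}
    (hE : ∀ q, 0 ≤ E q) :
    ∑ S ∈ univ.filter (fun S : Finset (Fin n) => ∏ i ∈ S, (p i : ℝ) ≤ T),
      C ^ S.card * E (∏ i ∈ S, p i) ≤
    ∑ q ∈ (Icc 1 ⌊T⌋₊).filter (fun q => Squarefree q ∧ Nat.Coprime W q),
      C ^ q.primeFactors.card * E q := by
  refine le_trans (le_of_eq ?_) (sum_le_sum_of_subset_of_nonneg (hp.image_prod_subset T)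
    fun q _ _ => mul_nonneg (pow_nonneg hC _) (hE q))
  rw [sum_image hp.prod_injective.injOn]
  exact sum_congr rfl fun S _ => by rw [hp.primeFactors_card]

lemma sum_pow_card_le (hp : SievePrimes W R p) {C : ℝ} (hC : 0 ≤ C) (hCp : ∀ i, C ≤ p i) {T : ℝ}
    (hT : 0 ≤ T) :
    ∑ S ∈ univ.filter (fun S : Finset (Fin n) => ∏ i ∈ S, (p i : ℝ) ≤ T), C ^ S.card ≤ T ^ 2 := by
  have hcard : ((univ.filter (fun S : Finset (Fin n) => ∏ i ∈ S, (p i : ℝ) ≤ T)).card : ℝ) ≤ T := by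
    rw [← card_image_of_injective _ hp.prod_injective]
    refine le_trans ?_ (Nat.floor_le hT)
    exact_mod_cast (card_le_card ((hp.image_prod_subset T).trans (filter_subset _ _))).trans
      (by simp)
  calc _ ≤ ∑ S ∈ univ.filter (fun S : Finset (Fin n) => ∏ i ∈ S, (p i : ℝ) ≤ T), T := by
        refine sum_le_sum fun S hS => le_trans ?_ (mem_filter.mp hS).2
        rw [← prod_const]
        exact prod_le_prod (fun _ _ => hC) fun i _ => hCp i
    _ ≤ T * T := by
        rw [sum_const, nsmul_eq_mul]; gcongr
    _ = _ := by ring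

end SievePrimes

set_option maxHeartbeats 1000000 in
lemma many_primes_of_level {I k W b n m M H : ℕ} (hk : k = 2 ^ I) {θ L R lam X : ℝ} {p : Fin n → ℕ}
    (hp : SievePrimes W R p) (hW : 0 < W) (hp8 : ∀ i, 8 * (k : ℝ) ≤ p i)
    (hp16 : ∀ i, (16 : ℝ) ≤ p i)
    (hsum : ∑ i, 1 / (p i : ℝ) ^ 2 ≤ 1 / (100 * (k : ℝ) ^ 2))
    (hpC : ∀ i, (k : ℝ) * 4 ^ k ≤ p i) (hθ : 0 < θ) (hθ' : θ ≤ 1 / 12)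
    (hlamdef : lam = θ * L / (768 * k * (I + 1))) (hR : R = Real.exp (θ * L / 2))
    (h1 : 2 * (Real.log W + 1) ≤ lam) (h2 : 1 + W / ((W.totient : ℝ) / W) ≤ lam)
    (h3 : 1 ≤ (W.totient : ℝ) / W * lam / 4) (hI : 9437184 * (16 * (m + 1)) ≤ (I + 1) * θ)
    {h : Fin k → ℕ} (hinj : Function.Injective h) (hlt : ∀ i c, h c < p i)
    (hbW : ∀ c, Nat.Coprime (b + h c) W) {v E : ℕ → ℝ} (hv0 : ∀ n, 0 ≤ v n)
    (hvL : ∀ n : ℕ, v n ≠ 0 → Real.exp L ≤ n) (hvM : ∀ n, M ≤ n → v n = 0)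
    (hV : 0 < ∑ n ∈ range M, v n) (hX : (∑ n ∈ range M, v n) / 2 ≤ X)
    (hX' : X ≤ 2 * ∑ n ∈ range M, v n)
    (hTV : totalVariation v M ≤ Real.exp (-(L / 2)) * ∑ n ∈ range M, v n) (hE : ∀ q, 0 ≤ E q)
    (hdist : ∀ q c : ℕ, Squarefree q → Nat.Coprime W q → (q : ℝ) ≤ Real.exp (θ * L) →
      Nat.Coprime c (W * q) →
      |∑ n ∈ range M, (if n.Prime ∧ n ≡ c [MOD W * q] then Real.log n * v n else 0) -
        X / (W * q).totient| ≤ E q)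
    (hEsum : ∑ q ∈ (Icc 1 ⌊Real.exp (θ * L)⌋₊).filter (fun q => Squarefree q ∧ Nat.Coprime W q),
      ((k : ℝ) * 4 ^ k) ^ q.primeFactors.card * E q ≤ X / L ^ (2 * k))
    (hL : 1 ≤ L) (hH : ∀ j, h j ≤ H) (hHR : (H : ℝ) ≤ R)
    (hML : (M + H : ℝ) ≤ Real.exp (4 * L))
    (n1 : 4 ^ k * (2 * L) ^ (2 * k) * W ^ 2 * Real.exp (-(L / 4)) ≤ 1)
    (n2 : (k : ℝ) * W * (4 ^ k * 4 ^ k) * 4 ≤ L)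
    (n3 : (k : ℝ) * W * (4 ^ k * (2 * L) ^ (2 * k)) *
      (4 * L * H * Real.exp (-(L / 4))) ≤ L / 2) :
    ∃ N, v N ≠ 0 ∧ N ≡ b [MOD W] ∧ m + 1 ≤ (univ.filter fun j => (N + h j).Prime).card := by
  have hL0 : 0 < L := by linarith
  have hθL : θ * L ≤ L / 12 := (mul_le_mul_of_nonneg_right hθ' hL0.le).trans (by linarith)
  have hWpos : (0 : ℝ) < W := by exact_mod_cast hW
  have hR0 : 0 < R := by rw [hR]; exact Real.exp_pos _
  have hR1 : 1 ≤ R := by rw [hR]; exact Real.one_le_exp (by positivity)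
  have hRsq : R ^ 2 = Real.exp (θ * L) := by
    rw [hR, ← Real.exp_nat_mul]; congr 1; push_cast; ring
  have hkpos : 0 < k := by rw [hk]; positivity
  have hlam : 0 < lam := by rw [hlamdef]; positivity
  obtain ⟨x, hx⟩ := exists_state hinj hlt
  obtain ⟨Z, hZ1, hmain1, hmain2⟩ := dyadic_main_terms hk hp hW hp8 hp16 hsum hlam (by
    have hkR : (k : ℝ) = 2 ^ I := by rw [hk]; push_cast; rfl
    rw [hR, hlamdef, hkR]; congr 1; field_simp; norm_num) h1 h2 h3
  set F := dyadicCutoff I (Real.exp lam) with hF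
  set V := ∑ n ∈ range M, v n with hVdef
  set TV := totalVariation v M with hTVdef
  have hTV0 : 0 ≤ TV := sum_nonneg fun _ _ => abs_nonneg _
  set P := SievePrimes.recipSum p R with hP
  have hP0 : 0 ≤ P := sum_nonneg fun S _ => by split_ifs <;> positivity
  have hP2 : P ≤ 2 * L := by
    refine (hp.recipSum_le_log hR1).trans ?_
    rw [hR, Real.log_exp]; linarith
  set C := (k : ℝ) * 4 ^ k with hC
  have hC0 : 0 ≤ C := by positivity
  have hPB : 4 ^ k * P ^ (2 * k) ≤ 4 ^ k * (2 * L) ^ (2 * k) := by gcongr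
  set B := (4 : ℝ) ^ k * (2 * L) ^ (2 * k) with hB
  have hB0 : 0 < B := by positivity
  have hcount := hp.sum_pow_card_le hC0 hpC (sq_nonneg R)
  set 𝒮 := univ.filter (fun S : Finset (Fin n) => ∏ i ∈ S, (p i : ℝ) ≤ R ^ 2) with h𝒮
  have hvR : ∀ n : ℕ, (n : ℝ) ≤ R → v n = 0 := by
    intro n hn
    by_contra hne
    have h5 := (hvL n hne).trans hn
    rw [hR, Real.exp_le_exp] at h5
    linarith
  have hG : V / W ≤ V / W * Z ^ k := le_mul_of_one_le_right (by positivity) (one_le_pow₀ hZ1)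
  set G := V / W * Z ^ k with hGdef
  have hexpR : R ^ 6 * Real.exp (-(L / 2)) ≤ Real.exp (-(L / 4)) := by
    rw [hR, ← Real.exp_nat_mul, ← Real.exp_add, Real.exp_le_exp]; push_cast; linarith
  have hF0 := dyadicCutoff_nonneg I (Real.exp lam)
  have hF2 := fun t => (dyadicCutoff_bounds I (Real.exp lam) t).1
  -- the unweighted sum
  have hS1 : ∑ N ∈ range M, (if N ≡ b [MOD W] then v N else 0) * sieveSquare p R F (x N) ≤ 2 * G := by
    have h5 := sieve_square_equidistribution hp hR0.le x (range M)
      (fun N => if N ≡ b [MOD W] then v N else 0) (V / W)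
      (fun i => uniformWeight (p i : ℝ)) F hF0 hF2
      (fun S => if ∏ i ∈ S, (p i : ℝ) ≤ R ^ 2 then W * R ^ 2 * TV else 0)
      (fun S => by split_ifs <;> positivity) (fun τ hτ => by
        rw [if_pos hτ]
        refine (uniform_state_error hp hW hlt hx hvM (hvR 0 (by simpa using hR0.le)) τ).trans ?_
        gcongr)
    have h6 : 4 ^ k * P ^ (2 * k) * ∑ S ∈ 𝒮, C ^ S.card *
        (if ∏ i ∈ S, (p i : ℝ) ≤ R ^ 2 then W * R ^ 2 * TV else 0) ≤ G := by
      calc _ = 4 ^ k * P ^ (2 * k) * ((∑ S ∈ 𝒮, C ^ S.card) * (W * R ^ 2 * TV)) := by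
            rw [sum_mul]
            congr 1
            exact sum_congr rfl fun S hS => by rw [if_pos (mem_filter.mp hS).2]
        _ ≤ B * ((R ^ 2) ^ 2 * (W * R ^ 2 * (Real.exp (-(L / 2)) * V))) := by gcongr
        _ = B * W ^ 2 * (R ^ 6 * Real.exp (-(L / 2))) * (V / W) := by field_simp
        _ ≤ B * W ^ 2 * Real.exp (-(L / 4)) * (V / W) := by gcongr
        _ ≤ 1 * (V / W) := by gcongr
        _ ≤ G := by linarith
    have h7 : V / W * ∑ z : Fin n → Option (Fin k), (∏ i, uniformWeight (p i : ℝ) (z i)) *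
        sieveSquare p R F z ≤ G := mul_le_mul_of_nonneg_left hmain1 (by positivity)
    have := (abs_le.mp h5).2
    linarith
  -- the prime-weighted sums
  have hS2 : ∀ j, 15 * (m + 1) * L * G / k ≤ ∑ N ∈ range M,
      (if N ≡ b [MOD W] ∧ (N + h j).Prime then Real.log ((N + h j : ℕ) : ℝ) * v N else 0) *
        sieveSquare p R F (x N) := by
    intro j
    have hjH : (h j : ℝ) ≤ H := by exact_mod_cast hH j
    have h5 := sieve_square_equidistribution hp hR0.le x (range M)
      (fun N => if N ≡ b [MOD W] ∧ (N + h j).Prime then Real.log ((N + h j : ℕ) : ℝ) * v N else 0)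
      (X / W.totient) (fun i => primeWeight j (p i : ℝ)) F hF0 hF2
      (fun S => E (∏ i ∈ S, p i) + 4 * L * (H * TV))
      (fun S => add_nonneg (hE _) (by positivity)) (fun τ hτ => by
        refine (prime_state_error hp hlt hbW hx hvM hvR (hjH.trans hHR) (L := L) ?_ (hE _) hL0.le τ
          fun c hc => hdist _ c (hp.squarefree_prod _) (hp.coprime_prod _) ?_ hc).trans ?_
        · refine le_trans ?_ hML; push_cast; linarith
        · rw [← hRsq]; push_cast; exact hτ
        · gcongr)
    have h6 : k * (4 ^ k * P ^ (2 * k) * ∑ S ∈ 𝒮, C ^ S.card *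
        (E (∏ i ∈ S, p i) + 4 * L * (H * TV))) ≤ L * G := by
      have hEs : ∑ S ∈ 𝒮, C ^ S.card * E (∏ i ∈ S, p i) ≤ 2 * V / L ^ (2 * k) := by
        refine (hp.sum_pow_card_mul_le hC0 (R ^ 2) hE).trans ?_
        rw [hRsq]
        exact hEsum.trans (by gcongr)
      have e1 : ∑ S ∈ 𝒮, C ^ S.card * (E (∏ i ∈ S, p i) + 4 * L * (H * TV)) =
          ∑ S ∈ 𝒮, C ^ S.card * E (∏ i ∈ S, p i) + (∑ S ∈ 𝒮, C ^ S.card) * (4 * L * (H * TV)) := by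
        rw [sum_mul, ← sum_add_distrib]
        exact sum_congr rfl fun S _ => by ring
      have hsum0 : 0 ≤ ∑ S ∈ 𝒮, C ^ S.card * (E (∏ i ∈ S, p i) + 4 * L * (H * TV)) :=
        sum_nonneg fun S _ => mul_nonneg (by positivity) (add_nonneg (hE _) (by positivity))
      have hR4 : (R ^ 2) ^ 2 ≤ R ^ 6 := by rw [← pow_mul]; exact pow_le_pow_right₀ hR1 (by norm_num)
      calc _ ≤ k * (B * ∑ S ∈ 𝒮, C ^ S.card * (E (∏ i ∈ S, p i) + 4 * L * (H * TV))) := by gcongr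
        _ ≤ k * (B * (2 * V / L ^ (2 * k) + R ^ 6 * (4 * L * (H * (Real.exp (-(L / 2)) * V))))) := by
            rw [e1]
            gcongr
            exact hcount.trans hR4
        _ = (k * W * B * (2 / L ^ (2 * k)) +
              k * W * B * (4 * L * H * (R ^ 6 * Real.exp (-(L / 2))))) * (V / W) := by
            field_simp
        _ ≤ (L / 2 + L / 2) * (V / W) := by
            gcongr
            · have : B * (2 / L ^ (2 * k)) = 4 ^ k * 4 ^ k * 2 := by
                rw [hB, mul_pow, pow_mul (2 : ℝ) 2 k]; norm_num; field_simp
              rw [mul_assoc, this]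
              linarith
            · exact le_trans (by gcongr) n3
        _ ≤ L * G := by
            rw [add_halves]; gcongr
    have h7 : 16 * (m + 1) * L * G / k ≤ X / W.totient * ∑ z : Fin n → Option (Fin k),
        (∏ i, primeWeight j (p i : ℝ) (z i)) * sieveSquare p R F z := by
      have htot : (0 : ℝ) < W.totient := by exact_mod_cast Nat.totient_pos.mpr hW
      calc _ ≤ V / 2 / W.totient * ((W.totient : ℝ) / W * lam * (I + 1) ^ 2 / 6144 * Z ^ k) := by
            have e : V / 2 / (W.totient : ℝ) * ((W.totient : ℝ) / W * lam * (I + 1) ^ 2 / 6144 * Z ^ k)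
              = G * L / k * ((I + 1) * θ / 9437184) := by
              rw [hGdef, hlamdef]; field_simp; norm_num
            rw [e]
            have : 16 * ((m : ℝ) + 1) ≤ (I + 1) * θ / 9437184 := by
              rw [le_div_iff₀ (by norm_num)]; linarith
            calc _ = G * L / k * (16 * (m + 1)) := by ring
              _ ≤ _ := by gcongr
        _ ≤ X / W.totient * ((W.totient : ℝ) / W * lam * (I + 1) ^ 2 / 6144 * Z ^ k) := by gcongr
        _ ≤ _ := by
            refine mul_le_mul_of_nonneg_left (hmain2 j) (div_nonneg (by linarith) htot.le)
    have h8 := (abs_le.mp h5).1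
    have hkp : (0 : ℝ) < k := by exact_mod_cast hkpos
    have h9 : 4 ^ k * P ^ (2 * k) * ∑ S ∈ 𝒮, C ^ S.card *
        (E (∏ i ∈ S, p i) + 4 * L * (H * TV)) ≤ (m + 1) * L * G / k := by
      rw [le_div_iff₀ hkp, mul_comm]
      refine h6.trans ?_
      have : 0 ≤ (m : ℝ) * (L * G) := by positivity
      linarith
    have e : 16 * ((m : ℝ) + 1) * L * G / k = 15 * (m + 1) * L * G / k + (m + 1) * L * G / k := by ring
    linarith
  have hG0 : 0 < G := (div_pos hV hWpos).trans_le hG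
  refine exists_many_primes (M := M) (Λ := 4 * L) hv0 (fun N => sq_nonneg _) (by positivity) (fun N hN j => ?_) ?_
    (f := fun N => sieveSquare p R F (x N))
  · rcases Nat.eq_zero_or_pos (N + h j) with h0 | h0
    · rw [h0]; simp; positivity
    rw [Real.log_le_iff_le_exp (by exact_mod_cast h0)]
    refine le_trans ?_ hML
    exact_mod_cast Nat.add_le_add hN.le (hH j)
  · have h5 := sum_le_sum fun j (_ : j ∈ (univ : Finset (Fin k))) => hS2 j
    rw [sum_const, card_univ, Fintype.card_fin, nsmul_eq_mul, mul_div_cancel₀ _ (by positivity)] at h5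
    refine lt_of_lt_of_le ?_ h5
    have : 0 ≤ (m : ℝ) * (L * G) := by positivity
    have : 0 < L * G := by positivity
    calc _ ≤ m * (4 * L) * (2 * G) := by gcongr
      _ < _ := by linarith

open Filter

lemma eventually_pow_mul_exp_neg_le (c : ℝ) (a : ℕ) {ε : ℝ} (hε : 0 < ε) :
    ∀ᶠ L : ℝ in atTop, c * L ^ a * Real.exp (-(L / 4)) ≤ ε := by
  have h1 : Tendsto (fun L : ℝ => c * ((4 : ℝ) ^ a * ((L / 4) ^ a * Real.exp (-(L / 4))))) atTop
      (nhds (c * ((4 : ℝ) ^ a * 0))) :=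
    (((Real.tendsto_pow_mul_exp_neg_atTop_nhds_zero a).comp
      (tendsto_id.atTop_div_const (by norm_num : (0 : ℝ) < 4))).const_mul _).const_mul _
  rw [mul_zero, mul_zero] at h1
  filter_upwards [h1.eventually_le_const hε] with L hL
  refine le_trans (le_of_eq ?_) hL
  rw [div_pow]; field_simp

set_option maxHeartbeats 1000000 in
theorem maynardTao_of_primesHaveLevel (hlev : PrimesHaveLevel) : MaynardTao := by
  obtain ⟨θ₀, hθ₀, hlev⟩ := hlev
  intro m
  set θ := min θ₀ (1 / 12) with hθdef
  have hθ : 0 < θ := lt_min hθ₀ (by norm_num)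
  obtain ⟨I, hI⟩ := exists_nat_ge (9437184 * (16 * ((m : ℝ) + 1)) / θ)
  have hI' : 9437184 * (16 * ((m : ℝ) + 1)) ≤ (I + 1) * θ := by
    rw [div_le_iff₀ hθ] at hI; linarith
  obtain ⟨k, hk⟩ : ∃ k, k = 2 ^ I := ⟨_, rfl⟩
  have hkpos : 0 < k := by rw [hk]; positivity
  have hkR : (1 : ℝ) ≤ k := by exact_mod_cast hkpos
  refine ⟨k, fun h hinj => ?_⟩
  obtain ⟨H, hH⟩ : ∃ H : ℕ, ∀ j, h j ≤ H :=
    ⟨∑ j, h j, fun j => single_le_sum (f := h) (fun _ _ => Nat.zero_le _) (mem_univ j)⟩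
  refine ⟨H + 200 * k ^ 2 + 16 + 8 * k + k * 4 ^ k, fun W b hW hDW hbW N₀ => ?_⟩
  set D := H + 200 * k ^ 2 + 16 + 8 * k + k * 4 ^ k with hD
  have hWR : (0 : ℝ) < W := by exact_mod_cast hW
  set κ := (W.totient : ℝ) / W with hκ
  have hκ0 : 0 < κ := div_pos (by exact_mod_cast Nat.totient_pos.mpr hW) hWR
  set c := θ / (768 * k * ((I : ℝ) + 1)) with hc
  have hc0 : 0 < c := by positivity
  have hid : Tendsto (fun L : ℝ => L) atTop atTop := tendsto_id
  have hlin : Tendsto (fun L : ℝ => c * L) atTop atTop := hid.const_mul_atTop hc0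
  have hexp : Tendsto (fun L : ℝ => Real.exp (θ * L / 2)) atTop atTop :=
    Real.tendsto_exp_atTop.comp ((hid.const_mul_atTop hθ).atTop_div_const (by norm_num))
  have hexp3 : Tendsto (fun L : ℝ => Real.exp (3 * L)) atTop atTop :=
    Real.tendsto_exp_atTop.comp (hid.const_mul_atTop (by norm_num))
  have hev := ((((((((((hid.eventually_ge_atTop 1).and
    (hlin.eventually_ge_atTop (2 * (Real.log W + 1)))).and
    (hlin.eventually_ge_atTop (1 + W / κ))).and
    (hlin.eventually_ge_atTop (4 / κ))).and
    (hexp.eventually_ge_atTop (H : ℝ))).and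
    (hexp3.eventually_ge_atTop (H : ℝ))).and
    (Real.tendsto_exp_atTop.eventually_ge_atTop (N₀ : ℝ))).and
    (eventually_pow_mul_exp_neg_le (4 ^ k * 2 ^ (2 * k) * W ^ 2) (2 * k) one_pos)).and
    (hid.eventually_ge_atTop ((k : ℝ) * W * (4 ^ k * 4 ^ k) * 4))).and
    (eventually_pow_mul_exp_neg_le ((k : ℝ) * W * 4 ^ k * 2 ^ (2 * k) * 4 * H) (2 * k)
      (one_half_pos (α := ℝ))))
  obtain ⟨L₁, hL₁⟩ := eventually_atTop.mp hev
  obtain ⟨L, hLL, v, E, M, X, hv0, hvL, hvM, hM, hV, hX, hX', hTV, hE, hdist, hEsum⟩ :=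
    hlev W hW ((k : ℝ) * 4 ^ k) (2 * k) L₁
  obtain ⟨⟨⟨⟨⟨⟨⟨⟨⟨hL1, g1⟩, g2⟩, g3⟩, g4⟩, g5⟩, g6⟩, g7⟩, g8⟩, g9⟩ := hL₁ L hLL
  have hL0 : 0 < L := by linarith
  obtain ⟨n, p, hp⟩ := exists_sievePrimes W (Real.exp (θ * L / 2))
  have hpD : ∀ i, D < p i := fun i => by
    by_contra hle
    exact hp.not_dvd i (hDW _ (hp.prime i) (not_lt.mp hle))
  have hpDR : ∀ i, (D : ℝ) ≤ p i := fun i => by exact_mod_cast (hpD i).le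
  have hDR : (D : ℝ) = H + 200 * k ^ 2 + 16 + 8 * k + k * 4 ^ k := by rw [hD]; push_cast; rfl
  have hD1 : 0 ≤ (k : ℝ) * 4 ^ k := by positivity
  have hD2 : 0 ≤ 200 * (k : ℝ) ^ 2 := by positivity
  have hD3 : (0 : ℝ) ≤ H := Nat.cast_nonneg H
  have hθL : θ * L ≤ θ₀ * L := mul_le_mul_of_nonneg_right (min_le_left _ _) hL0.le
  obtain ⟨N, hN0, hNb, hN⟩ := many_primes_of_level (m := m) (H := H) (L := L) (M := M) hk hp hW
    (fun i => by linarith [hpDR i]) (fun i => by linarith [hpDR i])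
    ((sum_inv_sq_le_of_injective hp.inj hpD).trans (by
      rw [div_le_div_iff₀ (by positivity) (by positivity)]; linarith))
    (fun i => by linarith [hpDR i]) hθ (min_le_right _ _) (lam := c * L) (by rw [hc]; ring) rfl g1 g2
    (by
      rw [div_le_iff₀ hκ0] at g3
      linarith)
    hI' hinj (fun i j => lt_of_le_of_lt ((hH j).trans (by omega)) (hpD i)) hbW hv0 hvL hvM hV
    hX hX' hTV hE
    (fun q c hq hWq hle => hdist q c hq hWq (hle.trans (Real.exp_le_exp.mpr hθL)))
    (le_trans (sum_le_sum_of_subset_of_nonneg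
      (filter_subset_filter _ (Icc_subset_Icc_right (Nat.floor_mono (Real.exp_le_exp.mpr hθL))))
      fun q _ _ => mul_nonneg (by positivity) (hE q)) hEsum)
    hL1 hH g4
    (by
      have h1 : (2 : ℝ) ≤ Real.exp L := by linarith [Real.add_one_le_exp L]
      have h2 : Real.exp (4 * L) = Real.exp L * Real.exp (3 * L) := by
        rw [← Real.exp_add]; congr 1; ring
      rw [h2]
      have h3 := mul_le_mul_of_nonneg_right h1 (Real.exp_pos (3 * L)).le
      linarith)
    (le_trans (le_of_eq (by rw [mul_pow]; ring)) g7) g8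
    (by
      have : (k : ℝ) * W * (4 ^ k * (2 * L) ^ (2 * k)) * (4 * L * H * Real.exp (-(L / 4))) =
        (k * W * 4 ^ k * 2 ^ (2 * k) * 4 * H * L ^ (2 * k) * Real.exp (-(L / 4))) * L := by
        rw [mul_pow]; ring
      rw [this]
      linarith [mul_le_mul_of_nonneg_right g9 hL0.le])
  exact ⟨N, by exact_mod_cast g6.trans (hvL N hN0), hNb, hN⟩

/-- A sequence in the closed unit disc all of whose sums over intervals are at most `r`. -/
def BoundedSums (r : ℝ) (f : ℕ → ℂ) : Prop :=
  (∀ n, ‖f n‖ ≤ 1) ∧ ∀ a b, ‖∑ n ∈ Ico a b, f n‖ ≤ r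

lemma BoundedSums.nonneg {r : ℝ} {f : ℕ → ℂ} (hf : BoundedSums r f) : 0 ≤ r :=
  (norm_nonneg _).trans (hf.2 0 0)

lemma BoundedSums.norm_sum_mul_le {r : ℝ} {f : ℕ → ℂ} (hf : BoundedSums r f) (h : ℕ → ℝ)
    {a b : ℕ} (hab : a ≤ b) :
    ‖∑ n ∈ Ico a b, f n * (h n : ℂ)‖ ≤ r * (|h b| + ∑ n ∈ Ico a b, |h (n + 1) - h n|) := by
  have key : ∑ n ∈ Ico a b, f n * (h n : ℂ) = (∑ n ∈ Ico a b, f n) * h b -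
      ∑ n ∈ Ico a b, (∑ k ∈ Ico a (n + 1), f k) * ((h (n + 1) - h n : ℝ) : ℂ) := by
    induction b, hab using Nat.le_induction with
    | base => simp
    | succ b hab ih =>
      rw [sum_Ico_succ_top hab, ih, sum_Ico_succ_top hab, sum_Ico_succ_top hab,
        sum_Ico_succ_top hab]
      push_cast; ring
  rw [key]
  refine (norm_sub_le _ _).trans ?_
  rw [mul_add, mul_sum]
  refine add_le_add ?_ ((norm_sum_le _ _).trans (sum_le_sum fun n _ => ?_))
  · rw [norm_mul, Complex.norm_real, Real.norm_eq_abs]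
    exact mul_le_mul_of_nonneg_right (hf.2 _ _) (abs_nonneg _)
  · rw [norm_mul, Complex.norm_real, Real.norm_eq_abs]
    exact mul_le_mul_of_nonneg_right (hf.2 _ _) (abs_nonneg _)

lemma inv_mul_sqrt_le_telescope {m : ℕ} (hm : 1 ≤ m) :
    1 / ((m : ℝ) * √m) ≤ 6 * (1 / √m - 1 / √(m + 1 : ℕ)) := by
  have hm' : (1 : ℝ) ≤ m := by exact_mod_cast hm
  set s := √(m : ℝ) with hs
  set t := √((m + 1 : ℕ) : ℝ) with ht
  have hs2 : s ^ 2 = m := Real.sq_sqrt (by positivity)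
  have ht2 : t ^ 2 = m + 1 := by rw [ht, Real.sq_sqrt (by positivity)]; push_cast; ring
  have hs1 : 1 ≤ s := by rw [hs]; exact Real.one_le_sqrt.mpr hm'
  have ht0 : 0 ≤ t := Real.sqrt_nonneg _
  have hst : s ≤ t := by nlinarith
  have hts : t ≤ 3 / 2 * s := by nlinarith
  have e : 1 / s - 1 / t = 1 / (s * t * (s + t)) := by
    have : 0 < t := by linarith
    have h0 : 0 < s := by linarith
    have h1 : (t - s) * (s + t) = 1 := by nlinarith
    field_simp
    linarith
  rw [e, ← hs2]
  have h0 : 0 < s := by linarith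
  have h1 : 0 < t := by linarith
  rw [mul_one_div, div_le_div_iff₀ (by positivity) (by positivity)]
  have : s * t * (s + t) ≤ s * (3 / 2 * s) * (s + 3 / 2 * s) := by gcongr
  nlinarith [pow_pos h0 3]

lemma sum_inv_mul_sqrt_le {a b : ℕ} (ha : 1 ≤ a) :
    ∑ m ∈ Ico a b, 1 / ((m : ℝ) * √m) ≤ 6 / √a := by
  rcases le_total b a with h | h
  · rw [Ico_eq_empty_of_le h]; simp; positivity
  calc _ ≤ ∑ m ∈ Ico a b, 6 * (1 / √(m : ℝ) - 1 / √((m + 1 : ℕ) : ℝ)) :=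
        sum_le_sum fun m hm => inv_mul_sqrt_le_telescope (ha.trans (mem_Ico.mp hm).1)
    _ = 6 * (1 / √(a : ℝ) - 1 / √(b : ℝ)) := by
        rw [← mul_sum]; congr 1
        have := sum_Ico_sub (fun m : ℕ => -(1 / √(m : ℝ))) h
        simp only [neg_sub_neg] at this
        rw [this]
    _ ≤ _ := by
        have : 0 ≤ 1 / √(b : ℝ) := by positivity
        rw [mul_sub, mul_one_div]; linarith

lemma BoundedSums.norm_sum_div_tail_le {r : ℝ} {f : ℕ → ℂ} (hf : BoundedSums r f) {ρ : ℕ → ℝ}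
    {a : ℕ} (ha : 1 ≤ a) {P : ℝ} (h1 : ∀ m, a ≤ m → |ρ m| ≤ P * √m)
    (h2 : ∀ m, a ≤ m → |ρ (m + 1) - ρ m| ≤ P / √m) (b : ℕ) :
    ‖∑ m ∈ Ico a b, f m * ((ρ m / m : ℝ) : ℂ)‖ ≤ 13 * r * P / √a := by
  have ha' : (1 : ℝ) ≤ a := by exact_mod_cast ha
  have hsa : 0 < √(a : ℝ) := Real.sqrt_pos.mpr (by linarith)
  have hP : 0 ≤ P := by
    have := (abs_nonneg _).trans (h1 a le_rfl)
    exact nonneg_of_mul_nonneg_left this hsa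
  have hr := hf.nonneg
  rcases le_total b a with h | h
  · rw [Ico_eq_empty_of_le h]; simp; positivity
  refine (hf.norm_sum_mul_le (fun m => ρ m / m) h).trans ?_
  have e : 13 * r * P / √(a : ℝ) = r * (P / √(a : ℝ) + 2 * P * (6 / √(a : ℝ))) := by ring
  rw [e]
  refine mul_le_mul_of_nonneg_left (add_le_add ?_ ?_) hr
  · have hb : (1 : ℝ) ≤ b := ha'.trans (by exact_mod_cast h)
    rw [abs_div, abs_of_nonneg (by positivity : (0 : ℝ) ≤ b), div_le_div_iff₀ (by positivity) hsa]
    have hsb : √(b : ℝ) * √b = b := Real.mul_self_sqrt (by positivity)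
    have hab : √(a : ℝ) ≤ √b := Real.sqrt_le_sqrt (by exact_mod_cast h)
    calc _ ≤ P * √b * √b := by
          have := h1 b h
          gcongr
      _ = P * b := by rw [mul_assoc, hsb]
  · refine le_trans ?_ (mul_le_mul_of_nonneg_left (sum_inv_mul_sqrt_le (b := b) ha)
      (by positivity : 0 ≤ 2 * P))
    rw [mul_sum]
    refine sum_le_sum fun m hm => ?_
    have ham := (mem_Ico.mp hm).1
    have hm1 : (1 : ℝ) ≤ m := by exact_mod_cast ha.trans ham
    have hm0 : (0 : ℝ) < m := by linarith
    have hs : 0 < √(m : ℝ) := Real.sqrt_pos.mpr hm0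
    have hss : √(m : ℝ) * √m = m := Real.mul_self_sqrt hm0.le
    have e2 : ρ (m + 1) / ((m + 1 : ℕ) : ℝ) - ρ m / m =
        (ρ (m + 1) - ρ m) / (m + 1) - ρ m / (m * (m + 1)) := by
      push_cast; field_simp; ring
    rw [e2]
    refine (abs_sub _ _).trans ?_
    rw [abs_div, abs_div, abs_of_pos (by positivity : (0 : ℝ) < m + 1),
      abs_of_pos (by positivity : (0 : ℝ) < m * (m + 1))]
    have i1 : |ρ (m + 1) - ρ m| / (m + 1) ≤ P / (m * √m) := by
      calc _ ≤ (P / √m) / m := by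
            have := h2 m ham
            gcongr
            linarith
        _ = _ := by field_simp
    have i2 : |ρ m| / (m * (m + 1)) ≤ P / (m * √m) := by
      calc _ ≤ (P * √m) / (m * m) := by
            have := h1 m ham
            gcongr
            linarith
        _ = _ := by
            rw [div_eq_div_iff (by positivity) (by positivity)]
            calc _ = P * (√m * √m) * m := by ring
              _ = _ := by rw [hss]; ring
    calc _ ≤ P / (m * √m) + P / (m * √m) := add_le_add i1 i2
      _ = _ := by ring

lemma BoundedSums.norm_sum_inv_tail_le {r : ℝ} {f : ℕ → ℂ} (hf : BoundedSums r f)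
    {a : ℕ} (ha : 1 ≤ a) (b : ℕ) :
    ‖∑ m ∈ Ico a b, f m * ((1 / m : ℝ) : ℂ)‖ ≤ 13 * r / a := by
  have ha' : (1 : ℝ) ≤ a := by exact_mod_cast ha
  have hsa : 0 < √(a : ℝ) := Real.sqrt_pos.mpr (by linarith)
  have := hf.norm_sum_div_tail_le (ρ := fun _ => 1) ha (P := 1 / √a) (fun m hm => ?_) (fun m hm => ?_) b
  · refine this.trans (le_of_eq ?_)
    have hss : √(a : ℝ) * √a = a := Real.mul_self_sqrt (by linarith)
    rw [mul_one_div, div_div, hss]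
  · have : √(a : ℝ) ≤ √m := Real.sqrt_le_sqrt (by exact_mod_cast hm)
    rw [abs_one, one_div_mul_eq_div, one_le_div hsa]; exact this
  · simp; positivity

lemma exists_one_add_log_pow_le (J : ℕ) :
    ∃ C : ℝ, 0 < C ∧ ∀ x : ℝ, 1 ≤ x → (1 + Real.log x) ^ J ≤ C * √x := by
  refine ⟨(2 * J + 2) ^ J, by positivity, fun x hx => ?_⟩
  rcases Nat.eq_zero_or_pos J with rfl | hJ
  · simpa using hx
  have hJ' : (0 : ℝ) < J := by exact_mod_cast hJ
  have hx0 : 0 ≤ x := by linarith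
  have hl := Real.log_le_rpow_div hx0 (ε := 1 / (2 * J)) (by positivity)
  have h1 : 1 ≤ x ^ (1 / (2 * J : ℝ)) := Real.one_le_rpow hx (by positivity)
  have hpow : (x ^ (1 / (2 * J : ℝ))) ^ J = √x := by
    rw [← Real.rpow_natCast, ← Real.rpow_mul hx0, Real.sqrt_eq_rpow]
    congr 1; field_simp
  calc _ ≤ ((2 * J + 2) * x ^ (1 / (2 * J : ℝ))) ^ J := by
        have : 0 ≤ Real.log x := Real.log_nonneg hx
        gcongr
        have : x ^ (1 / (2 * J : ℝ)) / (1 / (2 * J)) = 2 * J * x ^ (1 / (2 * J : ℝ)) := by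
          field_simp
        rw [this] at hl
        linarith
    _ = _ := by rw [mul_pow, hpow]

lemma sum_Ico_one_inv_le {b : ℕ} {x : ℝ} (hb : (b : ℝ) ≤ x) (hx : 1 ≤ x) :
    ∑ m ∈ Ico 1 b, 1 / (m : ℝ) ≤ 1 + Real.log x := by
  rcases Nat.eq_zero_or_pos b with rfl | hb0
  · simpa using add_nonneg zero_le_one (Real.log_nonneg hx)
  have h := harmonic_le_one_add_log b
  have hb1 : (1 : ℝ) ≤ b := by exact_mod_cast hb0
  have hl : Real.log b ≤ Real.log x := Real.log_le_log (by linarith) hb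
  refine le_trans ?_ (h.trans (by linarith))
  rw [harmonic_eq_sum_Icc]
  push_cast
  simp only [one_div]
  exact sum_le_sum_of_subset_of_nonneg (fun m hm => by simp at hm ⊢; omega)
    fun _ _ _ => by positivity

lemma exists_boundedSums_kernel_bound (J : ℕ) : ∃ C : ℝ, 1 ≤ C ∧ ∀ (r : ℝ) (f : ℕ → ℂ), 1 ≤ r →
    BoundedSums r f → ∀ (K : ℝ) (ρ : ℕ → ℝ), 0 ≤ K →
    (∀ m : ℕ, 1 ≤ m → |ρ m| ≤ K * (1 + Real.log m) ^ J) →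
    (∀ m : ℕ, 1 ≤ m → |ρ (m + 1) - ρ m| ≤ K * (1 + Real.log (m + 1)) ^ J / m) →
    ∀ M : ℕ, ‖∑ m ∈ Ico 1 M, f m * ((ρ m / m : ℝ) : ℂ)‖ ≤ C * K * (1 + Real.log r) ^ (J + 1) := by
  obtain ⟨C, hC, hlog⟩ := exists_one_add_log_pow_le J
  refine ⟨2 ^ (J + 1) + 26 * C, by
    have : (1 : ℝ) ≤ 2 ^ (J + 1) := one_le_pow₀ (by norm_num)
    linarith, fun r f hr hf K ρ hK h1 h2 M => ?_⟩
  set a := ⌈r ^ 2⌉₊ with ha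
  have hr2 : 1 ≤ r ^ 2 := one_le_pow₀ hr
  have ha1 : 1 ≤ a := Nat.one_le_ceil_iff.mpr (by linarith)
  have har : r ^ 2 ≤ a := Nat.le_ceil _
  have har2 : (a : ℝ) ≤ 2 * r ^ 2 := by
    have := Nat.ceil_lt_add_one (by linarith : 0 ≤ r ^ 2)
    linarith
  have hlr : 0 ≤ Real.log r := Real.log_nonneg hr
  have hla : 1 + Real.log (2 * r ^ 2) ≤ 2 * (1 + Real.log r) := by
    rw [Real.log_mul (by norm_num) (by positivity), Real.log_pow]
    have := Real.log_two_lt_d9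
    push_cast; linarith
  have hhead : ∀ b : ℕ, b ≤ a → ‖∑ m ∈ Ico 1 b, f m * ((ρ m / m : ℝ) : ℂ)‖ ≤
      2 ^ (J + 1) * K * (1 + Real.log r) ^ (J + 1) := by
    intro b hb
    have hb' : (b : ℝ) ≤ 2 * r ^ 2 := le_trans (by exact_mod_cast hb) har2
    calc _ ≤ ∑ m ∈ Ico 1 b, K * (2 * (1 + Real.log r)) ^ J * (1 / (m : ℝ)) := by
          refine norm_sum_le_of_le _ fun m hm => ?_
          obtain ⟨hm1, hmb⟩ := mem_Ico.mp hm
          have hm1' : (1 : ℝ) ≤ m := by exact_mod_cast hm1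
          have hm2 : (m : ℝ) ≤ 2 * r ^ 2 := le_trans (by exact_mod_cast hmb.le) hb'
          rw [norm_mul, Complex.norm_real, Real.norm_eq_abs, abs_div,
            abs_of_pos (by linarith : (0 : ℝ) < m), mul_one_div]
          have hlm : 0 ≤ Real.log m := Real.log_nonneg hm1'
          have : Real.log m ≤ Real.log (2 * r ^ 2) := Real.log_le_log (by linarith) hm2
          calc _ ≤ 1 * (|ρ m| / m) := by gcongr; exact hf.1 m
            _ = |ρ m| / m := one_mul _
            _ ≤ K * (1 + Real.log m) ^ J / m := by gcongr; exact h1 m hm1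
            _ ≤ _ := by gcongr; linarith
      _ ≤ K * (2 * (1 + Real.log r)) ^ J * (2 * (1 + Real.log r)) := by
          rw [← mul_sum]
          gcongr
          exact (sum_Ico_one_inv_le hb' (by linarith)).trans hla
      _ = _ := by rw [mul_pow]; ring
  have hone : (1 : ℝ) ≤ (1 + Real.log r) ^ (J + 1) := one_le_pow₀ (by linarith)
  rcases le_total M a with hMa | hMa
  · refine (hhead M hMa).trans ?_
    have : 0 ≤ 26 * C * (K * (1 + Real.log r) ^ (J + 1)) := by positivity
    nlinarith
  rw [← sum_Ico_consecutive _ ha1 hMa]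
  refine (norm_add_le _ _).trans ?_
  have htail := hf.norm_sum_div_tail_le (ρ := ρ) ha1 (P := 2 * C * K) (fun m hm => ?_)
    (fun m hm => ?_) M
  · have hsr : r ≤ √(a : ℝ) := Real.le_sqrt_of_sq_le har
    have : 13 * r * (2 * C * K) / √(a : ℝ) ≤ 26 * C * K := by
      rw [div_le_iff₀ (by linarith)]
      have : 26 * C * K * r ≤ 26 * C * K * √(a : ℝ) := by gcongr
      linarith
    have h3 := htail.trans this
    have h4 := hhead a le_rfl
    have h5 : 26 * C * K * 1 ≤ 26 * C * K * (1 + Real.log r) ^ (J + 1) := by gcongr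
    nlinarith
  · have hm1 : (1 : ℝ) ≤ m := by exact_mod_cast ha1.trans hm
    refine (h1 m (ha1.trans hm)).trans ?_
    have := hlog m hm1
    have h0 : 0 ≤ C * √(m : ℝ) := by positivity
    calc _ ≤ K * (C * √m) := by gcongr
      _ ≤ _ := by nlinarith
  · have hm1 : (1 : ℝ) ≤ m := by exact_mod_cast ha1.trans hm
    refine (h2 m (ha1.trans hm)).trans ?_
    have h3 := hlog (m + 1) (by linarith)
    have hs : 0 < √(m : ℝ) := Real.sqrt_pos.mpr (by linarith)
    have h4 : √((m : ℝ) + 1) ≤ 2 * √m := by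
      rw [Real.sqrt_le_left (by positivity), mul_pow, Real.sq_sqrt (by linarith)]; linarith
    have hss : √(m : ℝ) * √m = m := Real.mul_self_sqrt (by linarith)
    calc _ ≤ K * (C * (2 * √m)) / m := by
          gcongr
          exact h3.trans (by gcongr)
      _ = 2 * C * K * √m / (√m * √m) := by rw [hss]; ring
      _ = _ := by field_simp

open Topology

lemma sum_Ico_dirichletCharacter_eq_zero {n : ℕ} [NeZero n] {χ : DirichletCharacter ℂ n}
    (hχ : χ ≠ 1) (a : ℕ) : ∑ m ∈ Ico a (a + n), χ m = 0 := by
  induction a with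
  | zero =>
    rw [zero_add, Nat.Ico_zero_eq_range, ← MulChar.sum_eq_zero_of_ne_one hχ]
    refine sum_nbij' (fun m => (m : ZMod n)) (fun x => x.val) (fun _ _ => mem_univ _)
      (fun x _ => mem_range.mpr x.val_lt) (fun m hm => ZMod.val_cast_of_lt (mem_range.mp hm))
      (fun x _ => ZMod.natCast_zmod_val x) (fun _ _ => rfl)
  | succ a ih =>
    have h1 : ∑ m ∈ Ico a (a + n + 1), χ m = χ (a + n : ℕ) := by
      rw [sum_Ico_succ_top (by omega), ih, zero_add]
    rw [sum_eq_sum_Ico_succ_bot (by omega)] at h1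
    have h2 : a + n + 1 = a + 1 + n := by ring
    rw [← h2]
    have h3 : χ (a + n : ℕ) = χ (a : ZMod n) := by congr 1; simp
    rw [h3] at h1
    simpa using h1

lemma boundedSums_dirichletCharacter {n : ℕ} [NeZero n] {χ : DirichletCharacter ℂ n}
    (hχ : χ ≠ 1) : BoundedSums n (fun m => χ m) := by
  refine ⟨fun m => χ.norm_le_one _, fun a b => ?_⟩
  induction h : b - a using Nat.strong_induction_on generalizing a with
  | _ d ih =>
    rcases le_or_gt d n with hd | hd
    · refine (norm_sum_le_of_le _ fun m _ => χ.norm_le_one _).trans ?_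
      simp [h, hd]
    · have hn : 0 < n := Nat.pos_of_ne_zero (NeZero.ne n)
      rw [← sum_Ico_consecutive _ (by omega : a ≤ a + n) (by omega : a + n ≤ b),
        sum_Ico_dirichletCharacter_eq_zero hχ, zero_add]
      exact ih (b - (a + n)) (by omega) (a + n) rfl

/-- The value at `1` of the Dirichlet series of `f`, summed in order. -/
noncomputable def seriesAtOne (f : ℕ → ℂ) : ℂ :=
  limUnder atTop fun M : ℕ => ∑ m ∈ Ico 1 M, f m * ((1 / m : ℝ) : ℂ)

lemma BoundedSums.tendsto_seriesAtOne {r : ℝ} {f : ℕ → ℂ} (hf : BoundedSums r f) :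
    Tendsto (fun M : ℕ => ∑ m ∈ Ico 1 M, f m * ((1 / m : ℝ) : ℂ)) atTop (𝓝 (seriesAtOne f)) := by
  refine tendsto_nhds_limUnder (cauchySeq_tendsto_of_complete
    (Metric.cauchySeq_iff'.mpr fun ε hε => ?_))
  have hr := hf.nonneg
  refine ⟨⌈13 * r / ε⌉₊ + 1, fun n hn => ?_⟩
  rw [dist_eq_norm, ← sum_Ico_consecutive _ (by omega : 1 ≤ ⌈13 * r / ε⌉₊ + 1) hn,
    add_sub_cancel_left]
  refine (hf.norm_sum_inv_tail_le (by omega) n).trans_lt ?_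
  have := Nat.le_ceil (13 * r / ε)
  rw [div_lt_iff₀ (by positivity)]
  rw [div_le_iff₀ hε] at this
  push_cast; nlinarith

lemma rpow_neg_sub_rpow_neg_succ_le {m : ℕ} (hm : 1 ≤ m) {η : ℝ} (hη : 0 ≤ η) :
    (m : ℝ) ^ (-η) - ((m + 1 : ℕ) : ℝ) ^ (-η) ≤ η / m := by
  have hm1 : (1 : ℝ) ≤ m := by exact_mod_cast hm
  have hm0 : (0 : ℝ) < m := by linarith
  have e : ((m + 1 : ℕ) : ℝ) ^ (-η) = (m : ℝ) ^ (-η) * Real.exp (-η * Real.log (1 + 1 / m)) := by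
    have : ((m + 1 : ℕ) : ℝ) = m * (1 + 1 / m) := by push_cast; field_simp
    rw [this, Real.mul_rpow hm0.le (by positivity), Real.rpow_def_of_pos (by positivity : (0 : ℝ) <
      1 + 1 / m)]
    ring_nf
  have h1 := Real.add_one_le_exp (-η * Real.log (1 + 1 / m))
  have h2 : Real.log (1 + 1 / m) ≤ 1 / m := by
    have := Real.log_le_sub_one_of_pos (by positivity : (0 : ℝ) < 1 + 1 / m)
    linarith
  have h3 : (m : ℝ) ^ (-η) ≤ 1 := Real.rpow_le_one_of_one_le_of_nonpos hm1 (by linarith)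
  have h4 : 0 ≤ (m : ℝ) ^ (-η) := by positivity
  have hl : 0 ≤ Real.log (1 + 1 / m) := Real.log_nonneg (by
    have : (0:ℝ) ≤ 1 / m := by positivity
    linarith)
  rw [e]
  calc _ = (m : ℝ) ^ (-η) * (1 - Real.exp (-η * Real.log (1 + 1 / m))) := by ring
    _ ≤ (m : ℝ) ^ (-η) * (η * Real.log (1 + 1 / m)) := by gcongr; linarith
    _ ≤ 1 * (η * (1 / m)) := by gcongr
    _ = _ := by ring

lemma le_rpow_neg_sub_rpow_neg_succ {m : ℕ} (hm : 1 ≤ m) {η : ℝ} (hη : 0 < η) (hη1 : η ≤ 1) :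
    (m : ℝ) ^ (-η) / m ≤ 4 / η * ((m : ℝ) ^ (-η) - ((m + 1 : ℕ) : ℝ) ^ (-η)) := by
  have hm1 : (1 : ℝ) ≤ m := by exact_mod_cast hm
  have hm0 : (0 : ℝ) < m := by linarith
  have hpos : 0 < (m : ℝ) ^ (-η) := by positivity
  have hpos' : 0 < ((m + 1 : ℕ) : ℝ) ^ (-η) := by positivity
  have e : (m : ℝ) ^ (-η) = ((m + 1 : ℕ) : ℝ) ^ (-η) * Real.exp (η * Real.log (1 + 1 / m)) := by
    have : ((m + 1 : ℕ) : ℝ) = m * (1 + 1 / m) := by push_cast; field_simp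
    rw [this, Real.mul_rpow hm0.le (by positivity), Real.rpow_def_of_pos (by positivity : (0 : ℝ) <
      1 + 1 / m), mul_assoc, ← Real.exp_add]
    ring_nf; simp
  have h1 := Real.add_one_le_exp (η * Real.log (1 + 1 / m))
  have h2 : 1 / (m + 1 : ℝ) ≤ Real.log (1 + 1 / m) := by
    have := Real.one_sub_inv_le_log_of_pos (by positivity : (0 : ℝ) < 1 + 1 / m)
    refine le_trans (le_of_eq ?_) this
    field_simp; ring
  have h3 : η / (m + 1) ≤ η * Real.log (1 + 1 / m) := by
    rw [← mul_one_div]; gcongr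
  have h4 : ((m + 1 : ℕ) : ℝ) ^ (-η) * (η / (m + 1)) ≤
      (m : ℝ) ^ (-η) - ((m + 1 : ℕ) : ℝ) ^ (-η) := by
    rw [e]
    have := mul_le_mul_of_nonneg_left (h3.trans (by linarith :
      η * Real.log (1 + 1 / m) ≤ Real.exp (η * Real.log (1 + 1 / m)) - 1)) hpos'.le
    linarith
  have h5 : (m : ℝ) ^ (-η) ≤ 2 * ((m + 1 : ℕ) : ℝ) ^ (-η) := by
    have a1 : Real.log (1 + 1 / m) ≤ Real.log 2 := by
      refine Real.log_le_log (by positivity) ?_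
      have : 1 / (m : ℝ) ≤ 1 := by rw [div_le_one hm0]; exact hm1
      linarith
    have a2 : Real.exp (η * Real.log (1 + 1 / m)) ≤ 2 := by
      rw [← Real.exp_log (by norm_num : (0 : ℝ) < 2)]
      refine Real.exp_le_exp.mpr ?_
      have : 0 ≤ Real.log (1 + 1 / m) := h2.trans' (by positivity)
      nlinarith
    rw [e]; nlinarith
  have h6 : (m : ℝ) ^ (-η) / m ≤ 4 / η * (((m + 1 : ℕ) : ℝ) ^ (-η) * (η / (m + 1))) := by
    have e2 : 4 / η * (((m + 1 : ℕ) : ℝ) ^ (-η) * (η / (m + 1))) =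
      4 * ((m + 1 : ℕ) : ℝ) ^ (-η) / (m + 1) := by field_simp
    rw [e2, div_le_div_iff₀ hm0 (by positivity)]
    nlinarith
  exact h6.trans (by gcongr)

lemma sum_Ico_rpow_neg_le {η : ℝ} (hη : 0 < η) (hη1 : η ≤ 1) (M : ℕ) :
    ∑ m ∈ Ico 1 M, (m : ℝ) ^ (-η) / m ≤ 4 / η := by
  rcases Nat.eq_zero_or_pos M with rfl | hM
  · simp; positivity
  calc _ ≤ ∑ m ∈ Ico 1 M, 4 / η * ((m : ℝ) ^ (-η) - ((m + 1 : ℕ) : ℝ) ^ (-η)) :=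
        sum_le_sum fun m hm => le_rpow_neg_sub_rpow_neg_succ (mem_Ico.mp hm).1 hη hη1
    _ = 4 / η * (1 - (M : ℝ) ^ (-η)) := by
        rw [← mul_sum]; congr 1
        have := sum_Ico_sub (fun m : ℕ => -(m : ℝ) ^ (-η)) hM
        simp only [neg_sub_neg] at this
        rw [this]; simp
    _ ≤ 4 / η * 1 := by
        have : 0 ≤ (M : ℝ) ^ (-η) := by positivity
        gcongr; linarith
    _ = _ := mul_one _

lemma tendsto_sum_LSeries_one_add {f : ℕ → ℂ} (hf : ∀ n, ‖f n‖ ≤ 1) {η : ℝ} (hη : 0 < η) :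
    Tendsto (fun M : ℕ => ∑ m ∈ Ico 1 M, f m * (((m : ℝ) ^ (-η) / m : ℝ) : ℂ)) atTop
      (𝓝 (LSeries f (1 + η))) := by
  have hs : LSeriesSummable f (1 + (η : ℂ)) :=
    LSeriesSummable_of_bounded_of_one_lt_re (m := 1) (fun n _ => hf n) (by simpa using hη)
  refine (hs.hasSum.tendsto_sum_nat).congr fun M => ?_
  rcases Nat.eq_zero_or_pos M with rfl | hM
  · simp
  rw [← Nat.Ico_zero_eq_range, sum_eq_sum_Ico_succ_bot hM]
  simp only [LSeries.term_zero, zero_add]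
  refine sum_congr rfl fun m hm => ?_
  have hm1 : m ≠ 0 := by have := (mem_Ico.mp hm).1; omega
  have hm0 : (0 : ℝ) < m := by exact_mod_cast Nat.pos_of_ne_zero hm1
  rw [LSeries.term_of_ne_zero hm1, div_eq_mul_inv]
  congr 1
  have : (m : ℝ) ^ (-η) / m = ((m : ℝ) ^ (1 + η))⁻¹ := by
    rw [Real.rpow_add hm0, Real.rpow_one, Real.rpow_neg hm0.le, mul_inv]; field_simp
  rw [this]; push_cast
  rw [Complex.ofReal_cpow hm0.le]; simp

lemma norm_LSeries_one_add_le {f : ℕ → ℂ} (hf : ∀ n, ‖f n‖ ≤ 1) {η : ℝ} (hη : 0 < η)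
    (hη1 : η ≤ 1) : ‖LSeries f (1 + η)‖ ≤ 4 / η := by
  refine le_of_tendsto (tendsto_sum_LSeries_one_add hf hη).norm (Eventually.of_forall fun M => ?_)
  refine le_trans (norm_sum_le_of_le _ fun m _ => ?_) (sum_Ico_rpow_neg_le hη hη1 M)
  rw [norm_mul, Complex.norm_real, Real.norm_of_nonneg (by positivity)]
  exact mul_le_of_le_one_left (by positivity) (hf m)

lemma exists_LSeries_near_one_bound : ∃ C : ℝ, 1 ≤ C ∧ ∀ (r : ℝ) (f : ℕ → ℂ), 1 ≤ r →
    BoundedSums r f → ∀ η : ℝ, 0 < η → η ≤ 1 →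
      ‖LSeries f (1 + η)‖ ≤ C * (1 + Real.log r) ∧
      ‖seriesAtOne f - LSeries f (1 + η)‖ ≤ C * η * (1 + Real.log r) ^ 2 := by
  obtain ⟨C₀, h₀, hC₀⟩ := exists_boundedSums_kernel_bound 0
  obtain ⟨C₁, h₁, hC₁⟩ := exists_boundedSums_kernel_bound 1
  refine ⟨C₀ + C₁, by linarith, fun r f hr hf η hη hη1 => ?_⟩
  have hl : 0 ≤ Real.log r := Real.log_nonneg hr
  have mono : ∀ m : ℕ, 1 ≤ m → ((m + 1 : ℕ) : ℝ) ^ (-η) ≤ (m : ℝ) ^ (-η) := fun m hm =>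
    Real.rpow_le_rpow_of_nonpos (by exact_mod_cast hm) (by push_cast; linarith) (by linarith)
  constructor
  · have : ‖LSeries f (1 + η)‖ ≤ C₀ * 1 * (1 + Real.log r) ^ (0 + 1) := by
      refine le_of_tendsto (tendsto_sum_LSeries_one_add hf.1 hη).norm
        (Eventually.of_forall fun M => ?_)
      refine hC₀ r f hr hf 1 (fun m => (m : ℝ) ^ (-η)) zero_le_one (fun m hm => ?_)
        (fun m hm => ?_) M
      · rw [abs_of_nonneg (by positivity)]
        simpa using Real.rpow_le_one_of_one_le_of_nonpos (by exact_mod_cast hm) (by linarith)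
      · rw [abs_sub_comm, abs_of_nonneg (by linarith [mono m hm])]
        refine (rpow_neg_sub_rpow_neg_succ_le hm hη.le).trans ?_
        simp only [pow_zero, mul_one]
        gcongr
    simp only [zero_add, pow_one, mul_one] at this
    nlinarith
  · have : ‖seriesAtOne f - LSeries f (1 + η)‖ ≤ C₁ * η * (1 + Real.log r) ^ (1 + 1) := by
      refine le_of_tendsto (hf.tendsto_seriesAtOne.sub
        (tendsto_sum_LSeries_one_add hf.1 hη)).norm (Eventually.of_forall fun M => ?_)
      rw [← sum_sub_distrib]
      have e : ∀ m ∈ Ico 1 M, f m * ((1 / m : ℝ) : ℂ) - f m * (((m : ℝ) ^ (-η) / m : ℝ) : ℂ) =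
          f m * (((1 - (m : ℝ) ^ (-η)) / m : ℝ) : ℂ) := fun m _ => by push_cast; ring
      rw [sum_congr rfl e]
      refine hC₁ r f hr hf η (fun m => 1 - (m : ℝ) ^ (-η)) hη.le (fun m hm => ?_)
        (fun m hm => ?_) M
      · have hm1 : (1 : ℝ) ≤ m := by exact_mod_cast hm
        have h2 : (m : ℝ) ^ (-η) ≤ 1 := Real.rpow_le_one_of_one_le_of_nonpos hm1 (by linarith)
        have h3 : 1 - η * Real.log m ≤ (m : ℝ) ^ (-η) := by
          rw [Real.rpow_def_of_pos (by linarith)]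
          have := Real.add_one_le_exp (Real.log m * -η)
          linarith
        rw [abs_of_nonneg (by linarith), pow_one]
        linarith
      · have hm1 : (1 : ℝ) ≤ m := by exact_mod_cast hm
        rw [sub_sub_sub_cancel_left, abs_of_nonneg (by linarith [mono m hm])]
        refine (rpow_neg_sub_rpow_neg_succ_le hm hη.le).trans ?_
        have : 0 ≤ Real.log ((m : ℝ) + 1) := Real.log_nonneg (by linarith)
        gcongr
        rw [pow_one]; nlinarith
    refine this.trans ?_
    norm_num
    have : 0 ≤ η * (1 + Real.log r) ^ 2 := by positivity
    nlinarith

open ComplexConjugate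

/-- The values on `ℕ` of a nontrivial primitive Dirichlet character of conductor `r`. -/
def IsPrimitiveSeq (r : ℕ) (f : ℕ → ℂ) : Prop :=
  0 < r ∧ ∃ χ : DirichletCharacter ℂ r, χ.IsPrimitive ∧ χ ≠ 1 ∧ ∀ n : ℕ, f n = χ n

lemma changeLevel_natCast {n m : ℕ} (χ : DirichletCharacter ℂ n) (hm : n ∣ m) {a : ℕ}
    (ha : a.Coprime m) : DirichletCharacter.changeLevel hm χ a = χ a := by
  have := χ.changeLevel_eq_cast_of_dvd' hm (a := (a : ℤ)) (Nat.isCoprime_iff_coprime.mpr ha)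
  simpa using this

lemma dirichletCharacter_natCast_eq_zero {n : ℕ} (χ : DirichletCharacter ℂ n) {a : ℕ}
    (ha : ¬ a.Coprime n) : χ a = 0 :=
  χ.map_nonunit (by rwa [ZMod.isUnit_iff_coprime])

lemma eq_of_changeLevel_eq {n m : ℕ} (hn : 0 < n) (hm : 0 < m) {χ : DirichletCharacter ℂ n}
    {ψ : DirichletCharacter ℂ m} (hχ : χ.IsPrimitive) (hψ : ψ.IsPrimitive)
    (h : χ.changeLevel (n.dvd_mul_right m) = ψ.changeLevel (m.dvd_mul_left n)) :
    ∃ e : n = m, e ▸ χ = ψ := by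
  have : NeZero n := ⟨hn.ne'⟩
  have : NeZero m := ⟨hm.ne'⟩
  have h1 : n ≤ n.gcd m := by
    have := Nat.sInf_le (show n.gcd m ∈ χ.conductorSet from χ.factorsThrough_gcd ψ h)
    rwa [show sInf _ = n from hχ] at this
  have hnm : n ∣ m := by
    have h2 := Nat.le_of_dvd hn (Nat.gcd_dvd_left n m)
    have h3 : n.gcd m = n := le_antisymm h2 h1
    exact Nat.gcd_eq_left_iff_dvd.mp h3
  have h4 : χ.changeLevel hnm = ψ := by
    apply DirichletCharacter.changeLevel_injective (m.dvd_mul_left n)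
    rw [← h, ← DirichletCharacter.changeLevel_trans]
  have h5 : m ≤ n := by
    have := Nat.sInf_le (show n ∈ ψ.conductorSet from ⟨hnm, χ, h4.symm⟩)
    rwa [show sInf _ = m from hψ] at this
  have e : n = m := le_antisymm (Nat.le_of_dvd hm hnm) h5
  refine ⟨e, ?_⟩
  subst e
  rw [← h4, DirichletCharacter.changeLevel_self]

lemma IsPrimitiveSeq.mul_conj {r s : ℕ} {f g : ℕ → ℂ} (hf : IsPrimitiveSeq r f)
    (hg : IsPrimitiveSeq s g) (hfg : f ≠ g) : ∃ ψ : DirichletCharacter ℂ (r * s), ψ ≠ 1 ∧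
      ∀ n : ℕ, f n * conj (g n) = ψ n := by
  obtain ⟨hr, χ, hχ, -, hfχ⟩ := hf
  obtain ⟨hs, φ, hφ, -, hgφ⟩ := hg
  refine ⟨χ.changeLevel (r.dvd_mul_right s) * (φ.changeLevel (s.dvd_mul_left r))⁻¹, ?_, ?_⟩
  · intro h
    rw [mul_inv_eq_one] at h
    obtain ⟨e, h'⟩ := eq_of_changeLevel_eq hr hs hχ hφ h
    subst e
    exact hfg (funext fun n => by rw [hfχ, hgφ, ← h'])
  · intro n
    rw [hfχ, hgφ]
    by_cases hn : n.Coprime (r * s)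
    · rw [MulChar.mul_apply, changeLevel_natCast _ _ hn, ← MulChar.star_eq_inv, MulChar.star_apply,
        changeLevel_natCast _ _ hn]
      rfl
    · rw [dirichletCharacter_natCast_eq_zero _ hn]
      rw [Nat.coprime_mul_iff_right, not_and_or] at hn
      rcases hn with hn | hn
      · rw [dirichletCharacter_natCast_eq_zero _ hn, zero_mul]
      · rw [dirichletCharacter_natCast_eq_zero φ hn, map_zero, mul_zero]

lemma IsPrimitiveSeq.eq_left {r s : ℕ} {f : ℕ → ℂ} (hf : IsPrimitiveSeq r f)
    (hg : IsPrimitiveSeq s f) : r = s := by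
  obtain ⟨hr, χ, hχ, -, hfχ⟩ := hf
  obtain ⟨hs, φ, hφ, -, hgφ⟩ := hg
  have : NeZero (r * s) := ⟨(Nat.mul_pos hr hs).ne'⟩
  have h : χ.changeLevel (r.dvd_mul_right s) = φ.changeLevel (s.dvd_mul_left r) := by
    refine MulChar.ext fun a => ?_
    have e : (a : ZMod (r * s)) = ((a : ZMod (r * s)).val : ℕ) := (ZMod.natCast_zmod_val _).symm
    have hc : (a : ZMod (r * s)).val.Coprime (r * s) := ZMod.val_coe_unit_coprime a
    rw [e, changeLevel_natCast _ _ hc, changeLevel_natCast _ _ hc, ← hfχ, ← hgφ]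
  exact (eq_of_changeLevel_eq hr hs hχ hφ h).1

lemma IsPrimitiveSeq.boundedSums {r : ℕ} {f : ℕ → ℂ} (hf : IsPrimitiveSeq r f) :
    BoundedSums r f := by
  obtain ⟨hr, χ, -, hχ, hfχ⟩ := hf
  have : NeZero r := ⟨hr.ne'⟩
  rw [show f = fun n : ℕ => χ n from funext hfχ]
  exact boundedSums_dirichletCharacter hχ

lemma IsPrimitiveSeq.boundedSums_mul_conj {r s : ℕ} {f g : ℕ → ℂ} (hf : IsPrimitiveSeq r f)
    (hg : IsPrimitiveSeq s g) (hfg : f ≠ g) :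
    BoundedSums (r * s) (fun n => f n * conj (g n)) := by
  obtain ⟨ψ, hψ, h⟩ := hf.mul_conj hg hfg
  have : NeZero (r * s) := ⟨(Nat.mul_pos hf.1 hg.1).ne'⟩
  rw [show (fun n => f n * conj (g n)) = fun n : ℕ => ψ n from funext h]
  exact_mod_cast boundedSums_dirichletCharacter hψ

lemma IsPrimitiveSeq.map_mul {r : ℕ} {f : ℕ → ℂ} (hf : IsPrimitiveSeq r f) (a b : ℕ) :
    f (a * b) = f a * f b := by
  obtain ⟨-, χ, -, -, h⟩ := hf
  simp [h]

lemma IsPrimitiveSeq.seriesAtOne_ne_zero {r : ℕ} {f : ℕ → ℂ} (hf : IsPrimitiveSeq r f) :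
    seriesAtOne f ≠ 0 := by
  have hb := hf.boundedSums
  obtain ⟨hr, χ, -, hχ, hfχ⟩ := hf
  have : NeZero r := ⟨hr.ne'⟩
  have hr1 : (1 : ℝ) ≤ r := by exact_mod_cast hr
  obtain ⟨C, hC, h⟩ := exists_LSeries_near_one_bound
  intro h0
  refine DirichletCharacter.LFunction_apply_one_ne_zero hχ ?_
  set u : ℕ → ℝ := fun n => 1 / ((n : ℝ) + 1) with hu
  have hu0 : Tendsto u atTop (𝓝 0) := tendsto_one_div_add_atTop_nhds_zero_nat
  have hcont : Tendsto (fun n => DirichletCharacter.LFunction χ (1 + (u n : ℂ))) atTop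
      (𝓝 (DirichletCharacter.LFunction χ 1)) := by
    have h1 := (DirichletCharacter.differentiable_LFunction hχ).continuous.tendsto 1
    refine h1.comp ?_
    have : Tendsto (fun n => (u n : ℂ)) atTop (𝓝 ((0 : ℝ) : ℂ)) :=
      (Complex.continuous_ofReal.tendsto 0).comp hu0
    simpa using this.const_add 1
  refine tendsto_nhds_unique hcont (squeeze_zero_norm (a := fun n => C * u n * (1 + Real.log r) ^ 2)
    (fun n => ?_) ?_)
  · have hun : 0 < u n := by positivity
    have hun1 : u n ≤ 1 := by
      rw [hu]; simp only
      rw [div_le_one (by positivity)]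
      have : (0 : ℝ) ≤ n := by positivity
      linarith
    have := (h r f hr1 hb (u n) hun hun1).2
    rw [h0, zero_sub, norm_neg] at this
    rwa [DirichletCharacter.LFunction_eq_LSeries χ (by simpa using hun),
      show (fun n : ℕ => χ n) = f from (funext hfχ).symm]
  · simpa using (hu0.const_mul C).mul_const ((1 + Real.log r) ^ 2)

lemma one_le_log_add (r : ℕ) : 1 ≤ 1 + Real.log r := by
  have := Real.log_natCast_nonneg r
  linarith

lemma exists_seriesAtOne_lower_bound_complex : ∃ c : ℝ, 0 < c ∧ ∀ (r : ℕ) (f : ℕ → ℂ),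
    IsPrimitiveSeq r f → (∃ n, conj (f n) ≠ f n) →
    c / (1 + Real.log r) ^ 7 ≤ ‖seriesAtOne f‖ := by
  obtain ⟨C, hC, h⟩ := exists_LSeries_near_one_bound
  set a : ℝ := 1 / (2 ^ 11 * C ^ 5) with ha
  have hC0 : 0 < C := by linarith
  refine ⟨C * a, by positivity, fun r f hf hne => ?_⟩
  have hb := hf.boundedSums
  obtain ⟨hr, χ, hprim, hχ, hfχ⟩ := hf
  have : NeZero r := ⟨hr.ne'⟩
  have hr1 : (1 : ℝ) ≤ r := by exact_mod_cast hr
  set l := 1 + Real.log r with hl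
  have hl1 : 1 ≤ l := one_le_log_add r
  have hχ2 : χ ^ 2 ≠ 1 := by
    intro h2
    obtain ⟨n, hn⟩ := hne
    apply hn
    rw [hfχ]
    have h3 : χ⁻¹ = χ := by rw [inv_eq_iff_mul_eq_one, ← sq, h2]
    have h4 : star χ (n : ZMod r) = χ n := by rw [MulChar.star_eq_inv, h3]
    rw [MulChar.star_apply] at h4
    exact h4
  set η := a / l ^ 9 with hη
  have hη0 : 0 < η := by positivity
  have ha1 : a ≤ 1 := by
    rw [ha, div_le_one (by positivity)]
    have : (1 : ℝ) ≤ C ^ 5 := one_le_pow₀ hC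
    linarith
  have hη1 : η ≤ 1 := by
    rw [hη, div_le_one (by positivity)]
    exact ha1.trans (one_le_pow₀ hl1)
  by_contra! hlt
  have hp := DirichletCharacter.norm_LSeries_product_ge_one χ hη0 0
  simp only [Complex.ofReal_zero, mul_zero, add_zero] at hp
  rw [norm_mul, norm_mul, norm_pow, norm_pow] at hp
  have b1 := norm_LSeries_one_add_le (f := fun n : ℕ => (1 : DirichletCharacter ℂ r) n)
    (fun n => DirichletCharacter.norm_le_one _ _) hη0 hη1
  have b3 := (h r (fun n : ℕ => (χ ^ 2 : DirichletCharacter ℂ r) n) hr1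
    (boundedSums_dirichletCharacter hχ2) η hη0 hη1).1
  have b2 : ‖LSeries (fun n : ℕ => χ n) (1 + η)‖ ≤ 2 * C * a / l ^ 7 := by
    have := (h r f hr1 hb η hη0 hη1).2
    rw [show (fun n : ℕ => χ n) = f from (funext hfχ).symm]
    have e : C * η * l ^ 2 = C * a / l ^ 7 := by rw [hη]; field_simp
    rw [e] at this
    have := norm_sub_norm_le (LSeries f (1 + η)) (seriesAtOne f)
    rw [norm_sub_rev] at this
    have : 2 * C * a / l ^ 7 = C * a / l ^ 7 + C * a / l ^ 7 := by ring
    linarith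
  have : (1 : ℝ) ≤ (4 / η) ^ 3 * (2 * C * a / l ^ 7) ^ 4 * (C * l) := by
    refine le_trans hp ?_
    gcongr
  have e : (4 / η) ^ 3 * (2 * C * a / l ^ 7) ^ 4 * (C * l) = 2 ^ 10 * C ^ 5 * a := by
    rw [hη]; field_simp; ring
  rw [e, ha] at this
  have e2 : 2 ^ 10 * C ^ 5 * (1 / (2 ^ 11 * C ^ 5)) = 1 / 2 := by field_simp
  rw [e2] at this
  norm_num at this

lemma norm_euler_factor_product_le_one {t : ℝ} (ht0 : 0 ≤ t) (ht1 : t < 1) {α β : ℂ}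
    (hα : α = 0 ∨ α = 1 ∨ α = -1) (hβ : β = 0 ∨ β = 1 ∨ β = -1) :
    ‖(1 - (t : ℂ))‖ * ‖1 - α * t‖ * ‖1 - β * t‖ * ‖1 - α * β * t‖ ≤ 1 := by
  have e1 : ‖(1 : ℂ) - t‖ = 1 - t := by
    rw [← Complex.ofReal_one, ← Complex.ofReal_sub, Complex.norm_real, Real.norm_of_nonneg]
    linarith
  have e2 : ‖(1 : ℂ) + t‖ = 1 + t := by
    rw [← Complex.ofReal_one, ← Complex.ofReal_add, Complex.norm_real, Real.norm_of_nonneg]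
    linarith
  have q1 : 0 ≤ 1 - t := by linarith
  have q2 : (1 - t) * (1 + t) ≤ 1 := by nlinarith
  have q3 : 0 ≤ (1 - t) * (1 + t) := by nlinarith
  rcases hα with rfl | rfl | rfl <;> rcases hβ with rfl | rfl | rfl <;>
    simp only [zero_mul, mul_zero, one_mul, mul_one, sub_zero, norm_one, neg_mul, mul_neg,
      sub_neg_eq_add, neg_neg, neg_zero, e1, e2] <;> nlinarith

lemma IsPrimitiveSeq.eq_zero_or_of_real {r : ℕ} {f : ℕ → ℂ} (hf : IsPrimitiveSeq r f) {n : ℕ}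
    (h : conj (f n) = f n) : f n = 0 ∨ f n = 1 ∨ f n = -1 := by
  obtain ⟨hr, χ, -, -, hfχ⟩ := hf
  by_cases hn : IsUnit (n : ZMod r)
  · right
    have h1 : ‖f n‖ = 1 := by
      obtain ⟨u, hu⟩ := hn
      rw [hfχ, ← hu]
      have : NeZero r := ⟨hr.ne'⟩
      exact χ.unit_norm_eq_one u
    have h2 : f n * f n = 1 := by
      have := Complex.mul_conj (f n)
      rw [h, Complex.normSq_eq_norm_sq, h1] at this
      simpa using this
    exact mul_self_eq_one_iff.mp h2
  · left; rw [hfχ]; exact χ.map_nonunit hn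

lemma one_le_norm_of_hasProd {ι : Type*} {u : ι → ℂ} {x : ℂ} (hu : HasProd u x)
    (h : ∀ i, 1 ≤ ‖u i‖) : 1 ≤ ‖x‖ := by
  refine ge_of_tendsto hu.norm (Eventually.of_forall fun s => ?_)
  exact one_le_prod (fun i _ => h i)

lemma one_le_norm_LSeries_product_real {r s : ℕ} {f g : ℕ → ℂ} (hf : IsPrimitiveSeq r f)
    (hg : IsPrimitiveSeq s g) (hfg : f ≠ g) (hfr : ∀ n, conj (f n) = f n)
    (hgr : ∀ n, conj (g n) = g n) {η : ℝ} (hη : 0 < η) :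
    1 ≤ ‖LSeries (fun _ => 1) (1 + η)‖ * ‖LSeries f (1 + η)‖ * ‖LSeries g (1 + η)‖ *
      ‖LSeries (fun n => f n * conj (g n)) (1 + η)‖ := by
  have hf' := hf
  have hg' := hg
  obtain ⟨ψ, -, hψ⟩ := hf.mul_conj hg hfg
  obtain ⟨hr, χ, -, -, hfχ⟩ := hf
  obtain ⟨hs, φ, -, -, hgφ⟩ := hg
  have hre : 1 < (1 + (η : ℂ)).re := by simpa using hη
  have p0 := riemannZeta_eulerProduct_hasProd hre
  rw [← LSeries_one_eq_riemannZeta hre] at p0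
  have p1 := χ.LSeries_eulerProduct_hasProd hre
  have p2 := φ.LSeries_eulerProduct_hasProd hre
  have p3 := ψ.LSeries_eulerProduct_hasProd hre
  rw [show (fun n : ℕ => χ n) = f from (funext hfχ).symm] at p1
  rw [show (fun n : ℕ => φ n) = g from (funext hgφ).symm] at p2
  rw [show (fun n : ℕ => ψ n) = fun n => f n * conj (g n) from (funext hψ).symm] at p3
  have := one_le_norm_of_hasProd (((p0.mul p1).mul p2).mul p3) fun p => ?_
  · rw [show (fun _ : ℕ => (1 : ℂ)) = 1 from rfl]
    simpa only [norm_mul] using this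
  · rw [← hfχ, ← hgφ, ← hψ, hgr]
    have hp2 : (2 : ℝ) ≤ (p : ℕ) := by exact_mod_cast p.2.two_le
    have hp0 : (0 : ℝ) ≤ (p : ℕ) := by linarith
    set t : ℝ := ((p : ℕ) : ℝ) ^ (-(1 + η)) with ht
    have e : ((p : ℕ) : ℂ) ^ (-(1 + (η : ℂ))) = t := by
      rw [ht, Complex.ofReal_cpow hp0]; push_cast; rfl
    rw [e, ← mul_inv, ← mul_inv, ← mul_inv, norm_inv]
    have ht0 : 0 ≤ t := by positivity
    have ht1 : t < 1 := Real.rpow_lt_one_of_one_lt_of_neg (by linarith) (by linarith)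
    have hα := hf'.eq_zero_or_of_real (hfr p)
    have hβ := hg'.eq_zero_or_of_real (hgr p)
    have hle := norm_euler_factor_product_le_one ht0 ht1 hα hβ
    rw [← norm_mul, ← norm_mul, ← norm_mul] at hle
    refine (one_le_inv₀ ?_).mpr hle
    have nz : ∀ z : ℂ, ‖z‖ ≤ 1 → 1 - z * t ≠ 0 := fun z hz h0 => by
      have : z * t = 1 := by linear_combination -h0
      have := congrArg norm this
      rw [norm_mul, Complex.norm_real, Real.norm_of_nonneg ht0, norm_one] at this
      nlinarith
    have hF := hf'.boundedSums.1 p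
    have hG := hg'.boundedSums.1 p
    refine norm_pos_iff.mpr (mul_ne_zero (mul_ne_zero (mul_ne_zero ?_ (nz _ hF)) (nz _ hG))
      (nz _ ?_))
    · simpa using nz 1 (by simp)
    · rw [norm_mul]; exact mul_le_one₀ hF (norm_nonneg _) hG

lemma exists_seriesAtOne_lower_bound_real : ∃ c : ℝ, 0 < c ∧ ∀ (H : ℝ) (r s : ℕ) (f g : ℕ → ℂ),
    IsPrimitiveSeq r f → IsPrimitiveSeq s g → f ≠ g → (∀ n, conj (f n) = f n) →
    (∀ n, conj (g n) = g n) → (r : ℝ) ≤ H → (s : ℝ) ≤ H →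
    c / (1 + Real.log H) ^ 3 ≤ ‖seriesAtOne f‖ ∨ c / (1 + Real.log H) ^ 3 ≤ ‖seriesAtOne g‖ := by
  obtain ⟨C, hC, h⟩ := exists_LSeries_near_one_bound
  have hC0 : 0 < C := by linarith
  set a : ℝ := 1 / (2 ^ 6 * C ^ 3) with ha
  refine ⟨C * a, by positivity, fun H r s f g hf hg hfg hfr hgr hrH hsH => ?_⟩
  have hr1 : (1 : ℝ) ≤ r := by exact_mod_cast hf.1
  have hs1 : (1 : ℝ) ≤ s := by exact_mod_cast hg.1
  have hlr : Real.log r ≤ Real.log H := Real.log_le_log (by linarith) hrH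
  have hls : Real.log s ≤ Real.log H := Real.log_le_log (by linarith) hsH
  have hlr0 := Real.log_nonneg hr1
  have hls0 := Real.log_nonneg hs1
  set l := 1 + Real.log H with hl
  have hl1 : 1 ≤ l := by linarith
  have ha1 : a ≤ 1 := by
    rw [ha, div_le_one (by positivity)]
    have : (1 : ℝ) ≤ C ^ 3 := one_le_pow₀ hC
    linarith
  set η := a / l ^ 5 with hη
  have hη0 : 0 < η := by positivity
  have hη1 : η ≤ 1 := by
    rw [hη, div_le_one (by positivity)]
    exact ha1.trans (one_le_pow₀ hl1)
  by_contra! hlt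
  have hp := one_le_norm_LSeries_product_real hf hg hfg hfr hgr hη0
  have b0 := norm_LSeries_one_add_le (f := fun _ => 1) (fun _ => by simp) hη0 hη1
  have b3 : ‖LSeries (fun n => f n * conj (g n)) (1 + η)‖ ≤ C * (2 * l) := by
    refine (h (r * s) _ (by nlinarith) (hf.boundedSums_mul_conj hg hfg) η hη0 hη1).1.trans ?_
    rw [Real.log_mul (by linarith) (by linarith)]
    gcongr; linarith
  have b : ∀ (k : ℕ) (F : ℕ → ℂ), IsPrimitiveSeq k F → (k : ℝ) ≤ H →
      ‖seriesAtOne F‖ < C * a / l ^ 3 → ‖LSeries F (1 + η)‖ ≤ 2 * C * a / l ^ 3 := by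
    intro k F hF hk hlt
    have hk1 : (1 : ℝ) ≤ k := by exact_mod_cast hF.1
    have h1 := (h k F hk1 hF.boundedSums η hη0 hη1).2
    have hlk : Real.log k ≤ Real.log H := Real.log_le_log (by linarith) hk
    have hlk0 := Real.log_nonneg hk1
    have h2 : ‖seriesAtOne F - LSeries F (1 + η)‖ ≤ C * η * l ^ 2 := by
      refine h1.trans ?_
      gcongr; linarith
    have e : C * η * l ^ 2 = C * a / l ^ 3 := by rw [hη]; field_simp
    rw [e] at h2
    have := norm_sub_norm_le (LSeries F (1 + η)) (seriesAtOne F)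
    rw [norm_sub_rev] at this
    have : 2 * C * a / l ^ 3 = C * a / l ^ 3 + C * a / l ^ 3 := by ring
    linarith
  have b1 := b r f hf hrH hlt.1
  have b2 := b s g hg hsH hlt.2
  have : (1 : ℝ) ≤ (4 / η) * (2 * C * a / l ^ 3) * (2 * C * a / l ^ 3) * (C * (2 * l)) := by
    refine le_trans hp ?_
    gcongr
  have e : (4 / η) * (2 * C * a / l ^ 3) * (2 * C * a / l ^ 3) * (C * (2 * l)) =
      2 ^ 5 * C ^ 3 * a := by
    rw [hη]; field_simp; ring
  rw [e, ha] at this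
  have e2 : 2 ^ 5 * C ^ 3 * (1 / (2 ^ 6 * C ^ 3)) = 1 / 2 := by field_simp
  rw [e2] at this
  norm_num at this

lemma exists_good_height : ∃ c : ℝ, 0 < c ∧ ∀ H₀ : ℝ, ∃ H ≥ H₀, 1 ≤ H ∧ ∀ (r : ℕ) (f : ℕ → ℂ),
    IsPrimitiveSeq r f → (r : ℝ) ≤ H → c / (1 + Real.log H) ^ 7 ≤ ‖seriesAtOne f‖ := by
  obtain ⟨c₁, h₁, hcomplex⟩ := exists_seriesAtOne_lower_bound_complex
  obtain ⟨c₂, h₂, hreal⟩ := exists_seriesAtOne_lower_bound_real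
  set c := min c₁ c₂ with hc
  have hc0 : 0 < c := lt_min h₁ h₂
  refine ⟨c, hc0, fun H₀ => ?_⟩
  set H' := max H₀ 1 with hH'
  have hH'1 : 1 ≤ H' := le_max_right _ _
  by_cases hall : ∀ (r : ℕ) (f : ℕ → ℂ), IsPrimitiveSeq r f → (r : ℝ) ≤ H' →
      c / (1 + Real.log H') ^ 7 ≤ ‖seriesAtOne f‖
  · exact ⟨H', le_max_left _ _, hH'1, hall⟩
  push Not at hall
  obtain ⟨s, g, hg, hsH, hlt⟩ := hall
  have hlH' : 1 ≤ 1 + Real.log H' := by have := Real.log_nonneg hH'1; linarith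
  have hgr : ∀ n, conj (g n) = g n := by
    by_contra! hne
    have h1 := hcomplex s g hg hne
    have hs1 : (1 : ℝ) ≤ s := by exact_mod_cast hg.1
    have hls : Real.log s ≤ Real.log H' := Real.log_le_log (by linarith) hsH
    have hls0 := Real.log_nonneg hs1
    have : c / (1 + Real.log H') ^ 7 ≤ c₁ / (1 + Real.log s) ^ 7 := by
      gcongr; exact min_le_left _ _
    linarith
  set δ := ‖seriesAtOne g‖ with hδ
  have hδ0 : 0 < δ := norm_pos_iff.mpr hg.seriesAtOne_ne_zero
  set l : ℝ := (c / δ) ^ (1 / 7 : ℝ) with hl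
  have hl7 : l ^ 7 = c / δ := by
    rw [hl, ← Real.rpow_natCast, ← Real.rpow_mul (by positivity)]; norm_num
  have hl0 : 0 < l := by positivity
  have hll : 1 + Real.log H' < l := by
    by_contra! hle
    have : l ^ 7 ≤ (1 + Real.log H') ^ 7 := pow_le_pow_left₀ hl0.le hle 7
    rw [hl7, div_le_iff₀ hδ0] at this
    rw [lt_div_iff₀ (by positivity)] at hlt
    linarith
  set H := Real.exp (l - 1) with hH
  have hlogH : 1 + Real.log H = l := by rw [hH, Real.log_exp]; ring
  have hHH' : H' ≤ H := by
    rw [hH, ← Real.log_le_iff_le_exp (by linarith)]; linarith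
  have hl1 : 1 < l := by linarith
  refine ⟨H, (le_max_left _ _).trans hHH', hH'1.trans hHH', fun r f hf hr => ?_⟩
  rw [hlogH, hl7]
  have hcδ : c / (c / δ) = δ := by field_simp
  rw [hcδ]
  by_cases hfr : ∀ n, conj (f n) = f n
  · by_cases hfg : f = g
    · rw [hfg]
    have hδl : δ = c / l ^ 7 := by rw [hl7, hcδ]
    have hlt3 : δ < c₂ / l ^ 3 := by
      rw [hδl]
      have h7 : l ^ 3 < l ^ 7 := pow_lt_pow_right₀ hl1 (by norm_num)
      calc c / l ^ 7 < c / l ^ 3 := by gcongr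
        _ ≤ _ := by gcongr; exact min_le_right _ _
    rcases hreal H r s f g hf hg hfg hfr hgr hr (hsH.trans hHH') with h | h
    · rw [hlogH] at h; linarith
    · rw [hlogH] at h; linarith
  · push Not at hfr
    have h1 := hcomplex r f hf hfr
    have hr1 : (1 : ℝ) ≤ r := by exact_mod_cast hf.1
    have hlr : Real.log r ≤ Real.log H := Real.log_le_log (by linarith) hr
    have hlr0 := Real.log_nonneg hr1
    refine le_trans ?_ h1
    have hδl : δ = c / l ^ 7 := by rw [hl7, hcδ]
    rw [hδl]
    gcongr
    · exact min_le_left _ _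
    · linarith

/-- A smooth bump supported in `[1, 2]` and equal to `1` on `[4/3, 5/3]`. -/
noncomputable def smoothBump : ContDiffBump (3 / 2 : ℝ) := ⟨1 / 6, 1 / 2, by norm_num, by norm_num⟩

/-- The `i`-th derivative of the rescaled bump `t ↦ smoothBump (t / L)`. -/
noncomputable def bumpWeight (i : ℕ) (L t : ℝ) : ℝ := iteratedDeriv i smoothBump (t / L) / L ^ i

lemma bumpWeight_zero_nonneg (L t : ℝ) : 0 ≤ bumpWeight 0 L t := by
  simp only [bumpWeight, iteratedDeriv_zero, pow_zero, div_one]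
  exact smoothBump.nonneg

lemma bumpWeight_zero_le_one (L t : ℝ) : bumpWeight 0 L t ≤ 1 := by
  simp only [bumpWeight, iteratedDeriv_zero, pow_zero, div_one]
  exact smoothBump.le_one

lemma bumpWeight_zero_eq_one {L t : ℝ} (hL : 0 < L) (h1 : 4 / 3 * L ≤ t) (h2 : t ≤ 5 / 3 * L) :
    bumpWeight 0 L t = 1 := by
  simp only [bumpWeight, iteratedDeriv_zero, pow_zero, div_one]
  apply smoothBump.one_of_mem_closedBall
  rw [Metric.mem_closedBall, Real.dist_eq, abs_le, show smoothBump.rIn = 1 / 6 from rfl]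
  have h3 : 4 / 3 ≤ t / L := by rwa [le_div_iff₀ hL]
  have h4 : t / L ≤ 5 / 3 := by rwa [div_le_iff₀ hL]
  constructor <;> linarith

lemma contDiff_smoothBump : ContDiff ℝ (⊤ : ℕ∞) smoothBump := smoothBump.contDiff

lemma tsupport_iteratedDeriv_smoothBump (i : ℕ) :
    tsupport (iteratedDeriv i smoothBump) ⊆ Metric.closedBall (3 / 2 : ℝ) (1 / 2) := by
  induction i with
  | zero => rw [iteratedDeriv_zero, smoothBump.tsupport_eq]; rfl
  | succ i ih =>
    rw [iteratedDeriv_succ]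
    exact (closure_minimal support_deriv_subset (isClosed_tsupport _)).trans ih

lemma bumpWeight_eq_zero {i : ℕ} {L t : ℝ} (hL : 0 < L) (h : t < L ∨ 2 * L < t) :
    bumpWeight i L t = 0 := by
  have : iteratedDeriv i smoothBump (t / L) = 0 := by
    apply image_eq_zero_of_notMem_tsupport
    intro h1
    have h2 := tsupport_iteratedDeriv_smoothBump i h1
    rw [Metric.mem_closedBall, Real.dist_eq, abs_le] at h2
    have h3 : 1 ≤ t / L := by linarith
    have h4 : t / L ≤ 2 := by linarith
    rw [le_div_iff₀ hL] at h3
    rw [div_le_iff₀ hL] at h4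
    rcases h with h | h <;> linarith
  simp [bumpWeight, this]

lemma hasDerivAt_bumpWeight (i : ℕ) (L t : ℝ) :
    HasDerivAt (bumpWeight i L) (bumpWeight (i + 1) L t) t := by
  have h1 : Differentiable ℝ (iteratedDeriv i smoothBump) :=
    contDiff_smoothBump.differentiable_iteratedDeriv i (by exact_mod_cast WithTop.coe_lt_top i)
  have h2 := (h1 (t / L)).hasDerivAt
  rw [← iteratedDeriv_succ] at h2
  have h3 := (h2.comp t ((hasDerivAt_id t).div_const L)).div_const (L ^ i)
  have h4 : bumpWeight (i + 1) L t = iteratedDeriv (i + 1) smoothBump (t / L) * (1 / L) / L ^ i := by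
    rw [bumpWeight, pow_succ]
    ring
  rw [h4]
  exact h3

lemma exists_bumpWeight_bound (i : ℕ) : ∃ B : ℝ, 1 ≤ B ∧ ∀ L > 0, ∀ t, |bumpWeight i L t| ≤ B / L ^ i := by
  have h1 : Continuous (iteratedDeriv i smoothBump) :=
    contDiff_smoothBump.continuous_iteratedDeriv i (by exact_mod_cast le_top)
  have h2 : HasCompactSupport (iteratedDeriv i smoothBump) :=
    (isCompact_closedBall _ _).of_isClosed_subset (isClosed_tsupport _)
      (tsupport_iteratedDeriv_smoothBump i)
  obtain ⟨B, hB⟩ := h1.bounded_above_of_compact_support h2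
  refine ⟨max 1 B, le_max_left _ _, fun L hL t => ?_⟩
  rw [bumpWeight, abs_div, abs_of_pos (pow_pos hL i)]
  gcongr
  exact (hB _).trans (le_max_right _ _)

lemma abs_sub_le_of_hasDerivAt {φ φ' : ℝ → ℝ} {B x y : ℝ} (hφ : ∀ t, HasDerivAt φ (φ' t) t)
    (hB : ∀ t ∈ Set.Icc x y, |φ' t| ≤ B) (hxy : x ≤ y) : |φ y - φ x| ≤ B * (y - x) := by
  have := Convex.norm_image_sub_le_of_norm_hasDerivWithin_le (s := Set.Icc x y) (f := φ) (f' := φ')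
    (C := B) (fun t _ => (hφ t).hasDerivWithinAt) (fun t ht => by simpa using hB t ht)
    (convex_Icc x y) (Set.left_mem_Icc.mpr hxy) (Set.right_mem_Icc.mpr hxy)
  simpa [abs_of_nonneg (sub_nonneg.mpr hxy)] using this

lemma log_succ_sub_log_nonneg (m : ℕ) : 0 ≤ Real.log (m + 1 : ℕ) - Real.log m := by
  rcases Nat.eq_zero_or_pos m with rfl | hm
  · simp
  · rw [sub_nonneg]
    exact Real.log_le_log (by exact_mod_cast hm) (by push_cast; linarith)

lemma log_succ_sub_log_le {m : ℕ} (hm : 1 ≤ m) : Real.log (m + 1 : ℕ) - Real.log m ≤ 1 / m := by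
  have h0 : (0 : ℝ) < m := by exact_mod_cast hm
  rw [← Real.log_div (by positivity) h0.ne']
  have := Real.log_le_sub_one_of_pos (show (0 : ℝ) < ((m + 1 : ℕ) : ℝ) / m by positivity)
  refine this.trans (le_of_eq ?_)
  push_cast; field_simp; ring

lemma abs_log_step_le_of_hasDerivAt {φ φ' : ℝ → ℝ} {B : ℝ} (hφ : ∀ t, HasDerivAt φ (φ' t) t) {m : ℕ}
    (hB : ∀ t ∈ Set.Icc (Real.log m) (Real.log (m + 1 : ℕ)), |φ' t| ≤ B) (hm : 1 ≤ m) :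
    |φ (Real.log (m + 1 : ℕ)) - φ (Real.log m)| ≤ B / m := by
  have h0 : 0 ≤ B := (abs_nonneg _).trans (hB _ (Set.left_mem_Icc.mpr
    (sub_nonneg.mp (log_succ_sub_log_nonneg m))))
  refine (abs_sub_le_of_hasDerivAt hφ hB (sub_nonneg.mp (log_succ_sub_log_nonneg m))).trans ?_
  rw [div_eq_mul_one_div]
  exact mul_le_mul_of_nonneg_left (log_succ_sub_log_le hm) h0

/-- The Taylor remainder of order `J` of `bumpWeight k L` at `t`. -/
noncomputable def bumpRemainder (k J : ℕ) (L t y : ℝ) : ℝ :=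
  bumpWeight k L (t + y) - ∑ i ∈ range J, bumpWeight (k + i) L t * (y ^ i / i.factorial)

lemma hasDerivAt_bumpRemainder (k J : ℕ) (L t y : ℝ) :
    HasDerivAt (bumpRemainder k (J + 1) L t) (bumpRemainder (k + 1) J L t y) y := by
  unfold bumpRemainder
  refine HasDerivAt.sub ?_ ?_
  · have := (hasDerivAt_bumpWeight k L (t + y)).comp y ((hasDerivAt_id y).const_add t)
    rw [mul_one] at this
    exact this
  · have h : ∀ J : ℕ, HasDerivAt
        (fun y : ℝ => ∑ i ∈ range (J + 1), bumpWeight (k + i) L t * (y ^ i / i.factorial))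
        (∑ i ∈ range J, bumpWeight (k + 1 + i) L t * (y ^ i / i.factorial)) y := by
      intro J
      induction J with
      | zero => simpa using hasDerivAt_const y (bumpWeight k L t)
      | succ J ih =>
        simp_rw [sum_range_succ _ (J + 1)]
        rw [sum_range_succ]
        refine HasDerivAt.add (by simpa using ih) ?_
        have h1 := (((hasDerivAt_pow (J + 1) y).div_const ((J + 1).factorial : ℝ)).const_mul
          (bumpWeight (k + (J + 1)) L t))
        have h2 : bumpWeight (k + 1 + J) L t * (y ^ J / J.factorial) = bumpWeight (k + (J + 1)) L t *
            (((J + 1 : ℕ) : ℝ) * y ^ (J + 1 - 1) / (J + 1).factorial) := by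
          rw [show k + 1 + J = k + (J + 1) by ring, Nat.factorial_succ]
          have : (J.factorial : ℝ) ≠ 0 := by positivity
          push_cast
          field_simp
        rw [h2]
        exact h1
    exact h J

lemma exists_bumpRemainder_bound (J : ℕ) : ∀ k : ℕ, ∃ B : ℝ, 1 ≤ B ∧ ∀ L > 0, ∀ t y, 0 ≤ y →
    |bumpRemainder k J L t y| ≤ B / L ^ (k + J) * y ^ J := by
  induction J with
  | zero =>
    intro k
    obtain ⟨B, hB, h⟩ := exists_bumpWeight_bound k
    exact ⟨B, hB, fun L hL t y _ => by simpa [bumpRemainder] using h L hL (t + y)⟩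
  | succ J ih =>
    intro k
    obtain ⟨B, hB, h⟩ := ih (k + 1)
    refine ⟨B, hB, fun L hL t y hy => ?_⟩
    have h0 : bumpRemainder k (J + 1) L t 0 = 0 := by
      simp [bumpRemainder, sum_range_succ']
    have := abs_sub_le_of_hasDerivAt (B := B / L ^ (k + 1 + J) * y ^ J) (hasDerivAt_bumpRemainder k J L t)
      (fun z hz => (h L hL t z hz.1).trans (by
        have := pow_le_pow_left₀ hz.1 hz.2 J
        gcongr)) hy
    rw [h0, sub_zero, sub_zero] at this
    refine this.trans (le_of_eq ?_)
    rw [show k + 1 + J = k + (J + 1) by ring]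
    ring

open ArithmeticFunction (vonMangoldt)

/-- An upper bound for the integers `n` with `bumpWeight i L (log n) ≠ 0`. -/
noncomputable def bumpLength (L : ℝ) : ℕ := ⌈Real.exp (2 * L)⌉₊ + 1

lemma exp_lt_bumpLength (L : ℝ) : Real.exp (2 * L) < bumpLength L := by
  have := Nat.le_ceil (Real.exp (2 * L))
  rw [bumpLength]; push_cast; linarith

lemma one_le_bumpLength (L : ℝ) : 1 ≤ bumpLength L := by rw [bumpLength]; omega

lemma bumpLength_le_exp {L : ℝ} (hL : 1 ≤ L) : (bumpLength L : ℝ) ≤ Real.exp (3 * L) := by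
  have h1 := Nat.ceil_lt_add_one (Real.exp_pos (2 * L)).le
  have h2 : Real.exp (3 * L) = Real.exp L * Real.exp (2 * L) := by rw [← Real.exp_add]; ring_nf
  have h3 := Real.add_one_le_exp L
  have h4 := Real.add_one_le_exp (2 * L)
  rw [bumpLength, h2]; push_cast
  nlinarith

lemma log_bumpLength_le {L : ℝ} (hL : 1 ≤ L) : Real.log (bumpLength L) ≤ 3 * L := by
  rw [Real.log_le_iff_le_exp (by exact_mod_cast one_le_bumpLength L)]
  exact bumpLength_le_exp hL

lemma bumpWeight_log_eq_zero {i : ℕ} {L : ℝ} (hL : 0 < L) {n : ℕ}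
    (hn : (n : ℝ) < Real.exp L ∨ bumpLength L ≤ n) : bumpWeight i L (Real.log n) = 0 := by
  rcases hn with h | h
  · rcases Nat.eq_zero_or_pos n with rfl | h0
    · exact bumpWeight_eq_zero hL (Or.inl (by simpa using hL))
    · exact bumpWeight_eq_zero hL (Or.inl ((Real.log_lt_iff_lt_exp (by exact_mod_cast h0)).mpr h))
  · have h1 : Real.exp (2 * L) < n := (exp_lt_bumpLength L).trans_le (by exact_mod_cast h)
    exact bumpWeight_eq_zero hL (Or.inr ((Real.lt_log_iff_exp_lt ((Real.exp_pos _).trans h1)).mpr h1))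

lemma bumpWeight_log_add_log_eq_zero {i : ℕ} {L : ℝ} (hL : 0 < L) {m n : ℕ} (hm : 1 ≤ m) (hn : 1 ≤ n)
    (h : (m * n : ℝ) < Real.exp L ∨ bumpLength L ≤ m * n) :
    bumpWeight i L (Real.log m + Real.log n) = 0 := by
  have h1 := bumpWeight_log_eq_zero (i := i) hL (n := m * n) (by push_cast; exact h)
  rwa [Nat.cast_mul, Real.log_mul (by positivity) (by positivity)] at h1

lemma sum_divisorsAntidiagonal_eq_sum_sum {R : Type*} [AddCommMonoid R] {F : ℕ → ℕ → R} {N A B : ℕ}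
    (hF : ∀ a b, 1 ≤ a → 1 ≤ b → N ≤ a * b → F a b = 0) (hA : N ≤ A) (hB : N ≤ B) :
    ∑ n ∈ Ico 1 N, ∑ x ∈ n.divisorsAntidiagonal, F x.1 x.2 =
      ∑ a ∈ Ico 1 A, ∑ b ∈ Ico 1 B, F a b := by
  rw [← sum_product', Finset.sum_sigma']
  refine sum_bij_ne_zero (fun x _ _ => x.2) ?_ ?_ ?_ ?_
  · rintro ⟨n, a, b⟩ h _
    simp only [mem_sigma, mem_Ico, Nat.mem_divisorsAntidiagonal, mem_product] at h ⊢
    obtain ⟨⟨h1, h2⟩, h3, h4⟩ := h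
    have ha : 1 ≤ a := Nat.one_le_iff_ne_zero.mpr (by rintro rfl; simp at h3; omega)
    have hb : 1 ≤ b := Nat.one_le_iff_ne_zero.mpr (by rintro rfl; simp at h3; omega)
    have := Nat.le_mul_of_pos_right a hb
    have := Nat.le_mul_of_pos_left b ha
    omega
  · rintro ⟨n, x⟩ h _ ⟨n', x'⟩ h' _ e
    simp only [mem_sigma, mem_Ico, Nat.mem_divisorsAntidiagonal] at h h' e
    subst e
    have : n = n' := h.2.1.symm.trans h'.2.1
    subst this; rfl
  · rintro ⟨a, b⟩ h hne
    simp only [mem_product, mem_Ico] at h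
    refine ⟨⟨a * b, a, b⟩, ?_, hne, rfl⟩
    simp only [mem_sigma, mem_Ico, Nat.mem_divisorsAntidiagonal]
    have h1 : 1 ≤ a * b := Nat.mul_pos h.1.1 h.2.1
    refine ⟨⟨h1, ?_⟩, trivial, by omega⟩
    by_contra hc
    exact hne (hF a b h.1.1 h.2.1 (by omega))
  · intros; rfl

lemma exists_mertens : ∃ K : ℝ, 1 ≤ K ∧ ∀ N : ℕ, 1 ≤ N →
    |∑ n ∈ Ico 1 N, vonMangoldt n / n - Real.log N| ≤ K := by
  refine ⟨Real.log 4 + 6, by have := Real.log_nonneg (show (1:ℝ) ≤ 4 by norm_num); linarith, ?_⟩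
  have key : ∀ N : ℕ, 1 ≤ N → |∑ n ∈ Ioc 0 N, vonMangoldt n / n - Real.log N| ≤ Real.log 4 + 4 := by
    intro N hN
    have h0 : (0 : ℝ) < N := by exact_mod_cast hN
    have h4 := Real.log_nonneg (show (1:ℝ) ≤ 4 by norm_num)
    have h1 : Real.log (N.factorial) = ∑ n ∈ Ioc 0 N, vonMangoldt n * ((N / n : ℕ) : ℝ) := by
      rw [← ArithmeticFunction.sum_Ioc_mul_zeta_eq_sum]
      have : ∀ M : ℕ, Real.log (M.factorial) =
          ∑ n ∈ Ioc 0 M, (vonMangoldt * (ArithmeticFunction.zeta : ArithmeticFunction ℝ)) n := by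
        intro M
        induction M with
        | zero => simp
        | succ M ih =>
          rw [Finset.sum_Ioc_succ_top (Nat.zero_le M), ← ih, Nat.factorial_succ, Nat.cast_mul,
            Real.log_mul (by positivity) (by positivity), ArithmeticFunction.vonMangoldt_mul_zeta,
            ArithmeticFunction.log_apply]
          ring
      exact this N
    have h2 : Real.log (N.factorial) ≤ N * Real.log N := by
      rw [← Real.log_pow]
      exact Real.log_le_log (by positivity) (by exact_mod_cast N.factorial_le_pow)
    have h3 : N * Real.log N - N ≤ Real.log (N.factorial) := by
      have := Real.pow_div_factorial_le_exp (N : ℝ) h0.le N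
      have := Real.log_le_log (by positivity) this
      rw [Real.log_exp, Real.log_div (by positivity) (by positivity), Real.log_pow] at this
      linarith
    have h5 : ∑ n ∈ Ioc 0 N, vonMangoldt n = Chebyshev.psi N := by
      rw [Chebyshev.psi, Nat.floor_natCast]
    have h6 := Chebyshev.psi_le_const_mul_self h0.le
    have h7 : Real.log (N.factorial) ≤ N * ∑ n ∈ Ioc 0 N, vonMangoldt n / n := by
      rw [h1, mul_sum]
      refine sum_le_sum fun n hn => ?_
      have := Nat.cast_div_le (α := ℝ) (m := N) (n := n)
      have h8 : 0 ≤ vonMangoldt n := ArithmeticFunction.vonMangoldt_nonneg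
      calc _ ≤ vonMangoldt n * (N / n : ℝ) := by gcongr
        _ = _ := by ring
    have h8 : N * ∑ n ∈ Ioc 0 N, vonMangoldt n / n ≤ Real.log (N.factorial) + Chebyshev.psi N := by
      rw [h1, ← h5, mul_sum, ← sum_add_distrib]
      refine sum_le_sum fun n hn => ?_
      have h8 : 0 ≤ vonMangoldt n := ArithmeticFunction.vonMangoldt_nonneg
      have h9 : (N / n : ℝ) ≤ ((N / n : ℕ) : ℝ) + 1 := by
        have := Nat.lt_floor_add_one ((N : ℝ) / n)
        rw [Nat.floor_div_eq_div] at this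
        exact this.le
      calc _ = vonMangoldt n * (N / n : ℝ) := by ring
        _ ≤ vonMangoldt n * (((N / n : ℕ) : ℝ) + 1) := by gcongr
        _ = _ := by ring
    rw [abs_le]
    constructor
    · by_contra hc
      push Not at hc
      nlinarith
    · by_contra hc
      push Not at hc
      nlinarith
  intro N hN
  have h1 : ∑ n ∈ Ioc 0 N, vonMangoldt n / (n : ℝ) =
      ∑ n ∈ Ico 1 N, vonMangoldt n / (n : ℝ) + vonMangoldt N / N := by
    rw [← sum_Ico_succ_top hN]
    rfl
  have h0 : (0 : ℝ) < N := by exact_mod_cast hN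
  have h2 : vonMangoldt N / (N : ℝ) ≤ 1 := by
    rw [div_le_one h0]
    have := Real.log_le_sub_one_of_pos h0
    linarith [ArithmeticFunction.vonMangoldt_le_log (n := N)]
  have h3 : 0 ≤ vonMangoldt N / (N : ℝ) :=
    div_nonneg ArithmeticFunction.vonMangoldt_nonneg h0.le
  have h4 := key N hN
  rw [h1] at h4
  rw [abs_le] at h4 ⊢
  constructor <;> linarith

lemma exists_sum_vonMangoldt_div_le : ∃ K : ℝ, 1 ≤ K ∧ ∀ L : ℝ, 1 ≤ L →
    ∑ n ∈ Ico 1 (bumpLength L), vonMangoldt n / n ≤ K * L := by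
  obtain ⟨K, hK, h⟩ := exists_mertens
  refine ⟨K + 3, by linarith, fun L hL => ?_⟩
  have h1 := (abs_le.mp (h _ (one_le_bumpLength L))).2
  have h2 := log_bumpLength_le hL
  nlinarith

lemma exists_exp_neg_le_div_pow {c : ℝ} (hc : 0 < c) (J : ℕ) :
    ∃ C : ℝ, 1 ≤ C ∧ ∀ L : ℝ, 0 < L → Real.exp (-(c * L)) ≤ C / L ^ J := by
  refine ⟨max 1 (J.factorial / c ^ J), le_max_left _ _, fun L hL => ?_⟩
  have h1 := Real.pow_div_factorial_le_exp (c * L) (by positivity) J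
  rw [le_div_iff₀ (by positivity), Real.exp_neg]
  refine le_trans ?_ (le_max_right _ _)
  rw [inv_mul_le_iff₀ (Real.exp_pos _)]
  calc L ^ J = (c * L) ^ J / J.factorial * (J.factorial / c ^ J) := by
        rw [mul_pow]; field_simp
    _ ≤ _ := by gcongr

lemma exists_mul_bumpWeight_bound (k : ℕ) : ∃ B : ℝ, 1 ≤ B ∧ ∀ L > 0,
    (∀ t, |bumpWeight k L t| ≤ B / L ^ k) ∧ (∀ t, |t * bumpWeight k L t| ≤ B * L / L ^ k) ∧
    (∀ t, |bumpWeight k L t + t * bumpWeight (k + 1) L t| ≤ B / L ^ k) := by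
  obtain ⟨B, hB, h⟩ := exists_bumpWeight_bound k
  obtain ⟨B', hB', h'⟩ := exists_bumpWeight_bound (k + 1)
  have key : ∀ (i : ℕ) (D L t : ℝ), 0 < L → |bumpWeight i L t| ≤ D →
      |t * bumpWeight i L t| ≤ 2 * L * D := by
    intro i D L t hL hD
    have hD0 := (abs_nonneg _).trans hD
    by_cases ht : t < L ∨ 2 * L < t
    · rw [bumpWeight_eq_zero hL ht]
      simp only [mul_zero, abs_zero]; positivity
    · push Not at ht
      rw [abs_mul, abs_of_nonneg (hL.le.trans ht.1)]
      exact mul_le_mul ht.2 hD (abs_nonneg _) (by positivity)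
  refine ⟨2 * B + 2 * B', by linarith, fun L hL => ⟨fun t => (h L hL t).trans ?_, fun t => ?_,
    fun t => ?_⟩⟩
  · gcongr; linarith
  · refine (key k _ L t hL (h L hL t)).trans ?_
    rw [mul_div_assoc', mul_right_comm]
    gcongr; linarith
  · refine (abs_add_le _ _).trans ((add_le_add (h L hL t) (key _ _ L t hL (h' L hL t))).trans ?_)
    have : 2 * L * (B' / L ^ (k + 1)) = 2 * B' / L ^ k := by rw [pow_succ]; field_simp
    rw [this, ← add_div]
    gcongr; linarith

lemma one_le_sqrt_natCast {m : ℕ} (hm : 1 ≤ m) : 1 ≤ √(m : ℝ) :=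
  Real.one_le_sqrt.mpr (by exact_mod_cast hm)

lemma one_div_le_inv_sqrt {m : ℕ} (hm : 1 ≤ m) {P : ℝ} (hP : 0 ≤ P) : P / m ≤ P / √(m : ℝ) := by
  have h1 := one_le_sqrt_natCast hm
  have h2 : √(m : ℝ) ≤ m := by
    have := Real.mul_self_sqrt (Nat.cast_nonneg (α := ℝ) m)
    nlinarith
  gcongr

lemma BoundedSums.norm_smooth_tail_le {r : ℝ} {f : ℕ → ℂ} (hf : BoundedSums r f) {φ φ' : ℝ → ℝ}
    {P : ℝ} (hφ : ∀ t, HasDerivAt φ (φ' t) t) (h1 : ∀ t, 0 ≤ t → |φ t| ≤ P)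
    (h2 : ∀ t, 0 ≤ t → |φ' t| ≤ P) {a : ℕ} (ha : 1 ≤ a)
    (h0 : ∀ m, 1 ≤ m → m < a → φ (Real.log m) = 0) (b : ℕ) :
    ‖∑ m ∈ Ico 1 b, f m * ((φ (Real.log m) / m : ℝ) : ℂ)‖ ≤ 13 * r * P / √(a : ℝ) := by
  have hP : 0 ≤ P := (abs_nonneg _).trans (h1 0 le_rfl)
  have hsum : ∑ m ∈ Ico 1 b, f m * ((φ (Real.log m) / m : ℝ) : ℂ) =
      ∑ m ∈ Ico a b, f m * ((φ (Real.log m) / m : ℝ) : ℂ) := by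
    symm
    refine sum_subset (Ico_subset_Ico_left ha) fun m hm hm' => ?_
    simp only [mem_Ico] at hm hm'
    rw [h0 m hm.1 (by omega)]
    simp
  rw [hsum]
  refine hf.norm_sum_div_tail_le (ρ := fun m => φ (Real.log m)) ha (fun m hm => ?_)
    (fun m hm => ?_) b
  · exact (h1 _ (Real.log_natCast_nonneg m)).trans
      (le_mul_of_one_le_right hP (one_le_sqrt_natCast (ha.trans hm)))
  · exact (abs_log_step_le_of_hasDerivAt hφ
      (fun t ht => h2 t ((Real.log_natCast_nonneg m).trans ht.1)) (ha.trans hm)).trans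
      (one_div_le_inv_sqrt (ha.trans hm) hP)

lemma exists_log_bumpWeight_sum_bound (k J : ℕ) : ∃ C : ℝ, 1 ≤ C ∧ ∀ (L r : ℝ) (f : ℕ → ℂ),
    1 ≤ L → r ≤ Real.exp (L / 4) → BoundedSums r f →
    ‖∑ n ∈ Ico 1 (bumpLength L), f n * ((Real.log n * bumpWeight k L (Real.log n) / n : ℝ) : ℂ)‖ ≤
      C * (L / L ^ (k + J)) := by
  obtain ⟨B, hB, h⟩ := exists_mul_bumpWeight_bound k
  obtain ⟨C, hC, hC'⟩ := exists_exp_neg_le_div_pow (show (0 : ℝ) < 1 / 4 by norm_num) J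
  refine ⟨13 * B * C, by nlinarith, fun L r f hL hr hf => ?_⟩
  have hL0 : 0 < L := by linarith
  obtain ⟨hb1, hb2, hb3⟩ := h L hL0
  set a := ⌈Real.exp L⌉₊ with ha
  have haL : Real.exp L ≤ a := Nat.le_ceil _
  have ha1 : 1 ≤ a := Nat.one_le_iff_ne_zero.mpr (Nat.ceil_pos.mpr (Real.exp_pos L)).ne'
  have hP : 0 ≤ B * L / L ^ k := by positivity
  refine (hf.norm_smooth_tail_le (P := B * L / L ^ k) (φ := fun t => t * bumpWeight k L t)
    (φ' := fun t => bumpWeight k L t + t * bumpWeight (k + 1) L t) (fun t => ?_)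
    (fun t _ => hb2 t) (fun t _ => (hb3 t).trans ?_) ha1 (fun m _ hm => ?_) _).trans ?_
  · have := (hasDerivAt_id t).mul (hasDerivAt_bumpWeight k L t)
    rw [id, one_mul] at this
    exact this
  · gcongr
    nlinarith
  · simp only [bumpWeight_log_eq_zero hL0 (Or.inl (Nat.lt_ceil.mp hm)), mul_zero]
  · have hs : Real.exp (L / 2) ≤ √(a : ℝ) := by
      apply Real.le_sqrt_of_sq_le
      rw [← Real.exp_nat_mul]
      refine le_trans (le_of_eq ?_) haL
      congr 1; push_cast; ring
    calc 13 * r * (B * L / L ^ k) / √(a : ℝ) ≤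
          13 * Real.exp (L / 4) * (B * L / L ^ k) / Real.exp (L / 2) := by
          gcongr
      _ = 13 * (B * L / L ^ k) * Real.exp (-(1 / 4 * L)) := by
          rw [show L / 2 = L / 4 + 1 / 4 * L by ring, Real.exp_add, Real.exp_neg]
          field_simp
      _ ≤ 13 * (B * L / L ^ k) * (C / L ^ J) := by
          gcongr; exact hC' L hL0
      _ = _ := by rw [pow_add]; field_simp

lemma abs_log_pow_div_factorial_step_le {i m : ℕ} (hm : 1 ≤ m) :
    |Real.log (m + 1 : ℕ) ^ i / i.factorial - Real.log m ^ i / i.factorial| ≤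
      Real.log (m + 1 : ℕ) ^ (i - 1) / m := by
  have h0 : 0 ≤ Real.log m := Real.log_natCast_nonneg m
  refine abs_log_step_le_of_hasDerivAt (φ := fun t => t ^ i / i.factorial)
    (φ' := fun t => i * t ^ (i - 1) / i.factorial)
    (fun t => by simpa using (hasDerivAt_pow i t).div_const (i.factorial : ℝ)) (fun t ht => ?_) hm
  have ht0 : 0 ≤ t := h0.trans ht.1
  rw [abs_of_nonneg (by positivity), div_le_iff₀ (by positivity), mul_comm]
  have h1 : (i : ℝ) ≤ i.factorial := by exact_mod_cast i.self_le_factorial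
  have h2 := pow_le_pow_left₀ ht0 ht.2 (i - 1)
  exact mul_le_mul h2 h1 (by positivity) (by have := h0.trans (ht.1.trans ht.2); positivity)

lemma exists_log_pow_sum_bound (i : ℕ) : ∃ C : ℝ, 1 ≤ C ∧ ∀ (r : ℝ) (f : ℕ → ℂ), 1 ≤ r →
    BoundedSums r f → ∀ M : ℕ,
    ‖∑ m ∈ Ico 1 M, f m * ((Real.log m ^ i / i.factorial / m : ℝ) : ℂ)‖ ≤
      C * (1 + Real.log r) ^ (i + 1) := by
  obtain ⟨C, hC, h⟩ := exists_boundedSums_kernel_bound i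
  refine ⟨C, hC, fun r f hr hf M => ?_⟩
  have := h r f hr hf 1 (fun m => Real.log m ^ i / i.factorial) zero_le_one (fun m hm => ?_)
    (fun m hm => ?_) M
  · simpa using this
  · have h0 : 0 ≤ Real.log m := Real.log_natCast_nonneg m
    rw [abs_of_nonneg (by positivity), one_mul]
    refine (div_le_self (by positivity) (by exact_mod_cast i.factorial_pos)).trans ?_
    gcongr; linarith
  · refine (abs_log_pow_div_factorial_step_le hm).trans ?_
    have h0 : 0 ≤ Real.log (m + 1 : ℕ) := Real.log_natCast_nonneg (m + 1)
    push_cast at h0 ⊢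
    rw [one_mul]
    gcongr
    calc Real.log (m + 1) ^ (i - 1) ≤ (1 + Real.log (m + 1)) ^ (i - 1) := by gcongr; linarith
      _ ≤ _ := pow_le_pow_right₀ (by linarith) (by omega)

lemma exists_bumpRemainder_sum_bound (k J : ℕ) : ∃ C : ℝ, 1 ≤ C ∧ ∀ (L t r : ℝ) (f : ℕ → ℂ), 0 < L →
    1 ≤ r → BoundedSums r f → ∀ M : ℕ,
    ‖∑ m ∈ Ico 1 M, f m * ((bumpRemainder k (J + 1) L t (Real.log m) / m : ℝ) : ℂ)‖ ≤
      C * (1 + Real.log r) ^ (J + 2) / L ^ (k + (J + 1)) := by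
  obtain ⟨C, hC, h⟩ := exists_boundedSums_kernel_bound (J + 1)
  obtain ⟨B, hB, hB'⟩ := exists_bumpRemainder_bound (J + 1) k
  obtain ⟨D, hD, hD'⟩ := exists_bumpRemainder_bound J (k + 1)
  refine ⟨C * (B + D), by nlinarith, fun L t r f hL hr hf M => ?_⟩
  refine (h r f hr hf ((B + D) / L ^ (k + (J + 1)))
    (fun m => bumpRemainder k (J + 1) L t (Real.log m)) (by positivity) (fun m hm => ?_)
    (fun m hm => ?_) M).trans (le_of_eq (by ring))
  · have h0 : 0 ≤ Real.log m := Real.log_natCast_nonneg m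
    refine (hB' L hL t _ h0).trans ?_
    gcongr <;> linarith
  · refine abs_log_step_le_of_hasDerivAt (hasDerivAt_bumpRemainder k J L t) (fun y hy => ?_) hm
    have h0 : 0 ≤ Real.log m := Real.log_natCast_nonneg m
    have hy0 := h0.trans hy.1
    refine (hD' L hL t y hy0).trans ?_
    have h1 : y ≤ Real.log (m + 1) := by have := hy.2; push_cast at this; exact this
    rw [show k + 1 + J = k + (J + 1) by ring]
    gcongr
    · linarith
    · calc y ^ J ≤ (1 + Real.log (m + 1)) ^ J := by gcongr; linarith
        _ ≤ _ := pow_le_pow_right₀ (by linarith) (by omega)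

/-- The smoothed sum of `f n Λ(n) / n` with weight `bumpWeight k L (log n)`. -/
noncomputable def twistedSum (f : ℕ → ℂ) (L : ℝ) (k : ℕ) : ℂ :=
  ∑ n ∈ Ico 1 (bumpLength L), f n * ((vonMangoldt n * bumpWeight k L (Real.log n) / n : ℝ) : ℂ)

lemma log_twisted_sum_eq {f : ℕ → ℂ} (hf : ∀ a b, f (a * b) = f a * f b) {L : ℝ} (hL : 0 < L)
    (k J : ℕ) {M : ℕ} (hM : bumpLength L ≤ M) :
    ∑ n ∈ Ico 1 (bumpLength L), f n * ((Real.log n * bumpWeight k L (Real.log n) / n : ℝ) : ℂ) =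
      ∑ i ∈ range J, (∑ m ∈ Ico 1 M, f m * ((Real.log m ^ i / i.factorial / m : ℝ) : ℂ)) *
        twistedSum f L (k + i) +
      ∑ d ∈ Ico 1 (bumpLength L), f d * ((vonMangoldt d / d : ℝ) : ℂ) *
        ∑ m ∈ Ico 1 M, f m * ((bumpRemainder k J L (Real.log d) (Real.log m) / m : ℝ) : ℂ) := by
  have h1 : ∀ n ∈ Ico 1 (bumpLength L),
      f n * ((Real.log n * bumpWeight k L (Real.log n) / n : ℝ) : ℂ) =
      ∑ x ∈ n.divisorsAntidiagonal, f x.1 * f x.2 * ((vonMangoldt x.1 *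
        bumpWeight k L (Real.log x.1 + Real.log x.2) / (x.1 * x.2) : ℝ) : ℂ) := by
    intro n _
    have h0 : Real.log n = ∑ x ∈ n.divisorsAntidiagonal, vonMangoldt x.1 := by
      rw [Nat.sum_divisorsAntidiagonal (fun d _ => vonMangoldt d), ArithmeticFunction.vonMangoldt_sum]
    have h1 : f n * ((Real.log n * bumpWeight k L (Real.log n) / n : ℝ) : ℂ) =
        ∑ x ∈ n.divisorsAntidiagonal,
          f n * ((vonMangoldt x.1 * bumpWeight k L (Real.log n) / n : ℝ) : ℂ) := by
      rw [← mul_sum, ← Complex.ofReal_sum, ← sum_div, ← sum_mul, ← h0]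
    rw [h1]
    refine sum_congr rfl fun x hx => ?_
    obtain ⟨h2, h3⟩ := Nat.mem_divisorsAntidiagonal.mp hx
    rw [← h2] at h3 ⊢
    obtain ⟨h4, h5⟩ := mul_ne_zero_iff.mp h3
    rw [hf, Nat.cast_mul, Real.log_mul (by exact_mod_cast h4) (by exact_mod_cast h5)]
  rw [sum_congr rfl h1, sum_divisorsAntidiagonal_eq_sum_sum (F := fun a b => f a * f b *
    ((vonMangoldt a * bumpWeight k L (Real.log a + Real.log b) / (a * b) : ℝ) : ℂ)) ?_ le_rfl hM]
  · have h3 : ∑ i ∈ range J, (∑ m ∈ Ico 1 M, f m * ((Real.log m ^ i / i.factorial / m : ℝ) : ℂ)) *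
        twistedSum f L (k + i) = ∑ d ∈ Ico 1 (bumpLength L), ∑ m ∈ Ico 1 M, ∑ i ∈ range J,
          f m * ((Real.log m ^ i / i.factorial / m : ℝ) : ℂ) *
          (f d * ((vonMangoldt d * bumpWeight (k + i) L (Real.log d) / d : ℝ) : ℂ)) := by
      simp_rw [twistedSum, sum_mul_sum]
      exact sum_comm.trans ((sum_congr rfl fun m _ => sum_comm).trans sum_comm)
    rw [h3, ← sum_add_distrib]
    refine sum_congr rfl fun d hd => ?_
    rw [mul_sum, ← sum_add_distrib]
    refine sum_congr rfl fun m hm => ?_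
    have h2 : bumpWeight k L (Real.log d + Real.log m) = bumpRemainder k J L (Real.log d) (Real.log m)
      + ∑ i ∈ range J, bumpWeight (k + i) L (Real.log d) * (Real.log m ^ i / i.factorial) := by
      rw [bumpRemainder]; ring
    rw [h2, mul_add, add_div, mul_sum, sum_div, Complex.ofReal_add, Complex.ofReal_sum, mul_add,
      mul_sum, add_comm]
    congr 1
    · refine sum_congr rfl fun i _ => ?_
      push_cast; ring
    · push_cast; ring
  · intro a b ha hb hab
    rw [bumpWeight_log_add_log_eq_zero hL ha hb (Or.inr hab)]
    simp

lemma norm_vonMangoldt_sum_le {f : ℕ → ℂ} (hf : ∀ n, ‖f n‖ ≤ 1) {z : ℕ → ℂ} {B : ℝ}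
    (hz : ∀ n, ‖z n‖ ≤ B) (N : ℕ) :
    ‖∑ n ∈ Ico 1 N, f n * ((vonMangoldt n / n : ℝ) : ℂ) * z n‖ ≤
      B * ∑ n ∈ Ico 1 N, vonMangoldt n / n := by
  rw [mul_sum]
  refine (norm_sum_le _ _).trans (sum_le_sum fun n _ => ?_)
  have h0 : 0 ≤ vonMangoldt n / (n : ℝ) :=
    div_nonneg ArithmeticFunction.vonMangoldt_nonneg (Nat.cast_nonneg n)
  rw [norm_mul, norm_mul, Complex.norm_real, Real.norm_of_nonneg h0, mul_comm B]
  exact mul_le_mul (mul_le_of_le_one_left h0 (hf n)) (hz n) (norm_nonneg _) h0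

lemma exists_twistedSum_bound_zero (k : ℕ) : ∃ C : ℝ, 1 ≤ C ∧ ∀ (L : ℝ) (f : ℕ → ℂ), 1 ≤ L →
    (∀ n, ‖f n‖ ≤ 1) → ‖twistedSum f L k‖ ≤ C * (L / L ^ k) := by
  obtain ⟨K, hK, hK'⟩ := exists_sum_vonMangoldt_div_le
  obtain ⟨B, hB, hB'⟩ := exists_bumpWeight_bound k
  refine ⟨B * K, by nlinarith, fun L f hL hf => ?_⟩
  have h1 := norm_vonMangoldt_sum_le hf (z := fun n => ((bumpWeight k L (Real.log n) : ℝ) : ℂ))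
    (B := B / L ^ k) (fun n => by simpa using hB' L (by linarith) _) (bumpLength L)
  have h2 : twistedSum f L k = ∑ n ∈ Ico 1 (bumpLength L), f n * ((vonMangoldt n / n : ℝ) : ℂ) *
      ((bumpWeight k L (Real.log n) : ℝ) : ℂ) := by
    refine sum_congr rfl fun n _ => ?_
    push_cast; ring
  rw [h2]
  refine h1.trans ?_
  calc _ ≤ B / L ^ k * (K * L) := by gcongr; exact hK' L hL
    _ = _ := by ring

theorem exists_twistedSum_bound (J : ℕ) : ∀ k : ℕ, ∃ C : ℝ, 1 ≤ C ∧ ∀ (L r Ξ : ℝ) (f : ℕ → ℂ),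
    1 ≤ L → 1 ≤ r → r ≤ Real.exp (L / 4) → BoundedSums r f → (∀ a b, f (a * b) = f a * f b) →
    1 + Real.log r ≤ Ξ → 2 / Ξ ≤ ‖seriesAtOne f‖ →
    ‖twistedSum f L k‖ ≤ C * Ξ ^ (3 * J + 3) * (L / L ^ (k + J)) := by
  induction J using Nat.strong_induction_on with
  | _ J ih =>
  intro k
  rcases J with _ | J
  · obtain ⟨C, hC, h⟩ := exists_twistedSum_bound_zero k
    refine ⟨C, hC, fun L r Ξ f hL hr _ hf _ hΞ _ => (h L f hL hf.1).trans ?_⟩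
    have h1 : 1 ≤ Ξ := by linarith [Real.log_nonneg hr]
    have h2 := one_le_pow₀ h1 (n := 3 * 0 + 3)
    rw [add_zero]
    gcongr
    nlinarith
  have hi : ∀ i : ℕ, ∃ C : ℝ, 1 ≤ C ∧ ∀ (L r Ξ : ℝ) (f : ℕ → ℂ),
      1 ≤ L → 1 ≤ r → r ≤ Real.exp (L / 4) → BoundedSums r f → (∀ a b, f (a * b) = f a * f b) →
      1 + Real.log r ≤ Ξ → 2 / Ξ ≤ ‖seriesAtOne f‖ → i < J → ∀ M : ℕ,
      ‖(∑ m ∈ Ico 1 M, f m * ((Real.log m ^ (i + 1) / (i + 1).factorial / m : ℝ) : ℂ)) *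
        twistedSum f L (k + (i + 1))‖ ≤ C * Ξ ^ (3 * J + 5) * (L / L ^ (k + (J + 1))) := by
    intro i
    obtain ⟨C, hC, h⟩ := exists_log_pow_sum_bound (i + 1)
    by_cases hiJ : i < J
    · obtain ⟨D, hD, h'⟩ := ih (J - i) (by omega) (k + (i + 1))
      refine ⟨C * D, by nlinarith, fun L r Ξ f hL hr hr' hf hm hΞ hs _ M => ?_⟩
      have h1 := h r f hr hf M
      have h2 := h' L r Ξ f hL hr hr' hf hm hΞ hs
      have h0 : 1 ≤ 1 + Real.log r := by linarith [Real.log_nonneg hr]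
      have hΞ1 : 1 ≤ Ξ := h0.trans hΞ
      rw [norm_mul, show k + (J + 1) = k + (i + 1) + (J - i) by omega]
      calc _ ≤ (C * Ξ ^ (i + 1 + 1)) * (D * Ξ ^ (3 * (J - i) + 3) * (L / L ^ (k + (i + 1) + (J - i)))) := by
            refine mul_le_mul (h1.trans ?_) h2 (norm_nonneg _) (by positivity)
            gcongr
        _ = C * D * Ξ ^ ((i + 1 + 1) + (3 * (J - i) + 3)) * (L / L ^ (k + (i + 1) + (J - i))) := by
            rw [pow_add Ξ]; ring
        _ ≤ _ := by
            have := pow_le_pow_right₀ hΞ1 (show (i + 1 + 1) + (3 * (J - i) + 3) ≤ 3 * J + 5 by omega)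
            gcongr
    · exact ⟨1, le_rfl, fun _ _ _ _ _ _ _ _ _ _ _ h => absurd h hiJ⟩
  choose D hD hD' using hi
  obtain ⟨C₁, hC₁, h₁⟩ := exists_log_bumpWeight_sum_bound k (J + 1)
  obtain ⟨C₂, hC₂, h₂⟩ := exists_bumpRemainder_sum_bound k J
  obtain ⟨K, hK, hK'⟩ := exists_sum_vonMangoldt_div_le
  have hDs : 0 ≤ ∑ i ∈ range J, D i := sum_nonneg fun i _ => by linarith [hD i]
  refine ⟨C₁ + ∑ i ∈ range J, D i + C₂ * K, by nlinarith,
    fun L r Ξ f hL hr hr' hf hm hΞ hs => ?_⟩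
  have hL0 : 0 < L := by linarith
  have h0 : 1 ≤ 1 + Real.log r := by linarith [Real.log_nonneg hr]
  have hΞ1 : 1 ≤ Ξ := h0.trans hΞ
  have hlim : ∀ᶠ M : ℕ in atTop, 1 / Ξ < ‖∑ m ∈ Ico 1 M, f m * ((1 / m : ℝ) : ℂ)‖ :=
    hf.tendsto_seriesAtOne.norm.eventually (lt_mem_nhds (lt_of_lt_of_le (by gcongr; norm_num) hs))
  obtain ⟨M, hM1, hM2⟩ := (hlim.and (eventually_ge_atTop (bumpLength L))).exists
  have hid := log_twisted_sum_eq hm hL0 k (J + 1) hM2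
  rw [sum_range_succ'] at hid
  have hc0 : ∑ m ∈ Ico 1 M, f m * ((Real.log m ^ 0 / (0).factorial / m : ℝ) : ℂ) =
      ∑ m ∈ Ico 1 M, f m * ((1 / m : ℝ) : ℂ) := by
    simp
  rw [hc0, add_zero] at hid
  set c₀ := ∑ m ∈ Ico 1 M, f m * ((1 / m : ℝ) : ℂ)
  set P := Ξ ^ (3 * J + 5) * (L / L ^ (k + (J + 1))) with hP
  have hP0 : 0 ≤ P := by positivity
  have hb1 := h₁ L r f hL hr' hf
  have hb2 := norm_vonMangoldt_sum_le hf.1 (fun d => h₂ L (Real.log d) r f hL0 hr hf M) (bumpLength L)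
  have hb3 := norm_sum_le_of_le (range J) (fun i hi =>
    hD' i L r Ξ f hL hr hr' hf hm hΞ hs (mem_range.mp hi) M)
  have hb1' : C₁ * (L / L ^ (k + (J + 1))) ≤ C₁ * P := by
    rw [hP]
    have := one_le_pow₀ hΞ1 (n := 3 * J + 5)
    gcongr
    exact le_mul_of_one_le_left (by positivity) this
  have hb2' : C₂ * (1 + Real.log r) ^ (J + 2) / L ^ (k + (J + 1)) *
      ∑ n ∈ Ico 1 (bumpLength L), vonMangoldt n / n ≤ C₂ * K * P := by
    calc _ ≤ C₂ * Ξ ^ (3 * J + 5) / L ^ (k + (J + 1)) * (K * L) := by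
          gcongr ?_ * ?_
          · have h1 : (1 + Real.log r) ^ (J + 2) ≤ Ξ ^ (J + 2) := by gcongr
            have h2 := h1.trans (pow_le_pow_right₀ hΞ1 (show J + 2 ≤ 3 * J + 5 by omega))
            gcongr
          · exact hK' L hL
      _ = _ := by rw [hP]; ring
  have hb3' : ∑ i ∈ range J, D i * Ξ ^ (3 * J + 5) * (L / L ^ (k + (J + 1))) =
      (∑ i ∈ range J, D i) * P := by
    rw [sum_mul]; exact sum_congr rfl fun i _ => by rw [hP]; ring
  rw [hb3'] at hb3
  have hmain : ‖c₀ * twistedSum f L k‖ ≤ (C₁ + ∑ i ∈ range J, D i + C₂ * K) * P := by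
    have : c₀ * twistedSum f L k = ∑ n ∈ Ico 1 (bumpLength L),
        f n * ((Real.log n * bumpWeight k L (Real.log n) / n : ℝ) : ℂ) -
        ∑ i ∈ range J, (∑ m ∈ Ico 1 M,
          f m * ((Real.log m ^ (i + 1) / (i + 1).factorial / m : ℝ) : ℂ)) *
          twistedSum f L (k + (i + 1)) -
        ∑ d ∈ Ico 1 (bumpLength L), f d * ((vonMangoldt d / d : ℝ) : ℂ) *
          ∑ m ∈ Ico 1 M, f m *
            ((bumpRemainder k (J + 1) L (Real.log d) (Real.log m) / m : ℝ) : ℂ) := by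
      rw [hid]; ring
    rw [this]
    refine (norm_sub_le _ _).trans ?_
    have := norm_sub_le (∑ n ∈ Ico 1 (bumpLength L),
        f n * ((Real.log n * bumpWeight k L (Real.log n) / n : ℝ) : ℂ))
        (∑ i ∈ range J, (∑ m ∈ Ico 1 M,
          f m * ((Real.log m ^ (i + 1) / (i + 1).factorial / m : ℝ) : ℂ)) *
          twistedSum f L (k + (i + 1)))
    linarith
  rw [norm_mul] at hmain
  have hΞ0 : 0 < Ξ := by linarith
  have h5 : ‖twistedSum f L k‖ ≤ Ξ * (‖c₀‖ * ‖twistedSum f L k‖) := by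
    rw [← mul_assoc]
    refine le_mul_of_one_le_left (norm_nonneg _) ?_
    rw [div_lt_iff₀ hΞ0] at hM1
    linarith
  calc _ ≤ Ξ * ((C₁ + ∑ i ∈ range J, D i + C₂ * K) * P) := h5.trans (by gcongr)
    _ = _ := by
      rw [hP, show 3 * (J + 1) + 3 = (3 * J + 5) + 1 by ring, pow_succ Ξ]; ring

lemma exists_primitiveSeq_finset (Q : ℕ) : ∃ S : Finset (ℕ → ℂ), S.card ≤ Q ^ 2 ∧
    ∀ r ≤ Q, ∀ f, IsPrimitiveSeq r f → f ∈ S := by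
  classical
  let _ : ∀ i : ℕ, Fintype (DirichletCharacter ℂ (i + 1)) := fun i => Fintype.ofFinite _
  refine ⟨(range Q).biUnion fun i => (univ : Finset (DirichletCharacter ℂ (i + 1))).image
    fun χ (n : ℕ) => χ n, ?_, ?_⟩
  · refine card_biUnion_le.trans ?_
    calc _ ≤ ∑ i ∈ range Q, Q := by
          refine sum_le_sum fun i hi => card_image_le.trans ?_
          have h1 := DirichletCharacter.card_eq_totient_of_hasEnoughRootsOfUnity ℂ (i + 1)
          rw [Nat.card_eq_fintype_card] at h1
          rw [card_univ, h1]
          exact (Nat.totient_le _).trans (mem_range.mp hi)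
      _ = _ := by simp [sq]
  · rintro r hr f ⟨h0, χ, _, _, h⟩
    obtain ⟨i, rfl⟩ : ∃ i, r = i + 1 := ⟨r - 1, by omega⟩
    exact mem_biUnion.mpr ⟨i, mem_range.mpr (by omega), mem_image.mpr ⟨χ, mem_univ _, by
      ext n; exact (h n).symm⟩⟩

lemma finite_primitiveSeq (Q : ℕ) : {f : ℕ → ℂ | ∃ r ≤ Q, IsPrimitiveSeq r f}.Finite := by
  obtain ⟨S, _, h⟩ := exists_primitiveSeq_finset Q
  exact S.finite_toSet.subset fun f ⟨r, hr, hf⟩ => h r hr f hf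

/-- The nontrivial primitive Dirichlet characters of conductor at most `Q`, as functions on `ℕ`. -/
noncomputable def primitiveFamily (Q : ℕ) : Finset (ℕ → ℂ) := (finite_primitiveSeq Q).toFinset

lemma mem_primitiveFamily {Q : ℕ} {f : ℕ → ℂ} :
    f ∈ primitiveFamily Q ↔ ∃ r ≤ Q, IsPrimitiveSeq r f := by
  simp [primitiveFamily]

lemma card_primitiveFamily_le (Q : ℕ) : (primitiveFamily Q).card ≤ Q ^ 2 := by
  obtain ⟨S, hS, h⟩ := exists_primitiveSeq_finset Q
  refine (card_le_card fun f hf => ?_).trans hS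
  obtain ⟨r, hr, hf⟩ := mem_primitiveFamily.mp hf
  exact h r hr f hf

lemma BoundedSums.mono {r s : ℝ} {f : ℕ → ℂ} (hf : BoundedSums r f) (h : r ≤ s) : BoundedSums s f :=
  ⟨hf.1, fun a b => (hf.2 a b).trans h⟩

lemma boundedSums_of_mem_primitiveFamily {Q : ℕ} {f : ℕ → ℂ} (hf : f ∈ primitiveFamily Q) :
    BoundedSums Q f := by
  obtain ⟨r, hr, hf⟩ := mem_primitiveFamily.mp hf
  exact hf.boundedSums.mono (by exact_mod_cast hr)

lemma boundedSums_mul_conj_of_mem_primitiveFamily {Q : ℕ} {f g : ℕ → ℂ}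
    (hf : f ∈ primitiveFamily Q) (hg : g ∈ primitiveFamily Q) (hfg : f ≠ g) :
    BoundedSums ((Q : ℝ) ^ 2) (fun n => f n * conj (g n)) := by
  obtain ⟨r, hr, hf⟩ := mem_primitiveFamily.mp hf
  obtain ⟨s, hs, hg⟩ := mem_primitiveFamily.mp hg
  refine (hf.boundedSums_mul_conj hg hfg).mono ?_
  have h1 : (r : ℝ) ≤ Q := by exact_mod_cast hr
  have h2 : (s : ℝ) ≤ Q := by exact_mod_cast hs
  nlinarith [Nat.cast_nonneg (α := ℝ) r, Nat.cast_nonneg (α := ℝ) s]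

/-- The dual form of the large sieve for the family of primitive characters. -/
lemma large_sieve_dual {Q U R : ℕ} (hU : 1 ≤ U) (hQU : Q ^ 4 ≤ U) (T : (ℕ → ℂ) → ℂ) :
    ∑ n ∈ Ico U R, (1 / n : ℝ) * ‖∑ f ∈ primitiveFamily Q, T f * f n‖ ^ 2 ≤
      (∑ n ∈ Ico U R, (1 / n : ℝ) + 13) * ∑ f ∈ primitiveFamily Q, ‖T f‖ ^ 2 := by
  classical
  set S := primitiveFamily Q with hS
  have hU0 : (0 : ℝ) < U := by exact_mod_cast hU
  have h1 : ((∑ n ∈ Ico U R, (1 / n : ℝ) * ‖∑ f ∈ S, T f * f n‖ ^ 2 : ℝ) : ℂ) =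
      ∑ f ∈ S, ∑ g ∈ S, T f * conj (T g) *
        ∑ n ∈ Ico U R, (f n * conj (g n)) * ((1 / n : ℝ) : ℂ) := by
    rw [Complex.ofReal_sum]
    have : ∀ n ∈ Ico U R, (((1 / n : ℝ) * ‖∑ f ∈ S, T f * f n‖ ^ 2 : ℝ) : ℂ) =
        ∑ f ∈ S, ∑ g ∈ S, T f * conj (T g) * ((f n * conj (g n)) * ((1 / n : ℝ) : ℂ)) := by
      intro n _
      rw [Complex.ofReal_mul, Complex.ofReal_pow, ← Complex.mul_conj', map_sum, sum_mul_sum, mul_sum]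
      refine sum_congr rfl fun f _ => ?_
      rw [mul_sum]
      refine sum_congr rfl fun g _ => ?_
      rw [map_mul]; ring
    rw [sum_congr rfl this, sum_comm]
    refine sum_congr rfl fun f _ => ?_
    rw [sum_comm]
    refine sum_congr rfl fun g _ => ?_
    rw [mul_sum]
  have hH : 0 ≤ ∑ n ∈ Ico U R, (1 / n : ℝ) := sum_nonneg fun n _ => by positivity
  have h2 : ∀ f ∈ S, ∀ g ∈ S, ‖∑ n ∈ Ico U R, (f n * conj (g n)) * ((1 / n : ℝ) : ℂ)‖ ≤
      (if f = g then ∑ n ∈ Ico U R, (1 / n : ℝ) else 0) + 13 * (Q : ℝ) ^ 2 / U := by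
    intro f hf g hg
    split_ifs with h
    · subst h
      refine (norm_sum_le _ _).trans ?_
      refine le_trans (sum_le_sum (g := fun n : ℕ => (1 / n : ℝ)) fun n _ => ?_)
        (le_add_of_nonneg_right (by positivity))
      have h3 := (boundedSums_of_mem_primitiveFamily hf).1 n
      rw [norm_mul, norm_mul, Complex.norm_conj, Complex.norm_real,
        Real.norm_of_nonneg (show (0 : ℝ) ≤ 1 / n by positivity)]
      exact mul_le_of_le_one_left (by positivity) (mul_le_one₀ h3 (norm_nonneg _) h3)
    · rw [zero_add]
      exact (boundedSums_mul_conj_of_mem_primitiveFamily hf hg h).norm_sum_inv_tail_le hU R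
  have h3 : ∑ n ∈ Ico U R, (1 / n : ℝ) * ‖∑ f ∈ S, T f * f n‖ ^ 2 ≤
      ∑ f ∈ S, ∑ g ∈ S, ‖T f‖ * ‖T g‖ *
        ((if f = g then ∑ n ∈ Ico U R, (1 / n : ℝ) else 0) + 13 * (Q : ℝ) ^ 2 / U) := by
    refine (le_abs_self _).trans ?_
    rw [← Real.norm_eq_abs, ← Complex.norm_real, h1]
    refine (norm_sum_le _ _).trans (sum_le_sum fun f hf => (norm_sum_le _ _).trans
      (sum_le_sum fun g hg => ?_))
    rw [norm_mul, norm_mul, Complex.norm_conj]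
    exact mul_le_mul_of_nonneg_left (h2 f hf g hg) (by positivity)
  refine h3.trans ?_
  have h4 : ∑ f ∈ S, ∑ g ∈ S, ‖T f‖ * ‖T g‖ *
        ((if f = g then ∑ n ∈ Ico U R, (1 / n : ℝ) else 0) + 13 * (Q : ℝ) ^ 2 / U) =
      (∑ n ∈ Ico U R, (1 / n : ℝ)) * ∑ f ∈ S, ‖T f‖ ^ 2 +
        13 * (Q : ℝ) ^ 2 / U * (∑ f ∈ S, ‖T f‖) ^ 2 := by
    simp_rw [mul_add, sum_add_distrib]
    congr 1
    · rw [mul_sum]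
      refine sum_congr rfl fun f hf => ?_
      simp only [mul_ite, mul_zero]
      rw [sum_ite_eq S f, if_pos hf]; ring
    · simp_rw [← sum_mul]
      rw [← sum_mul_sum, ← sq, mul_comm]
  rw [h4, add_mul]
  have h5 : (∑ f ∈ S, ‖T f‖) ^ 2 ≤ S.card * ∑ f ∈ S, ‖T f‖ ^ 2 := sq_sum_le_card_mul_sum_sq
  have h6 : (S.card : ℝ) ≤ (Q : ℝ) ^ 2 := by exact_mod_cast card_primitiveFamily_le Q
  have h7 : (Q : ℝ) ^ 4 ≤ U := by exact_mod_cast hQU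
  have h8 : 0 ≤ ∑ f ∈ S, ‖T f‖ ^ 2 := sum_nonneg fun f _ => by positivity
  refine add_le_add le_rfl ?_
  calc 13 * (Q : ℝ) ^ 2 / U * (∑ f ∈ S, ‖T f‖) ^ 2 ≤
        13 * (Q : ℝ) ^ 2 / U * ((Q : ℝ) ^ 2 * ∑ f ∈ S, ‖T f‖ ^ 2) := by
        gcongr
        exact h5.trans (by gcongr)
    _ = 13 * ((Q : ℝ) ^ 4 / U) * ∑ f ∈ S, ‖T f‖ ^ 2 := by ring
    _ ≤ 13 * 1 * ∑ f ∈ S, ‖T f‖ ^ 2 := by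
        gcongr _ * ?_ * _
        rwa [div_le_one hU0]
    _ = _ := by rw [mul_one]

lemma large_sieve {Q U R : ℕ} (hU : 1 ≤ U) (hQU : Q ^ 4 ≤ U) (c : ℕ → ℂ) :
    ∑ f ∈ primitiveFamily Q, ‖∑ n ∈ Ico U R, f n * c n‖ ^ 2 ≤
      (∑ n ∈ Ico U R, (1 / n : ℝ) + 13) * ∑ n ∈ Ico U R, (n : ℝ) * ‖c n‖ ^ 2 := by
  set S := primitiveFamily Q with hS
  set T : (ℕ → ℂ) → ℂ := fun f => conj (∑ n ∈ Ico U R, f n * c n) with hT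
  set A := ∑ f ∈ S, ‖∑ n ∈ Ico U R, f n * c n‖ ^ 2 with hA
  set D := ∑ n ∈ Ico U R, (1 / n : ℝ) + 13
  have hTn : ∑ f ∈ S, ‖T f‖ ^ 2 = A := by simp only [hT, Complex.norm_conj, hA]
  have h0 : 0 ≤ A := sum_nonneg fun f _ => by positivity
  have h1 := large_sieve_dual (R := R) hU hQU T
  rw [hTn] at h1
  have h2 : (A : ℂ) = ∑ n ∈ Ico U R, c n * ∑ f ∈ S, T f * f n := by
    rw [hA, Complex.ofReal_sum]
    simp_rw [mul_sum]
    rw [sum_comm]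
    refine sum_congr rfl fun f _ => ?_
    rw [Complex.ofReal_pow, ← Complex.conj_mul', mul_sum]
    refine sum_congr rfl fun n _ => ?_
    simp only [hT]; ring
  have h3 : A ≤ ∑ n ∈ Ico U R, (√(n : ℝ) * ‖c n‖) * (√(1 / n : ℝ) * ‖∑ f ∈ S, T f * f n‖) := by
    calc A = ‖(A : ℂ)‖ := by rw [Complex.norm_real, Real.norm_of_nonneg h0]
      _ ≤ _ := by
        rw [h2]
        refine (norm_sum_le _ _).trans (sum_le_sum fun n hn => le_of_eq ?_)
        have hn0 : (0 : ℝ) < n := by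
          have := (mem_Ico.mp hn).1
          exact_mod_cast hU.trans this
        have : √(n : ℝ) * √(1 / n : ℝ) = 1 := by
          rw [← Real.sqrt_mul hn0.le, mul_one_div_cancel hn0.ne', Real.sqrt_one]
        rw [norm_mul]
        calc _ = (√(n : ℝ) * √(1 / n : ℝ)) * (‖c n‖ * ‖∑ f ∈ S, T f * f n‖) := by rw [this, one_mul]
          _ = _ := by ring
  have h4 := sum_mul_sq_le_sq_mul_sq (Ico U R) (fun n : ℕ => √(n : ℝ) * ‖c n‖)
    (fun n : ℕ => √(1 / n : ℝ) * ‖∑ f ∈ S, T f * f n‖)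
  have h5 : ∑ n ∈ Ico U R, (√(n : ℝ) * ‖c n‖) ^ 2 = ∑ n ∈ Ico U R, (n : ℝ) * ‖c n‖ ^ 2 :=
    sum_congr rfl fun n _ => by rw [mul_pow, Real.sq_sqrt (Nat.cast_nonneg n)]
  have h6 : ∑ n ∈ Ico U R, (√(1 / n : ℝ) * ‖∑ f ∈ S, T f * f n‖) ^ 2 =
      ∑ n ∈ Ico U R, (1 / n : ℝ) * ‖∑ f ∈ S, T f * f n‖ ^ 2 :=
    sum_congr rfl fun n _ => by rw [mul_pow, Real.sq_sqrt (by positivity)]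
  rw [h5, h6] at h4
  set E := ∑ n ∈ Ico U R, (n : ℝ) * ‖c n‖ ^ 2
  have hE : 0 ≤ E := sum_nonneg fun n _ => by positivity
  have h7 : A * A ≤ (D * E) * A := by
    calc A * A ≤ (∑ n ∈ Ico U R, (√(n : ℝ) * ‖c n‖) * (√(1 / n : ℝ) * ‖∑ f ∈ S, T f * f n‖)) ^ 2 := by
          rw [← sq]; gcongr
      _ ≤ E * (D * A) := h4.trans (by gcongr)
      _ = _ := by ring
  rcases h0.eq_or_lt with h | h
  · rw [← h]
    have hD : 0 ≤ D := add_nonneg (sum_nonneg fun n _ => by positivity) (by norm_num)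
    positivity
  · exact le_of_mul_le_mul_right h7 h

lemma twisted_convolution_sum_eq {f : ℕ → ℂ} (hf : ∀ a b, f (a * b) = f a * f b) {L : ℝ} (hL : 0 < L)
    (α β : ArithmeticFunction ℝ) :
    ∑ n ∈ Ico 1 (bumpLength L), f n * (((α * β) n * bumpWeight 0 L (Real.log n) / n : ℝ) : ℂ) =
      ∑ a ∈ Ico 1 (bumpLength L), ∑ b ∈ Ico 1 (bumpLength L), f a * ((α a / a : ℝ) : ℂ) *
        (f b * ((β b * bumpWeight 0 L (Real.log a + Real.log b) / b : ℝ) : ℂ)) := by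
  rw [← sum_divisorsAntidiagonal_eq_sum_sum (F := fun a b => f a * ((α a / a : ℝ) : ℂ) *
        (f b * ((β b * bumpWeight 0 L (Real.log a + Real.log b) / b : ℝ) : ℂ))) ?_ le_rfl le_rfl]
  · refine sum_congr rfl fun n _ => ?_
    rw [ArithmeticFunction.mul_apply, sum_mul, sum_div, Complex.ofReal_sum, mul_sum]
    refine sum_congr rfl fun x hx => ?_
    obtain ⟨h2, h3⟩ := Nat.mem_divisorsAntidiagonal.mp hx
    rw [← h2] at h3 ⊢
    obtain ⟨h4, h5⟩ := mul_ne_zero_iff.mp h3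
    rw [hf, Nat.cast_mul, Real.log_mul (by exact_mod_cast h4) (by exact_mod_cast h5)]
    push_cast
    field_simp
  · intro a b ha hb hab
    rw [bumpWeight_log_add_log_eq_zero hL ha hb (Or.inr hab)]
    simp

lemma typeI_sum_bound {f : ℕ → ℂ} (hf : ∀ a b, f (a * b) = f a * f b) {L r P : ℝ} (hL : 0 < L)
    (hr : BoundedSums r f) {α β : ArithmeticFunction ℝ} {Y : ℕ} (hY : (Y : ℝ) ≤ Real.exp (L / 4))
    (hα : ∀ a, |α a| ≤ a) (hα0 : ∀ a, Y < a → α a = 0)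
    (hβ : ∀ a : ℕ, 1 ≤ a → ∃ φ φ' : ℝ → ℝ, (∀ t, HasDerivAt φ (φ' t) t) ∧
      (∀ t, 0 ≤ t → |φ t| ≤ P) ∧ (∀ t, 0 ≤ t → |φ' t| ≤ P) ∧
      ∀ b : ℕ, 1 ≤ b → φ (Real.log b) = β b * bumpWeight 0 L (Real.log a + Real.log b)) :
    ‖∑ n ∈ Ico 1 (bumpLength L), f n * (((α * β) n * bumpWeight 0 L (Real.log n) / n : ℝ) : ℂ)‖ ≤
      13 * r * P * Real.exp (-(1 / 8 * L)) := by
  have hr0 := hr.nonneg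
  obtain ⟨_, _, _, hP1, _⟩ := hβ 1 le_rfl
  have hP : 0 ≤ P := (abs_nonneg _).trans (hP1 0 le_rfl)
  set c := ⌈Real.exp (3 / 4 * L)⌉₊ with hc
  have hcL : Real.exp (3 / 4 * L) ≤ c := Nat.le_ceil _
  have hc1 : 1 ≤ c := Nat.one_le_iff_ne_zero.mpr (Nat.ceil_pos.mpr (Real.exp_pos _)).ne'
  rw [twisted_convolution_sum_eq hf hL]
  have h1 : ∀ a ∈ Ico 1 (bumpLength L), ‖∑ b ∈ Ico 1 (bumpLength L), f a * ((α a / a : ℝ) : ℂ) *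
        (f b * ((β b * bumpWeight 0 L (Real.log a + Real.log b) / b : ℝ) : ℂ))‖ ≤
        if a ≤ Y then 13 * r * P / √(c : ℝ) else 0 := by
    intro a ha
    have ha1 := (mem_Ico.mp ha).1
    split_ifs with haY
    · obtain ⟨φ, φ', hφ, hφ1, hφ2, hφ3⟩ := hβ a ha1
      have h2 := hr.norm_smooth_tail_le hφ hφ1 hφ2 hc1 (fun m hm hmc => by
        rw [hφ3 m hm, bumpWeight_log_add_log_eq_zero hL ha1 hm (Or.inl ?_), mul_zero]
        have h3 : (m : ℝ) < Real.exp (3 / 4 * L) := Nat.lt_ceil.mp hmc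
        have h4 : (a : ℝ) ≤ Real.exp (L / 4) := le_trans (by exact_mod_cast haY) hY
        calc (a * m : ℝ) ≤ Real.exp (L / 4) * m := by gcongr
          _ < Real.exp (L / 4) * Real.exp (3 / 4 * L) := by gcongr
          _ = Real.exp L := by rw [← Real.exp_add]; ring_nf) (bumpLength L)
      rw [← mul_sum, norm_mul]
      have h5 : ‖f a * ((α a / a : ℝ) : ℂ)‖ ≤ 1 := by
        rw [norm_mul, Complex.norm_real, Real.norm_eq_abs, abs_div, Nat.abs_cast]
        exact mul_le_one₀ (hr.1 a) (by positivity) (div_le_one_of_le₀ (hα a) (Nat.cast_nonneg a))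
      have h6 : ∑ b ∈ Ico 1 (bumpLength L),
          f b * ((β b * bumpWeight 0 L (Real.log a + Real.log b) / b : ℝ) : ℂ) =
          ∑ b ∈ Ico 1 (bumpLength L), f b * ((φ (Real.log b) / b : ℝ) : ℂ) :=
        sum_congr rfl fun b hb => by rw [hφ3 b (mem_Ico.mp hb).1]
      rw [h6]
      exact (mul_le_of_le_one_left (norm_nonneg _) h5).trans h2
    · rw [hα0 a (by omega)]
      simp
  refine (norm_sum_le_of_le _ h1).trans ?_
  rw [← sum_filter, sum_const, nsmul_eq_mul]
  have h2 : (((Ico 1 (bumpLength L)).filter (fun a => a ≤ Y)).card : ℝ) ≤ Real.exp (L / 4) := by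
    refine le_trans ?_ hY
    have : ((Ico 1 (bumpLength L)).filter (fun a => a ≤ Y)) ⊆ Icc 1 Y := by
      intro a; simp only [mem_filter, mem_Ico, mem_Icc]; omega
    have := card_le_card this
    rw [Nat.card_Icc] at this
    exact_mod_cast (by omega)
  have hs : Real.exp (3 / 8 * L) ≤ √(c : ℝ) := by
    apply Real.le_sqrt_of_sq_le
    rw [← Real.exp_nat_mul]
    refine le_trans (le_of_eq ?_) hcL
    congr 1; push_cast; ring
  calc _ ≤ Real.exp (L / 4) * (13 * r * P / Real.exp (3 / 8 * L)) := by gcongr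
    _ = 13 * r * P * (Real.exp (L / 4) / Real.exp (3 / 8 * L)) := by ring
    _ = _ := by rw [← Real.exp_sub]; ring_nf

lemma exists_typeI_kernel_bound : ∃ B : ℝ, 1 ≤ B ∧ ∀ L : ℝ, 1 ≤ L →
    ∀ β : ArithmeticFunction ℝ, (β = ArithmeticFunction.log ∨ β = ArithmeticFunction.zeta) →
    ∀ a : ℕ, 1 ≤ a → ∃ φ φ' : ℝ → ℝ, (∀ t, HasDerivAt φ (φ' t) t) ∧
      (∀ t, 0 ≤ t → |φ t| ≤ B * L) ∧ (∀ t, 0 ≤ t → |φ' t| ≤ B * L) ∧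
      ∀ b : ℕ, 1 ≤ b → φ (Real.log b) = β b * bumpWeight 0 L (Real.log a + Real.log b) := by
  obtain ⟨B, hB, h⟩ := exists_mul_bumpWeight_bound 0
  obtain ⟨D, hD, h'⟩ := exists_mul_bumpWeight_bound 1
  refine ⟨B + D, by linarith, fun L hL β hβ a ha => ?_⟩
  have hL0 : 0 < L := by linarith
  obtain ⟨b1, b2, -⟩ := h L hL0
  obtain ⟨d1, d2, -⟩ := h' L hL0
  have hs : 0 ≤ Real.log a := Real.log_natCast_nonneg a
  have hw : ∀ t, HasDerivAt (fun t => bumpWeight 0 L (Real.log a + t))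
      (bumpWeight 1 L (Real.log a + t)) t := by
    intro t
    have := (hasDerivAt_bumpWeight 0 L (Real.log a + t)).comp t ((hasDerivAt_id t).const_add _)
    rw [mul_one] at this
    exact this
  have e1 : ∀ t, |bumpWeight 0 L t| ≤ B := fun t => by simpa using b1 t
  have e2 : ∀ t, |t * bumpWeight 0 L t| ≤ B * L := fun t => by simpa using b2 t
  have e3 : ∀ t, |bumpWeight 1 L t| ≤ D := fun t => (d1 t).trans (by
    rw [pow_one]; exact div_le_self (by linarith) hL)
  have e4 : ∀ t, |t * bumpWeight 1 L t| ≤ D := fun t => (d2 t).trans (le_of_eq (by field_simp))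
  have e5 : ∀ i t, 0 ≤ t → |t * bumpWeight i L (Real.log a + t)| ≤
      |(Real.log a + t) * bumpWeight i L (Real.log a + t)| := by
    intro i t ht
    rw [abs_mul, abs_mul, abs_of_nonneg ht, abs_of_nonneg (add_nonneg hs ht)]
    gcongr; linarith
  rcases hβ with rfl | rfl
  · refine ⟨fun t => t * bumpWeight 0 L (Real.log a + t), fun t => bumpWeight 0 L (Real.log a + t) +
      t * bumpWeight 1 L (Real.log a + t), fun t => ?_, fun t ht => ?_, fun t ht => ?_, fun b hb => ?_⟩
    · have := (hasDerivAt_id t).mul (hw t)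
      rw [id, one_mul] at this
      exact this
    · refine ((e5 0 t ht).trans (e2 _)).trans ?_
      gcongr; linarith
    · refine (abs_add_le _ _).trans ((add_le_add (e1 _) ((e5 1 t ht).trans (e4 _))).trans ?_)
      nlinarith
    · rw [ArithmeticFunction.log_apply]
  · refine ⟨_, _, hw, fun t _ => (e1 _).trans (by nlinarith), fun t _ => (e3 _).trans (by nlinarith),
      fun b hb => ?_⟩
    simp [ArithmeticFunction.zeta_apply, show b ≠ 0 by omega]

open ArithmeticFunction (moebius)

/-- The restriction of an arithmetic function to the integers up to `U`. -/
def truncateAt (U : ℕ) (g : ArithmeticFunction ℝ) : ArithmeticFunction ℝ :=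
  ⟨fun n => if n ≤ U then g n else 0, by simp⟩

lemma truncateAt_apply (U : ℕ) (g : ArithmeticFunction ℝ) (n : ℕ) :
    truncateAt U g n = if n ≤ U then g n else 0 := rfl

lemma ArithmeticFunction.real_sub_apply (f g : ArithmeticFunction ℝ) (n : ℕ) :
    (f - g) n = f n - g n := by
  rw [sub_eq_add_neg, ArithmeticFunction.add_apply, ArithmeticFunction.neg_apply, sub_eq_add_neg]

lemma vaughan_identity (F M : ArithmeticFunction ℝ) :
    vonMangoldt = F + M * ArithmeticFunction.log - M * F * (ArithmeticFunction.zeta : ArithmeticFunction ℝ)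
      + (vonMangoldt - F) * (((moebius : ArithmeticFunction ℝ) - M) *
        (ArithmeticFunction.zeta : ArithmeticFunction ℝ)) := by
  have h1 := ArithmeticFunction.vonMangoldt_mul_zeta
  have h2 := ArithmeticFunction.coe_moebius_mul_coe_zeta (R := ℝ)
  linear_combination (F - vonMangoldt) * h2 + M * h1

lemma abs_truncateAt_moebius_le (U a : ℕ) : |truncateAt U (moebius : ArithmeticFunction ℝ) a| ≤ 1 := by
  rw [truncateAt_apply]
  split_ifs
  · rw [ArithmeticFunction.intCoe_apply]
    exact_mod_cast ArithmeticFunction.abs_moebius_le_one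
  · simp

lemma truncateAt_vonMangoldt_nonneg (U a : ℕ) : 0 ≤ truncateAt U vonMangoldt a := by
  rw [truncateAt_apply]; split_ifs
  · exact ArithmeticFunction.vonMangoldt_nonneg
  · exact le_rfl

lemma truncateAt_vonMangoldt_le (U a : ℕ) : truncateAt U vonMangoldt a ≤ vonMangoldt a := by
  rw [truncateAt_apply]; split_ifs
  · exact le_rfl
  · exact ArithmeticFunction.vonMangoldt_nonneg

lemma abs_moebius_sub_truncateAt_le (U a : ℕ) :
    |((moebius : ArithmeticFunction ℝ) - truncateAt U (moebius : ArithmeticFunction ℝ)) a| ≤ 1 := by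
  rw [ArithmeticFunction.real_sub_apply, truncateAt_apply]
  split_ifs
  · simp
  · rw [sub_zero, ArithmeticFunction.intCoe_apply]
    exact_mod_cast ArithmeticFunction.abs_moebius_le_one

lemma abs_truncated_convolution_le (U a : ℕ) :
    |(truncateAt U (moebius : ArithmeticFunction ℝ) * truncateAt U vonMangoldt) a| ≤ a := by
  rcases Nat.eq_zero_or_pos a with rfl | ha
  · simp
  rw [ArithmeticFunction.mul_apply]
  calc _ ≤ ∑ x ∈ a.divisorsAntidiagonal, vonMangoldt x.2 := by
        refine (abs_sum_le_sum_abs _ _).trans (sum_le_sum fun x _ => ?_)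
        rw [abs_mul, abs_of_nonneg (truncateAt_vonMangoldt_nonneg U _)]
        exact (mul_le_of_le_one_left (truncateAt_vonMangoldt_nonneg U _)
          (abs_truncateAt_moebius_le U _)).trans (truncateAt_vonMangoldt_le U _)
    _ = Real.log a := by
        rw [Nat.sum_divisorsAntidiagonal' (fun _ d => vonMangoldt d),
          ArithmeticFunction.vonMangoldt_sum]
    _ ≤ a := by
        have := Real.log_le_sub_one_of_pos (show (0 : ℝ) < a by exact_mod_cast ha)
        linarith

lemma truncated_convolution_eq_zero {U a : ℕ} (ha : U ^ 2 < a) (g h : ArithmeticFunction ℝ) :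
    (truncateAt U g * truncateAt U h) a = 0 := by
  rw [ArithmeticFunction.mul_apply]
  refine sum_eq_zero fun x hx => ?_
  have h1 := (Nat.mem_divisorsAntidiagonal.mp hx).1
  rw [truncateAt_apply, truncateAt_apply]
  split_ifs with h2 h3 <;> try simp
  exfalso
  have := Nat.mul_le_mul h2 h3
  rw [h1, ← sq] at this
  omega

lemma moebius_tail_mul_zeta_eq_zero {U n : ℕ} (hn : n ≤ U) :
    (((moebius : ArithmeticFunction ℝ) - truncateAt U (moebius : ArithmeticFunction ℝ)) *
      (ArithmeticFunction.zeta : ArithmeticFunction ℝ)) n = 0 := by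
  rw [ArithmeticFunction.coe_mul_zeta_apply]
  refine sum_eq_zero fun d hd => ?_
  rw [ArithmeticFunction.real_sub_apply, truncateAt_apply, if_pos ((Nat.divisor_le hd).trans hn), sub_self]

lemma abs_moebius_tail_mul_zeta_le (U n : ℕ) :
    |(((moebius : ArithmeticFunction ℝ) - truncateAt U (moebius : ArithmeticFunction ℝ)) *
      (ArithmeticFunction.zeta : ArithmeticFunction ℝ)) n| ≤ n.divisors.card := by
  rw [ArithmeticFunction.coe_mul_zeta_apply]
  refine (abs_sum_le_sum_abs _ _).trans ?_
  refine (sum_le_sum fun d _ => abs_moebius_sub_truncateAt_le U d).trans ?_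
  simp

lemma sum_card_divisors_mul_le {w : ℕ → ℝ} (hw : ∀ n, 0 ≤ w n) (N : ℕ) :
    ∑ n ∈ Ico 1 N, (n.divisors.card : ℝ) * w n ≤ ∑ a ∈ Ico 1 N, ∑ b ∈ Ico 1 N, w (a * b) := by
  have h1 := sum_divisorsAntidiagonal_eq_sum_sum (N := N) (A := N) (B := N)
    (F := fun a b => if a * b < N then w (a * b) else 0)
    (fun a b _ _ h => if_neg (by omega)) le_rfl le_rfl
  have h2 : ∑ n ∈ Ico 1 N, (n.divisors.card : ℝ) * w n = ∑ n ∈ Ico 1 N,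
      ∑ x ∈ n.divisorsAntidiagonal, if x.1 * x.2 < N then w (x.1 * x.2) else 0 := by
    refine sum_congr rfl fun n hn => ?_
    rw [Nat.sum_divisorsAntidiagonal (fun a b => if a * b < N then w (a * b) else 0),
      ← nsmul_eq_mul, ← sum_const]
    refine sum_congr rfl fun d hd => ?_
    rw [Nat.mul_div_cancel' (Nat.dvd_of_mem_divisors hd), if_pos (mem_Ico.mp hn).2]
  rw [h2, h1]
  refine sum_le_sum fun a _ => sum_le_sum fun b _ => ?_
  split_ifs
  · exact le_rfl
  · exact hw _

lemma sum_card_divisors_sq_div_le (N : ℕ) :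
    ∑ n ∈ Ico 1 N, (n.divisors.card : ℝ) ^ 2 / n ≤ (∑ n ∈ Ico 1 N, (1 / n : ℝ)) ^ 4 := by
  have h1 : ∑ n ∈ Ico 1 N, (n.divisors.card : ℝ) / n ≤ (∑ n ∈ Ico 1 N, (1 / n : ℝ)) ^ 2 := by
    have := sum_card_divisors_mul_le (w := fun n => 1 / (n : ℝ)) (fun n => by positivity) N
    rw [sq, sum_mul_sum]
    simp only [mul_one_div] at this
    refine this.trans (le_of_eq ?_)
    refine sum_congr rfl fun a _ => sum_congr rfl fun b _ => ?_
    push_cast; field_simp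
  have h2 := sum_card_divisors_mul_le (w := fun n => (n.divisors.card : ℝ) / n)
    (fun n => by positivity) N
  calc _ = ∑ n ∈ Ico 1 N, (n.divisors.card : ℝ) * ((n.divisors.card : ℝ) / n) :=
        sum_congr rfl fun n _ => by ring
    _ ≤ ∑ a ∈ Ico 1 N, ∑ b ∈ Ico 1 N, ((a * b).divisors.card : ℝ) / (a * b : ℕ) := h2
    _ ≤ ∑ a ∈ Ico 1 N, ∑ b ∈ Ico 1 N, ((a.divisors.card : ℝ) / a) * ((b.divisors.card : ℝ) / b) := by
        refine sum_le_sum fun a _ => sum_le_sum fun b _ => ?_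
        rw [div_mul_div_comm, Nat.cast_mul]
        gcongr
        rw [Nat.divisors_mul]
        exact_mod_cast Finset.card_mul_le
    _ = (∑ n ∈ Ico 1 N, (n.divisors.card : ℝ) / n) ^ 2 := by rw [sq, sum_mul_sum]
    _ ≤ ((∑ n ∈ Ico 1 N, (1 / n : ℝ)) ^ 2) ^ 2 := by
        gcongr
    _ = _ := by ring

lemma sum_mul_bumpWeight_eq_sum_mul_sum {L : ℝ} (hL : 0 < L) {u : ℕ} (hu : 1 ≤ u) {x y : ℕ → ℂ}
    (hx : ∀ a < u, x a = 0) (hy : ∀ b < u, y b = 0) :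
    ∑ a ∈ Ico 1 (bumpLength L), ∑ b ∈ Ico 1 (bumpLength L), x a * (y b *
        (bumpWeight 0 L (Real.log a + Real.log b) : ℂ)) =
      -∑ k ∈ Ico 1 (bumpLength L), (∑ a ∈ Ico u (k + 1), x a) * ∑ b ∈ Ico u (bumpLength L), y b *
        ((bumpWeight 0 L (Real.log (k + 1 : ℕ) + Real.log b) -
          bumpWeight 0 L (Real.log k + Real.log b) : ℝ) : ℂ) := by
  have h0 : ∀ a ∈ Ico 1 (bumpLength L), ∀ b ∈ Ico 1 (bumpLength L),
      (bumpWeight 0 L (Real.log a + Real.log b) : ℂ) = -∑ k ∈ Ico 1 (bumpLength L), if a ≤ k then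
        ((bumpWeight 0 L (Real.log (k + 1 : ℕ) + Real.log b) -
          bumpWeight 0 L (Real.log k + Real.log b) : ℝ) : ℂ) else 0 := by
    intro a ha b hb
    rw [mem_Ico] at ha hb
    rw [← sum_filter, show (Ico 1 (bumpLength L)).filter (fun k => a ≤ k) = Ico a (bumpLength L) by
      ext k; simp only [mem_filter, mem_Ico]; omega, ← Complex.ofReal_sum,
      sum_Ico_sub (fun k : ℕ => bumpWeight 0 L (Real.log k + Real.log b)) ha.2.le,
      bumpWeight_log_add_log_eq_zero hL (one_le_bumpLength L) hb.1
        (Or.inr (Nat.le_mul_of_pos_right _ hb.1))]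
    simp
  have hz : ∀ (z : ℕ → ℂ) (R : ℕ), (∀ a < u, z a = 0) → ∑ a ∈ Ico 1 R, z a = ∑ a ∈ Ico u R, z a := by
    intro z R hz
    symm
    apply sum_subset (Ico_subset_Ico_left hu)
    intro a ha ha'
    exact hz a (by simp only [mem_Ico] at ha ha'; omega)
  calc _ = ∑ a ∈ Ico 1 (bumpLength L), ∑ b ∈ Ico 1 (bumpLength L), -∑ k ∈ Ico 1 (bumpLength L),
        (if a ≤ k then x a else 0) * (y b *
          ((bumpWeight 0 L (Real.log (k + 1 : ℕ) + Real.log b) -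
          bumpWeight 0 L (Real.log k + Real.log b) : ℝ) : ℂ)) := by
        refine sum_congr rfl fun a ha => sum_congr rfl fun b hb => ?_
        rw [h0 a ha b hb, mul_neg, mul_neg, mul_sum, mul_sum]
        congr 1
        refine sum_congr rfl fun k _ => ?_
        split_ifs <;> simp
    _ = -∑ k ∈ Ico 1 (bumpLength L), ∑ a ∈ Ico 1 (bumpLength L), ∑ b ∈ Ico 1 (bumpLength L),
        (if a ≤ k then x a else 0) * (y b *
          ((bumpWeight 0 L (Real.log (k + 1 : ℕ) + Real.log b) -
          bumpWeight 0 L (Real.log k + Real.log b) : ℝ) : ℂ)) := by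
        simp only [sum_neg_distrib]
        congr 1
        rw [sum_comm' (t' := Ico 1 (bumpLength L)) (s' := fun _ => Ico 1 (bumpLength L)) (by tauto)]
        rw [sum_comm]
        refine (sum_congr rfl fun a _ => sum_comm).trans ?_
        rw [sum_comm]
    _ = _ := by
        congr 1
        refine sum_congr rfl fun k hk => ?_
        rw [← sum_mul_sum]
        congr 1
        · rw [← sum_filter, show (Ico 1 (bumpLength L)).filter (fun a => a ≤ k) = Ico 1 (k + 1) by
            ext a; simp only [mem_filter, mem_Ico] at hk ⊢; omega]
          exact hz _ _ hx
        · exact hz _ _ fun b hb => by rw [hy b hb, zero_mul]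

lemma exists_typeII_bound : ∃ C : ℝ, 1 ≤ C ∧ ∀ L : ℝ, 1 ≤ L → ∀ (Q U : ℕ), Q ^ 4 ≤ U →
    ∀ g h : ArithmeticFunction ℝ, (∀ n ≤ U, g n = 0) → (∀ n ≤ U, h n = 0) →
    (∀ n, |g n| ≤ vonMangoldt n) → (∀ n, |h n| ≤ n.divisors.card) →
    ∑ f ∈ primitiveFamily Q, ‖∑ n ∈ Ico 1 (bumpLength L),
      f n * (((g * h) n * bumpWeight 0 L (Real.log n) / n : ℝ) : ℂ)‖ ≤ C * L ^ 6 := by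
  obtain ⟨K, hK, hΛ⟩ := exists_sum_vonMangoldt_div_le
  obtain ⟨B, hB, hG⟩ := exists_bumpWeight_bound 1
  refine ⟨204 * K + 17408 * B ^ 2, by nlinarith, fun L hL Q U hQU g h hg0 hh0 hg hh => ?_⟩
  have hL0 : 0 < L := by linarith
  set N := bumpLength L with hN
  have hlogN : Real.log N ≤ 3 * L := log_bumpLength_le hL
  have hinv : ∑ n ∈ Ico 1 N, (1 / n : ℝ) ≤ 4 * L := by
    have := sum_Ico_one_inv_le (b := N) (x := N) le_rfl (by exact_mod_cast one_le_bumpLength L)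
    linarith
  have hsub : ∀ R ≤ N, Ico (U + 1) R ⊆ Ico 1 N := fun R hR a ha => by
    simp only [mem_Ico] at ha ⊢; omega
  have hD : ∀ R ≤ N, ∑ n ∈ Ico (U + 1) R, (1 / n : ℝ) + 13 ≤ 17 * L := fun R hR => by
    have := sum_le_sum_of_subset_of_nonneg (f := fun n : ℕ => (1 / n : ℝ)) (hsub R hR)
      (fun _ _ _ => by positivity)
    linarith
  have hA : ∀ k ∈ Ico 1 N, ∑ f ∈ primitiveFamily Q,
      ‖∑ a ∈ Ico (U + 1) (k + 1), f a * ((g a / a : ℝ) : ℂ)‖ ^ 2 ≤ 51 * K * L ^ 3 := by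
    intro k hk
    have hkN : k + 1 ≤ N := (mem_Ico.mp hk).2
    refine (large_sieve (by omega) (by omega) _).trans ?_
    have h1 : ∑ n ∈ Ico (U + 1) (k + 1), (n : ℝ) * ‖((g n / n : ℝ) : ℂ)‖ ^ 2 ≤ 3 * L * (K * L) := by
      calc _ ≤ ∑ n ∈ Ico (U + 1) (k + 1), 3 * L * (vonMangoldt n / n) := by
            refine sum_le_sum fun n hn => ?_
            have hn' := mem_Ico.mp (hsub _ hkN hn)
            have hn0 : (0 : ℝ) < n := by exact_mod_cast hn'.1
            have h2 : vonMangoldt n ≤ 3 * L := ArithmeticFunction.vonMangoldt_le_log.trans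
              ((Real.log_le_log hn0 (by exact_mod_cast hn'.2.le)).trans hlogN)
            have h3 : (n : ℝ) * ‖((g n / n : ℝ) : ℂ)‖ ^ 2 = |g n| * |g n| / n := by
              rw [Complex.norm_real, Real.norm_eq_abs, abs_div, Nat.abs_cast]
              field_simp
            rw [h3, ← mul_div_assoc]
            have h4 := hg n
            gcongr
            · exact h4.trans h2
        _ ≤ ∑ n ∈ Ico 1 N, 3 * L * (vonMangoldt n / n) :=
            sum_le_sum_of_subset_of_nonneg (hsub _ hkN) fun n _ _ => by
              have := ArithmeticFunction.vonMangoldt_nonneg (n := n)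
              positivity
        _ ≤ _ := by
            rw [← mul_sum]
            exact mul_le_mul_of_nonneg_left (hΛ L hL) (by positivity)
    calc _ ≤ 17 * L * (3 * L * (K * L)) :=
          mul_le_mul (hD _ hkN) h1 (sum_nonneg fun n _ => by positivity) (by positivity)
      _ = _ := by ring
  have hBk : ∀ k ∈ Ico 1 N, ∑ f ∈ primitiveFamily Q,
      ‖∑ b ∈ Ico (U + 1) N, f b * (((h b / b : ℝ) : ℂ) *
        ((bumpWeight 0 L (Real.log (k + 1 : ℕ) + Real.log b) -
          bumpWeight 0 L (Real.log k + Real.log b) : ℝ) : ℂ))‖ ^ 2 ≤ 4352 * B ^ 2 * L ^ 5 / k ^ 2 := by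
    intro k hk
    have hk1 := (mem_Ico.mp hk).1
    have hk0 : (0 : ℝ) < k := by exact_mod_cast hk1
    refine (large_sieve (by omega) (by omega) _).trans ?_
    have h1 : ∑ n ∈ Ico (U + 1) N, (n : ℝ) * ‖((h n / n : ℝ) : ℂ) *
        ((bumpWeight 0 L (Real.log (k + 1 : ℕ) + Real.log n) -
          bumpWeight 0 L (Real.log k + Real.log n) : ℝ) : ℂ)‖ ^ 2 ≤ (B / k) ^ 2 * (4 * L) ^ 4 := by
      calc _ ≤ ∑ n ∈ Ico (U + 1) N, (B / k) ^ 2 * ((n.divisors.card : ℝ) ^ 2 / n) := by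
            refine sum_le_sum fun n hn => ?_
            have hn' := mem_Ico.mp (hsub _ le_rfl hn)
            have hn0 : (0 : ℝ) < n := by exact_mod_cast hn'.1
            have h2 := abs_log_step_le_of_hasDerivAt (B := B) (m := k)
              (φ := fun t => bumpWeight 0 L (t + Real.log n))
              (φ' := fun t => bumpWeight 1 L (t + Real.log n))
              (fun t => by
                have := (hasDerivAt_bumpWeight 0 L (t + Real.log n)).comp t
                  ((hasDerivAt_id t).add_const _)
                rw [mul_one] at this
                exact this)
              (fun t _ => (hG L hL0 _).trans (by
                rw [pow_one]; exact div_le_self (by linarith) hL)) hk1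
            rw [norm_mul, Complex.norm_real, Complex.norm_real, Real.norm_eq_abs, Real.norm_eq_abs,
              abs_div, Nat.abs_cast, mul_pow]
            calc (n : ℝ) * ((|h n| / n) ^ 2 * _) ≤ (n : ℝ) * ((n.divisors.card / n) ^ 2 * (B / k) ^ 2) := by
                  gcongr
                  exact hh n
              _ = _ := by field_simp
        _ ≤ ∑ n ∈ Ico 1 N, (B / k) ^ 2 * ((n.divisors.card : ℝ) ^ 2 / n) :=
            sum_le_sum_of_subset_of_nonneg (hsub _ le_rfl) fun n _ _ => by positivity
        _ ≤ _ := by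
            rw [← mul_sum]
            refine mul_le_mul_of_nonneg_left ((sum_card_divisors_sq_div_le N).trans ?_) (by positivity)
            gcongr
    calc _ ≤ 17 * L * ((B / k) ^ 2 * (4 * L) ^ 4) :=
          mul_le_mul (hD _ le_rfl) h1 (sum_nonneg fun n _ => by positivity) (by positivity)
      _ = _ := by field_simp; ring
  have hf : ∀ f ∈ primitiveFamily Q, ‖∑ n ∈ Ico 1 N,
      f n * (((g * h) n * bumpWeight 0 L (Real.log n) / n : ℝ) : ℂ)‖ ≤ ∑ k ∈ Ico 1 N,
        (‖∑ a ∈ Ico (U + 1) (k + 1), f a * ((g a / a : ℝ) : ℂ)‖ ^ 2 * (1 / k) +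
        ‖∑ b ∈ Ico (U + 1) N, f b * (((h b / b : ℝ) : ℂ) *
        ((bumpWeight 0 L (Real.log (k + 1 : ℕ) + Real.log b) -
          bumpWeight 0 L (Real.log k + Real.log b) : ℝ) : ℂ))‖ ^ 2 * k) := by
    intro f hf
    obtain ⟨r, -, hr⟩ := mem_primitiveFamily.mp hf
    rw [twisted_convolution_sum_eq hr.map_mul hL0]
    have h1 := sum_mul_bumpWeight_eq_sum_mul_sum hL0 (u := U + 1) (by omega)
      (x := fun a => f a * ((g a / a : ℝ) : ℂ)) (y := fun b => f b * ((h b / b : ℝ) : ℂ))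
      (fun a ha => by simp [hg0 a (by omega)]) (fun b hb => by simp [hh0 b (by omega)])
    have h2 : ∀ a b : ℕ, f b * ((h b * bumpWeight 0 L (Real.log a + Real.log b) / b : ℝ) : ℂ) =
        f b * ((h b / b : ℝ) : ℂ) * (bumpWeight 0 L (Real.log a + Real.log b) : ℂ) := by
      intro a b; push_cast; ring
    simp only [h2]
    rw [h1, norm_neg]
    refine (norm_sum_le _ _).trans (sum_le_sum fun k hk => ?_)
    have hk0 : (0 : ℝ) < k := by exact_mod_cast (mem_Ico.mp hk).1
    simp only [mul_assoc]
    rw [norm_mul]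
    set p := ‖∑ a ∈ Ico (U + 1) (k + 1), f a * ((g a / a : ℝ) : ℂ)‖
    set q := ‖∑ b ∈ Ico (U + 1) N, f b * (((h b / b : ℝ) : ℂ) *
        ((bumpWeight 0 L (Real.log (k + 1 : ℕ) + Real.log b) -
          bumpWeight 0 L (Real.log k + Real.log b) : ℝ) : ℂ))‖
    have hp : 0 ≤ p := norm_nonneg _
    have hq : 0 ≤ q := norm_nonneg _
    have h3 : p ^ 2 * (1 / k) + q ^ 2 * k - p * q = ((p - k * q) ^ 2 + p * (k * q)) / k := by
      field_simp; ring
    have h4 : 0 ≤ ((p - k * q) ^ 2 + p * (k * q)) / k := by positivity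
    linarith
  refine (sum_le_sum hf).trans ?_
  rw [sum_comm]
  calc _ ≤ ∑ k ∈ Ico 1 N, (51 * K * L ^ 3 + 4352 * B ^ 2 * L ^ 5) * (1 / k : ℝ) := by
        refine sum_le_sum fun k hk => ?_
        have hk0 : (0 : ℝ) < k := by exact_mod_cast (mem_Ico.mp hk).1
        rw [sum_add_distrib, ← sum_mul, ← sum_mul]
        calc _ ≤ 51 * K * L ^ 3 * (1 / k) + 4352 * B ^ 2 * L ^ 5 / k ^ 2 * k :=
              add_le_add (mul_le_mul_of_nonneg_right (hA k hk) (by positivity))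
                (mul_le_mul_of_nonneg_right (hBk k hk) (by positivity))
          _ = _ := by field_simp
    _ ≤ (51 * K * L ^ 5 + 4352 * B ^ 2 * L ^ 5) * (4 * L) := by
        rw [← mul_sum]
        have : L ^ 3 ≤ L ^ 5 := pow_le_pow_right₀ hL (by norm_num)
        gcongr
    _ ≤ _ := by
        exact le_of_eq (by ring)

lemma exists_sum_twistedSum_bound : ∃ C : ℝ, 1 ≤ C ∧ ∀ L : ℝ, 1 ≤ L → ∀ Q : ℕ, (Q : ℝ) ≤ Real.exp (L / 32) →
    ∑ f ∈ primitiveFamily Q, ‖twistedSum f L 0‖ ≤ C * L ^ 6 := by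
  obtain ⟨C, hC, hII⟩ := exists_typeII_bound
  obtain ⟨B, hB, hI⟩ := exists_typeI_kernel_bound
  refine ⟨C + 26 * B, by linarith, fun L hL Q hQ => ?_⟩
  have hL0 : 0 < L := by linarith
  set U := Q ^ 4 with hU
  set M := truncateAt U (moebius : ArithmeticFunction ℝ) with hM
  set F := truncateAt U vonMangoldt with hF
  set h := ((moebius : ArithmeticFunction ℝ) - M) * (ArithmeticFunction.zeta : ArithmeticFunction ℝ) with hh
  have hQ4 : (U : ℝ) ≤ Real.exp (L / 8) := by
    rw [hU, Nat.cast_pow, show L / 8 = (4 : ℕ) * (L / 32) by push_cast; ring, Real.exp_nat_mul]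
    gcongr
  have hQ8 : ((U ^ 2 : ℕ) : ℝ) ≤ Real.exp (L / 4) := by
    rw [Nat.cast_pow, show L / 4 = (2 : ℕ) * (L / 8) by push_cast; ring, Real.exp_nat_mul]
    gcongr
  have hUU : U ≤ U ^ 2 := Nat.le_self_pow two_ne_zero U
  have hsplit : ∀ f : ℕ → ℂ, ‖twistedSum f L 0‖ ≤
      ‖∑ n ∈ Ico 1 (bumpLength L),
        f n * (((M * ArithmeticFunction.log) n * bumpWeight 0 L (Real.log n) / n : ℝ) : ℂ)‖ +
      ‖∑ n ∈ Ico 1 (bumpLength L), f n * (((M * F * (ArithmeticFunction.zeta : ArithmeticFunction ℝ)) n *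
        bumpWeight 0 L (Real.log n) / n : ℝ) : ℂ)‖ +
      ‖∑ n ∈ Ico 1 (bumpLength L),
        f n * ((((vonMangoldt - F) * h) n * bumpWeight 0 L (Real.log n) / n : ℝ) : ℂ)‖ := by
    intro f
    have h1 : twistedSum f L 0 = ∑ n ∈ Ico 1 (bumpLength L),
        f n * (((M * ArithmeticFunction.log) n * bumpWeight 0 L (Real.log n) / n : ℝ) : ℂ) -
      ∑ n ∈ Ico 1 (bumpLength L), f n * (((M * F * (ArithmeticFunction.zeta : ArithmeticFunction ℝ)) n *
        bumpWeight 0 L (Real.log n) / n : ℝ) : ℂ) +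
      ∑ n ∈ Ico 1 (bumpLength L),
        f n * ((((vonMangoldt - F) * h) n * bumpWeight 0 L (Real.log n) / n : ℝ) : ℂ) := by
      rw [← sum_sub_distrib, ← sum_add_distrib]
      refine sum_congr rfl fun n hn => ?_
      have h2 : vonMangoldt n * bumpWeight 0 L (Real.log n) = ((M * ArithmeticFunction.log) n -
          (M * F * (ArithmeticFunction.zeta : ArithmeticFunction ℝ)) n + ((vonMangoldt - F) * h) n) *
          bumpWeight 0 L (Real.log n) := by
        by_cases hnU : n ≤ U
        · rw [bumpWeight_log_eq_zero hL0 (Or.inl ?_), mul_zero, mul_zero]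
          calc (n : ℝ) ≤ U := by exact_mod_cast hnU
            _ ≤ Real.exp (L / 8) := hQ4
            _ < Real.exp L := Real.exp_lt_exp.mpr (by linarith)
        · congr 1
          conv_lhs => rw [vaughan_identity F M]
          rw [ArithmeticFunction.add_apply, ArithmeticFunction.real_sub_apply,
            ArithmeticFunction.add_apply, hF, truncateAt_apply, if_neg hnU, zero_add]
      rw [h2]
      push_cast
      ring
    rw [h1]
    refine (norm_add_le _ _).trans ?_
    gcongr
    exact norm_sub_le _ _
  have hfam : ∀ f ∈ primitiveFamily Q, ∀ α β : ArithmeticFunction ℝ,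
      (β = ArithmeticFunction.log ∨ β = ArithmeticFunction.zeta) → (∀ a, |α a| ≤ a) →
      (∀ a, U ^ 2 < a → α a = 0) →
      ‖∑ n ∈ Ico 1 (bumpLength L), f n * (((α * β) n * bumpWeight 0 L (Real.log n) / n : ℝ) : ℂ)‖ ≤
        13 * Q * (B * L) * Real.exp (-(1 / 8 * L)) := by
    intro f hf α β hβ hα hα0
    obtain ⟨r, -, hr⟩ := mem_primitiveFamily.mp hf
    exact typeI_sum_bound hr.map_mul hL0 (boundedSums_of_mem_primitiveFamily hf) hQ8 hα hα0
      (hI L hL β hβ)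
  have hsum : ∑ f ∈ primitiveFamily Q, 13 * Q * (B * L) * Real.exp (-(1 / 8 * L)) ≤ 13 * B * L := by
    rw [sum_const, nsmul_eq_mul]
    have h1 : ((primitiveFamily Q).card : ℝ) ≤ (Q : ℝ) ^ 2 := by exact_mod_cast card_primitiveFamily_le Q
    have h2 : (Q : ℝ) ^ 3 ≤ Real.exp (3 / 32 * L) := by
      rw [show 3 / 32 * L = (3 : ℕ) * (L / 32) by push_cast; ring, Real.exp_nat_mul]
      gcongr
    calc _ ≤ (Q : ℝ) ^ 2 * (13 * Q * (B * L) * Real.exp (-(1 / 8 * L))) := by gcongr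
      _ = 13 * B * L * ((Q : ℝ) ^ 3 * Real.exp (-(1 / 8 * L))) := by ring
      _ ≤ 13 * B * L * 1 := by
          gcongr
          calc _ ≤ Real.exp (3 / 32 * L) * Real.exp (-(1 / 8 * L)) := by gcongr
            _ = Real.exp (-(1 / 32 * L)) := by rw [← Real.exp_add]; ring_nf
            _ ≤ 1 := Real.exp_le_one_iff.mpr (by linarith)
      _ = _ := mul_one _
  have hM0 : ∀ a, |M a| ≤ a := by
    intro a
    rcases Nat.eq_zero_or_pos a with rfl | ha
    · simp
    · exact (abs_truncateAt_moebius_le U a).trans (by exact_mod_cast ha)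
  have hE : ∀ n ≤ U, (vonMangoldt - F) n = 0 := fun n hn => by
    rw [ArithmeticFunction.real_sub_apply, hF, truncateAt_apply, if_pos hn, sub_self]
  have hE' : ∀ n, |(vonMangoldt - F) n| ≤ vonMangoldt n := fun n => by
    rw [ArithmeticFunction.real_sub_apply, abs_of_nonneg (sub_nonneg.mpr (truncateAt_vonMangoldt_le U n))]
    linarith [truncateAt_vonMangoldt_nonneg U n]
  calc _ ≤ _ := sum_le_sum fun f _ => hsplit f
    _ ≤ 13 * B * L + 13 * B * L + C * L ^ 6 := by
        rw [sum_add_distrib, sum_add_distrib]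
        refine add_le_add (add_le_add ((sum_le_sum fun f hf => ?_).trans hsum)
          ((sum_le_sum fun f hf => ?_).trans hsum)) ?_
        · exact hfam f hf _ _ (Or.inl rfl) hM0 fun a ha => by
            rw [hM, truncateAt_apply, if_neg (by omega)]
        · exact hfam f hf _ _ (Or.inr rfl) (abs_truncated_convolution_le U) fun a ha =>
            truncated_convolution_eq_zero ha _ _
        · exact hII L hL Q U le_rfl _ _ hE (fun n hn => moebius_tail_mul_zeta_eq_zero hn) hE'
            (abs_moebius_tail_mul_zeta_le U)
    _ ≤ _ := by
        have : B * L ≤ B * L ^ 6 := by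
          gcongr
          exact le_self_pow₀ hL (by norm_num)
        linarith

/-- A smooth logarithmic weight supported on the integers between `exp L` and `exp (2 * L)`. -/
noncomputable def logWeight (L : ℝ) (n : ℕ) : ℝ := bumpWeight 0 L (Real.log n) / n

lemma logWeight_nonneg (L : ℝ) (n : ℕ) : 0 ≤ logWeight L n :=
  div_nonneg (bumpWeight_zero_nonneg _ _) (Nat.cast_nonneg n)

lemma logWeight_le (L : ℝ) (n : ℕ) : logWeight L n ≤ 1 / n :=
  div_le_div_of_nonneg_right (bumpWeight_zero_le_one _ _) (Nat.cast_nonneg n)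

lemma logWeight_zero (L : ℝ) : logWeight L 0 = 0 := by simp [logWeight]

lemma exp_le_of_logWeight_ne_zero {L : ℝ} (hL : 0 < L) {n : ℕ} (h : logWeight L n ≠ 0) :
    Real.exp L ≤ n := by
  by_contra hn
  exact h (by rw [logWeight, bumpWeight_log_eq_zero hL (Or.inl (not_le.mp hn)), zero_div])

lemma logWeight_eq_zero {L : ℝ} (hL : 0 < L) {n : ℕ} (h : bumpLength L ≤ n) : logWeight L n = 0 := by
  rw [logWeight, bumpWeight_log_eq_zero hL (Or.inr h), zero_div]

lemma sum_range_bumpLength {E : Type*} [AddCommMonoid E] (L : ℝ) {F : ℕ → E} (h : F 0 = 0) :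
    ∑ n ∈ range (bumpLength L), F n = ∑ n ∈ Ico 1 (bumpLength L), F n := by
  rw [range_eq_Ico, sum_eq_sum_Ico_succ_bot (one_le_bumpLength L), h, zero_add]

lemma le_sum_logWeight {L : ℝ} (hL : 0 < L) :
    L / 3 - 1 ≤ ∑ n ∈ range (bumpLength L), logWeight L n := by
  set a := ⌈Real.exp (4 / 3 * L)⌉₊ with ha
  set b := ⌊Real.exp (5 / 3 * L)⌋₊ with hb
  have ha1 : 1 ≤ a := Nat.one_le_iff_ne_zero.mpr (Nat.ceil_pos.mpr (Real.exp_pos _)).ne'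
  have hbE : (b : ℝ) ≤ Real.exp (5 / 3 * L) := Nat.floor_le (Real.exp_pos _).le
  have hbE' : Real.exp (5 / 3 * L) < b + 1 := Nat.lt_floor_add_one _
  have haE : Real.exp (4 / 3 * L) ≤ a := Nat.le_ceil _
  have haE' : (a : ℝ) < Real.exp (4 / 3 * L) + 1 := Nat.ceil_lt_add_one (Real.exp_pos _).le
  have hbN : b + 1 ≤ bumpLength L := by
    have : (b : ℝ) < bumpLength L := hbE.trans_lt ((Real.exp_lt_exp.mpr (by linarith)).trans
      (exp_lt_bumpLength L))
    exact_mod_cast this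
  have h1 : ∑ n ∈ Ico a (b + 1), (1 / n : ℝ) ≤ ∑ n ∈ range (bumpLength L), logWeight L n := by
    calc _ = ∑ n ∈ Ico a (b + 1), logWeight L n := by
          refine sum_congr rfl fun n hn => ?_
          have hn' := mem_Ico.mp hn
          have hn1 : (a : ℝ) ≤ n := by exact_mod_cast hn'.1
          have hn2 : (n : ℝ) ≤ b := by exact_mod_cast Nat.lt_succ_iff.mp hn'.2
          have hn0 : (0 : ℝ) < n := lt_of_lt_of_le (by exact_mod_cast ha1) hn1
          rw [logWeight, bumpWeight_zero_eq_one hL]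
          · exact (Real.le_log_iff_exp_le hn0).mpr (haE.trans hn1)
          · exact (Real.log_le_iff_le_exp hn0).mpr (hn2.trans hbE)
      _ ≤ _ := sum_le_sum_of_subset_of_nonneg (fun n hn => by
          have := mem_Ico.mp hn; exact mem_range.mpr (by omega)) fun n _ _ => logWeight_nonneg L n
  have hab : a ≤ b + 1 := Nat.ceil_le.mpr (by
    push_cast
    exact (Real.exp_le_exp.mpr (by linarith)).trans hbE'.le)
  have h2 : Real.log (b + 1 : ℕ) - Real.log a ≤ ∑ n ∈ Ico a (b + 1), (1 / n : ℝ) := by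
    rw [← sum_Ico_sub (fun n : ℕ => Real.log n) hab]
    exact sum_le_sum fun n hn => log_succ_sub_log_le (ha1.trans (mem_Ico.mp hn).1)
  have h3 : 5 / 3 * L ≤ Real.log (b + 1 : ℕ) := by
    rw [Real.le_log_iff_exp_le (by positivity)]
    push_cast
    exact hbE'.le
  have h4 : Real.log a ≤ 4 / 3 * L + 1 := by
    rw [Real.log_le_iff_le_exp (by exact_mod_cast ha1), Real.exp_add]
    have h5 : 2 ≤ Real.exp 1 := by linarith [Real.add_one_le_exp 1]
    have h6 : 1 ≤ Real.exp (4 / 3 * L) := Real.one_le_exp (by positivity)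
    nlinarith
  linarith

lemma exists_totalVariation_logWeight_le : ∃ C : ℝ, 1 ≤ C ∧ ∀ L : ℝ, 1 ≤ L →
    totalVariation (logWeight L) (bumpLength L) ≤ C * L * Real.exp (-L) := by
  obtain ⟨B, hB, hG⟩ := exists_bumpWeight_bound 1
  refine ⟨8 * (B + 1), by linarith, fun L hL => ?_⟩
  have hL0 : 0 < L := by linarith
  have hstep : ∀ n, 1 ≤ n → |logWeight L (n + 1) - logWeight L n| ≤
      (B + 1) * (2 * Real.exp (-L)) * (1 / n) := by
    intro n hn
    have hn1 : (1 : ℝ) ≤ n := by exact_mod_cast hn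
    have hn0 : (0 : ℝ) < n := by linarith
    by_cases hnL : ((n + 1 : ℕ) : ℝ) < Real.exp L
    · rw [logWeight, logWeight, bumpWeight_log_eq_zero hL0 (Or.inl hnL),
        bumpWeight_log_eq_zero hL0 (Or.inl (lt_trans (by push_cast; linarith) hnL))]
      simp
      positivity
    · push Not at hnL
      have hd : ∀ t, HasDerivAt (fun t => bumpWeight 0 L t * Real.exp (-t))
          (bumpWeight 1 L t * Real.exp (-t) + bumpWeight 0 L t * (Real.exp (-t) * -1)) t := fun t =>
        (hasDerivAt_bumpWeight 0 L t).mul ((hasDerivAt_neg t).exp)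
      have h1 := abs_log_step_le_of_hasDerivAt (B := (B + 1) * (1 / n)) hd (m := n) (fun t ht => by
        have h2 : Real.exp (-t) ≤ 1 / n := by
          rw [Real.exp_neg, one_div]
          apply inv_anti₀ hn0
          exact (Real.log_le_iff_le_exp hn0).mp ht.1
        have h3 : |bumpWeight 1 L t| ≤ B := (hG L hL0 t).trans (by
          rw [pow_one]; exact div_le_self (by linarith) hL)
        have h4 : |bumpWeight 0 L t| ≤ 1 := by
          rw [abs_of_nonneg (bumpWeight_zero_nonneg _ _)]; exact bumpWeight_zero_le_one _ _
        have h5 : |Real.exp (-t)| = Real.exp (-t) := abs_of_pos (Real.exp_pos _)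
        calc _ ≤ |bumpWeight 1 L t| * Real.exp (-t) + |bumpWeight 0 L t| * Real.exp (-t) := by
              refine (abs_add_le _ _).trans (le_of_eq ?_)
              rw [abs_mul, abs_mul, abs_mul, h5]; simp
          _ = (|bumpWeight 1 L t| + |bumpWeight 0 L t|) * Real.exp (-t) := by ring
          _ ≤ (B + 1) * (1 / n) := by gcongr) hn
      have h6 : ∀ m : ℕ, 1 ≤ m → bumpWeight 0 L (Real.log m) * Real.exp (-Real.log m) =
          logWeight L m := fun m hm => by
        rw [Real.exp_neg, Real.exp_log (by exact_mod_cast hm), logWeight, div_eq_mul_inv]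
      rw [h6 n hn, h6 (n + 1) (by omega)] at h1
      have h7 : 1 / (n : ℝ) ≤ 2 * Real.exp (-L) := by
        rw [Real.exp_neg, ← div_eq_mul_inv, div_le_div_iff₀ hn0 (Real.exp_pos L)]
        push_cast at hnL
        linarith
      calc _ ≤ (B + 1) * (1 / n) / n := h1
        _ = (B + 1) * (1 / n) * (1 / n) := by ring
        _ ≤ _ := by gcongr
  rw [totalVariation, range_eq_Ico, sum_eq_sum_Ico_succ_bot (one_le_bumpLength L)]
  have h0 : logWeight L (0 + 1) - logWeight L 0 = 0 := by
    rw [logWeight_zero, logWeight, bumpWeight_log_eq_zero hL0 (Or.inl ?_), zero_div, sub_zero]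
    simpa using hL0
  rw [h0, abs_zero, zero_add]
  have h1 : ∑ n ∈ Ico 1 (bumpLength L), (1 / n : ℝ) ≤ 4 * L := by
    have := sum_Ico_one_inv_le (b := bumpLength L) (x := bumpLength L) le_rfl
      (by exact_mod_cast one_le_bumpLength L)
    linarith [log_bumpLength_le hL]
  calc _ ≤ ∑ n ∈ Ico 1 (bumpLength L), (B + 1) * (2 * Real.exp (-L)) * (1 / n : ℝ) :=
        sum_le_sum fun n hn => hstep n (mem_Ico.mp hn).1
    _ ≤ (B + 1) * (2 * Real.exp (-L)) * (4 * L) := by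
        rw [← mul_sum]
        gcongr
    _ = _ := by ring

lemma exists_sum_vonMangoldt_logWeight_sub_le : ∃ K : ℝ, 1 ≤ K ∧ ∀ L : ℝ, 1 ≤ L →
    |∑ n ∈ range (bumpLength L), vonMangoldt n * logWeight L n -
      ∑ n ∈ range (bumpLength L), logWeight L n| ≤ K := by
  obtain ⟨K, hK, hΛ⟩ := exists_mertens
  obtain ⟨B, hB, hG⟩ := exists_bumpWeight_bound 1
  have hinv : ∀ N : ℕ, 1 ≤ N → |∑ n ∈ Ico 1 N, (1 / n : ℝ) - Real.log N| ≤ 1 := by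
    intro N hN
    have h1 := sum_Ico_one_inv_le (b := N) (x := N) le_rfl (by exact_mod_cast hN)
    have h2 : Real.log N - Real.log (1 : ℕ) ≤ ∑ n ∈ Ico 1 N, (1 / n : ℝ) := by
      rw [← sum_Ico_sub (fun n : ℕ => Real.log n) hN]
      exact sum_le_sum fun n hn => log_succ_sub_log_le (mem_Ico.mp hn).1
    rw [Nat.cast_one, Real.log_one] at h2
    rw [abs_le]
    constructor <;> linarith
  have hD : ∀ N : ℕ, 1 ≤ N → |∑ n ∈ Ico 1 N, (vonMangoldt n / n - 1 / n : ℝ)| ≤ K + 1 := by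
    intro N hN
    have h1 := abs_le.mp (hΛ N hN)
    have h2 := abs_le.mp (hinv N hN)
    rw [sum_sub_distrib, abs_le]
    constructor <;> linarith [h1.1, h1.2, h2.1, h2.2]
  have hD1 : ∀ a b : ℕ, 1 ≤ a → |∑ n ∈ Ico a b, (vonMangoldt n / n - 1 / n : ℝ)| ≤ 2 * (K + 1) := by
    intro a b ha
    rcases le_total b a with hab | hab
    · rw [Ico_eq_empty_of_le hab, sum_empty, abs_zero]; linarith
    · have h1 := sum_Ico_consecutive (fun n : ℕ => (vonMangoldt n / n - 1 / n : ℝ)) ha hab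
      have h2 := abs_le.mp (hD a ha)
      have h3 := abs_le.mp (hD b (ha.trans hab))
      rw [abs_le]
      constructor <;> linarith [h2.1, h2.2, h3.1, h3.2]
  have hbs : BoundedSums (2 * (K + 1)) fun n => ((vonMangoldt n / n - 1 / n : ℝ) : ℂ) := by
    refine ⟨fun n => ?_, fun a b => ?_⟩
    · rw [Complex.norm_real, Real.norm_eq_abs]
      rcases Nat.eq_zero_or_pos n with rfl | hn
      · simp
      have hn0 : (0 : ℝ) < n := by exact_mod_cast hn
      have h1 : vonMangoldt n / n ≤ 1 := by
        rw [div_le_one hn0]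
        linarith [ArithmeticFunction.vonMangoldt_le_log (n := n), Real.log_le_sub_one_of_pos hn0]
      have h2 : 0 ≤ vonMangoldt n / n := div_nonneg ArithmeticFunction.vonMangoldt_nonneg hn0.le
      have h3 : 1 / (n : ℝ) ≤ 1 := by
        rw [div_le_one hn0]; exact_mod_cast hn
      have h4 : 0 ≤ 1 / (n : ℝ) := by positivity
      rw [abs_le]
      constructor <;> linarith
    · rw [← Complex.ofReal_sum, Complex.norm_real, Real.norm_eq_abs]
      rcases Nat.eq_zero_or_pos a with rfl | ha
      · rcases Nat.eq_zero_or_pos b with rfl | hb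
        · simp; linarith
        · rw [sum_eq_sum_Ico_succ_bot hb]
          simpa using hD1 1 b le_rfl
      · exact hD1 a b ha
  refine ⟨8 * (K + 1) * B, by nlinarith, fun L hL => ?_⟩
  have hL0 : 0 < L := by linarith
  have h1 := hbs.norm_sum_mul_le (fun n => bumpWeight 0 L (Real.log n)) (one_le_bumpLength L)
  rw [bumpWeight_log_eq_zero hL0 (Or.inr le_rfl), abs_zero, zero_add] at h1
  have h2 : ∑ n ∈ Ico 1 (bumpLength L), |bumpWeight 0 L (Real.log (n + 1 : ℕ)) -
      bumpWeight 0 L (Real.log n)| ≤ 4 * B := by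
    calc _ ≤ ∑ n ∈ Ico 1 (bumpLength L), B / L * (1 / n : ℝ) := by
          refine sum_le_sum fun n hn => ?_
          rw [← div_eq_mul_one_div]
          exact abs_log_step_le_of_hasDerivAt (hasDerivAt_bumpWeight 0 L) (fun t _ => by
            simpa using hG L hL0 t) (mem_Ico.mp hn).1
      _ ≤ B / L * (4 * L) := by
          rw [← mul_sum]
          have := sum_Ico_one_inv_le (b := bumpLength L) (x := bumpLength L) le_rfl
            (by exact_mod_cast one_le_bumpLength L)
          have := log_bumpLength_le hL
          gcongr
          linarith
      _ = _ := by field_simp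
  rw [← sum_sub_distrib, sum_range_bumpLength L (by simp [logWeight_zero])]
  have h3 : ∑ n ∈ Ico 1 (bumpLength L), (vonMangoldt n * logWeight L n - logWeight L n) =
      ∑ n ∈ Ico 1 (bumpLength L), (vonMangoldt n / n - 1 / n : ℝ) * bumpWeight 0 L (Real.log n) :=
    sum_congr rfl fun n _ => by rw [logWeight]; ring
  rw [h3, ← Real.norm_eq_abs, ← Complex.norm_real, Complex.ofReal_sum]
  simp only [Complex.ofReal_mul]
  refine h1.trans ?_
  calc _ ≤ 2 * (K + 1) * (4 * B) := by gcongr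
    _ = _ := by ring

lemma sum_div_le_of_partial_sums {a : ℕ → ℝ} (ha : ∀ n, 0 ≤ a n) {C : ℝ}
    (hC : ∀ n : ℕ, ∑ k ∈ Ico 1 (n + 1), a k ≤ C * √n) {s N : ℕ} (hs : 1 ≤ s) :
    ∑ n ∈ Ico s N, a n / n ≤ 7 * C / √s := by
  have hC0 : 0 ≤ C := by simpa using (ha 1).trans (by simpa using hC 1)
  rcases le_total N s with hN | hN
  · rw [Ico_eq_empty_of_le hN, sum_empty]; positivity
  have key : ∑ n ∈ Ico s N, a n / n ≤ (∑ k ∈ Ico 1 N, a k) / N +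
      ∑ n ∈ Ico s N, (∑ k ∈ Ico 1 (n + 1), a k) / (n * (n + 1)) := by
    induction N, hN using Nat.le_induction with
    | base => simpa using div_nonneg (sum_nonneg fun k _ => ha k) (Nat.cast_nonneg s)
    | succ N hN ih =>
      rw [sum_Ico_succ_top hN, sum_Ico_succ_top hN]
      have hN0 : (0 : ℝ) < N := by exact_mod_cast hs.trans hN
      have h1 : (∑ k ∈ Ico 1 (N + 1), a k) / ((N + 1 : ℕ) : ℝ) +
          (∑ k ∈ Ico 1 (N + 1), a k) / (N * (N + 1)) = (∑ k ∈ Ico 1 N, a k) / N + a N / N := by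
        rw [sum_Ico_succ_top (hs.trans hN)]
        push_cast
        field_simp
      linarith
  have hs0 : (0 : ℝ) < s := by exact_mod_cast hs
  have hN0 : (0 : ℝ) < N := by exact_mod_cast hs.trans hN
  have h1 : (∑ k ∈ Ico 1 N, a k) / N ≤ C * (1 / √s) := by
    have h2 : ∑ k ∈ Ico 1 N, a k ≤ C * √N :=
      (sum_le_sum_of_subset_of_nonneg (Ico_subset_Ico_right (Nat.le_succ N)) fun k _ _ => ha k).trans
        (hC N)
    calc _ ≤ C * √N / N := by gcongr
      _ = C * (1 / √N) := by
          rw [mul_div_assoc, Real.sqrt_div_self']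
      _ ≤ _ := by gcongr
  have h2 : ∑ n ∈ Ico s N, (∑ k ∈ Ico 1 (n + 1), a k) / (n * (n + 1) : ℝ) ≤ C * (6 / √s) := by
    refine le_trans ?_ (mul_le_mul_of_nonneg_left (sum_inv_mul_sqrt_le (b := N) hs) hC0)
    rw [mul_sum]
    refine sum_le_sum fun n hn => ?_
    have hn0 : (0 : ℝ) < n := by exact_mod_cast hs.trans (mem_Ico.mp hn).1
    have hsq : √(n : ℝ) * √n = n := Real.mul_self_sqrt hn0.le
    have hsp : 0 < √(n : ℝ) := Real.sqrt_pos.mpr hn0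
    calc _ ≤ C * √n / (n * n) := by
          have := hC n
          gcongr
          linarith
      _ = C * (√n / (n * (√n * √n))) := by rw [hsq, mul_div_assoc]
      _ = _ := by field_simp
  calc _ ≤ _ := key
    _ ≤ C * (1 / √s) + C * (6 / √s) := add_le_add h1 h2
    _ = _ := by ring

lemma exists_sum_primePower_logWeight_le : ∃ C : ℝ, 1 ≤ C ∧ ∀ L : ℝ, 1 ≤ L →
    ∑ n ∈ range (bumpLength L), (vonMangoldt n - if n.Prime then Real.log n else 0) * logWeight L n ≤
      C * Real.exp (-(L / 2)) := by
  obtain ⟨C, hC⟩ := Chebyshev.psi_sub_theta_le_mul_sqrt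
  set a : ℕ → ℝ := fun n => vonMangoldt n - if n.Prime then Real.log n else 0 with ha
  have ha0 : ∀ n, 0 ≤ a n := fun n => by
    simp only [ha]
    split_ifs with h
    · rw [ArithmeticFunction.vonMangoldt_apply_prime h, sub_self]
    · rw [sub_zero]; exact ArithmeticFunction.vonMangoldt_nonneg
  have hsum : ∀ n : ℕ, ∑ k ∈ Ico 1 (n + 1), a k ≤ max C 1 * √n := by
    intro n
    have h1 := hC n
    rw [Chebyshev.psi, Chebyshev.theta, sum_filter, ← sum_sub_distrib, Nat.floor_natCast] at h1
    exact h1.trans (mul_le_mul_of_nonneg_right (le_max_left _ _) (Real.sqrt_nonneg _))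
  refine ⟨7 * max C 1, by linarith [le_max_right C 1], fun L hL => ?_⟩
  have hL0 : 0 < L := by linarith
  set s := ⌈Real.exp L⌉₊ with hs
  have hs1 : 1 ≤ s := Nat.one_le_iff_ne_zero.mpr (Nat.ceil_pos.mpr (Real.exp_pos _)).ne'
  have hsL : Real.exp L ≤ s := Nat.le_ceil _
  have hsqrt : Real.exp (L / 2) ≤ √(s : ℝ) := by
    apply Real.le_sqrt_of_sq_le
    rw [← Real.exp_nat_mul]
    refine le_trans (le_of_eq ?_) hsL
    congr 1; push_cast; ring
  have h1 := sum_div_le_of_partial_sums ha0 hsum (N := bumpLength L) hs1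
  calc _ = ∑ n ∈ range (bumpLength L), a n * logWeight L n := rfl
    _ ≤ ∑ n ∈ range (bumpLength L), if n ∈ Ico s (bumpLength L) then a n / n else 0 := by
        refine sum_le_sum fun n hn => ?_
        split_ifs with h
        · rw [div_eq_mul_one_div]
          exact mul_le_mul_of_nonneg_left (logWeight_le L n) (ha0 n)
        · rw [mem_Ico, not_and_or] at h
          have h2 : (n : ℝ) < Real.exp L := Nat.lt_ceil.mp (by
            have := mem_range.mp hn; omega)
          rw [logWeight, bumpWeight_log_eq_zero hL0 (Or.inl h2), zero_div, mul_zero]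
    _ = ∑ n ∈ Ico s (bumpLength L), a n / n := by
        rw [← sum_filter]
        congr 1
        ext n; simp only [mem_filter, mem_range, mem_Ico]; omega
    _ ≤ 7 * max C 1 / √s := h1
    _ ≤ 7 * max C 1 / Real.exp (L / 2) := by gcongr
    _ = _ := by rw [Real.exp_neg]; rfl

lemma exists_pow_card_primeFactors_le (K : ℕ) (hK : 1 ≤ K) : ∃ C : ℝ, 1 ≤ C ∧ ∀ d : ℕ, 1 ≤ d →
    (K : ℝ) ^ d.primeFactors.card ≤ C * √d := by
  refine ⟨(K : ℝ) ^ K ^ 2, one_le_pow₀ (by exact_mod_cast hK), fun d hd => ?_⟩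
  have hK1 : (1 : ℝ) ≤ K := by exact_mod_cast hK
  rw [← card_filter_add_card_filter_not (s := d.primeFactors) (fun p => p < K ^ 2), pow_add]
  have h1 : (d.primeFactors.filter (fun p => p < K ^ 2)).card ≤ K ^ 2 := by
    have : d.primeFactors.filter (fun p => p < K ^ 2) ⊆ range (K ^ 2) := fun p hp =>
      mem_range.mpr (mem_filter.mp hp).2
    simpa using card_le_card this
  have h2 : (K ^ (d.primeFactors.filter (fun p => ¬p < K ^ 2)).card) ^ 2 ≤ d := by
    calc _ = ∏ p ∈ d.primeFactors.filter (fun p => ¬p < K ^ 2), K ^ 2 := by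
          rw [prod_const, ← pow_mul, ← pow_mul, mul_comm]
      _ ≤ ∏ p ∈ d.primeFactors.filter (fun p => ¬p < K ^ 2), p :=
          prod_le_prod' fun p hp => not_lt.mp (mem_filter.mp hp).2
      _ ≤ ∏ p ∈ d.primeFactors, p :=
          prod_le_prod_of_subset_of_one_le' (filter_subset _ _) fun p hp _ =>
            (Nat.prime_of_mem_primeFactors hp).one_lt.le
      _ ≤ d := Nat.le_of_dvd hd (Nat.prod_primeFactors_dvd d)
  gcongr
  exact Real.le_sqrt_of_sq_le (by exact_mod_cast h2)

lemma succ_pow_card_primeFactors_le_sum {n : ℕ} (hn : n ≠ 0) (K : ℕ) :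
    (K + 1 : ℝ) ^ n.primeFactors.card ≤ ∑ d ∈ n.divisors, (K : ℝ) ^ d.primeFactors.card := by
  have hp : ∀ t ∈ n.primeFactors.powerset, ∀ p ∈ t, p.Prime := fun t ht p hp =>
    Nat.prime_of_mem_primeFactors (mem_powerset.mp ht hp)
  have h1 : ∑ t ∈ n.primeFactors.powerset, (K : ℝ) ^ t.card = (K + 1 : ℝ) ^ n.primeFactors.card := by
    rw [← sum_pow_mul_eq_add_pow]
    simp
  rw [← h1]
  calc _ = ∑ t ∈ n.primeFactors.powerset, (K : ℝ) ^ (∏ p ∈ t, p).primeFactors.card :=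
        sum_congr rfl fun t ht => by rw [Nat.primeFactors_prod (hp t ht)]
    _ = ∑ d ∈ n.primeFactors.powerset.image (fun t => ∏ p ∈ t, p), (K : ℝ) ^ d.primeFactors.card := by
        rw [sum_image]
        intro s hs t ht hst
        rw [← Nat.primeFactors_prod (hp s hs), ← Nat.primeFactors_prod (hp t ht)]
        exact congrArg _ hst
    _ ≤ _ := by
        refine sum_le_sum_of_subset_of_nonneg (fun d hd => ?_) fun _ _ _ => by positivity
        obtain ⟨t, ht, rfl⟩ := mem_image.mp hd
        exact Nat.mem_divisors.mpr ⟨(prod_dvd_prod_of_subset _ _ _ (mem_powerset.mp ht)).trans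
          (Nat.prod_primeFactors_dvd n), hn⟩

lemma sum_squarefree_pow_card_div_le (K N : ℕ) :
    ∑ n ∈ (Ico 1 N).filter Squarefree, (K : ℝ) ^ n.primeFactors.card / n ≤
      (1 + ∑ n ∈ Ico 1 N, (1 / n : ℝ)) ^ K := by
  have hs : 0 ≤ ∑ n ∈ Ico 1 N, (1 / n : ℝ) := sum_nonneg fun _ _ => by positivity
  induction K with
  | zero =>
    rw [pow_zero]
    calc _ ≤ ∑ n ∈ (Ico 1 N).filter Squarefree, if n = 1 then (1 : ℝ) else 0 := by
          refine sum_le_sum fun n hn => ?_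
          have hn1 := (mem_Ico.mp (mem_filter.mp hn).1).1
          split_ifs with h
          · simp [h]
          · have : n.primeFactors.card ≠ 0 := by
              rw [Ne, card_eq_zero, Nat.primeFactors_eq_empty]; omega
            simp [zero_pow this]
      _ ≤ _ := by
          rw [sum_ite_eq']
          split_ifs <;> norm_num
  | succ K ih =>
    have h1 := sum_divisorsAntidiagonal_eq_sum_sum (N := N) (A := N) (B := N)
      (F := fun a b => if a * b < N ∧ Squarefree a then (K : ℝ) ^ a.primeFactors.card / (a * b : ℕ) else 0)
      (fun a b _ _ h => if_neg (by omega)) le_rfl le_rfl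
    calc _ ≤ ∑ n ∈ Ico 1 N, ∑ x ∈ n.divisorsAntidiagonal, if x.1 * x.2 < N ∧ Squarefree x.1 then
          (K : ℝ) ^ x.1.primeFactors.card / (x.1 * x.2 : ℕ) else 0 := by
          rw [sum_filter]
          refine sum_le_sum fun n hn => ?_
          split_ifs with hsq
          · rw [Nat.sum_divisorsAntidiagonal (fun a b => if a * b < N ∧ Squarefree a then
              (K : ℝ) ^ a.primeFactors.card / (a * b : ℕ) else 0)]
            have h2 : ∀ d ∈ n.divisors, (if d * (n / d) < N ∧ Squarefree d then
                (K : ℝ) ^ d.primeFactors.card / (d * (n / d) : ℕ) else 0) =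
                (K : ℝ) ^ d.primeFactors.card / n := by
              intro d hd
              have hdn := Nat.dvd_of_mem_divisors hd
              rw [Nat.mul_div_cancel' hdn, if_pos ⟨(mem_Ico.mp hn).2, hsq.squarefree_of_dvd hdn⟩]
            rw [sum_congr rfl h2, ← sum_div]
            gcongr
            push_cast
            exact succ_pow_card_primeFactors_le_sum hsq.ne_zero K
          · exact sum_nonneg fun _ _ => by split_ifs <;> positivity
      _ = _ := h1
      _ ≤ ∑ a ∈ Ico 1 N, ∑ b ∈ Ico 1 N,
          (if Squarefree a then (K : ℝ) ^ a.primeFactors.card / a else 0) * (1 / b : ℝ) := by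
          refine sum_le_sum fun a _ => sum_le_sum fun b _ => ?_
          split_ifs with h2 h3 h3
          · push_cast
            exact le_of_eq (by rw [div_mul_div_comm, mul_one])
          · exact absurd h2.2 h3
          · positivity
          · simp
      _ = (∑ n ∈ (Ico 1 N).filter Squarefree, (K : ℝ) ^ n.primeFactors.card / n) *
          ∑ n ∈ Ico 1 N, (1 / n : ℝ) := by rw [sum_filter, sum_mul_sum]
      _ ≤ (1 + ∑ n ∈ Ico 1 N, (1 / n : ℝ)) ^ K * (1 + ∑ n ∈ Ico 1 N, (1 / n : ℝ)) := by
          gcongr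
          linarith
      _ = _ := (pow_succ _ _).symm

lemma le_totient_mul_two_pow (n : ℕ) : n ≤ n.totient * 2 ^ n.primeFactors.card := by
  have h1 := Nat.totient_mul_prod_primeFactors n
  have h2 : ∏ p ∈ n.primeFactors, p ≤ 2 ^ n.primeFactors.card * ∏ p ∈ n.primeFactors, (p - 1) := by
    rw [← prod_const, ← prod_mul_distrib]
    refine prod_le_prod' fun p hp => ?_
    have := (Nat.prime_of_mem_primeFactors hp).two_le
    omega
  have h3 : 0 < ∏ p ∈ n.primeFactors, p := prod_pos fun p hp => (Nat.prime_of_mem_primeFactors hp).pos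
  refine Nat.le_of_mul_le_mul_right ?_ h3
  calc n * ∏ p ∈ n.primeFactors, p ≤ n * (2 ^ n.primeFactors.card * ∏ p ∈ n.primeFactors, (p - 1)) :=
        Nat.mul_le_mul_left _ h2
    _ = 2 ^ n.primeFactors.card * (n * ∏ p ∈ n.primeFactors, (p - 1)) := by ring
    _ = _ := by rw [← h1]; ring

lemma card_primeFactors_mul_le (a b : ℕ) :
    (a * b).primeFactors.card ≤ a.primeFactors.card + b.primeFactors.card := by
  rcases eq_or_ne a 0 with rfl | ha
  · simp
  rcases eq_or_ne b 0 with rfl | hb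
  · simp
  rw [Nat.primeFactors_mul ha hb]
  exact card_union_le _ _

lemma exists_sum_pow_card_div_totient_le (K W : ℕ) (hK : 1 ≤ K) (hW : 0 < W) : ∃ C : ℝ, 1 ≤ C ∧
    ∀ (r N : ℕ) (x : ℝ), 1 ≤ r → 1 ≤ x → (N : ℝ) ≤ x →
    ∑ q ∈ (Icc 1 N).filter (fun q => (Squarefree q ∧ Nat.Coprime W q) ∧ r ∣ W * q),
      (K : ℝ) ^ q.primeFactors.card / (W * q).totient ≤ C * (3 + Real.log x) ^ (2 * K) / √r := by
  obtain ⟨C, hC, hCd⟩ := exists_pow_card_primeFactors_le (2 * K) (by omega)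
  have hW1 : (1 : ℝ) ≤ W := by exact_mod_cast hW
  have hsW : 1 ≤ √(W : ℝ) := Real.one_le_sqrt.mpr hW1
  refine ⟨C * √W, by nlinarith, fun r N x hr hx hN => ?_⟩
  set g := r.gcd W with hg
  have hg0 : 0 < g := Nat.gcd_pos_of_pos_left _ hr
  set d := r / g with hd
  have hdr : g * d = r := Nat.mul_div_cancel' (Nat.gcd_dvd_left r W)
  have hd1 : 1 ≤ d := Nat.one_le_iff_ne_zero.mpr (by rintro h; rw [h] at hdr; omega)
  have hd0 : (0 : ℝ) < d := by exact_mod_cast hd1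
  have hrW : (r : ℝ) ≤ W * d := by
    rw [← hdr]
    push_cast
    gcongr
    exact Nat.le_of_dvd hW (Nat.gcd_dvd_right r W)
  have hdq : ∀ q, r ∣ W * q → d ∣ q := by
    intro q hq
    have h1 : Nat.Coprime d (W / g) := Nat.coprime_div_gcd_div_gcd hg0
    have h2 : g * d ∣ g * (W / g * q) := by
      rw [hdr, ← mul_assoc, Nat.mul_div_cancel' (Nat.gcd_dvd_right r W)]; exact hq
    exact h1.dvd_of_dvd_mul_left (Nat.dvd_of_mul_dvd_mul_left hg0 h2)
  have hterm : ∀ q ∈ (Icc 1 N).filter (fun q => (Squarefree q ∧ Nat.Coprime W q) ∧ r ∣ W * q),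
      (K : ℝ) ^ q.primeFactors.card / (W * q).totient ≤ ((2 * K : ℕ) : ℝ) ^ q.primeFactors.card / q := by
    intro q hq
    obtain ⟨h1, ⟨h2, h3⟩, h4⟩ := mem_filter.mp hq
    have hq0 : 0 < q := (mem_Icc.mp h1).1
    have hφ : (0 : ℝ) < (W * q).totient := by
      exact_mod_cast Nat.totient_pos.mpr (Nat.mul_pos hW hq0)
    have h5 : (q : ℝ) ≤ (W * q).totient * 2 ^ q.primeFactors.card := by
      have h6 := le_totient_mul_two_pow q
      have h7 : q.totient ≤ (W * q).totient :=
        Nat.le_of_dvd (Nat.totient_pos.mpr (Nat.mul_pos hW hq0))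
          (Nat.totient_dvd_of_dvd (Dvd.intro_left W rfl))
      exact_mod_cast h6.trans (Nat.mul_le_mul_right _ h7)
    rw [div_le_div_iff₀ hφ (by exact_mod_cast hq0)]
    push_cast
    rw [mul_pow]
    have : (0 : ℝ) ≤ (K : ℝ) ^ q.primeFactors.card := by positivity
    nlinarith
  refine (sum_le_sum hterm).trans ?_
  calc _ ≤ ∑ q ∈ ((Ico 1 (N + 1)).filter Squarefree).image (fun e => d * e),
        ((2 * K : ℕ) : ℝ) ^ q.primeFactors.card / q := by
        refine sum_le_sum_of_subset_of_nonneg (fun q hq => ?_) fun _ _ _ => by positivity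
        obtain ⟨h1, ⟨h2, h3⟩, h4⟩ := mem_filter.mp hq
        obtain ⟨e, rfl⟩ := hdq q h4
        have h5 := mem_Icc.mp h1
        refine mem_image.mpr ⟨e, mem_filter.mpr ⟨mem_Ico.mpr ⟨?_, ?_⟩, ?_⟩, rfl⟩
        · exact Nat.pos_of_mul_pos_left (by omega : 0 < d * e)
        · exact Nat.lt_succ_iff.mpr ((Nat.le_mul_of_pos_left e hd1).trans h5.2)
        · exact h2.squarefree_of_dvd (Dvd.intro_left d rfl)
    _ = ∑ e ∈ (Ico 1 (N + 1)).filter Squarefree,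
        ((2 * K : ℕ) : ℝ) ^ (d * e).primeFactors.card / (d * e : ℕ) :=
        sum_image fun a _ b _ h => Nat.eq_of_mul_eq_mul_left hd1 h
    _ ≤ ∑ e ∈ (Ico 1 (N + 1)).filter Squarefree, (C / √d) *
        (((2 * K : ℕ) : ℝ) ^ e.primeFactors.card / e) := by
        refine sum_le_sum fun e he => ?_
        have he0 : (0 : ℝ) < e := by exact_mod_cast (mem_Ico.mp (mem_filter.mp he).1).1
        have hK2 : (1 : ℝ) ≤ ((2 * K : ℕ) : ℝ) := by exact_mod_cast (by omega : 1 ≤ 2 * K)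
        have hsd : 0 < √(d : ℝ) := Real.sqrt_pos.mpr hd0
        calc _ ≤ ((2 * K : ℕ) : ℝ) ^ (d.primeFactors.card + e.primeFactors.card) / (d * e : ℕ) := by
              gcongr
              exact card_primeFactors_mul_le d e
          _ ≤ (C * √d) * ((2 * K : ℕ) : ℝ) ^ e.primeFactors.card / (d * e : ℕ) := by
              rw [pow_add]
              gcongr
              exact hCd d hd1
          _ = _ := by
              have : √(d : ℝ) * √d = d := Real.mul_self_sqrt hd0.le
              rw [Nat.cast_mul d e]
              generalize √(d : ℝ) = s at this hsd ⊢
              rw [← this]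
              field_simp
    _ = C / √d * ∑ e ∈ (Ico 1 (N + 1)).filter Squarefree,
        (((2 * K : ℕ) : ℝ) ^ e.primeFactors.card / e) := by rw [mul_sum]
    _ ≤ (C * √W / √r) * (3 + Real.log x) ^ (2 * K) := by
        have h1 := sum_squarefree_pow_card_div_le (2 * K) (N + 1)
        have h2 := sum_Ico_one_inv_le (b := N + 1) (x := x + 1) (by push_cast; linarith) (by linarith)
        have h3 : Real.log (x + 1) ≤ 1 + Real.log x := by
          have h4 : Real.log (x + 1) ≤ Real.log (Real.exp 1 * x) := by
            apply Real.log_le_log (by linarith)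
            nlinarith [Real.add_one_le_exp 1]
          rwa [Real.log_mul (Real.exp_pos 1).ne' (by linarith), Real.log_exp] at h4
        have h5 : 0 ≤ ∑ n ∈ Ico 1 (N + 1), (1 / n : ℝ) := sum_nonneg fun _ _ => by positivity
        have hr0 : (0 : ℝ) < r := by exact_mod_cast hr
        have h6 : C / √d ≤ C * √W / √r := by
          rw [div_le_div_iff₀ (Real.sqrt_pos.mpr hd0) (Real.sqrt_pos.mpr hr0), mul_assoc,
            ← Real.sqrt_mul (Nat.cast_nonneg W)]
          gcongr
        refine mul_le_mul h6 (h1.trans ?_) (sum_nonneg fun _ _ => by positivity) (by positivity)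
        exact pow_le_pow_left₀ (by linarith) (by linarith) _
    _ = _ := by ring

open scoped Classical in
lemma abs_sum_modEq_sub_le {m : ℕ} [NeZero m] {w : ℕ → ℝ}
    {s : Finset ℕ} (hw : ∀ n ∈ s, w n ≠ 0 → n.Coprime m) {c : ℕ} (hc : c.Coprime m) :
    |∑ n ∈ s, (if n ≡ c [MOD m] then w n else 0) - (∑ n ∈ s, w n) / m.totient| ≤
      1 / m.totient * ∑ χ ∈ univ.filter (fun χ : DirichletCharacter ℂ m => χ ≠ 1),
        ‖∑ n ∈ s, χ n * (w n : ℂ)‖ := by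
  have hφ : (0 : ℝ) < m.totient := by exact_mod_cast Nat.totient_pos.mpr (NeZero.pos m)
  have hu : IsUnit (c : ZMod m) := (ZMod.isUnit_iff_coprime c m).mpr hc
  have hmain : ((m.totient : ℝ) * ∑ n ∈ s, (if n ≡ c [MOD m] then w n else 0) : ℂ) =
      ∑ χ : DirichletCharacter ℂ m, χ (c : ZMod m)⁻¹ * ∑ n ∈ s, χ n * (w n : ℂ) := by
    simp_rw [mul_sum]
    rw [sum_comm, Complex.ofReal_sum, mul_sum]
    refine sum_congr rfl fun n _ => ?_
    simp_rw [← mul_assoc]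
    rw [← sum_mul]
    have h1 := DirichletCharacter.sum_char_inv_mul_char_eq ℂ hu (n : ZMod m)
    have h2 : ((c : ZMod m) = n) ↔ n ≡ c [MOD m] := by
      rw [ZMod.natCast_eq_natCast_iff]; exact ⟨Nat.ModEq.symm, Nat.ModEq.symm⟩
    simp only [h2] at h1
    convert congrArg (fun z : ℂ => z * (w n : ℂ)) h1.symm using 1
    · split_ifs <;> simp
  have h1 : ∑ n ∈ s, (1 : DirichletCharacter ℂ m) n * (w n : ℂ) = ((∑ n ∈ s, w n : ℝ) : ℂ) := by
    push_cast
    refine sum_congr rfl fun n hn => ?_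
    by_cases h : w n = 0
    · simp [h]
    · rw [MulChar.one_apply ((ZMod.isUnit_iff_coprime n m).mpr (hw n hn h)), one_mul]
  rw [← sum_filter_add_sum_filter_not univ (fun χ : DirichletCharacter ℂ m => χ = 1)] at hmain
  rw [filter_eq' univ (1 : DirichletCharacter ℂ m), if_pos (mem_univ _), sum_singleton, h1] at hmain
  rw [MulChar.one_apply (IsUnit.of_mul_eq_one _ (ZMod.inv_mul_of_unit _ hu)), one_mul] at hmain
  have h2 : (m.totient : ℝ) * |∑ n ∈ s, (if n ≡ c [MOD m] then w n else 0) -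
      (∑ n ∈ s, w n) / m.totient| ≤
      ∑ χ ∈ univ.filter (fun χ : DirichletCharacter ℂ m => χ ≠ 1), ‖∑ n ∈ s, χ n * (w n : ℂ)‖ := by
    calc _ = ‖((m.totient : ℝ) * ∑ n ∈ s, (if n ≡ c [MOD m] then w n else 0) : ℂ) -
          ((∑ n ∈ s, w n : ℝ) : ℂ)‖ := by
          have h3 : ((m.totient : ℝ) * ∑ n ∈ s, (if n ≡ c [MOD m] then w n else 0) : ℂ) -
            ((∑ n ∈ s, w n : ℝ) : ℂ) = (((m.totient : ℝ) * (∑ n ∈ s, (if n ≡ c [MOD m] then w n else 0) -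
            (∑ n ∈ s, w n) / m.totient) : ℝ) : ℂ) := by
            rw [mul_sub, mul_div_cancel₀ _ hφ.ne']
            push_cast
            simp
          rw [h3, Complex.norm_real, Real.norm_eq_abs, abs_mul, abs_of_pos hφ]
      _ = ‖∑ χ ∈ univ.filter (fun χ : DirichletCharacter ℂ m => χ ≠ 1),
          χ (c : ZMod m)⁻¹ * ∑ n ∈ s, χ n * (w n : ℂ)‖ := by rw [hmain, add_sub_cancel_left]
      _ ≤ _ := (norm_sum_le _ _).trans (sum_le_sum fun χ _ => by
          rw [norm_mul]
          exact mul_le_of_le_one_left (norm_nonneg _) (χ.norm_le_one _))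
  rw [one_div, ← div_eq_inv_mul, le_div_iff₀ hφ, mul_comm]
  exact h2

lemma exists_isPrimitiveSeq_of_ne_one {m : ℕ} [NeZero m] {χ : DirichletCharacter ℂ m} (hχ : χ ≠ 1) :
    IsPrimitiveSeq χ.conductor (fun n : ℕ => χ.primitiveCharacter n) ∧
      ∀ n : ℕ, n.Coprime m → χ n = χ.primitiveCharacter n := by
  refine ⟨⟨Nat.pos_of_ne_zero χ.conductor_ne_zero, _, χ.primitiveCharacter_isPrimitive, ?_, fun _ => rfl⟩,
    fun n hn => ?_⟩
  · intro h
    apply hχ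
    rw [← χ.changeLevel_primitiveCharacter, h, map_one]
  · conv_lhs => rw [← χ.changeLevel_primitiveCharacter]
    exact changeLevel_natCast _ _ hn

open scoped Classical in
lemma sum_norm_char_sum_le {m : ℕ} [NeZero m] {w : ℕ → ℝ}
    {s : Finset ℕ} (hw : ∀ n ∈ s, w n ≠ 0 → n.Coprime m) {Q : ℕ} (hQ : m ≤ Q) :
    ∑ χ ∈ univ.filter (fun χ : DirichletCharacter ℂ m => χ ≠ 1), ‖∑ n ∈ s, χ n * (w n : ℂ)‖ ≤
      ∑ f ∈ (primitiveFamily Q).filter (fun f => ∃ r, r ∣ m ∧ IsPrimitiveSeq r f),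
        ‖∑ n ∈ s, f n * (w n : ℂ)‖ := by
  have hinj : Set.InjOn (fun (χ : DirichletCharacter ℂ m) (n : ℕ) => χ.primitiveCharacter n)
      (univ.filter (fun χ : DirichletCharacter ℂ m => χ ≠ 1)) := by
    intro χ hχ ψ hψ h
    have hχ := exists_isPrimitiveSeq_of_ne_one (mem_filter.mp hχ).2
    have hψ := exists_isPrimitiveSeq_of_ne_one (mem_filter.mp hψ).2
    refine MulChar.ext fun a => ?_
    have ha : (a : ZMod m) = ((a : ZMod m).val : ℕ) := (ZMod.natCast_zmod_val _).symm
    have hcop : ((a : ZMod m).val).Coprime m := ZMod.val_coe_unit_coprime a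
    rw [ha, hχ.2 _ hcop, hψ.2 _ hcop]
    exact congrFun h _
  calc _ = ∑ χ ∈ univ.filter (fun χ : DirichletCharacter ℂ m => χ ≠ 1),
      ‖∑ n ∈ s, χ.primitiveCharacter n * (w n : ℂ)‖ := by
        refine sum_congr rfl fun χ hχ => ?_
        congr 1
        refine sum_congr rfl fun n hn => ?_
        by_cases h : w n = 0
        · simp [h]
        · rw [(exists_isPrimitiveSeq_of_ne_one (mem_filter.mp hχ).2).2 n (hw n hn h)]
    _ = ∑ f ∈ (univ.filter (fun χ : DirichletCharacter ℂ m => χ ≠ 1)).image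
        (fun χ (n : ℕ) => χ.primitiveCharacter n), ‖∑ n ∈ s, f n * (w n : ℂ)‖ := by
        rw [sum_image hinj]
    _ ≤ _ := by
        refine sum_le_sum_of_subset_of_nonneg (fun f hf => ?_) fun _ _ _ => norm_nonneg _
        obtain ⟨χ, hχ, rfl⟩ := mem_image.mp hf
        have h1 := (exists_isPrimitiveSeq_of_ne_one (mem_filter.mp hχ).2).1
        exact mem_filter.mpr ⟨mem_primitiveFamily.mpr ⟨_, (Nat.le_of_dvd (NeZero.pos m)
          χ.conductor_dvd_level).trans hQ, h1⟩, _, χ.conductor_dvd_level, h1⟩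

lemma vonMangoldt_sub_prime_nonneg (n : ℕ) :
    0 ≤ vonMangoldt n - if n.Prime then Real.log n else 0 := by
  split_ifs with h
  · rw [ArithmeticFunction.vonMangoldt_apply_prime h, sub_self]
  · rw [sub_zero]; exact ArithmeticFunction.vonMangoldt_nonneg

lemma norm_sum_prime_le {f : ℕ → ℂ} (hf : ∀ n, ‖f n‖ ≤ 1) (L : ℝ) :
    ‖∑ n ∈ range (bumpLength L), f n * ((if n.Prime then Real.log n * logWeight L n else 0 : ℝ) : ℂ)‖ ≤
      ‖twistedSum f L 0‖ + ∑ n ∈ range (bumpLength L),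
        (vonMangoldt n - if n.Prime then Real.log n else 0) * logWeight L n := by
  have h1 : twistedSum f L 0 = ∑ n ∈ range (bumpLength L), f n * ((vonMangoldt n * logWeight L n : ℝ) : ℂ) := by
    rw [sum_range_bumpLength L (by simp), twistedSum]
    refine sum_congr rfl fun n _ => ?_
    rw [logWeight, mul_div_assoc]
  have h2 : ∑ n ∈ range (bumpLength L), f n * ((if n.Prime then Real.log n * logWeight L n else 0 : ℝ) : ℂ) =
      twistedSum f L 0 - ∑ n ∈ range (bumpLength L),
        f n * (((vonMangoldt n - if n.Prime then Real.log n else 0) * logWeight L n : ℝ) : ℂ) := by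
    rw [h1, ← sum_sub_distrib]
    refine sum_congr rfl fun n _ => ?_
    rw [← mul_sub, ← Complex.ofReal_sub]
    congr 2
    split_ifs <;> ring
  rw [h2]
  refine (norm_sub_le _ _).trans (add_le_add le_rfl ((norm_sum_le _ _).trans (sum_le_sum fun n _ => ?_)))
  have h3 := mul_nonneg (vonMangoldt_sub_prime_nonneg n) (logWeight_nonneg L n)
  rw [norm_mul, Complex.norm_real, Real.norm_eq_abs, abs_of_nonneg h3]
  exact mul_le_of_le_one_left h3 (hf n)

open scoped Classical in
theorem abs_sum_prime_modEq_sub_le {L : ℝ} (hL : 1 ≤ L) {m Q c : ℕ} (hm : 0 < m)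
    (hmL : (m : ℝ) < Real.exp L) (hQ : m ≤ Q) (hc : c.Coprime m) {ε : ℝ}
    (hε : ∑ n ∈ range (bumpLength L),
        (vonMangoldt n - if n.Prime then Real.log n else 0) * logWeight L n ≤ ε) :
    |∑ n ∈ range (bumpLength L), (if n.Prime ∧ n ≡ c [MOD m] then Real.log n * logWeight L n else 0) -
      (∑ n ∈ range (bumpLength L), if n.Prime then Real.log n * logWeight L n else 0) / m.totient| ≤
      1 / m.totient * ∑ f ∈ (primitiveFamily Q).filter (fun f => ∃ r, r ∣ m ∧ IsPrimitiveSeq r f),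
        (‖twistedSum f L 0‖ + ε) := by
  have : NeZero m := ⟨hm.ne'⟩
  have hw : ∀ n ∈ range (bumpLength L),
      (if n.Prime then Real.log n * logWeight L n else 0) ≠ 0 → n.Coprime m := by
    intro n _ h
    obtain ⟨h1, h2⟩ : n.Prime ∧ Real.log n * logWeight L n ≠ 0 := by
      by_cases h1 : n.Prime
      · exact ⟨h1, by simpa [h1] using h⟩
      · simp [h1] at h
    rw [h1.coprime_iff_not_dvd]
    intro h3
    have h4 := exp_le_of_logWeight_ne_zero (by linarith) (right_ne_zero_of_mul h2)
    have h5 : (n : ℝ) ≤ m := by exact_mod_cast Nat.le_of_dvd hm h3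
    linarith
  have h1 := abs_sum_modEq_sub_le hw hc
  have h2 : ∀ n : ℕ, (if n.Prime ∧ n ≡ c [MOD m] then Real.log n * logWeight L n else 0) =
      if n ≡ c [MOD m] then (if n.Prime then Real.log n * logWeight L n else 0) else 0 := by
    intro n
    by_cases h : n.Prime <;> simp [h]
  simp only [h2]
  refine h1.trans (mul_le_mul_of_nonneg_left ((sum_norm_char_sum_le hw hQ).trans
    (sum_le_sum fun f hf => ?_)) (by positivity))
  exact (norm_sum_prime_le (boundedSums_of_mem_primitiveFamily (mem_filter.mp hf).1).1 L).trans
    (add_le_add le_rfl hε)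

open scoped Classical in
lemma sum_pow_mul_conductor_sum_le {W K Q : ℕ} {x B : ℝ}
    (hB : ∀ r : ℕ, 1 ≤ r → ∑ q ∈ (Icc 1 ⌊x⌋₊).filter (fun q => (Squarefree q ∧ Nat.Coprime W q) ∧ r ∣ W * q),
      (K : ℝ) ^ q.primeFactors.card / (W * q).totient ≤ B / √r) {t s : (ℕ → ℂ) → ℝ}
    (ht : ∀ f, 0 ≤ t f)
    (hs : ∀ r, ∀ f ∈ primitiveFamily Q, IsPrimitiveSeq r f → t f * (B / √r) ≤ s f) :
    ∑ q ∈ (Icc 1 ⌊x⌋₊).filter (fun q => Squarefree q ∧ Nat.Coprime W q), (K : ℝ) ^ q.primeFactors.card *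
      (1 / (W * q).totient *
        ∑ f ∈ (primitiveFamily Q).filter (fun f => ∃ r, r ∣ W * q ∧ IsPrimitiveSeq r f), t f) ≤
      ∑ f ∈ primitiveFamily Q, s f := by
  have h1 : ∀ q : ℕ, (K : ℝ) ^ q.primeFactors.card * (1 / (W * q).totient *
      ∑ f ∈ (primitiveFamily Q).filter (fun f => ∃ r, r ∣ W * q ∧ IsPrimitiveSeq r f), t f) =
      ∑ f ∈ primitiveFamily Q, if ∃ r, r ∣ W * q ∧ IsPrimitiveSeq r f then
        t f * ((K : ℝ) ^ q.primeFactors.card / (W * q).totient) else 0 := by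
    intro q
    rw [sum_filter, ← mul_assoc, mul_sum]
    refine sum_congr rfl fun f _ => ?_
    split_ifs
    · ring
    · rw [mul_zero]
  simp only [h1]
  rw [sum_comm]
  refine sum_le_sum fun f hf => ?_
  obtain ⟨r, -, hr⟩ := mem_primitiveFamily.mp hf
  refine le_trans ?_ (hs r f hf hr)
  have h2 : ∀ q : ℕ, (∃ r, r ∣ W * q ∧ IsPrimitiveSeq r f) ↔ r ∣ W * q := fun q =>
    ⟨fun ⟨r', h, h'⟩ => by rwa [hr.eq_left h'], fun h => ⟨r, h, hr⟩⟩
  simp only [h2]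
  rw [← sum_filter, filter_filter, ← mul_sum]
  refine mul_le_mul_of_nonneg_left ((le_of_eq ?_).trans (hB r hr.1)) (ht f)
  congr!

lemma sum_primitiveFamily_split_le {Q : ℕ} {T : (ℕ → ℂ) → ℝ} (hT : ∀ f, 0 ≤ T f) {B H τ S ε : ℝ}
    (hB : 0 ≤ B) (hH : 1 ≤ H) (hε : 0 ≤ ε) (hτ0 : 0 ≤ τ)
    (hτ : ∀ (r : ℕ) f, (r : ℝ) ≤ H → IsPrimitiveSeq r f → T f ≤ τ)
    (hS : ∑ f ∈ primitiveFamily Q, T f ≤ S) :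
    ∃ s : (ℕ → ℂ) → ℝ,
      (∀ r, ∀ f ∈ primitiveFamily Q, IsPrimitiveSeq r f → (T f + ε) * (B / √r) ≤ s f) ∧
      ∑ f ∈ primitiveFamily Q, s f ≤ B * (H ^ 2 * τ + S / √H + (Q : ℝ) ^ 2 * ε) := by
  classical
  refine ⟨fun f => B * ((if f ∈ primitiveFamily ⌊H⌋₊ then τ else 0) + T f / √H + ε), ?_, ?_⟩
  · intro r f hf hr
    have hr1 : (1 : ℝ) ≤ √r := Real.one_le_sqrt.mpr (by exact_mod_cast hr.1)
    have hH0 : 0 < √H := Real.sqrt_pos.mpr (by linarith)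
    have h1 : T f / √r ≤ (if f ∈ primitiveFamily ⌊H⌋₊ then τ else 0) + T f / √H := by
      by_cases h : (r : ℝ) ≤ H
      · rw [if_pos (mem_primitiveFamily.mpr ⟨r, Nat.le_floor h, hr⟩)]
        have h2 := hτ r f h hr
        have h3 := div_le_self (hT f) hr1
        have h4 := div_nonneg (hT f) hH0.le
        linarith
      · have h2 : T f / √r ≤ T f / √H :=
          div_le_div_of_nonneg_left (hT f) hH0 (Real.sqrt_le_sqrt (not_le.mp h).le)
        have h3 : 0 ≤ (if f ∈ primitiveFamily ⌊H⌋₊ then τ else 0) := by split_ifs <;> simp [hτ0]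
        linarith
    have h2 := div_le_self hε hr1
    calc (T f + ε) * (B / √r) = B * (T f / √r + ε / √r) := by ring
      _ ≤ _ := mul_le_mul_of_nonneg_left (by linarith) hB
  · rw [← mul_sum]
    refine mul_le_mul_of_nonneg_left ?_ hB
    rw [sum_add_distrib, sum_add_distrib, sum_const, nsmul_eq_mul, ← sum_div]
    have h1 : ∑ f ∈ primitiveFamily Q, (if f ∈ primitiveFamily ⌊H⌋₊ then τ else 0) ≤ H ^ 2 * τ := by
      rw [← sum_filter, sum_const, nsmul_eq_mul]
      refine mul_le_mul_of_nonneg_right ?_ hτ0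
      have h2 : ((primitiveFamily Q).filter (fun f => f ∈ primitiveFamily ⌊H⌋₊)).card ≤ ⌊H⌋₊ ^ 2 :=
        (card_le_card fun f hf => (mem_filter.mp hf).2).trans (card_primitiveFamily_le _)
      calc _ ≤ ((⌊H⌋₊ ^ 2 : ℕ) : ℝ) := by exact_mod_cast h2
        _ ≤ H ^ 2 := by
          push_cast
          exact pow_le_pow_left₀ (by positivity) (Nat.floor_le (by linarith)) 2
    have h2 : ((primitiveFamily Q).card : ℝ) ≤ (Q : ℝ) ^ 2 := by exact_mod_cast card_primitiveFamily_le Q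
    have h3 := div_le_div_of_nonneg_right hS (Real.sqrt_nonneg H)
    have h4 := mul_le_mul_of_nonneg_right h2 hε
    linarith

lemma abs_sum_prime_logWeight_sub_le {L K C : ℝ}
    (hK : |∑ n ∈ range (bumpLength L), vonMangoldt n * logWeight L n -
      ∑ n ∈ range (bumpLength L), logWeight L n| ≤ K)
    (hC : ∑ n ∈ range (bumpLength L),
      (vonMangoldt n - if n.Prime then Real.log n else 0) * logWeight L n ≤ C) :
    |(∑ n ∈ range (bumpLength L), if n.Prime then Real.log n * logWeight L n else 0) -
      ∑ n ∈ range (bumpLength L), logWeight L n| ≤ K + C := by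
  have h0 : 0 ≤ ∑ n ∈ range (bumpLength L),
      (vonMangoldt n - if n.Prime then Real.log n else 0) * logWeight L n :=
    sum_nonneg fun n _ => mul_nonneg (vonMangoldt_sub_prime_nonneg n) (logWeight_nonneg L n)
  have h1 : ∑ n ∈ range (bumpLength L),
      (vonMangoldt n - if n.Prime then Real.log n else 0) * logWeight L n =
      ∑ n ∈ range (bumpLength L), vonMangoldt n * logWeight L n -
        ∑ n ∈ range (bumpLength L), if n.Prime then Real.log n * logWeight L n else 0 := by
    rw [← sum_sub_distrib]
    refine sum_congr rfl fun n _ => ?_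
    split_ifs <;> ring
  rw [h1] at h0 hC
  rw [abs_le] at hK ⊢
  constructor <;> linarith

lemma exists_twistedSum_le_of_good_height {c : ℝ} (hc : 0 < c) (J : ℕ) : ∃ C : ℝ, 1 ≤ C ∧ ∀ L H : ℝ,
    1 ≤ L → 1 ≤ H → H ≤ Real.exp (L / 4) →
    (∀ r f, IsPrimitiveSeq r f → (r : ℝ) ≤ H → c / (1 + Real.log H) ^ 7 ≤ ‖seriesAtOne f‖) →
    ∀ (r : ℕ) f, (r : ℝ) ≤ H → IsPrimitiveSeq r f → ‖twistedSum f L 0‖ ≤ C * √H * (L / L ^ J) := by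
  obtain ⟨C₁, hC₁, h₁⟩ := exists_twistedSum_bound J 0
  obtain ⟨C₂, hC₂, h₂⟩ := exists_one_add_log_pow_le (7 * (3 * J + 3))
  refine ⟨max 1 (C₁ * ((2 / c + 1) ^ (3 * J + 3) * C₂)), le_max_left _ _,
    fun L H hL hH hHL hgood r f hr hf => ?_⟩
  have hlog : 1 ≤ 1 + Real.log H := by linarith [Real.log_nonneg hH]
  have hr1 : (1 : ℝ) ≤ r := by exact_mod_cast hf.1
  have hpow : 1 + Real.log H ≤ (1 + Real.log H) ^ 7 := le_self_pow₀ hlog (by norm_num)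
  have hP : 0 < (1 + Real.log H) ^ 7 := by positivity
  have h3 := h₁ L r ((2 / c + 1) * (1 + Real.log H) ^ 7) f hL hr1 (hr.trans hHL) hf.boundedSums hf.map_mul
    (by
      have h4 := Real.log_le_log (by linarith) hr
      have h5 : 0 ≤ 2 / c * (1 + Real.log H) ^ 7 := by positivity
      linarith)
    ((le_of_le_of_eq (div_le_div_of_nonneg_left (by norm_num) (by positivity)
      (mul_le_mul_of_nonneg_right (le_add_of_nonneg_right zero_le_one) hP.le))
      (by field_simp)).trans (hgood r f hf hr))
  rw [zero_add] at h3
  refine h3.trans (mul_le_mul_of_nonneg_right ?_ (by positivity))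
  calc _ = C₁ * ((2 / c + 1) ^ (3 * J + 3) * (1 + Real.log H) ^ (7 * (3 * J + 3))) := by
        rw [mul_pow, ← pow_mul]
    _ ≤ C₁ * ((2 / c + 1) ^ (3 * J + 3) * (C₂ * √H)) := by
        gcongr
        exact h₂ H hH
    _ = C₁ * ((2 / c + 1) ^ (3 * J + 3) * C₂) * √H := by ring
    _ ≤ _ := mul_le_mul_of_nonneg_right (le_max_right _ _) (Real.sqrt_nonneg _)

lemma exists_error_total_le {C₁ C₂ C₃ C₄ : ℝ} (h₃ : 0 ≤ C₃) (h₄ : 0 ≤ C₄)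
    (N A b : ℕ) (hb : b = N + A + 7) : ∃ L₀ : ℝ, ∀ L, L₀ ≤ L → 1 ≤ L → ∀ Q : ℕ, (Q : ℝ) ≤ Real.exp (L / 32) →
    C₄ * L ^ N * ((L ^ (2 * b)) ^ 2 * (C₁ * √(L ^ (2 * b)) * (L / L ^ (5 * b + N + A + 2))) +
      C₂ * L ^ 6 / √(L ^ (2 * b)) + (Q : ℝ) ^ 2 * (C₃ * Real.exp (-(L / 2)))) ≤ 1 / L ^ A := by
  obtain ⟨D, hD, hexp⟩ := exists_exp_neg_le_div_pow (c := 1 / 4) (by norm_num) (N + A + 1)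
  refine ⟨C₄ * (C₁ + C₂ + C₃ * D), fun L hL hL1 Q hQ => ?_⟩
  have hL0 : 0 < L := by linarith
  have hsqrt : √(L ^ (2 * b)) = L ^ b := by
    rw [mul_comm, pow_mul]; exact Real.sqrt_sq (by positivity)
  rw [hsqrt]
  have e1 : (L ^ (2 * b)) ^ 2 * (C₁ * L ^ b * (L / L ^ (5 * b + N + A + 2))) = C₁ * (1 / L ^ (N + A + 1)) := by
    field_simp
    ring
  have e2 : C₂ * L ^ 6 / L ^ b = C₂ * (1 / L ^ (N + A + 1)) := by
    rw [hb]
    field_simp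
    ring
  have e3 : (Q : ℝ) ^ 2 * (C₃ * Real.exp (-(L / 2))) ≤ C₃ * D * (1 / L ^ (N + A + 1)) := by
    calc _ ≤ Real.exp (L / 32) ^ 2 * (C₃ * Real.exp (-(L / 2))) := by gcongr
      _ = C₃ * Real.exp (2 * (L / 32) + -(L / 2)) := by
        rw [Real.exp_add, ← Real.exp_nat_mul]; push_cast; ring
      _ ≤ C₃ * Real.exp (-(1 / 4 * L)) := by
        gcongr
        linarith
      _ ≤ C₃ * (D / L ^ (N + A + 1)) := by
        gcongr
        exact hexp L hL0
      _ = _ := by ring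
  calc _ ≤ C₄ * L ^ N * (C₁ * (1 / L ^ (N + A + 1)) + C₂ * (1 / L ^ (N + A + 1)) +
        C₃ * D * (1 / L ^ (N + A + 1))) := by
        rw [e1, e2]
        gcongr
    _ = C₄ * (C₁ + C₂ + C₃ * D) / L * (1 / L ^ A) := by
        field_simp
        ring
    _ ≤ 1 * (1 / L ^ A) := by
        gcongr
        exact (div_le_one hL0).mpr hL
    _ = _ := one_mul _

set_option maxHeartbeats 1000000 in
theorem primesHaveLevel : PrimesHaveLevel := by
  classical
  refine ⟨1 / 64, by norm_num, fun W hW C A L₁ => ?_⟩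
  set K : ℕ := max 1 ⌈|C|⌉₊ with hK
  have hK1 : 1 ≤ K := le_max_left _ _
  have hCK : |C| ≤ K := (Nat.le_ceil _).trans (by exact_mod_cast le_max_right 1 _)
  set N := 2 * K with hN
  set b := N + A + 7 with hb
  obtain ⟨c, hc, hgood⟩ := exists_good_height
  obtain ⟨C₁, hC₁, h₁⟩ := exists_twistedSum_le_of_good_height hc (5 * b + N + A + 2)
  obtain ⟨C₂, hC₂, h₂⟩ := exists_sum_twistedSum_bound
  obtain ⟨C₃, hC₃, h₃⟩ := exists_sum_primePower_logWeight_le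
  obtain ⟨C₄, hC₄, h₄⟩ := exists_sum_pow_card_div_totient_le K W hK1 hW
  obtain ⟨C₅, hC₅, h₅⟩ := exists_sum_vonMangoldt_logWeight_sub_le
  obtain ⟨C₆, hC₆, h₆⟩ := exists_totalVariation_logWeight_le
  obtain ⟨D₁, hD₁, hexp₁⟩ := exists_exp_neg_le_div_pow (c := 1 / 4) (by norm_num) (2 * b + 1)
  obtain ⟨D₂, hD₂, hexp₂⟩ := exists_exp_neg_le_div_pow (c := 1 / 2) (by norm_num) 2
  obtain ⟨L₀, hL₀⟩ := exists_error_total_le (C₁ := C₁) (C₂ := C₂) (C₃ := C₃) (C₄ := C₄ * 4 ^ N)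
    (by linarith) (by positivity) N A b hb
  set L₂ : ℝ := max L₁ (max L₀ (max D₁ (max (C₆ * D₂) (max (64 * W) (6 * (C₅ + C₃) + 3))))) with hL₂
  obtain ⟨H, hH, hH1, hgood⟩ := hgood (max 1 L₂ ^ (2 * b))
  have hb0 : 2 * b ≠ 0 := by omega
  obtain ⟨L, hL0, hLH⟩ : ∃ L : ℝ, 0 ≤ L ∧ L ^ (2 * b) = H :=
    ⟨H ^ ((2 * b : ℕ) : ℝ)⁻¹, Real.rpow_nonneg (by linarith) _,
      Real.rpow_inv_natCast_pow (by linarith) hb0⟩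
  have hLL : max 1 L₂ ≤ L := by
    rw [← hLH] at hH
    exact (pow_le_pow_iff_left₀ (by positivity) hL0 hb0).mp hH
  have hL1 : 1 ≤ L := (le_max_left _ _).trans hLL
  have hLL₂ : L₂ ≤ L := (le_max_right _ _).trans hLL
  simp only [hL₂, max_le_iff] at hLL₂
  obtain ⟨hLa, hLb, hLc, hLd, hLe, hLf⟩ := hLL₂
  have hLpos : 0 < L := by linarith
  set V := ∑ n ∈ range (bumpLength L), logWeight L n with hV
  set X := ∑ n ∈ range (bumpLength L), (if n.Prime then Real.log n * logWeight L n else 0) with hX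
  set ε := C₃ * Real.exp (-(L / 2)) with hε
  have hε0 : 0 ≤ ε := by positivity
  have hεC : ε ≤ C₃ := mul_le_of_le_one_right (by linarith) (Real.exp_le_one_iff.mpr (by linarith))
  have hVlow : L / 3 - 1 ≤ V := le_sum_logWeight hLpos
  have hXV : |X - V| ≤ C₅ + C₃ := abs_sum_prime_logWeight_sub_le (h₅ L hL1) ((h₃ L hL1).trans hεC)
  have hV2 : 2 * (C₅ + C₃) ≤ V := by linarith
  have hXV' := abs_le.mp hXV
  have hX1 : 1 ≤ X := by linarith
  set x := Real.exp (1 / 64 * L) with hx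
  have hx1 : 1 ≤ x := Real.one_le_exp (by positivity)
  set Q := ⌊W * x⌋₊ with hQ
  have hWx : (W : ℝ) * x ≤ Real.exp (L / 32) := by
    have h7 : (W : ℝ) ≤ x := by
      have := Real.add_one_le_exp (1 / 64 * L)
      linarith
    calc (W : ℝ) * x ≤ x * x := by gcongr
      _ = _ := by rw [hx, ← Real.exp_add]; ring_nf
  have hQexp : (Q : ℝ) ≤ Real.exp (L / 32) := (Nat.floor_le (by positivity)).trans hWx
  refine ⟨L, hLa, logWeight L, fun q => 1 / (W * q).totient *
    ∑ f ∈ (primitiveFamily Q).filter (fun f => ∃ r, r ∣ W * q ∧ IsPrimitiveSeq r f),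
      (‖twistedSum f L 0‖ + ε), bumpLength L, X, logWeight_nonneg L,
    fun n hn => exp_le_of_logWeight_ne_zero hLpos hn, fun n hn => logWeight_eq_zero hLpos hn,
    bumpLength_le_exp hL1, by linarith, by linarith, by linarith, ?_, fun q => by positivity, ?_, ?_⟩
  · refine (h₆ L hL1).trans ?_
    have h7 := hexp₂ L hLpos
    have h8 : C₆ * L * Real.exp (-(1 / 2 * L)) ≤ 1 := by
      calc _ ≤ C₆ * L * (D₂ / L ^ 2) := by gcongr
        _ = C₆ * D₂ / L := by field_simp
        _ ≤ 1 := (div_le_one hLpos).mpr hLd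
    have h9 : Real.exp (-L) = Real.exp (-(L / 2)) * Real.exp (-(1 / 2 * L)) := by
      rw [← Real.exp_add]
      congr 1
      ring
    calc C₆ * L * Real.exp (-L) = Real.exp (-(L / 2)) * (C₆ * L * Real.exp (-(1 / 2 * L))) := by
          rw [h9]; ring
      _ ≤ Real.exp (-(L / 2)) * V := mul_le_mul_of_nonneg_left (by linarith) (Real.exp_pos _).le
  · intro q c' hq hWq hqx hc'
    have hWqx : ((W * q : ℕ) : ℝ) ≤ W * x := by
      push_cast
      exact mul_le_mul_of_nonneg_left hqx (Nat.cast_nonneg _)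
    refine abs_sum_prime_modEq_sub_le hL1 (Nat.mul_pos hW (Nat.pos_of_ne_zero hq.ne_zero)) ?_
      (Nat.le_floor hWqx) hc' (h₃ L hL1)
    exact (hWqx.trans hWx).trans_lt (Real.exp_lt_exp.mpr (by linarith))
  · have hHexp : H ≤ Real.exp (L / 4) := by
      have h7 := hexp₁ L hLpos
      rw [Real.exp_neg, inv_le_comm₀ (Real.exp_pos _) (by positivity), inv_div] at h7
      rw [← hLH]
      calc L ^ (2 * b) ≤ L / D₁ * L ^ (2 * b) :=
            le_mul_of_one_le_left (by positivity) ((one_le_div (by linarith)).mpr hLc)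
        _ = L ^ (2 * b + 1) / D₁ := by ring
        _ ≤ _ := h7.trans_eq (by congr 1; ring)
    set B := C₄ * (3 + 1 / 64 * L) ^ N with hB
    have hB0 : 0 ≤ B := by positivity
    have hBle : B ≤ C₄ * 4 ^ N * L ^ N := by
      rw [hB, mul_assoc, ← mul_pow]
      gcongr
      linarith
    obtain ⟨s, hs, hsum⟩ := sum_primitiveFamily_split_le (Q := Q) (T := fun f => ‖twistedSum f L 0‖)
      (S := C₂ * L ^ 6) (fun f => norm_nonneg _) hB0 hH1 hε0 (by positivity)
      (h₁ L H hL1 hH1 hHexp hgood) (h₂ L hL1 Q hQexp)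
    have h7 := sum_pow_mul_conductor_sum_le (W := W) (K := K) (Q := Q) (x := x) (B := B)
      (fun r hr => by
        have h8 := h₄ r ⌊x⌋₊ x hr hx1 (Nat.floor_le (by linarith))
        rw [hx, Real.log_exp] at h8
        exact h8) (t := fun f => ‖twistedSum f L 0‖ + ε) (fun f => by positivity) hs
    have h8 : B * (H ^ 2 * (C₁ * √H * (L / L ^ (5 * b + N + A + 2))) + C₂ * L ^ 6 / √H +
        (Q : ℝ) ^ 2 * ε) ≤ 1 / L ^ A := by
      refine le_trans ?_ (hL₀ L hLb hL1 Q hQexp)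
      rw [hLH]
      exact mul_le_mul_of_nonneg_right hBle (by positivity)
    calc _ ≤ ∑ q ∈ (Icc 1 ⌊x⌋₊).filter (fun q => Squarefree q ∧ Nat.Coprime W q),
          (K : ℝ) ^ q.primeFactors.card * (1 / (W * q).totient *
          ∑ f ∈ (primitiveFamily Q).filter (fun f => ∃ r, r ∣ W * q ∧ IsPrimitiveSeq r f),
            (‖twistedSum f L 0‖ + ε)) := by
          refine sum_le_sum fun q _ => mul_le_mul_of_nonneg_right ?_ (by positivity)
          calc C ^ q.primeFactors.card ≤ |C| ^ q.primeFactors.card := by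
                rw [← abs_pow]; exact le_abs_self _
            _ ≤ _ := pow_le_pow_left₀ (abs_nonneg _) hCK _
      _ ≤ 1 / L ^ A := h7.trans (hsum.trans h8)
      _ ≤ X / L ^ A := by gcongr

/-- For every `m ≥ 2` there are infinitely many `r` such that the run of
consecutive prime gaps `δ j = primeGap r j` for `1 ≤ j ≤ m` satisfies
`δ (j+1) ∣ δ j` for every `j` with `1 ≤ j ≤ m - 1`. -/
theorem reverse_dividing_prime_gap_runs (m : ℕ) (hm : 2 ≤ m) :
    {r : ℕ | ∀ j : ℕ, 1 ≤ j → j ≤ m - 1 → primeGap r (j + 1) ∣ primeGap r j}.Infinite := by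
  exact infinite_of_maynardTao (maynardTao_of_primesHaveLevel primesHaveLevel) m hm
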